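/- For every integer g ≥ 2 and every natural number K ≥ 1, there are infinitely many natural numbers n such that s_g(p_n) > s_g(p_{n+1}) > ⋯ > s_g(p_{n+K−1}), i.e., the base-g digit sum is strictly decreasing along some run of K consecutive primes, for infinitely many starting indices n. -/

import Mathlib

namespace DSR
open Finset Filter Topology

lemma abel_identity (a u : ℕ → ℂ) (N M : ℕ) (h : N ≤ M) :
    ∑ n ∈ Ico N M, a n * u n = (∑ n ∈ range M, a n) * u M - (∑ n ∈ range N, a n) * u N
      + ∑ n ∈ Ico N M, (∑ j ∈ range (n+1), a j) * (u n - u (n+1)) := by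
  induction M, h using Nat.le_induction with
  | base => simp
  | succ M h ih =>
    rw [sum_Ico_succ_top h, sum_Ico_succ_top h, ih, sum_range_succ]
    ring

lemma abel_bound (a u : ℕ → ℂ) (B : ℝ) (hB : ∀ N, ‖∑ n ∈ range N, a n‖ ≤ B) (N M : ℕ) (h : N ≤ M) :
    ‖∑ n ∈ Ico N M, a n * u n‖ ≤ B * (‖u M‖ + ‖u N‖ + ∑ n ∈ Ico N M, ‖u n - u (n+1)‖) := by
  rw [abel_identity a u N M h]
  have h1 : ‖(∑ n ∈ range M, a n) * u M‖ ≤ B * ‖u M‖ := by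
    rw [norm_mul]; gcongr; exact hB M
  have h2 : ‖(∑ n ∈ range N, a n) * u N‖ ≤ B * ‖u N‖ := by
    rw [norm_mul]; gcongr; exact hB N
  have h3 : ‖∑ n ∈ Ico N M, (∑ j ∈ range (n+1), a j) * (u n - u (n+1))‖
      ≤ B * ∑ n ∈ Ico N M, ‖u n - u (n+1)‖ := by
    rw [mul_sum]
    refine norm_sum_le_of_le _ fun n _ => ?_
    rw [norm_mul]; gcongr; exact hB _
  calc _ ≤ ‖(∑ n ∈ range M, a n) * u M‖ + ‖(∑ n ∈ range N, a n) * u N‖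
        + ‖∑ n ∈ Ico N M, (∑ j ∈ range (n+1), a j) * (u n - u (n+1))‖ :=
        (norm_add_le _ _).trans (by gcongr; exact norm_sub_le _ _)
    _ ≤ _ := by nlinarith

/-- `(1+log y)^i ≤ C (1+log q)^i (y/q)^{1/2}` for `y ≥ q ≥ 1`. -/
lemma sum_inv_le (N : ℕ) : ∑ n ∈ range (N+1), (1:ℝ)/n ≤ 1 + Real.log N := by
  have := harmonic_le_one_add_log N
  unfold harmonic at this
  push_cast at this
  rw [sum_range_succ']
  simpa using this

lemma logMul_iter (f : ℕ → ℂ) (m n : ℕ) :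
    (LSeries.logMul^[m] f) n = (Real.log n : ℂ)^m * f n := by
  induction m generalizing f with
  | zero => simp
  | succ m ih =>
    rw [Function.iterate_succ, Function.comp, ih]
    simp only [LSeries.logMul]
    rw [Complex.natCast_log]; ring

lemma log_pow_anti (i : ℕ) (s : ℝ) (hs : 1 ≤ s) (x y : ℝ) (hx : Real.exp i ≤ x) (hxy : x ≤ y) :
    (Real.log y)^i / y^s ≤ (Real.log x)^i / x^s := by
  have hx0 : 0 < x := lt_of_lt_of_le (Real.exp_pos _) hx
  have hx1 : 1 ≤ x := le_trans (by simp) hx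
  rcases Nat.eq_zero_or_pos i with rfl | hi
  · simp only [pow_zero]
    gcongr
  · have hi' : (0:ℝ) < i := by exact_mod_cast hi
    have key := Real.log_div_self_rpow_antitoneOn (a := s / i) (by positivity)
    have hmem : ∀ z, x ≤ z → z ∈ Set.Ici (Real.exp (s/i)⁻¹) := by
      intro z hz
      rw [Set.mem_Ici]
      refine le_trans ?_ (hx.trans hz)
      rw [Real.exp_le_exp, inv_div]
      exact div_le_self hi'.le hs
    have h1 := key (hmem x le_rfl) (hmem y hxy) hxy
    simp only at h1
    have h2 : ∀ z, 0 < z → (Real.log z)^i / z^s = (Real.log z / z^(s/i))^i := by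
      intro z hz
      rw [div_pow, ← Real.rpow_natCast (z^(s/i)), ← Real.rpow_mul hz.le, div_mul_cancel₀ _ hi'.ne']
    rw [h2 _ hx0, h2 _ (hx0.trans_le hxy)]
    have : 0 ≤ Real.log y := Real.log_nonneg (hx1.trans hxy)
    have hy0 : 0 < y := hx0.trans_le hxy
    refine pow_le_pow_left₀ (by positivity) h1 i

lemma Lbound (a : ℕ → ℂ) (q : ℝ) (hq : 1 ≤ q) (ha : ∀ n, ‖a n‖ ≤ 1)
    (hA : ∀ N, ‖∑ n ∈ range N, a n‖ ≤ q) (i : ℕ) (s : ℝ) (hs : 1 < s) (M : ℝ)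
    (hM : Real.log q + i + 1 ≤ M) :
    ‖LSeries (LSeries.logMul^[i] a) s‖ ≤ 3 * M^(i+1) := by
  have hlq := Real.log_nonneg hq
  set M0 := Real.log q + i with hM0
  have hM00 : 0 ≤ M0 := by positivity
  set u : ℕ → ℂ := fun n => (((Real.log n)^i / (n:ℝ)^s : ℝ) : ℂ) with hu
  have hterm : ∀ n, LSeries.term (LSeries.logMul^[i] a) s n = a n * u n := by
    intro n
    rcases Nat.eq_zero_or_pos n with rfl | hn
    · simp only [LSeries.term_zero, hu]
      simp [Real.zero_rpow (by linarith : s ≠ 0)]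
    · rw [LSeries.term_of_ne_zero hn.ne', logMul_iter, hu]
      simp only []
      push_cast
      rw [Complex.ofReal_cpow (by positivity)]
      push_cast
      ring
  have hu0 : ∀ n : ℕ, 0 ≤ (Real.log n)^i / (n:ℝ)^s := fun n => by
    have := Real.log_natCast_nonneg n
    positivity
  have hun : ∀ n, ‖u n‖ = (Real.log n)^i / (n:ℝ)^s := fun n => by
    rw [hu]; simp only []; rw [Complex.norm_real, Real.norm_of_nonneg (hu0 n)]
  set y := q * Real.exp i with hy
  have hy0 : 0 < y := by positivity
  have hye : Real.exp i ≤ y := by rw [hy]; nlinarith [Real.exp_pos (i:ℝ)]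
  have hy1 : 1 ≤ y := le_trans (by simp) hye
  have hlogy : Real.log y = M0 := by
    rw [hy, Real.log_mul (by linarith) (Real.exp_ne_zero _), Real.log_exp]
  set N0 := ⌈y⌉₊ with hN0
  have hN0y : y ≤ N0 := Nat.le_ceil y
  have hN0pos : 0 < N0 := Nat.ceil_pos.2 hy0
  -- head
  have head : ∀ N ≤ N0, ‖∑ n ∈ range N, a n * u n‖ ≤ M0^i * (1 + M0) := by
    intro N hN
    calc ‖∑ n ∈ range N, a n * u n‖ ≤ ∑ n ∈ range N, ‖a n * u n‖ := norm_sum_le _ _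
      _ ≤ ∑ n ∈ range N, M0^i * (1 / (n:ℝ)) := by
          refine sum_le_sum fun n hn => ?_
          rw [norm_mul, hun]
          rw [mem_range] at hn
          rcases Nat.eq_zero_or_pos n with rfl | hn0
          · simp [Real.zero_rpow (by linarith : s ≠ 0)]
          have hn1 : (1:ℝ) ≤ n := by exact_mod_cast hn0
          have hny : (n:ℝ) ≤ y := by
            have := Nat.lt_ceil.1 (lt_of_lt_of_le hn hN)
            exact this.le
          have h1 : Real.log n ≤ M0 := hlogy ▸ Real.log_le_log (by linarith) hny
          have h2 : (n:ℝ) ≤ (n:ℝ)^s := by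
            simpa using Real.rpow_le_rpow_of_exponent_le hn1 hs.le
          have h3 := Real.log_natCast_nonneg n
          calc ‖a n‖ * ((Real.log n)^i / (n:ℝ)^s) ≤ 1 * (M0^i / n) := by
                gcongr
                exact ha n
            _ = _ := by ring
      _ ≤ ∑ n ∈ range N0, M0^i * (1 / (n:ℝ)) := by
          refine sum_le_sum_of_subset_of_nonneg (range_mono hN) fun _ _ _ => by positivity
      _ = M0^i * ∑ n ∈ range (N0 - 1 + 1), (1 / (n:ℝ)) := by
          rw [← mul_sum, Nat.sub_add_cancel hN0pos]
      _ ≤ M0^i * (1 + Real.log ((N0 - 1 : ℕ) : ℝ)) := by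
          gcongr; exact sum_inv_le _
      _ ≤ M0^i * (1 + M0) := by
          gcongr
          rcases Nat.eq_zero_or_pos (N0 - 1) with h | h
          · rw [h]; simpa using hM00
          · rw [← hlogy]
            refine Real.log_le_log (by exact_mod_cast h) ?_
            exact (Nat.lt_ceil.1 (by omega : N0 - 1 < N0)).le
  have anti : ∀ n m : ℕ, N0 ≤ n → n ≤ m →
      (Real.log m)^i / (m:ℝ)^s ≤ (Real.log n)^i / (n:ℝ)^s := by
    intro n m h1 h2
    refine log_pow_anti i s hs.le _ _ ?_ (by exact_mod_cast h2)
    exact hye.trans (hN0y.trans (by exact_mod_cast h1))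
  have tail : ∀ N, N0 ≤ N → ‖∑ n ∈ Ico N0 N, a n * u n‖ ≤ 2 * M0^i := by
    intro N hN
    have h1 := abel_bound a u q hA N0 N hN
    have h2 : ∑ n ∈ Ico N0 N, ‖u n - u (n+1)‖ = ‖u N0‖ - ‖u N‖ := by
      rw [hun, hun]
      have : ∀ n ∈ Ico N0 N, ‖u n - u (n+1)‖ = -((Real.log (n+1:ℕ))^i / ((n+1:ℕ):ℝ)^s)
          - -((Real.log n)^i / (n:ℝ)^s) := by
        intro n hn
        rw [mem_Ico] at hn
        rw [hu]; simp only []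
        rw [← Complex.ofReal_sub, Complex.norm_real, Real.norm_of_nonneg]
        · ring
        · linarith [anti n (n+1) hn.1 (by omega)]
      rw [sum_congr rfl this, sum_Ico_sub (fun n : ℕ => -((Real.log n)^i / (n:ℝ)^s)) hN]
      ring
    rw [h2] at h1
    have h3 : ‖u N0‖ ≤ M0^i / q := by
      rw [hun]
      refine (log_pow_anti i s hs.le y N0 hye hN0y).trans ?_
      rw [hlogy]
      gcongr
      calc q ≤ y := by rw [hy]; nlinarith [Real.one_le_exp (Nat.cast_nonneg (α := ℝ) i)]
        _ ≤ y^s := by simpa using Real.rpow_le_rpow_of_exponent_le hy1 hs.le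
    calc _ ≤ _ := h1
      _ = 2 * (q * ‖u N0‖) := by ring
      _ ≤ 2 * (q * (M0^i/q)) := by gcongr
      _ = _ := by field_simp
  have all : ∀ N, ‖∑ n ∈ range N, a n * u n‖ ≤ 3 * M^(i+1) := by
    intro N
    have h1 : M0^i * (1+M0) + 2 * M0^i ≤ 3 * M^(i+1) := by
      have e1 : M0^i ≤ M^i := by gcongr; linarith
      have e2 : (0:ℝ) ≤ M0^i := by positivity
      calc M0^i * (1+M0) + 2 * M0^i = M0^i * (3 + M0) := by ring
        _ ≤ M^i * (3 * M) := by
          gcongr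
          all_goals linarith
        _ = _ := by ring
    rcases le_total N N0 with h | h
    · have := head N h
      have e2 : (0:ℝ) ≤ M0^i := by positivity
      linarith
    · rw [← sum_range_add_sum_Ico _ h]
      refine (norm_add_le _ _).trans ?_
      have := head N0 le_rfl
      have := tail N h
      linarith
  unfold LSeries
  by_cases hsum : Summable (LSeries.term (LSeries.logMul^[i] a) (s:ℂ))
  · have := hsum.hasSum.tendsto_sum_nat.norm
    refine le_of_tendsto' this fun N => ?_
    rw [sum_congr rfl fun n _ => hterm n]
    exact all N
  · rw [tsum_eq_zero_of_not_summable hsum]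
    simp only [norm_zero]
    have : 0 ≤ M := by linarith
    positivity

end DSR

namespace DSR
open Finset

/-! Character sums and the bounds for twisted von Mangoldt sums. -/

lemma char_range_q {q : ℕ} [NeZero q] (χ : DirichletCharacter ℂ q) (hχ : χ ≠ 1) :
    ∑ n ∈ range q, χ (n : ZMod q) = 0 := by
  rw [← MulChar.sum_eq_zero_of_ne_one hχ]
  refine sum_nbij' (fun n => (n : ZMod q)) (fun x => x.val) ?_ ?_ ?_ ?_ ?_
  · intro a _; exact mem_univ _
  · intro a _; exact mem_range.2 (ZMod.val_lt a)
  · intro a ha; exact ZMod.val_cast_of_lt (mem_range.1 ha)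
  · intro a _; exact ZMod.natCast_zmod_val a
  · intro a _; rfl

lemma char_sum_bound {q : ℕ} [NeZero q] (χ : DirichletCharacter ℂ q) (hχ : χ ≠ 1) (N : ℕ) :
    ‖∑ n ∈ range N, χ (n : ZMod q)‖ ≤ q := by
  have h1 : ∀ a, ∑ n ∈ range (q * a), χ (n : ZMod q) = 0 := by
    intro a
    induction a with
    | zero => simp
    | succ a ih =>
      rw [Nat.mul_succ, sum_range_add, ih, zero_add]
      rw [← char_range_q χ hχ]
      refine sum_congr rfl fun n _ => ?_
      congr 1
      push_cast
      simp
  rw [← Nat.div_add_mod N q, sum_range_add, h1, zero_add]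
  refine (norm_sum_le _ _).trans ?_
  calc ∑ n ∈ range (N % q), ‖χ (((q * (N / q) + n : ℕ)) : ZMod q)‖
      ≤ ∑ n ∈ range (N % q), (1:ℝ) := sum_le_sum fun n _ => DirichletCharacter.norm_le_one _ _
    _ = (N % q : ℕ) := by simp
    _ ≤ q := by exact_mod_cast (Nat.mod_lt _ (NeZero.pos q)).le

lemma char_Lbound {q : ℕ} [NeZero q] (χ : DirichletCharacter ℂ q) (hχ : χ ≠ 1) (i : ℕ) (s : ℝ)
    (hs : 1 < s) (M : ℝ) (hM : Real.log q + i + 1 ≤ M) :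
    ‖LSeries (LSeries.logMul^[i] (fun n => χ (n : ZMod q))) s‖ ≤ 3 * M^(i+1) := by
  refine Lbound _ q ?_ (fun n => DirichletCharacter.norm_le_one _ _) (char_sum_bound χ hχ) i s hs M hM
  exact_mod_cast NeZero.one_le

/-- the twisted von Mangoldt function -/
noncomputable def chiL {q : ℕ} (χ : DirichletCharacter ℂ q) : ℕ → ℂ :=
  (fun n : ℕ => χ (n : ZMod q)) * (fun n : ℕ => ((ArithmeticFunction.vonMangoldt n : ℝ) : ℂ))

lemma abs_chiL {q : ℕ} (χ : DirichletCharacter ℂ q) : LSeries.abscissaOfAbsConv (chiL χ) ≤ 1 := by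
  refine LSeries.abscissaOfAbsConv_le_of_forall_lt_LSeriesSummable fun y hy => ?_
  exact DirichletCharacter.LSeriesSummable_twist_vonMangoldt χ (by simpa using hy)

lemma T_recursion {q : ℕ} [NeZero q] (χ : DirichletCharacter ℂ q) (j : ℕ) (s : ℝ) (hs : 1 < s) :
    ∑ i ∈ range (j+1), (j.choose i : ℂ) * LSeries (LSeries.logMul^[i] (chiL χ)) s *
      LSeries (LSeries.logMul^[j-i] (fun n => χ (n : ZMod q))) s
    = LSeries (LSeries.logMul^[j+1] (fun n => χ (n : ZMod q))) s := by
  set f : ℕ → ℂ := fun n => χ (n : ZMod q) with hf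
  have hs' : (1:EReal) < ((s:ℂ).re : EReal) := by
    rw [Complex.ofReal_re]; exact_mod_cast hs
  have hfa : LSeries.abscissaOfAbsConv f < ((s:ℂ).re : EReal) := by
    rw [hf, DirichletCharacter.absicssaOfAbsConv_eq_one (NeZero.ne q)]; exact hs'
  have hfl : LSeries.abscissaOfAbsConv (LSeries.logMul f) < ((s:ℂ).re : EReal) := by
    rw [LSeries.abscissaOfAbsConv_logMul]; exact hfa
  have hTa : LSeries.abscissaOfAbsConv (chiL χ) < ((s:ℂ).re : EReal) :=
    lt_of_le_of_lt (abs_chiL χ) hs'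
  have hopen : {z : ℂ | 1 < z.re} ∈ nhds (s:ℂ) := by
    refine (isOpen_lt continuous_const Complex.continuous_re).mem_nhds ?_
    simpa using hs
  have hEq : (LSeries (chiL χ) * LSeries f) =ᶠ[nhds (s:ℂ)] LSeries (LSeries.logMul f) := by
    filter_upwards [hopen] with z hz
    have hz : 1 < z.re := hz
    have h1 := DirichletCharacter.LSeriesSummable_twist_vonMangoldt χ hz
    have h2 : LSeriesSummable f z := DirichletCharacter.LSeriesSummable_of_one_lt_re χ hz
    rw [Pi.mul_apply]
    unfold chiL
    rw [← LSeries_convolution' h1 h2, DirichletCharacter.convolution_twist_vonMangoldt]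
    exact LSeries_congr (fun _ ↦ by simp [mul_comm, LSeries.logMul, hf]) z
  have hA : AnalyticAt ℂ (LSeries (chiL χ)) s := LSeries_analyticOnNhd _ _ hTa
  have hB : AnalyticAt ℂ (LSeries f) s := LSeries_analyticOnNhd _ _ hfa
  have h := hEq.iteratedDeriv_eq j
  rw [iteratedDeriv_mul hA.contDiffAt hB.contDiffAt, LSeries_iteratedDeriv j hfl] at h
  have h2 : ∀ i ∈ range (j+1), (j.choose i : ℂ) * iteratedDeriv i (LSeries (chiL χ)) s *
      iteratedDeriv (j-i) (LSeries f) s = (-1)^j * ((j.choose i : ℂ) *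
        LSeries (LSeries.logMul^[i] (chiL χ)) s * LSeries (LSeries.logMul^[j-i] f) s) := by
    intro i hi
    have : i ≤ j := by rw [mem_range] at hi; omega
    rw [LSeries_iteratedDeriv i hTa, LSeries_iteratedDeriv (j-i) hfa]
    have e : (-1:ℂ)^j = (-1)^i * (-1)^(j-i) := by rw [← pow_add]; congr 1; omega
    rw [e]; ring
  rw [sum_congr rfl h2, ← mul_sum] at h
  have h3 := mul_left_cancel₀ (pow_ne_zero j (by norm_num : (-1:ℂ) ≠ 0)) h
  rw [h3, Function.iterate_succ, Function.comp]

lemma Tbound {q : ℕ} [NeZero q] (χ : DirichletCharacter ℂ q) (hχ : χ ≠ 1) (j : ℕ) (s : ℝ)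
    (hs : 1 < s) (M : ℝ) (hM : Real.log q + j + 2 ≤ M) (l : ℝ) (hl : 0 < l) (hl1 : l ≤ 1)
    (hL : l ≤ ‖LSeries (fun n => χ (n : ZMod q)) s‖) :
    ‖LSeries (LSeries.logMul^[j] (chiL χ)) s‖ ≤ j.factorial * M^(j+1) * (6 * M / l)^(j+1) := by
  have hM2 : 2 ≤ M := by
    have := Real.log_natCast_nonneg q
    have : (0:ℝ) ≤ j := Nat.cast_nonneg _
    linarith
  set β := 6 * M / l with hβ
  have hβ2 : 2 ≤ β := by
    rw [hβ, le_div_iff₀ hl]; nlinarith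
  have hlβ : l * β = 6 * M := by rw [hβ]; field_simp
  set f : ℕ → ℂ := fun n => χ (n : ZMod q) with hf
  have hLb : ∀ i ≤ j+1, ‖LSeries (LSeries.logMul^[i] f) s‖ ≤ 3 * M^(i+1) := by
    intro i hi
    refine char_Lbound χ hχ i s hs M ?_
    have : (i:ℝ) ≤ j + 1 := by exact_mod_cast hi
    linarith
  have main : ∀ m ≤ j, ‖LSeries (LSeries.logMul^[m] (chiL χ)) s‖ ≤
      m.factorial * M^(m+1) * β^(m+1) := by
    intro m
    induction m using Nat.strong_induction_on with
    | _ m ih =>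
    intro hm
    have hrec := T_recursion χ m s hs
    rw [sum_range_succ] at hrec
    simp only [Nat.choose_self, Nat.cast_one, one_mul, Nat.sub_self, Function.iterate_zero, id] at hrec
    have e1 : LSeries (LSeries.logMul^[m] (chiL χ)) s * LSeries f s =
        LSeries (LSeries.logMul^[m+1] f) s - ∑ i ∈ range m, (m.choose i : ℂ) *
          LSeries (LSeries.logMul^[i] (chiL χ)) s * LSeries (LSeries.logMul^[m-i] f) s := by
      rw [← hrec]; ring
    have e2 : ‖LSeries (LSeries.logMul^[m] (chiL χ)) s‖ * ‖LSeries f s‖ ≤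
        3 * M^(m+2) + ∑ i ∈ range m, 3 * M^(m+2) * m.factorial * β^(i+1) := by
      rw [← norm_mul, e1]
      refine (norm_sub_le _ _).trans ?_
      refine add_le_add (hLb (m+1) (by omega)) ((norm_sum_le _ _).trans (sum_le_sum fun i hi => ?_))
      rw [mem_range] at hi
      rw [norm_mul, norm_mul, Complex.norm_natCast]
      have h1 := ih i hi (by omega)
      have h2 := hLb (m-i) (by omega)
      have h3 : (m.choose i : ℝ) * i.factorial ≤ m.factorial := by
        have := Nat.choose_mul_factorial_mul_factorial hi.le
        have h4 : m.choose i * i.factorial ≤ m.factorial := by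
          rw [← this]; exact Nat.le_mul_of_pos_right _ (Nat.factorial_pos _)
        exact_mod_cast h4
      calc (m.choose i : ℝ) * ‖LSeries (LSeries.logMul^[i] (chiL χ)) s‖ *
            ‖LSeries (LSeries.logMul^[m-i] f) s‖
          ≤ (m.choose i : ℝ) * (i.factorial * M^(i+1) * β^(i+1)) * (3 * M^(m-i+1)) := by gcongr
        _ = ((m.choose i : ℝ) * i.factorial) * (3 * (M^(i+1) * M^(m-i+1)) * β^(i+1)) := by ring
        _ ≤ m.factorial * (3 * (M^(i+1) * M^(m-i+1)) * β^(i+1)) := by gcongr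
        _ = _ := by
          rw [← pow_add, show i + 1 + (m - i + 1) = m + 2 by omega]; ring
    have e3 : ∑ i ∈ range m, β^(i+1) + 1 ≤ 2 * β^m := by
      clear e2 e1 hrec ih hm
      induction m with
      | zero => simp
      | succ m ih =>
        rw [sum_range_succ]
        have : 2 * β^m ≤ β^(m+1) := by rw [pow_succ]; nlinarith [pow_pos (by linarith : 0 < β) m]
        linarith
    have hfac : (1:ℝ) ≤ m.factorial := by exact_mod_cast Nat.factorial_pos m
    have e4 : 3 * M^(m+2) + ∑ i ∈ range m, 3 * M^(m+2) * m.factorial * β^(i+1) ≤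
        3 * M^(m+2) * m.factorial * (2 * β^m) := by
      rw [← mul_sum]
      have : 3 * M^(m+2) * 1 ≤ 3 * M^(m+2) * m.factorial := by gcongr
      calc _ ≤ 3 * M^(m+2) * m.factorial * (∑ i ∈ range m, β^(i+1) + 1) := by linarith
        _ ≤ _ := by gcongr
    have e5 : ‖LSeries (LSeries.logMul^[m] (chiL χ)) s‖ * l ≤
        (m.factorial * M^(m+1) * β^(m+1)) * l := by
      calc _ ≤ ‖LSeries (LSeries.logMul^[m] (chiL χ)) s‖ * ‖LSeries f s‖ := by gcongr
        _ ≤ _ := e2.trans e4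
        _ = m.factorial * M^(m+1) * β^m * (6 * M) := by ring
        _ = _ := by rw [← hlβ]; ring
    exact le_of_mul_le_mul_right e5 hl
  exact main j le_rfl

end DSR

namespace DSR
open Finset

/-! Lower bounds for L-series at real points. -/

lemma rpow_tele (n : ℕ) (hn : 1 ≤ n) (x : ℝ) (hx : 0 < x) :
    1 / ((n+1:ℕ):ℝ)^(1+x) ≤ (1/x) * (1 / (n:ℝ)^x - 1 / ((n+1:ℕ):ℝ)^x) := by
  have hn0 : (0:ℝ) < n := by exact_mod_cast hn
  set m : ℝ := ((n+1:ℕ):ℝ) with hm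
  have hm0 : 0 < m := by positivity
  have hmn : m = n + 1 := by rw [hm]; push_cast; ring
  have h1 : 1 + x / m ≤ (m / n)^x := by
    rw [Real.rpow_def_of_pos (by positivity)]
    have h2 : 1/m ≤ Real.log (m/n) := by
      have := Real.one_sub_inv_le_log_of_pos (show 0 < m/n by positivity)
      have e : 1 - (m/n)⁻¹ = 1/m := by rw [hmn]; field_simp; ring
      linarith
    have := Real.add_one_le_exp (Real.log (m/n) * x)
    have : 1/m * x ≤ Real.log (m/n) * x := by gcongr
    have e : x/m = 1/m*x := by ring
    linarith
  rw [Real.div_rpow hm0.le hn0.le] at h1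
  have hmx : 0 < m^x := by positivity
  have hnx : 0 < (n:ℝ)^x := by positivity
  have h3 : 1/m^x * (1 + x/m) ≤ 1/m^x * (m^x / (n:ℝ)^x) := by gcongr
  have e3 : 1/m^x * (m^x / (n:ℝ)^x) = 1/(n:ℝ)^x := by field_simp
  rw [e3] at h3
  rw [Real.rpow_add hm0, Real.rpow_one]
  calc 1/(m * m^x) = (1/x) * (1/m^x * (1 + x/m) - 1/m^x) := by field_simp; ring
    _ ≤ _ := by gcongr

lemma sum_rpow_le (N : ℕ) (x : ℝ) (hx : 0 < x) :
    ∑ n ∈ range N, 1 / (n:ℝ)^(1+x) ≤ 1 + 1/x := by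
  have key : ∀ N : ℕ, 1 ≤ N → ∑ n ∈ range (N+1), 1 / (n:ℝ)^(1+x) ≤
      1 + 1/x * (1 - 1/(N:ℝ)^x) := by
    intro N hN
    induction N, hN using Nat.le_induction with
    | base => simp [sum_range_succ, Real.zero_rpow (by linarith : 1 + x ≠ 0)]
    | succ n hn ih =>
      rw [sum_range_succ]
      have := rpow_tele n hn x hx
      calc _ ≤ 1 + 1/x * (1 - 1/(n:ℝ)^x) + (1/x) * (1 / (n:ℝ)^x - 1 / ((n+1:ℕ):ℝ)^x) :=
            add_le_add ih this
        _ = _ := by ring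
  have h1 := key (N+1) (by omega)
  have h2 : ∑ n ∈ range N, 1 / (n:ℝ)^(1+x) ≤ ∑ n ∈ range (N+1+1), 1 / (n:ℝ)^(1+x) :=
    sum_le_sum_of_subset_of_nonneg (range_mono (by omega)) fun _ _ _ => by positivity
  have h3 : 0 ≤ 1/x * (1/((N+1:ℕ):ℝ)^x) := by positivity
  linarith [mul_sub (1/x) 1 (1/((N+1:ℕ):ℝ)^x)]

lemma zeta_bound (a : ℕ → ℂ) (ha : ∀ n, ‖a n‖ ≤ 1) (s : ℝ) (hs : 1 < s) :
    ‖LSeries a s‖ ≤ 1 + 1/(s-1) := by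
  have all : ∀ N, ‖∑ n ∈ range N, LSeries.term a s n‖ ≤ 1 + 1/(s-1) := by
    intro N
    refine (norm_sum_le _ _).trans (le_trans (sum_le_sum fun n _ => ?_) (sum_rpow_le N (s-1) (by linarith)))
    rw [LSeries.norm_term_eq]
    split_ifs with h
    · positivity
    · rw [Complex.ofReal_re, show 1 + (s-1) = s by ring]
      gcongr; exact ha n
  unfold LSeries
  by_cases hsum : Summable (LSeries.term a (s:ℂ))
  · exact le_of_tendsto' hsum.hasSum.tendsto_sum_nat.norm all
  · rw [tsum_eq_zero_of_not_summable hsum, norm_zero]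
    have : 0 < s - 1 := by linarith
    positivity

/-- shorthand for the L-series at a real point -/
noncomputable def LL {q : ℕ} (χ : DirichletCharacter ℂ q) (s : ℝ) : ℂ :=
  LSeries (fun n => χ (n : ZMod q)) s

lemma LL_bound {q : ℕ} [NeZero q] (χ : DirichletCharacter ℂ q) (hχ : χ ≠ 1) (s : ℝ)
    (hs : 1 < s) (M : ℝ) (hM : Real.log q + 2 ≤ M) : ‖LL χ s‖ ≤ 3 * M := by
  have := char_Lbound χ hχ 0 s hs M (by push_cast; linarith)
  simpa [LL] using this

lemma LL_lip {q : ℕ} [NeZero q] (χ : DirichletCharacter ℂ q) (hχ : χ ≠ 1) (s s' : ℝ)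
    (hs : 1 < s) (hs' : 1 < s') (M : ℝ) (hM : Real.log q + 2 ≤ M) :
    ‖LL χ s - LL χ s'‖ ≤ 3 * M^2 * |s - s'| := by
  have := Convex.norm_image_sub_le_of_norm_hasDerivWithin_le (𝕜 := ℝ) (f := fun t : ℝ => LL χ t)
    (f' := fun t : ℝ => -LSeries (LSeries.logMul (fun n => χ (n : ZMod q))) t) (C := 3 * M^2)
    (s := Set.Ioi (1:ℝ)) (x := s') (y := s) ?_ ?_ (convex_Ioi 1) hs' hs
  · simpa using this
  · intro t ht
    have ha : LSeries.abscissaOfAbsConv (fun n => χ (n : ZMod q)) < ((t:ℂ).re : EReal) := by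
      rw [DirichletCharacter.absicssaOfAbsConv_eq_one (NeZero.ne q), Complex.ofReal_re]
      exact_mod_cast ht
    exact (LSeries_hasDerivAt ha).comp_ofReal.hasDerivWithinAt
  · intro t ht
    rw [norm_neg]
    simpa using char_Lbound χ hχ 1 t ht M (by push_cast; linarith)

lemma LL_complex {q : ℕ} [NeZero q] (χ : DirichletCharacter ℂ q) (hχ : χ^2 ≠ 1) (s : ℝ)
    (hs : 1 < s) (hs2 : s ≤ 2) (M : ℝ) (hM : Real.log q + 2 ≤ M) :
    1 / (10368 * M^7) ≤ ‖LL χ s‖ := by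
  have hM2 : 2 ≤ M := by
    have := Real.log_natCast_nonneg q
    linarith
  have hχ1 : χ ≠ 1 := by rintro rfl; simp at hχ
  have dir : ∀ y : ℝ, 0 < y → y ≤ 1 → y^3 / (24 * M) ≤ ‖LL χ (1+y)‖^4 := by
    intro y hy hy1
    have h := DirichletCharacter.norm_LSeries_product_ge_one χ hy 0
    rw [norm_mul, norm_mul, norm_pow, norm_pow] at h
    simp only [Complex.ofReal_zero, mul_zero, add_zero] at h
    have e : (1:ℂ) + y = ((1+y:ℝ):ℂ) := by push_cast; ring
    rw [e] at h
    have h1 := zeta_bound (fun n => (1 : DirichletCharacter ℂ q) (n : ZMod q))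
      (fun n => DirichletCharacter.norm_le_one _ _) (1+y) (by linarith)
    have h1' : 1 + 1/(1+y-1) ≤ 2/y := by
      rw [add_sub_cancel_left, le_div_iff₀ hy]; field_simp; linarith
    have h2 := LL_bound (χ^2) hχ (1+y) (by linarith) M hM
    have h3 : 1 ≤ (2/y)^3 * ‖LL χ (1+y)‖^4 * (3*M) := by
      refine le_trans h ?_
      gcongr
      · exact h1.trans h1'
      · exact le_rfl
      · exact h2
    rw [div_le_iff₀ (by positivity)]
    calc y^3 ≤ y^3 * ((2/y)^3 * ‖LL χ (1+y)‖^4 * (3*M)) := by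
          nlinarith [pow_pos hy 3]
      _ = _ := by field_simp; ring
  set c : ℝ := 1/31104 with hc
  set x : ℝ := c / M^9 with hx
  have hM9 : (1:ℝ) ≤ M^9 := one_le_pow₀ (by linarith)
  have hx0 : 0 < x := by positivity
  have hx1 : x ≤ 1 := by
    rw [hx, div_le_one (by positivity)]; rw [hc]; linarith
  have big : ∀ y : ℝ, x ≤ y → y ≤ 1 → 6 * c / M^7 ≤ ‖LL χ (1+y)‖ := by
    intro y hy hy1
    have h := dir y (by linarith) hy1
    have h2 : (6*c/M^7)^4 ≤ ‖LL χ (1+y)‖^4 := by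
      refine le_trans ?_ h
      calc (6*c/M^7)^4 = x^3/(24*M) := by rw [hx, hc]; field_simp; norm_num
        _ ≤ _ := by gcongr
    exact le_of_pow_le_pow_left₀ (by norm_num) (norm_nonneg _) h2
  have hgoal : 1 / (10368 * M^7) = 3 * c / M^7 := by rw [hc]; field_simp; norm_num
  rw [hgoal]
  rcases le_total x (s-1) with h | h
  · have := big (s-1) h (by linarith)
    rw [add_sub_cancel] at this
    refine le_trans ?_ this
    have : 0 ≤ c := by rw [hc]; norm_num
    gcongr; norm_num
  · have h1 := big x le_rfl hx1
    have h2 := LL_lip χ hχ1 (1+x) s (by linarith) hs M hM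
    have h3 : |1 + x - s| ≤ x := by rw [abs_of_nonneg (by linarith)]; linarith
    have h4 : 3 * M^2 * |1+x-s| ≤ 3 * c / M^7 := by
      calc _ ≤ 3 * M^2 * x := by gcongr
        _ = _ := by rw [hx]; field_simp
    have h5 := norm_sub_norm_le (LL χ (1+x)) (LL χ s)
    have h6 : 6 * c / M^7 = 3 * c / M^7 + 3 * c/M^7 := by ring
    linarith

/-- product character -/
noncomputable def prodChar {q r : ℕ} (χ : DirichletCharacter ℂ q) (ψ : DirichletCharacter ℂ r) :
    DirichletCharacter ℂ (q*r) :=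
  DirichletCharacter.changeLevel (dvd_mul_right q r) χ * DirichletCharacter.changeLevel (dvd_mul_left r q) ψ

lemma prodChar_apply {q r : ℕ} (χ : DirichletCharacter ℂ q) (ψ : DirichletCharacter ℂ r)
    (n : ℕ) : prodChar χ ψ (n : ZMod (q*r)) = χ (n : ZMod q) * ψ (n : ZMod r) := by
  unfold prodChar
  rw [MulChar.mul_apply]
  by_cases h : Nat.Coprime n (q*r)
  · have h' : IsCoprime (n:ℤ) ((q*r : ℕ):ℤ) := Nat.isCoprime_iff_coprime.2 h
    have h1 := DirichletCharacter.changeLevel_eq_cast_of_dvd' χ (dvd_mul_right q r) h'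
    have h2 := DirichletCharacter.changeLevel_eq_cast_of_dvd' ψ (dvd_mul_left r q) h'
    simp only [Int.cast_natCast] at h1 h2
    rw [h1, h2]
  · have hz : ¬ IsUnit (n : ZMod (q*r)) := by rwa [ZMod.isUnit_iff_coprime]
    rw [MulChar.map_nonunit _ hz, zero_mul]
    rw [Nat.coprime_mul_iff_right] at h
    rcases not_and_or.1 h with h | h
    · rw [MulChar.map_nonunit χ (by rwa [ZMod.isUnit_iff_coprime]), zero_mul]
    · rw [MulChar.map_nonunit ψ (by rwa [ZMod.isUnit_iff_coprime]), mul_zero]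

lemma prodChar_ne_one {q r : ℕ} [NeZero q] [NeZero r] (χ : DirichletCharacter ℂ q)
    (ψ : DirichletCharacter ℂ r) (hχ : χ.IsPrimitive) (hψ : ψ.IsPrimitive)
    (h : prodChar χ ψ⁻¹ = 1) : (⟨q, χ⟩ : Σ n : ℕ, DirichletCharacter ℂ n) = ⟨r, ψ⟩ := by
  unfold prodChar at h
  rw [map_inv, mul_inv_eq_one] at h
  haveI : NeZero (q*r) := ⟨mul_ne_zero (NeZero.ne q) (NeZero.ne r)⟩
  have h1 := DirichletCharacter.conductor_changeLevel (χ := χ) (dvd_mul_right q r)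
  have h2 := DirichletCharacter.conductor_changeLevel (χ := ψ) (dvd_mul_left r q)
  rw [h, h2] at h1
  have hqr : q = r := by
    rw [← (DirichletCharacter.isPrimitive_def _).1 hχ, ← (DirichletCharacter.isPrimitive_def _).1 hψ, h1]
  subst hqr
  have := DirichletCharacter.changeLevel_injective _ h
  rw [this]

end DSR

namespace DSR
open Finset

lemma real_char_val {q : ℕ} (χ : DirichletCharacter ℂ q) (h : χ^2 = 1) (n : ZMod q) :
    χ n = 0 ∨ χ n = 1 ∨ χ n = -1 := by
  by_cases hn : IsUnit n
  · right
    have : (χ^2) n = 1 := by rw [h, MulChar.one_apply hn]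
    rw [MulChar.pow_apply' _ two_ne_zero] at this
    have h2 : (χ n - 1) * (χ n + 1) = 0 := by linear_combination this
    rcases mul_eq_zero.1 h2 with h | h
    · left; linear_combination h
    · right; linear_combination h
  · left; exact MulChar.map_nonunit _ hn

lemma landau_local (t : ℝ) (ht : 0 < t) (ht1 : t < 1) (a b : ℂ) (ha : a = 0 ∨ a = 1 ∨ a = -1)
    (hb : b = 0 ∨ b = 1 ∨ b = -1) :
    0 ≤ (-Complex.log (1 - t)).re + (-Complex.log (1 - a * t)).re + (-Complex.log (1 - b * t)).re
      + (-Complex.log (1 - (a*b) * t)).re := by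
  have h1 : ‖(1:ℂ) - t‖ = 1 - t := by
    rw [← Complex.ofReal_one, ← Complex.ofReal_sub, Complex.norm_real, Real.norm_of_nonneg (by linarith)]
  have h2 : ‖(1:ℂ) + t‖ = 1 + t := by
    rw [← Complex.ofReal_one, ← Complex.ofReal_add, Complex.norm_real, Real.norm_of_nonneg (by linarith)]
  have l1 : Real.log (1 - t) ≤ 0 := Real.log_nonpos (by linarith) (by linarith)
  have l2 : Real.log (1 - t) + Real.log (1+t) ≤ 0 := by
    rw [← Real.log_mul (by linarith) (by linarith)]
    exact Real.log_nonpos (by nlinarith) (by nlinarith)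
  rcases ha with rfl | rfl | rfl <;> rcases hb with rfl | rfl | rfl <;>
    simp only [Complex.neg_re, Complex.log_re, zero_mul, mul_zero, one_mul, mul_one, sub_zero, neg_mul,
      sub_neg_eq_add, norm_one, Real.log_one, h1, h2, neg_neg, neg_zero] <;> linarith

lemma landau_prod {q r : ℕ} (χ : DirichletCharacter ℂ q) (ψ : DirichletCharacter ℂ r)
    (hχ : χ^2 = 1) (hψ : ψ^2 = 1) (s : ℝ) (hs : 1 < s) :
    1 ≤ ‖LL (1 : DirichletCharacter ℂ 1) s‖ * ‖LL χ s‖ * ‖LL ψ s‖ * ‖LL (prodChar χ ψ) s‖ := by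
  have h₀ : 1 < (s:ℂ).re := by simpa using hs
  have H0 := DirichletCharacter.summable_neg_log_one_sub_mul_prime_cpow (1 : DirichletCharacter ℂ 1) h₀
  have H1 := DirichletCharacter.summable_neg_log_one_sub_mul_prime_cpow χ h₀
  have H2 := DirichletCharacter.summable_neg_log_one_sub_mul_prime_cpow ψ h₀
  have H3 := DirichletCharacter.summable_neg_log_one_sub_mul_prime_cpow (prodChar χ ψ) h₀
  unfold LL
  rw [← DirichletCharacter.LSeries_eulerProduct_exp_log _ h₀,
    ← DirichletCharacter.LSeries_eulerProduct_exp_log _ h₀,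
    ← DirichletCharacter.LSeries_eulerProduct_exp_log _ h₀,
    ← DirichletCharacter.LSeries_eulerProduct_exp_log _ h₀]
  rw [Complex.norm_exp, Complex.norm_exp, Complex.norm_exp, Complex.norm_exp, ← Real.exp_add,
    ← Real.exp_add, ← Real.exp_add, Real.one_le_exp_iff, Complex.re_tsum H0, Complex.re_tsum H1,
    Complex.re_tsum H2, Complex.re_tsum H3]
  have S0 := (Complex.hasSum_re H0.hasSum).summable
  have S1 := (Complex.hasSum_re H1.hasSum).summable
  have S2 := (Complex.hasSum_re H2.hasSum).summable
  have S3 := (Complex.hasSum_re H3.hasSum).summable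
  rw [← S0.tsum_add S1, ← (S0.add S1).tsum_add S2, ← ((S0.add S1).add S2).tsum_add S3]
  refine tsum_nonneg fun p => ?_
  have hp := p.prop.two_le
  have hpt : ((p : ℕ):ℂ) ^ (-(s:ℂ)) = (((p:ℕ):ℝ)^(-s) : ℝ) := by
    rw [Complex.ofReal_cpow (Nat.cast_nonneg _)]; simp
  have ht1 : ((p:ℕ):ℝ)^(-s) < 1 := by
    apply Real.rpow_lt_one_of_one_lt_of_neg
    · exact_mod_cast p.prop.one_lt
    · linarith
  have ht : 0 < ((p:ℕ):ℝ)^(-s) := by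
    have := p.prop.pos
    positivity
  have := landau_local _ ht ht1 _ _ (real_char_val χ hχ (p:ℕ)) (real_char_val ψ hψ (p:ℕ))
  rw [hpt, prodChar_apply, MulChar.one_apply (isUnit_of_subsingleton _), one_mul]
  exact this

/-- Landau: two distinct real primitive characters cannot both have small `L`-values. -/
lemma landau {q r : ℕ} [NeZero q] [NeZero r] (χ : DirichletCharacter ℂ q)
    (ψ : DirichletCharacter ℂ r) (hχp : χ.IsPrimitive) (hψp : ψ.IsPrimitive)
    (hχ : χ^2 = 1) (hψ : ψ^2 = 1)
    (hne : (⟨q, χ⟩ : Σ n : ℕ, DirichletCharacter ℂ n) ≠ ⟨r, ψ⟩) (y : ℝ) (hy : 0 < y) (hy1 : y ≤ 1)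
    (M : ℝ) (hM : Real.log q + Real.log r + 2 ≤ M) :
    y / (6 * M) ≤ ‖LL χ (1+y)‖ * ‖LL ψ (1+y)‖ := by
  have h := landau_prod χ ψ hχ hψ (1+y) (by linarith)
  have hz : ‖LL (1 : DirichletCharacter ℂ 1) (1+y)‖ ≤ 2 / y := by
    have := zeta_bound (fun n => (1 : DirichletCharacter ℂ 1) (n : ZMod 1))
      (fun n => DirichletCharacter.norm_le_one _ _) (1+y) (by linarith)
    refine le_trans this ?_
    rw [add_sub_cancel_left, show 2 / y = 1/y + 1/y by ring]
    have : 1 ≤ 1/y := by rw [le_div_iff₀ hy]; linarith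
    linarith
  have hne1 : prodChar χ ψ ≠ 1 := by
    intro h1
    apply hne
    apply prodChar_ne_one χ ψ hχp hψp
    rwa [show ψ⁻¹ = ψ from ?_]
    rw [inv_eq_iff_mul_eq_one, ← sq, hψ]
  have : NeZero (q*r) := ⟨mul_ne_zero (NeZero.ne q) (NeZero.ne r)⟩
  have hq0 : (q:ℝ) ≠ 0 := by exact_mod_cast NeZero.ne q
  have hr0 : (r:ℝ) ≠ 0 := by exact_mod_cast NeZero.ne r
  have hb := LL_bound (prodChar χ ψ) hne1 (1+y) (by linarith) M (by
    push_cast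
    rw [Real.log_mul hq0 hr0]; exact hM)
  have hMp : 0 < M := by
    have := Real.log_natCast_nonneg q
    have := Real.log_natCast_nonneg r
    linarith
  rw [div_le_iff₀ (by positivity)]
  have h2 : 1 ≤ 2 / y * (‖LL χ (1+y)‖ * ‖LL ψ (1+y)‖) * (3 * M) := by
    refine h.trans ?_
    rw [mul_assoc ‖LL (1 : DirichletCharacter ℂ 1) (1+y)‖]
    gcongr
  calc y = y * 1 := by ring
    _ ≤ y * (2 / y * (‖LL χ (1+y)‖ * ‖LL ψ (1+y)‖) * (3 * M)) := by gcongr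
    _ = _ := by field_simp; ring

/-- `σ_i = B i e^{-i}` -/
noncomputable def sig (B i : ℕ) : ℝ := B * i * Real.exp (-i)

def Bad (A B i : ℕ) (c : Σ n : ℕ, DirichletCharacter ℂ n) : Prop :=
  c.1 ≠ 0 ∧ (c.1 : ℝ) ≤ Real.exp (A * i) ∧ c.2.IsPrimitive ∧ c.2 ≠ 1 ∧
    ‖LL c.2 (1 + sig B i)‖ < 1 / (i:ℝ)^8

lemma sig_small (A B : ℕ) : ∀ᶠ i : ℕ in Filter.atTop, sig B i * (5 * A * i)^7 ≤ 1 := by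
  have h := (Real.tendsto_pow_mul_exp_neg_atTop_nhds_zero 8).comp (tendsto_natCast_atTop_atTop (R := ℝ))
  have h2 := h.const_mul ((B:ℝ) * (5*A)^7)
  rw [mul_zero] at h2
  filter_upwards [h2.eventually (gt_mem_nhds one_pos)] with i hi
  unfold sig
  simp only [Function.comp] at hi
  refine le_trans (le_of_eq ?_) hi.le
  ring

lemma bad_real (A B : ℕ) (hA : 1 ≤ A) (hB : 1 ≤ B) : ∀ᶠ i : ℕ in Filter.atTop,
    ∀ c, Bad A B i c → c.2^2 = 1 := by
  filter_upwards [sig_small A B, Filter.eventually_ge_atTop (10368 * (3*A)^7 + 2)] with i hi hi2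
  rintro ⟨q, χ⟩ ⟨h0, h1, h2, h3, h4⟩
  dsimp only at *
  by_contra hne
  have : NeZero q := ⟨h0⟩
  have hA' : (1:ℝ) ≤ A := by exact_mod_cast hA
  have hi2' : (10368 * (3*A)^7 + 2 : ℝ) ≤ i := by exact_mod_cast hi2
  have hi3 : (2:ℝ) ≤ i := by
    have : (0:ℝ) ≤ 10368 * (3*A)^7 := by positivity
    linarith
  have hB' : (1:ℝ) ≤ B := by exact_mod_cast hB
  have hs : 0 < sig B i := by unfold sig; positivity
  have hAi : (1:ℝ) ≤ 5 * A * i := by nlinarith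
  have hs1 : sig B i ≤ 1 := by
    have : (1:ℝ) ≤ (5*A*i)^7 := one_le_pow₀ hAi
    nlinarith
  have hq : Real.log q ≤ A * i := by
    rw [Real.log_le_iff_le_exp (by exact_mod_cast Nat.pos_of_ne_zero h0)]; exact h1
  have := LL_complex χ hne (1 + sig B i) (by linarith) (by linarith) (3 * A * i)
    (by nlinarith)
  have h5 : 1 / (i:ℝ)^8 ≤ 1 / (10368 * (3*A*i)^7) := by
    apply one_div_le_one_div_of_le (by positivity)
    calc (10368 * (3*A*i)^7 : ℝ) = (10368 * (3*A)^7) * i^7 := by ring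
      _ ≤ i * i^7 := by gcongr; linarith
      _ = _ := by ring
  linarith

set_option maxHeartbeats 400000 in
lemma bad_unique (A B : ℕ) (hA : 1 ≤ A) (hB : 1 ≤ B) : ∀ᶠ i : ℕ in Filter.atTop,
    ∀ c c', Bad A B i c → Bad A B (i+1) c' → c = c' := by
  have e1 := bad_real A B hA hB
  have e2 := sig_small A B
  filter_upwards [e1, e2, (Filter.tendsto_add_atTop_nat 1).eventually e1,
    (Filter.tendsto_add_atTop_nat 1).eventually e2,
    Filter.eventually_ge_atTop ((5*A)^5 * 2^8 + 10)] with i r1 s1 r2 s2 hi c c' hc hc'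
  by_contra hne
  have R1 := r1 c hc
  have R2 := r2 c' hc'
  obtain ⟨q, χ⟩ := c
  obtain ⟨r, ψ⟩ := c'
  obtain ⟨h0, h1, h2, h3, h4⟩ := hc
  obtain ⟨k0, k1, k2, k3, k4⟩ := hc'
  dsimp only at *
  have : NeZero q := ⟨h0⟩
  have : NeZero r := ⟨k0⟩
  have hA' : (1:ℝ) ≤ A := by exact_mod_cast hA
  have hB' : (1:ℝ) ≤ B := by exact_mod_cast hB
  have hi' : ((5*A)^5 * 2^8 + 10 : ℝ) ≤ i := by exact_mod_cast hi
  have hi3 : (10:ℝ) ≤ i := by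
    have : (0:ℝ) ≤ (5*A)^5 * 2^8 := by positivity
    linarith
  push_cast at k1 k4 s2
  set M : ℝ := 5 * A * (i+1) with hM
  have hM10 : 10 ≤ M := by nlinarith
  have hq : Real.log q ≤ A * i := by
    rw [Real.log_le_iff_le_exp (by exact_mod_cast Nat.pos_of_ne_zero h0)]; exact h1
  have hr : Real.log r ≤ A * (i+1) := by
    rw [Real.log_le_iff_le_exp (by exact_mod_cast Nat.pos_of_ne_zero k0)]; exact k1
  have hqr : Real.log q + Real.log r + 2 ≤ M := by nlinarith
  have lq := Real.log_natCast_nonneg q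
  have lr := Real.log_natCast_nonneg r
  set y : ℝ := 1 / M^7 with hy
  have hy0 : 0 < y := by positivity
  have hy1 : y ≤ 1 := by
    rw [hy, div_le_one (by positivity)]; exact one_le_pow₀ (by linarith)
  have L := landau χ ψ h2 k2 R1 R2 hne y hy0 hy1 M hqr
  have hs1 : 0 < sig B i := by unfold sig; positivity
  have hs2 : 0 < sig B (i+1) := by unfold sig; positivity
  have sy2 : sig B (i+1) ≤ y := by rw [hy, le_div_iff₀ (by positivity)]; exact s2
  have i5 : (1:ℝ) / i^8 ≤ 1 / M^5 := by
    apply one_div_le_one_div_of_le (by positivity)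
    calc M^5 ≤ (5 * (A:ℝ) * (2 * (i:ℝ)))^5 := by rw [hM]; gcongr; linarith
      _ = ((5*(A:ℝ))^5 * 2^5) * (i:ℝ)^5 := by ring
      _ ≤ (i:ℝ)^3 * (i:ℝ)^5 := by
        gcongr
        have : (5*A)^5 * 2^5 ≤ (i:ℝ) := by
          have : (0:ℝ) ≤ (5*A)^5 := by positivity
          linarith
        have h1 : (i:ℝ)^1 ≤ i^3 := pow_le_pow_right₀ (by linarith) (by norm_num)
        linarith
      _ = _ := by ring
  have i6 : (1:ℝ) / (i+1)^8 ≤ 1/M^5 := by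
    refine le_trans ?_ i5
    gcongr; linarith
  have key : ∀ {t : ℕ} [NeZero t] (ξ : DirichletCharacter ℂ t), ξ ≠ 1 → Real.log t + 2 ≤ M →
      ∀ z, 0 < z → z ≤ 2 * y → ‖LL ξ (1 + z)‖ < 1 / M^5 → ‖LL ξ (1+y)‖ ≤ 4 / M^5 := by
    intro t _ ξ hξ ht z hz hzy hb
    have := LL_lip ξ hξ (1+y) (1+z) (by linarith) (by linarith) M ht
    have h3 : |1 + y - (1+z)| ≤ y := by rw [abs_le]; constructor <;> linarith
    have h4 : 3 * M^2 * |1+y-(1+z)| ≤ 3 / M^5 := by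
      calc _ ≤ 3 * M^2 * y := by gcongr
        _ = _ := by rw [hy]; field_simp
    have h5 := norm_sub_norm_le (LL ξ (1+y)) (LL ξ (1+z))
    have h6 : 4 / M^5 = 1/M^5 + 3 / M^5 := by ring
    linarith
  have sy1 : sig B i ≤ 2 * y := by
    rw [hy]
    have : sig B i * M^7 ≤ 2 := by
      calc sig B i * M^7 = sig B i * (5*A*i)^7 * ((i+1)/i)^7 := by rw [hM]; field_simp
        _ ≤ 1 * (1.1)^7 := by
          gcongr
          rw [div_le_iff₀ (by linarith)]; linarith
        _ ≤ 2 := by norm_num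
    rw [mul_one_div, le_div_iff₀ (by positivity)]; exact this
  have K1 := key χ h3 (by linarith) _ hs1 sy1 (by linarith)
  have K2 := key ψ k3 (by linarith) _ hs2 (by linarith) (by linarith)
  have : y / (6*M) ≤ (4 / M^5) * (4/M^5) := L.trans (by gcongr)
  rw [hy, div_div, div_mul_div_comm, div_le_div_iff₀ (by positivity) (by positivity)] at this
  have hM2 : 0 < M^2 - 96 := by nlinarith
  have h8 : 0 < M^8 * (M^2 - 96) := mul_pos (by positivity) hM2
  linarith [show M^8 * (M^2 - 96) = 1 * (M^5 * M^5) - 4 * 4 * (M^7 * (6*M)) by ring]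

/-- Infinitely many good scales. -/
lemma good_scales (A B : ℕ) (hA : 1 ≤ A) (hB : 1 ≤ B) (I0 : ℕ) : ∃ i, I0 ≤ i ∧ ∀ c, ¬ Bad A B i c := by
  by_contra hcon
  push Not at hcon
  obtain ⟨I1, hI1⟩ := Filter.eventually_atTop.1 (bad_unique A B hA hB)
  choose! c hc using hcon
  set N := max I0 (max I1 1)
  have hfix : ∀ n, c (N + n) = c N := by
    intro n
    induction n with
    | zero => rfl
    | succ n ih =>
      rw [← ih]
      exact (hI1 (N+n) (by omega) _ _ (hc (N+n) (by omega)) (hc (N+n+1) (by omega))).symm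
  rcases hcN : c N with ⟨q, χ⟩
  have hall : ∀ n, Bad A B (N+n) ⟨q, χ⟩ := fun n => by
    have := hc (N+n) (by omega)
    rwa [hfix n, hcN] at this
  obtain ⟨h0, -, -, h3, -⟩ := hall 0
  dsimp only at h0 h3
  have : NeZero q := ⟨h0⟩
  have hsig : Filter.Tendsto (fun i : ℕ => sig B i) Filter.atTop (nhds 0) := by
    have h := (Real.tendsto_pow_mul_exp_neg_atTop_nhds_zero 1).comp (tendsto_natCast_atTop_atTop (R := ℝ))
    have h2 := h.const_mul (B:ℝ)
    rw [mul_zero] at h2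
    refine h2.congr fun i => ?_
    simp only [Function.comp, sig]; ring
  have hlim : Filter.Tendsto (fun i : ℕ => ‖χ.LFunction (1 + sig B i : ℝ)‖) Filter.atTop
      (nhds ‖χ.LFunction 1‖) := by
    apply Filter.Tendsto.norm
    have hcont := (DirichletCharacter.differentiable_LFunction h3).continuous
    have h1 : Filter.Tendsto (fun i : ℕ => (((1 + sig B i : ℝ)):ℂ)) Filter.atTop (nhds ((1:ℝ):ℂ)) := by
      refine (Complex.continuous_ofReal.tendsto _).comp ?_
      simpa using hsig.const_add 1
    rw [Complex.ofReal_one] at h1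
    exact (hcont.tendsto 1).comp h1
  have hzero : Filter.Tendsto (fun n : ℕ => 1 / ((N+n : ℕ):ℝ)^8) Filter.atTop (nhds 0) := by
    have h1 : Filter.Tendsto (fun x : ℝ => 1 / x^8) Filter.atTop (nhds 0) := by
      simp only [one_div]
      exact (Filter.tendsto_pow_atTop (by norm_num)).inv_tendsto_atTop
    exact h1.comp (tendsto_natCast_atTop_atTop.comp (Filter.tendsto_atTop_mono
      (fun n => Nat.le_add_left n N) Filter.tendsto_id))
  have hlim2 := hlim.comp (Filter.tendsto_atTop_mono (fun n => Nat.le_add_left n N) Filter.tendsto_id)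
  have hle : ‖χ.LFunction 1‖ ≤ 0 := by
    refine le_of_tendsto_of_tendsto' hlim2 hzero fun n => ?_
    have hb := (hall n).2.2.2.2.le
    have hs : 0 < sig B (N+n) := by
      have : 1 ≤ N := by omega
      unfold sig; positivity
    dsimp only at hb
    simp only [Function.comp, id]
    rwa [DirichletCharacter.LFunction_eq_LSeries _ (by
      rw [Complex.ofReal_re]; linarith)]
  exact DirichletCharacter.LFunction_apply_one_ne_zero h3 (norm_le_zero_iff.1 hle)

end DSR

namespace DSR
open Finset

noncomputable def phi (v : ℝ) : ℝ := max v 0 * Real.exp (1 - max v 0)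
noncomputable def ff (j : ℕ) (v : ℝ) : ℝ := max (phi v ^ j - Real.exp (-j)) 0

lemma phi_nonneg (v : ℝ) : 0 ≤ phi v := mul_nonneg (le_max_right _ _) (Real.exp_pos _).le

lemma mul_exp_le (w : ℝ) : w * Real.exp (1 - w) ≤ 1 := by
  have h := Real.add_one_le_exp (w - 1)
  have h2 : Real.exp (w-1) * Real.exp (1-w) = 1 := by rw [← Real.exp_add]; simp
  have := mul_le_mul_of_nonneg_right h (Real.exp_pos (1-w)).le
  simp only [sub_add_cancel] at this
  linarith

lemma phi_le_one (v : ℝ) : phi v ≤ 1 := mul_exp_le _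

lemma ff_nonneg (j : ℕ) (v : ℝ) : 0 ≤ ff j v := le_max_right _ _

lemma ff_le_one (j : ℕ) (v : ℝ) : ff j v ≤ 1 := by
  refine max_le ?_ zero_le_one
  have := pow_le_one₀ (n := j) (phi_nonneg v) (phi_le_one v)
  have := Real.exp_pos (-(j:ℝ))
  linarith

lemma phi_small (v : ℝ) (h : v < 1/8 ∨ 4 < v) : phi v ≤ Real.exp (-1) := by
  unfold phi
  rcases h with h | h
  · have h1 : max v 0 ≤ 1/8 := max_le h.le (by norm_num)
    have h0 : 0 ≤ max v 0 := le_max_right _ _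
    calc _ ≤ 1/8 * Real.exp 1 := by gcongr; linarith
      _ ≤ Real.exp (-1) := by
        rw [Real.exp_neg, inv_eq_one_div, le_div_iff₀ (Real.exp_pos _)]
        have := Real.exp_one_lt_d9
        have := Real.exp_pos 1
        nlinarith
  · rw [max_eq_left (by linarith)]
    have h1 : v ≤ Real.exp (v - 2) := by
      have := Real.quadratic_le_exp_of_nonneg (x := v - 2) (by linarith)
      nlinarith
    calc v * Real.exp (1-v) ≤ Real.exp (v-2) * Real.exp (1-v) := by gcongr
      _ = _ := by rw [← Real.exp_add]; ring_nf

lemma ff_supp (j : ℕ) (v : ℝ) (h : v < 1/8 ∨ 4 < v) : ff j v = 0 := by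
  unfold ff
  refine max_eq_right ?_
  have := pow_le_pow_left₀ (phi_nonneg v) (phi_small v h) j
  rw [← Real.exp_nat_mul, mul_neg_one] at this
  linarith

lemma phi_lip (v w : ℝ) : |phi v - phi w| ≤ Real.exp 1 * |v - w| := by
  have h := Convex.norm_image_sub_le_of_norm_hasDerivWithin_le (𝕜 := ℝ)
    (f := fun t : ℝ => t * Real.exp (1 - t))
    (f' := fun t : ℝ => 1 * Real.exp (1-t) + t * (Real.exp (1-t) * (-1))) (C := Real.exp 1)
    (s := Set.Ici (0:ℝ)) (x := max w 0) (y := max v 0) ?_ ?_ (convex_Ici 0)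
    (Set.mem_Ici.2 (le_max_right _ _)) (Set.mem_Ici.2 (le_max_right _ _))
  · rw [Real.norm_eq_abs, Real.norm_eq_abs] at h
    refine h.trans ?_
    exact mul_le_mul_of_nonneg_left (abs_max_sub_max_le_abs v w 0) (Real.exp_pos 1).le
  · intro t _
    apply HasDerivAt.hasDerivWithinAt
    refine (hasDerivAt_id' t).mul ?_
    exact ((hasDerivAt_id' t).const_sub 1).exp
  · intro t ht
    have ht : 0 ≤ t := ht
    rw [show 1 * Real.exp (1-t) + t * (Real.exp (1-t) * (-1)) = (1-t) * Real.exp (1-t) by ring,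
      norm_mul, Real.norm_eq_abs, Real.norm_eq_abs, abs_of_pos (Real.exp_pos _), Real.exp_sub]
    have h1 : |1 - t| ≤ Real.exp t := by
      have := Real.add_one_le_exp t
      rw [abs_le]; constructor <;> linarith
    rw [mul_div_assoc', div_le_iff₀ (Real.exp_pos _), mul_comm]
    gcongr

lemma pow_lip (a b : ℝ) (ha : 0 ≤ a) (ha1 : a ≤ 1) (hb : 0 ≤ b) (hb1 : b ≤ 1) (j : ℕ) :
    |a^j - b^j| ≤ j * |a - b| := by
  induction j with
  | zero => simp
  | succ j ih =>
    rw [show a^(j+1) - b^(j+1) = a^j * (a - b) + (a^j - b^j) * b by ring]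
    refine (abs_add_le _ _).trans ?_
    rw [abs_mul, abs_mul, abs_of_nonneg hb, abs_of_nonneg (pow_nonneg ha j)]
    have h1 := pow_le_one₀ (n := j) ha ha1
    have h2 := abs_nonneg (a - b)
    have h3 := abs_nonneg (a^j - b^j)
    push_cast
    nlinarith

lemma ff_lip (j : ℕ) (v w : ℝ) : |ff j v - ff j w| ≤ Real.exp 1 * j * |v - w| := by
  unfold ff
  refine (abs_max_sub_max_le_abs _ _ _).trans ?_
  rw [sub_sub_sub_cancel_right]
  refine (pow_lip _ _ (phi_nonneg _) (phi_le_one _) (phi_nonneg _) (phi_le_one _) j).trans ?_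
  have := phi_lip v w
  calc _ ≤ (j:ℝ) * (Real.exp 1 * |v - w|) := by gcongr
    _ = _ := by ring

lemma phi_ff_diff (j : ℕ) (hj : 4 ≤ j) (v : ℝ) (hv : 0 ≤ v) :
    |phi v ^ j - ff j v| ≤ Real.exp (-(j/7 : ℝ)) * Real.exp (-v) := by
  have hp := pow_nonneg (phi_nonneg v) j
  have hm : |phi v ^ j - ff j v| = min (phi v^j) (Real.exp (-j)) := by
    unfold ff
    have := Real.exp_pos (-(j:ℝ))
    rcases le_total (phi v^j - Real.exp (-j)) 0 with h | h
    · rw [max_eq_right h, min_eq_left (by linarith), sub_zero, abs_of_nonneg hp]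
    · rw [max_eq_left h, min_eq_right (by linarith), sub_sub_cancel, abs_of_pos this]
  rw [hm]
  have hphi : phi v ≤ 2 * Real.exp (-(v/2)) := by
    unfold phi
    rw [max_eq_left hv]
    have h1 := mul_exp_le (v/2)
    calc v * Real.exp (1 - v) = 2 * ((v/2) * Real.exp (1 - v/2)) * Real.exp (-(v/2)) := by
          rw [show (1:ℝ) - v = (1 - v/2) + -(v/2) by ring, Real.exp_add]; ring
      _ ≤ 2 * 1 * Real.exp (-(v/2)) := by gcongr
      _ = _ := by ring
  have hphi2 : phi v ≤ Real.exp (0.6932 - v/2) := by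
    refine hphi.trans ?_
    rw [sub_eq_add_neg, Real.exp_add]
    gcongr
    have := Real.log_two_lt_d9
    rw [← Real.log_le_iff_le_exp (by norm_num)]; linarith
  have hj' : (4:ℝ) ≤ j := by exact_mod_cast hj
  have hsq : (min (phi v^j) (Real.exp (-j)))^2 ≤ (Real.exp (-(j/7 : ℝ)) * Real.exp (-v))^2 := by
    have h0 : 0 ≤ min (phi v^j) (Real.exp (-j)) := le_min hp (Real.exp_pos _).le
    calc (min (phi v^j) (Real.exp (-j)))^2 = min (phi v^j) (Real.exp (-j)) * min (phi v^j) (Real.exp (-j)) := sq _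
      _ ≤ phi v ^ j * Real.exp (-j) := by
        gcongr
        · exact min_le_left _ _
        · exact min_le_right _ _
      _ ≤ Real.exp (0.6932 - v/2)^j * Real.exp (-j) := by
        have := phi_nonneg v
        gcongr
      _ = Real.exp (j * (0.6932 - v/2) + -j) := by rw [← Real.exp_nat_mul, ← Real.exp_add]
      _ ≤ Real.exp (2 * (-(j/7) + -v)) := by
        apply Real.exp_le_exp.2
        nlinarith
      _ = _ := by rw [← Real.exp_add, ← Real.exp_nat_mul]; norm_cast
  exact le_of_sq_le_sq hsq (by positivity)

end DSR

namespace DSR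
open Finset

noncomputable def Nx (X : ℝ) : ℕ := ⌊Real.exp (4*X)⌋₊ + 1

lemma f_zero_of_ge {f : ℝ → ℝ} (hf : ∀ v, (v < 1/8 ∨ 4 < v) → f v = 0) (X : ℝ) (hX : 0 < X) (n : ℕ)
    (hn : Nx X ≤ n) : f (Real.log n / X) = 0 := by
  apply hf
  right
  rw [lt_div_iff₀ hX, Real.lt_log_iff_exp_lt]
  · exact Nat.lt_of_floor_lt (by unfold Nx at hn; omega)
  · have : 0 < n := by unfold Nx at hn; omega
    exact_mod_cast this

noncomputable def SL {q : ℕ} (X : ℝ) (f : ℝ → ℝ) (χ : DirichletCharacter ℂ q) : ℂ :=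
  ∑ n ∈ range (Nx X), chiL χ n * ((f (Real.log n / X) / n : ℝ) : ℂ)

lemma norm_chiL {q : ℕ} (χ : DirichletCharacter ℂ q) (n : ℕ) :
    ‖chiL χ n‖ ≤ ArithmeticFunction.vonMangoldt n := by
  unfold chiL
  rw [Pi.mul_apply, norm_mul, Complex.norm_real,
    Real.norm_of_nonneg ArithmeticFunction.vonMangoldt_nonneg]
  exact mul_le_of_le_one_left ArithmeticFunction.vonMangoldt_nonneg (DirichletCharacter.norm_le_one _ _)

lemma term_phi {q : ℕ} (χ : DirichletCharacter ℂ q) (X : ℝ) (hX : 0 < X) (j n : ℕ) :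
    ((Real.exp 1 / X : ℝ) : ℂ)^j * LSeries.term (LSeries.logMul^[j] (chiL χ)) ((1 + j / X : ℝ) : ℂ) n
      = chiL χ n * ((phi (Real.log n / X) ^ j / n : ℝ) : ℂ) := by
  rcases Nat.eq_zero_or_pos n with rfl | hn
  · simp
  rw [LSeries.term_of_ne_zero hn.ne', logMul_iter]
  have hnr : (0:ℝ) < n := by exact_mod_cast hn
  have h1 : ((n:ℂ))^((1 + j/X : ℝ) : ℂ) = ((n * Real.exp (j * (Real.log n / X)) : ℝ) : ℂ) := by
    rw [show (n:ℂ) = ((n:ℝ):ℂ) by simp, ← Complex.ofReal_cpow hnr.le, Real.rpow_add hnr, Real.rpow_one,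
      Real.rpow_def_of_pos hnr]
    congr 3; ring_nf
  have h2 : phi (Real.log n / X) ^ j = (Real.exp 1/X)^j * Real.log n^j / Real.exp (j * (Real.log n / X)) := by
    have : 0 ≤ Real.log n / X := div_nonneg (Real.log_natCast_nonneg n) hX.le
    unfold phi
    rw [max_eq_left this, Real.exp_sub, Real.exp_nat_mul, mul_pow, div_pow, div_pow, div_pow]
    field_simp
  rw [h1, h2]
  push_cast
  have e1 : Complex.exp (j * (Complex.log n / X)) ≠ 0 := Complex.exp_ne_zero _
  have e2 : (n:ℂ) ≠ 0 := by exact_mod_cast hn.ne'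
  have e3 : (X:ℂ) ≠ 0 := by exact_mod_cast hX.ne'
  rw [← Complex.natCast_log]
  field_simp

lemma partA_bound {q : ℕ} [NeZero q] (χ : DirichletCharacter ℂ q) (hχ : χ ≠ 1) (X : ℝ) (hX : 0 < X)
    (j : ℕ) (hj : 4 ≤ j) (M : ℝ) (hM : Real.log q + j + 2 ≤ M) (l : ℝ) (hl : 0 < l) (hl1 : l ≤ 1)
    (hL : l ≤ ‖LL χ (1 + j / X)‖) :
    ‖SL X (ff j) χ‖ ≤ (Real.exp 1 / X)^j * (j.factorial * M^(j+1) * (6 * M / l)^(j+1)) +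
      Real.exp (-(j/7 : ℝ)) * (2 * X * (1 + 2 * X)) := by
  have hjX : 0 < (j:ℝ) / X := div_pos (by exact_mod_cast (by omega : 0 < j)) hX
  have hT := Tbound χ hχ j (1 + j/X) (by linarith) M hM l hl hl1 hL
  set L := LSeries (LSeries.logMul^[j] (chiL χ)) ((1 + j / X : ℝ) : ℂ) with hLdef
  have hsum : HasSum (fun n => ((Real.exp 1 / X : ℝ) : ℂ)^j *
      LSeries.term (LSeries.logMul^[j] (chiL χ)) ((1 + j / X : ℝ) : ℂ) n) (((Real.exp 1 / X : ℝ) : ℂ)^j * L) := by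
    apply HasSum.mul_left
    have : LSeriesSummable (LSeries.logMul^[j] (chiL χ)) ((1 + j / X : ℝ) : ℂ) := by
      apply LSeriesSummable_of_abscissaOfAbsConv_lt_re
      rw [LSeries.absicssaOfAbsConv_logPowMul]
      refine lt_of_le_of_lt (abs_chiL χ) ?_
      rw [Complex.ofReal_re]
      exact_mod_cast (by linarith : 1 < 1 + (j:ℝ)/X)
    exact this.LSeriesHasSum
  simp_rw [term_phi χ X hX] at hsum
  have hlim := hsum.tendsto_sum_nat
  have hev : ∀ᶠ N in Filter.atTop, ‖∑ n ∈ range N, chiL χ n * ((phi (Real.log n / X) ^ j / n : ℝ) : ℂ)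
      - SL X (ff j) χ‖ ≤ Real.exp (-(j/7 : ℝ)) * (2 * X * (1 + 2 * X)) := by
    filter_upwards [Filter.eventually_ge_atTop (Nx X)] with N hN
    have hS : SL X (ff j) χ = ∑ n ∈ range N, chiL χ n * ((ff j (Real.log n / X) / n : ℝ) : ℂ) := by
      unfold SL
      refine sum_subset (range_mono hN) fun n _ hn => ?_
      rw [f_zero_of_ge (ff_supp j) X hX n (by simpa using hn)]; simp
    rw [hS, ← sum_sub_distrib]
    refine (norm_sum_le _ _).trans ?_
    calc _ ≤ ∑ n ∈ range N, Real.exp (-(j/7 : ℝ)) * (2 * X * (1 / (n:ℝ)^(1 + 1/(2*X)))) := by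
          refine sum_le_sum fun n _ => ?_
          rcases Nat.eq_zero_or_pos n with rfl | hn
          · simp
            rw [Real.zero_rpow (by positivity)]; simp
          have hnr : (0:ℝ) < n := by exact_mod_cast hn
          have hv : 0 ≤ Real.log n / X := div_nonneg (Real.log_natCast_nonneg n) hX.le
          rw [← mul_sub, ← Complex.ofReal_sub, norm_mul, Complex.norm_real, ← sub_div, norm_div,
            Real.norm_eq_abs, Real.norm_eq_abs, abs_of_pos hnr]
          have hd := phi_ff_diff j hj _ hv
          have h1 : ‖chiL χ n‖ ≤ Real.log n :=
            (norm_chiL χ n).trans ArithmeticFunction.vonMangoldt_le_log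
          have h3 : Real.log n ≤ 2 * X * Real.exp (Real.log n / (2*X)) := by
            have := Real.add_one_le_exp (Real.log n / (2*X))
            have h4 : Real.log n / (2*X) ≤ Real.exp (Real.log n / (2*X)) := by linarith
            rw [div_le_iff₀ (by positivity)] at h4
            linarith
          have h5 : (n:ℝ)^(1 + 1/(2*X)) = n * Real.exp (Real.log n / (2*X)) := by
            rw [Real.rpow_add hnr, Real.rpow_one, Real.rpow_def_of_pos hnr]; ring_nf
          rw [h5]
          have hlog := Real.log_natCast_nonneg n
          calc _ ≤ (2 * X * Real.exp (Real.log n / (2*X))) *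
              (Real.exp (-(j/7 : ℝ)) * Real.exp (-(Real.log n / X)) / n) := by gcongr; exact h1.trans h3
            _ = _ := by
              rw [show -(Real.log n / X) = -(Real.log n/(2*X)) + -(Real.log n/(2*X)) by field_simp; ring,
                Real.exp_add, Real.exp_neg (Real.log n/(2*X))]
              field_simp
      _ = Real.exp (-(j/7 : ℝ)) * (2 * X * ∑ n ∈ range N, 1 / (n:ℝ)^(1 + 1/(2*X))) := by
          rw [mul_sum, mul_sum]
      _ ≤ _ := by
          have := sum_rpow_le N (1/(2*X)) (by positivity)
          rw [one_div_one_div] at this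
          gcongr
  have hfin := le_of_tendsto (hlim.sub_const (SL X (ff j) χ)).norm hev
  have h1 : ‖((Real.exp 1 / X : ℝ) : ℂ)^j * L‖ ≤ (Real.exp 1 / X)^j * (j.factorial * M^(j+1) * (6 * M / l)^(j+1)) := by
    rw [norm_mul, norm_pow, Complex.norm_real, Real.norm_of_nonneg (by positivity)]
    gcongr
  have h2 := norm_sub_norm_le (SL X (ff j) χ) (((Real.exp 1 / X : ℝ) : ℂ)^j * L)
  rw [norm_sub_rev] at h2
  linarith

lemma exp_beats (C : ℝ) (k : ℕ) (c : ℝ) (hc : 0 < c) :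
    ∀ᶠ i : ℕ in Filter.atTop, C * (i:ℝ)^k ≤ Real.exp (c * i) := by
  have h := (Real.tendsto_pow_mul_exp_neg_atTop_nhds_zero k).comp
    ((tendsto_natCast_atTop_atTop (R := ℝ)).const_mul_atTop hc)
  have h2 := h.const_mul (C / c^k)
  rw [mul_zero] at h2
  filter_upwards [h2.eventually (gt_mem_nhds one_pos)] with i hi
  simp only [Function.comp] at hi
  rw [mul_pow, Real.exp_neg] at hi
  have h3 : C / c^k * (c^k * (i:ℝ)^k * (Real.exp (c*i))⁻¹) = C * (i:ℝ)^k / Real.exp (c*i) := by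
    field_simp
  rw [h3, div_lt_one (Real.exp_pos _)] at hi
  exact hi.le

lemma aux_X4 (X : ℝ) (h : 12 ≤ X) : 2 * X * (1 + 2 * X) ≤ 1/2 * X^4 := by
  have h1 : 2 * X * (1 + 2*X) ≤ 6 * X^2 := by nlinarith
  have h2 : 144 ≤ X^2 := by nlinarith
  have h3 : X^4 = X^2 * X^2 := by ring
  have h4 : 144 * X^2 ≤ X^2 * X^2 := mul_le_mul_of_nonneg_right h2 (sq_nonneg X)
  linarith [sq_nonneg X]

set_option maxHeartbeats 800000 in
/-- Part A: small conductors. -/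
lemma partA (A A' : ℕ) (hA : 1 ≤ A) : ∃ B : ℕ, 1 ≤ B ∧ ∀ᶠ i : ℕ in Filter.atTop,
    (∀ c, ¬ Bad A B i c) → ∀ (q : ℕ) [NeZero q] (χ : DirichletCharacter ℂ q), χ.IsPrimitive → χ ≠ 1 →
      (q:ℝ) ≤ Real.exp (A * i) → ‖SL (Real.exp i) (ff (B*i)) χ‖ ≤ Real.exp (-(A' * i)) := by
  refine ⟨7 * (A' + 4), by omega, ?_⟩
  set B := 7 * (A' + 4) with hB
  set C : ℝ := A + B + 2 with hC
  filter_upwards [exp_beats (6 * Real.exp 1 * C^3) 11 (1/2) (by norm_num), exp_beats (6 * C^2) 10 1 one_pos,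
    exp_beats 12 1 1 one_pos, Filter.eventually_ge_atTop 2] with i h1 h2 h3 hi2 hgood q _ χ hp hne hq
  have hi : (2:ℝ) ≤ i := by exact_mod_cast hi2
  set X := Real.exp (i:ℝ) with hX
  have hX0 : 0 < X := Real.exp_pos _
  have hX1 : 1 ≤ X := Real.one_le_exp (by linarith)
  have hB28 : 28 ≤ B := by omega
  have hj : 4 ≤ B * i := by nlinarith
  set M : ℝ := C * i with hM
  have hlq : Real.log q ≤ A * i := by
    rw [Real.log_le_iff_le_exp (by exact_mod_cast Nat.pos_of_ne_zero (NeZero.ne q))]; exact hq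
  set l : ℝ := 1 / (i:ℝ)^8 with hl
  have hl0 : 0 < l := by positivity
  have hl1 : l ≤ 1 := by
    rw [hl, div_le_one (by positivity)]; exact one_le_pow₀ (by linarith)
  have hsig : ((B * i : ℕ):ℝ) / X = sig B i := by
    unfold sig; rw [Real.exp_neg, ← hX]; push_cast; rw [div_eq_mul_inv]
  have hLL : l ≤ ‖LL χ (1 + (B*i : ℕ)/X)‖ := by
    by_contra hlt
    rw [hsig] at hlt
    exact hgood ⟨q, χ⟩ ⟨NeZero.ne q, hq, hp, hne, not_le.1 hlt⟩
  have hmain := partA_bound χ hne X hX0 (B*i) hj M (by rw [hM, hC]; push_cast; nlinarith) l hl0 hl1 hLL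
  refine hmain.trans ?_
  set j := B * i with hjd
  have hA'0 : (0:ℝ) ≤ A' := Nat.cast_nonneg _
  have hBr : (B:ℝ) = 7 * (A' + 4) := by rw [hB]; push_cast; ring
  have hjr : (j:ℝ) = 7 * (A'+4) * i := by rw [hjd]; push_cast; rw [hBr]
  have hC0 : 0 < C := by positivity
  have hM0 : 0 < M := by positivity
  have hjM : (j:ℝ) ≤ M := by
    rw [hjd, hM, hC]; push_cast
    have : (0:ℝ) ≤ A := Nat.cast_nonneg _
    nlinarith
  have first : (Real.exp 1 / X)^j * (j.factorial * M^(j+1) * (6 * M / l)^(j+1)) ≤ 1/2 * Real.exp (-(A' * i)) := by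
    have f1 : (j.factorial : ℝ) ≤ M^j := by
      calc (j.factorial : ℝ) ≤ (j:ℝ)^j := by exact_mod_cast Nat.factorial_le_pow j
        _ ≤ M^j := by gcongr
    calc _ ≤ (Real.exp 1 / X)^j * (M^j * M^(j+1) * (6 * M / l)^(j+1)) := by gcongr
      _ = (6 * Real.exp 1 * C^3 * (i:ℝ)^11 / X)^j * (6 * C^2 * (i:ℝ)^10) := by
        rw [show 6 * M / l = 6 * C * (i:ℝ)^9 by rw [hM, hl]; field_simp, hM, pow_succ, pow_succ]
        rw [show 6 * Real.exp 1 * C^3 * (i:ℝ)^11 / X = (Real.exp 1 / X) * (C * i) * (C * i) * (6 * C * (i:ℝ)^9) by ring]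
        simp only [mul_pow]
        ring
      _ ≤ (Real.exp (1/2 * i) / X)^j * Real.exp (1 * i) := by gcongr
      _ = Real.exp (j * (1/2 * i - i) + 1 * i) := by
        rw [hX, ← Real.exp_sub, ← Real.exp_nat_mul, ← Real.exp_add]
      _ ≤ Real.exp (-1 + -(A' * i)) := by
        apply Real.exp_le_exp.2
        rw [hjr]
        nlinarith [mul_nonneg hA'0 (by linarith : (0:ℝ) ≤ i), mul_nonneg hA'0 (mul_nonneg (by linarith : (0:ℝ) ≤ i) (by linarith : (0:ℝ) ≤ i - 2))]
      _ ≤ _ := by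
        rw [Real.exp_add]
        gcongr
        rw [Real.exp_neg, inv_eq_one_div]
        apply one_div_le_one_div_of_le (by norm_num)
        have := Real.add_one_le_exp 1
        linarith
  have second : Real.exp (-(j/7 : ℝ)) * (2 * X * (1 + 2 * X)) ≤ 1/2 * Real.exp (-(A' * i)) := by
    have e1 : Real.exp (-(j/7 : ℝ)) = Real.exp (-(A' * i)) / X^4 := by
      rw [hX, ← Real.exp_nat_mul, ← Real.exp_sub, hjr]; congr 1; push_cast; ring
    have h12 : 12 ≤ X := by
      rw [pow_one, one_mul] at h3
      linarith
    have e2 : 2 * X * (1 + 2 * X) ≤ 1/2 * X^4 := by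
      exact aux_X4 X h12
    rw [e1, div_mul_eq_mul_div, div_le_iff₀ (by positivity)]
    calc _ ≤ Real.exp (-(A' * i)) * (1/2 * X^4) := by gcongr
      _ = _ := by ring
  linarith

end DSR

namespace DSR
open Finset ComplexConjugate

abbrev Ch := Σ n : ℕ, DirichletCharacter ℂ n

/-- the value of a character (of some modulus) at a natural number -/
noncomputable def cv (c : Ch) (n : ℕ) : ℂ := c.2 (n : ZMod c.1)

lemma cv_norm (c : Ch) (n : ℕ) : ‖cv c n‖ ≤ 1 := DirichletCharacter.norm_le_one _ _

lemma cv_mul (c : Ch) (m n : ℕ) : cv c (m*n) = cv c m * cv c n := by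
  unfold cv; push_cast; rw [map_mul]

structure PF (C : Finset Ch) (Q : ℕ) : Prop where
  ne : ∀ c ∈ C, c.1 ≠ 0
  le : ∀ c ∈ C, c.1 ≤ Q
  prim : ∀ c ∈ C, c.2.IsPrimitive
  ne1 : ∀ c ∈ C, c.2 ≠ 1
  card : C.card ≤ Q^2

lemma sum_tele (u : ℕ → ℝ) (N M : ℕ) (h : N ≤ M) : ∑ n ∈ Ico N M, (u n - u (n+1)) = u N - u M := by
  induction M, h using Nat.le_induction with
  | base => simp
  | succ M hM ih => rw [sum_Ico_succ_top hM, ih]; ring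

lemma char_inv_sum {q : ℕ} [NeZero q] (ξ : DirichletCharacter ℂ q) (h : ξ ≠ 1) (V Z : ℕ) :
    ‖∑ m ∈ Ioc V Z, ξ m * (1 / (m:ℂ))‖ ≤ 2 * q / (V+1) := by
  rcases le_total Z V with hVZ | hVZ
  · rw [Ioc_eq_empty (by omega), sum_empty, norm_zero]; positivity
  have hI : Ioc V Z = Ico (V+1) (Z+1) := by ext x; simp only [mem_Ioc, mem_Ico]; omega
  rw [hI]
  have := abel_bound (fun m => ξ m) (fun m => 1 / (m:ℂ)) q (char_sum_bound ξ h) (V+1) (Z+1) (by omega)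
  refine this.trans ?_
  have hs : ∑ n ∈ Ico (V+1) (Z+1), ‖(1 / (n:ℂ)) - 1 / ((n+1 : ℕ):ℂ)‖ =
      1/((V+1 : ℕ):ℝ) - 1/((Z+1 : ℕ):ℝ) := by
    rw [← sum_tele (fun n : ℕ => 1/((n:ℕ):ℝ)) (V+1) (Z+1) (by omega)]
    refine sum_congr rfl fun n hn => ?_
    have hn0 : 0 < n := by rw [mem_Ico] at hn; omega
    have hn1 : (0:ℝ) < n := by exact_mod_cast hn0
    have h5 : (1 / ((n+1 : ℕ):ℝ)) ≤ 1 / (n:ℝ) := by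
      apply one_div_le_one_div_of_le hn1; push_cast; linarith
    have h6 : (1 / (n:ℂ)) - 1 / ((n+1 : ℕ):ℂ) = ((1 / (n:ℝ) - 1 / ((n+1 : ℕ):ℝ) : ℝ) : ℂ) := by push_cast; ring
    rw [h6, Complex.norm_real, Real.norm_of_nonneg (by linarith)]
  rw [hs]
  simp only [one_div, norm_inv, Complex.norm_natCast]
  apply le_of_eq
  push_cast
  ring

lemma offdiag (c d : Ch) (hc0 : c.1 ≠ 0) (hd0 : d.1 ≠ 0) (hc : c.2.IsPrimitive)
    (hd : d.2.IsPrimitive) (hne : c ≠ d) (Q : ℕ) (hcQ : c.1 ≤ Q) (hdQ : d.1 ≤ Q) (V Z : ℕ) :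
    ‖∑ m ∈ Ioc V Z, (1/(m:ℂ)) * (cv c m * conj (cv d m))‖ ≤ 2 * Q^2 / (V+1) := by
  have : NeZero c.1 := ⟨hc0⟩
  have : NeZero d.1 := ⟨hd0⟩
  have : NeZero (c.1 * d.1) := ⟨mul_ne_zero hc0 hd0⟩
  have h1 : prodChar c.2 d.2⁻¹ ≠ 1 := fun h => hne (prodChar_ne_one c.2 d.2 hc hd h)
  have h2 := char_inv_sum _ h1 V Z
  have h3 : ∀ m : ℕ, prodChar c.2 d.2⁻¹ (m : ZMod (c.1*d.1)) = cv c m * conj (cv d m) := by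
    intro m
    rw [prodChar_apply, ← MulChar.star_eq_inv, MulChar.star_apply]; rfl
  simp_rw [h3] at h2
  simp_rw [mul_comm (1 / (_:ℂ))]
  refine h2.trans ?_
  have : ((c.1 * d.1 : ℕ) : ℝ) ≤ Q^2 := by
    rw [sq]; exact_mod_cast Nat.mul_le_mul hcQ hdQ
  gcongr

lemma diag_le (c : Ch) (V Z : ℕ) :
    ‖∑ m ∈ Ioc V Z, (1/(m:ℂ)) * (cv c m * conj (cv c m))‖ ≤ 1 + Real.log Z := by
  refine (norm_sum_le _ _).trans ((le_trans (sum_le_sum (g := fun m : ℕ => (1:ℝ)/m) fun m _ => ?_) ?_).trans (sum_inv_le Z))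
  · rw [norm_mul, norm_mul, Complex.norm_conj, norm_div, norm_one, Complex.norm_natCast]
    have := cv_norm c m
    have := norm_nonneg (cv c m)
    refine mul_le_of_le_one_right (by positivity) ?_
    nlinarith
  · refine sum_le_sum_of_subset_of_nonneg (fun m hm => ?_) (fun _ _ _ => by positivity)
    simp at hm ⊢; omega

/-- dual large sieve -/
lemma ls_dual (C : Finset Ch) (Q : ℕ) (hC : PF C Q) (V Z : ℕ) (hV : Q^4 ≤ V) (b : Ch → ℂ) :
    ∑ m ∈ Ioc V Z, (1/(m:ℝ)) * ‖∑ c ∈ C, b c * cv c m‖^2 ≤ (3 + Real.log Z) * ∑ c ∈ C, ‖b c‖^2 := by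
  have key : ((∑ m ∈ Ioc V Z, (1/(m:ℝ)) * ‖∑ c ∈ C, b c * cv c m‖^2 : ℝ) : ℂ) =
      ∑ c ∈ C, ∑ d ∈ C, b c * conj (b d) * ∑ m ∈ Ioc V Z, (1/(m:ℂ)) * (cv c m * conj (cv d m)) := by
    push_cast
    simp_rw [← Complex.mul_conj', map_sum, map_mul, sum_mul_sum, mul_sum]
    rw [sum_comm]
    refine sum_congr rfl fun c _ => ?_
    rw [sum_comm]
    refine sum_congr rfl fun d _ => sum_congr rfl fun m _ => ?_
    ring
  have hL := Real.log_natCast_nonneg Z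
  have hre : ∑ m ∈ Ioc V Z, (1/(m:ℝ)) * ‖∑ c ∈ C, b c * cv c m‖^2 = 
     ‖((∑ m ∈ Ioc V Z, (1/(m:ℝ)) * ‖∑ c ∈ C, b c * cv c m‖^2 : ℝ) : ℂ)‖ := by
    rw [Complex.norm_real, Real.norm_of_nonneg]
    exact sum_nonneg fun m _ => by positivity
  rw [hre, key]
  classical
  calc _ ≤ ∑ c ∈ C, ∑ d ∈ C, ‖b c‖ * ‖b d‖ * ((if c = d then 1 + Real.log Z else 0) + 2 * Q^2/(V+1)) := by
        refine (norm_sum_le _ _).trans (sum_le_sum fun c hc => ?_)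
        refine (norm_sum_le _ _).trans (sum_le_sum fun d hd => ?_)
        rw [norm_mul, norm_mul, Complex.norm_conj]
        gcongr
        split_ifs with h
        · subst h
          have := diag_le c V Z
          have : (0:ℝ) ≤ 2 * Q^2/(V+1) := by positivity
          linarith
        · rw [zero_add]
          exact offdiag c d (hC.ne c hc) (hC.ne d hd) (hC.prim c hc) (hC.prim d hd) h Q (hC.le c hc) (hC.le d hd) V Z
    _ = (1 + Real.log Z) * ∑ c ∈ C, ‖b c‖^2 + 2 * Q^2/(V+1) * (∑ c ∈ C, ‖b c‖)^2 := by
        simp_rw [mul_add, sum_add_distrib, mul_ite, mul_zero, sum_ite_eq]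
        congr 1
        · rw [mul_sum]; refine sum_congr rfl fun c hc => ?_
          rw [if_pos hc]; ring
        · rw [sq (∑ c ∈ C, ‖b c‖), sum_mul_sum, mul_sum]; refine sum_congr rfl fun c hc => ?_
          rw [mul_sum]; refine sum_congr rfl fun d hd => ?_
          ring
    _ ≤ (1 + Real.log Z) * ∑ c ∈ C, ‖b c‖^2 + 2 * ∑ c ∈ C, ‖b c‖^2 := by
        refine add_le_add le_rfl ?_
        have h1 := sq_sum_le_card_mul_sum_sq (s := C) (f := fun c => ‖b c‖)
        have h2 : (C.card : ℝ) ≤ Q^2 := by exact_mod_cast hC.card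
        have h3 : (Q:ℝ)^4 ≤ V := by exact_mod_cast hV
        have h4 : 0 ≤ ∑ c ∈ C, ‖b c‖^2 := sum_nonneg fun _ _ => by positivity
        calc 2 * (Q:ℝ)^2/(V+1) * (∑ c ∈ C, ‖b c‖)^2 ≤ 2 * (Q:ℝ)^2/(V+1) * (Q^2 * ∑ c ∈ C, ‖b c‖^2) := by
              gcongr; exact h1.trans (by gcongr)
          _ = (2 * Q^4/(V+1)) * ∑ c ∈ C, ‖b c‖^2 := by ring
          _ ≤ 2 * ∑ c ∈ C, ‖b c‖^2 := by
              gcongr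
              rw [div_le_iff₀ (by positivity)]; linarith
    _ = _ := by ring

/-- large sieve -/
lemma ls (C : Finset Ch) (Q : ℕ) (hC : PF C Q) (V Z : ℕ) (hV : Q^4 ≤ V) (a : ℕ → ℂ) :
    ∑ c ∈ C, ‖∑ m ∈ Ioc V Z, a m * cv c m / m‖^2 ≤ (3 + Real.log Z) * ∑ m ∈ Ioc V Z, ‖a m‖^2 / m := by
  set T : Ch → ℂ := fun c => ∑ m ∈ Ioc V Z, a m * cv c m / m with hT
  set S := ∑ c ∈ C, ‖T c‖^2 with hS
  have hS0 : 0 ≤ S := sum_nonneg fun _ _ => by positivity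
  have hL := Real.log_natCast_nonneg Z
  have hD := ls_dual C Q hC V Z hV (fun c => conj (T c))
  simp only [Complex.norm_conj] at hD
  set A := ∑ m ∈ Ioc V Z, ‖a m‖^2 / m with hA
  have hA0 : 0 ≤ A := sum_nonneg fun _ _ => by positivity
  have key : (S : ℂ) = ∑ m ∈ Ioc V Z, (a m / m) * ∑ c ∈ C, conj (T c) * cv c m := by
    rw [hS]; push_cast
    simp_rw [← Complex.conj_mul', mul_sum]
    rw [sum_comm]
    refine sum_congr rfl fun c _ => ?_
    conv_lhs => rw [hT]
    simp only
    rw [mul_sum]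
    refine sum_congr rfl fun m _ => ?_
    ring
  have h1 : S ≤ ∑ m ∈ Ioc V Z, (‖a m‖ / Real.sqrt m) * (‖∑ c ∈ C, conj (T c) * cv c m‖ / Real.sqrt m) := by
    calc S = ‖(S:ℂ)‖ := by rw [Complex.norm_real, Real.norm_of_nonneg hS0]
      _ ≤ _ := by
        rw [key]
        refine (norm_sum_le _ _).trans (sum_le_sum fun m _ => le_of_eq ?_)
        rw [norm_mul, norm_div, Complex.norm_natCast, div_mul_div_comm, Real.mul_self_sqrt (Nat.cast_nonneg _)]
        ring
  have h2 := sum_mul_sq_le_sq_mul_sq (Ioc V Z) (fun m : ℕ => ‖a m‖ / Real.sqrt m)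
    (fun m : ℕ => ‖∑ c ∈ C, conj (T c) * cv c m‖ / Real.sqrt m)
  have e1 : ∑ m ∈ Ioc V Z, (‖a m‖ / Real.sqrt m)^2 = A := by
    rw [hA]; refine sum_congr rfl fun m _ => ?_
    rw [div_pow, Real.sq_sqrt (Nat.cast_nonneg _)]
  have e2 : ∑ m ∈ Ioc V Z, (‖∑ c ∈ C, conj (T c) * cv c m‖ / Real.sqrt m)^2 ≤ (3 + Real.log Z) * S := by
    refine le_trans (le_of_eq (sum_congr rfl fun m _ => ?_)) hD
    rw [div_pow, Real.sq_sqrt (Nat.cast_nonneg _)]; ring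
  rw [e1] at h2
  have h3 : S^2 ≤ A * ((3 + Real.log Z) * S) := by
    calc S^2 ≤ _ := pow_le_pow_left₀ hS0 h1 2
      _ ≤ _ := h2
      _ ≤ _ := by gcongr
  rcases hS0.eq_or_lt with h | h
  · rw [← h]; positivity
  · have : S * S ≤ ((3 + Real.log Z) * A) * S := by linarith [sq S]
    exact le_of_mul_le_mul_right this h

end DSR

namespace DSR
open Finset ArithmeticFunction
open scoped ArithmeticFunction.zeta ArithmeticFunction.Moebius

lemma conv_sum (a b : ArithmeticFunction ℝ) (w : ℕ → ℂ) (Z : ℕ) (hw : ∀ n, Z < n → w n = 0) :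
    ∑ n ∈ Ioc 0 Z, (((a * b) n : ℝ) : ℂ) * w n =
      ∑ d ∈ Ioc 0 Z, ∑ m ∈ Ioc 0 Z, ((a d : ℝ) : ℂ) * ((b m : ℝ) : ℂ) * w (d*m) := by
  rw [← sum_product']
  rw [← sum_filter_add_sum_filter_not (Ioc 0 Z ×ˢ Ioc 0 Z) (fun p => p.1 * p.2 ≤ Z)]
  rw [sum_eq_zero (s := (Ioc 0 Z ×ˢ Ioc 0 Z).filter (fun p => ¬ p.1 * p.2 ≤ Z)) (fun p hp => by
    rw [hw _ (not_le.1 (mem_filter.1 hp).2), mul_zero]), add_zero]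
  rw [← sum_fiberwise_of_maps_to (g := fun p : ℕ × ℕ => p.1 * p.2) (t := Ioc 0 Z)]
  · refine sum_congr rfl fun n hn => ?_
    rw [mul_apply]
    push_cast
    rw [sum_mul]
    have hs : n.divisorsAntidiagonal = (((Ioc 0 Z ×ˢ Ioc 0 Z).filter (fun p => p.1 * p.2 ≤ Z)).filter
        fun p => p.1 * p.2 = n) := by
      ext ⟨d, m⟩
      simp only [Nat.mem_divisorsAntidiagonal, mem_filter, mem_product, mem_Ioc] at hn ⊢
      constructor
      · rintro ⟨h, h0⟩
        have hd : 0 < d := Nat.pos_of_ne_zero (by rintro rfl; simp at h; omega)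
        have hm : 0 < m := Nat.pos_of_ne_zero (by rintro rfl; simp at h; omega)
        refine ⟨⟨⟨⟨hd, ?_⟩, hm, ?_⟩, by omega⟩, h⟩
        · have := Nat.le_mul_of_pos_right d hm; omega
        · have := Nat.le_mul_of_pos_left m hd; omega
      · rintro ⟨_, h⟩
        exact ⟨h, by omega⟩
    rw [hs]
    refine sum_congr rfl fun p hp => ?_
    rw [(mem_filter.1 hp).2]
  · rintro ⟨d, m⟩ hp
    simp only [mem_filter, mem_product, mem_Ioc] at hp ⊢
    exact ⟨Nat.mul_pos hp.1.1.1 hp.1.2.1, hp.2⟩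

/-- inequality version: sums of a convolution over all products -/
lemma conv_sum_le (a b : ArithmeticFunction ℝ) (ha : ∀ n, 0 ≤ a n) (hb : ∀ n, 0 ≤ b n) (w : ℕ → ℝ)
    (hw : ∀ n, 0 ≤ w n) (Z : ℕ) :
    ∑ n ∈ Ioc 0 Z, (a * b) n * w n ≤ ∑ d ∈ Ioc 0 Z, ∑ m ∈ Ioc 0 Z, a d * b m * w (d*m) := by
  have h := conv_sum a b (fun n => if n ≤ Z then ((w n : ℝ):ℂ) else 0) Z (fun n hn => if_neg (by omega))
  have h1 : ∑ n ∈ Ioc 0 Z, (a * b) n * w n =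
      ∑ d ∈ Ioc 0 Z, ∑ m ∈ Ioc 0 Z, a d * b m * (if d*m ≤ Z then w (d*m) else 0) := by
    have h2 : ∑ n ∈ Ioc 0 Z, (((a * b) n : ℝ) : ℂ) * (if n ≤ Z then ((w n : ℝ):ℂ) else 0) =
        ((∑ n ∈ Ioc 0 Z, (a * b) n * w n : ℝ) : ℂ) := by
      push_cast
      refine sum_congr rfl fun n hn => ?_
      rw [if_pos (mem_Ioc.1 hn).2]
    rw [h2] at h
    have h3 := congrArg Complex.re h
    rw [Complex.ofReal_re] at h3
    rw [h3, Complex.re_sum]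
    refine sum_congr rfl fun d _ => ?_
    rw [Complex.re_sum]
    refine sum_congr rfl fun m _ => ?_
    split_ifs <;> simp [← Complex.ofReal_mul]
  rw [h1]
  refine sum_le_sum fun d _ => sum_le_sum fun m _ => ?_
  refine mul_le_mul_of_nonneg_left ?_ (mul_nonneg (ha _) (hb _))
  split_ifs
  · exact le_rfl
  · exact hw _

/-- the divisor function as a real -/
noncomputable def tau (n : ℕ) : ℝ := (n.divisors.card : ℝ)

lemma tau_nonneg (n : ℕ) : 0 ≤ tau n := Nat.cast_nonneg _

lemma tau_mul_le (a b : ℕ) : tau (a*b) ≤ tau a * tau b := by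
  unfold tau
  rw [Nat.divisors_mul]
  exact_mod_cast card_mul_le

lemma zeta_conv (n : ℕ) : ((ζ : ArithmeticFunction ℝ) * ζ) n = tau n := by
  rw [coe_zeta_mul_apply]
  unfold tau
  rw [card_eq_sum_ones]
  push_cast
  refine sum_congr rfl fun d hd => ?_
  rw [natCoe_apply, zeta_apply_ne (Nat.pos_of_mem_divisors hd).ne']; simp

lemma sum_inv_Ioc (Z : ℕ) : ∑ n ∈ Ioc 0 Z, (1:ℝ)/n ≤ 1 + Real.log Z := by
  refine le_trans (sum_le_sum_of_subset_of_nonneg (fun m hm => ?_) (fun _ _ _ => by positivity)) (sum_inv_le Z)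
  simp at hm ⊢; omega

lemma zeta_real (n : ℕ) (hn : 0 < n) : (ζ : ArithmeticFunction ℝ) n = 1 := by
  rw [natCoe_apply, zeta_apply_ne hn.ne']; simp

lemma zeta_real_nonneg (n : ℕ) : 0 ≤ (ζ : ArithmeticFunction ℝ) n := by
  rw [natCoe_apply]; positivity

lemma tau_sum (Z : ℕ) : ∑ n ∈ Ioc 0 Z, tau n / n ≤ (1 + Real.log Z)^2 := by
  have h := conv_sum_le (ζ : ArithmeticFunction ℝ) ζ zeta_real_nonneg zeta_real_nonneg (fun n => 1/(n:ℝ))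
    (fun n => by positivity) Z
  simp_rw [zeta_conv, mul_one_div] at h
  refine h.trans ?_
  calc _ = (∑ n ∈ Ioc 0 Z, (1:ℝ)/n)^2 := by
        rw [sq, sum_mul_sum]
        refine sum_congr rfl fun d hd => sum_congr rfl fun m hm => ?_
        rw [zeta_real d (mem_Ioc.1 hd).1, zeta_real m (mem_Ioc.1 hm).1]
        push_cast; rw [div_mul_div_comm]
    _ ≤ _ := by
      have := sum_inv_Ioc Z
      gcongr
      
lemma tau_sq_sum (Z : ℕ) : ∑ n ∈ Ioc 0 Z, tau n ^2 / n ≤ (1 + Real.log Z)^4 := by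
  have h := conv_sum_le (ζ : ArithmeticFunction ℝ) ζ zeta_real_nonneg zeta_real_nonneg (fun n => tau n/(n:ℝ))
    (fun n => div_nonneg (tau_nonneg n) (Nat.cast_nonneg _)) Z
  simp_rw [zeta_conv] at h
  calc _ = ∑ n ∈ Ioc 0 Z, tau n * (tau n / n) := by
        refine sum_congr rfl fun d hd => ?_
        ring
    _ ≤ _ := h
    _ ≤ (∑ n ∈ Ioc 0 Z, tau n/n)^2 := by
        rw [sq, sum_mul_sum]
        refine sum_le_sum fun d hd => sum_le_sum fun m hm => ?_
        rw [zeta_real d (mem_Ioc.1 hd).1, zeta_real m (mem_Ioc.1 hm).1]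
        push_cast; rw [div_mul_div_comm, one_mul, one_mul]
        have := tau_mul_le d m
        gcongr
    _ ≤ ((1 + Real.log Z)^2)^2 := by
      have := tau_sum Z
      have h0 : 0 ≤ ∑ n ∈ Ioc 0 Z, tau n/n := sum_nonneg fun n _ => div_nonneg (tau_nonneg n) (Nat.cast_nonneg _)
      gcongr
    _ = _ := by ring

/-- restriction of an arithmetic function -/
noncomputable def restr (p : ℕ → Prop) [DecidablePred p] (a : ArithmeticFunction ℝ) : ArithmeticFunction ℝ :=
  ⟨fun n => if p n then a n else 0, by simp⟩

lemma restr_apply (p : ℕ → Prop) [DecidablePred p] (a : ArithmeticFunction ℝ) (n : ℕ) :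
    restr p a n = if p n then a n else 0 := rfl

lemma restr_split (V : ℕ) (a : ArithmeticFunction ℝ) : a = restr (· ≤ V) a + restr (V < ·) a := by
  ext n
  rw [ArithmeticFunction.add_apply, restr_apply, restr_apply]
  by_cases h : n ≤ V
  · rw [if_pos h, if_neg (by omega), add_zero]
  · rw [if_neg h, if_pos (by omega), zero_add]

lemma vaughan (U V : ℕ) :
    restr (V < ·) vonMangoldt = restr (· ≤ U) (μ : ArithmeticFunction ℝ) * log
      - (restr (· ≤ V) vonMangoldt * restr (· ≤ U) (μ : ArithmeticFunction ℝ)) * (ζ : ArithmeticFunction ℝ)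
      + restr (V < ·) vonMangoldt * (restr (U < ·) (μ : ArithmeticFunction ℝ) * (ζ : ArithmeticFunction ℝ)) := by
  have h1 : (μ : ArithmeticFunction ℝ) * (ζ : ArithmeticFunction ℝ) = 1 := coe_moebius_mul_coe_zeta
  have h2 : (vonMangoldt : ArithmeticFunction ℝ) * (ζ : ArithmeticFunction ℝ) = log := vonMangoldt_mul_zeta
  set m1 := restr (· ≤ U) (μ : ArithmeticFunction ℝ)
  set m2 := restr (U < ·) (μ : ArithmeticFunction ℝ)
  have hm : (μ : ArithmeticFunction ℝ) = m1 + m2 := restr_split U _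
  set l1 := restr (· ≤ V) (vonMangoldt : ArithmeticFunction ℝ)
  set l2 := restr (V < ·) (vonMangoldt : ArithmeticFunction ℝ)
  have hl : (vonMangoldt : ArithmeticFunction ℝ) = l1 + l2 := restr_split V _
  rw [hm] at h1
  rw [hl] at h2
  rw [← h2]
  calc l2 = l2 * ((m1 + m2) * (ζ : ArithmeticFunction ℝ)) := by rw [h1, mul_one]
    _ = _ := by ring

end DSR

namespace DSR
open Finset

structure FF (X : ℝ) (f : ℝ → ℝ) : Prop where
  pos : 0 < X
  nonneg : ∀ v, 0 ≤ f v
  le1 : ∀ v, f v ≤ 1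
  supp : ∀ v, (v < 1/8 ∨ 4 < v) → f v = 0
  lip : ∀ v w, |f v - f w| ≤ X * |v - w|

lemma cs_norm (C : Finset Ch) (u v : Ch → ℂ) (A B : ℝ) (hA : ∑ c ∈ C, ‖u c‖^2 ≤ A)
    (hB : ∑ c ∈ C, ‖v c‖^2 ≤ B) : ∑ c ∈ C, ‖u c * v c‖ ≤ √A * √B := by
  simp_rw [norm_mul]
  refine (Real.sum_mul_le_sqrt_mul_sqrt C (fun c => ‖u c‖) (fun c => ‖v c‖)).trans ?_
  gcongr

lemma sqrt_pow_bound {T : ℝ} (hT : 3 ≤ T) (a b : ℕ) (h : a ≤ 2*b) : √(T^a) ≤ T^b := by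
  rw [Real.sqrt_le_left (by positivity), ← pow_mul]
  exact pow_le_pow_right₀ (by linarith) (by omega)

lemma typeII_main (C : Finset Ch) (Q : ℕ) (hC : PF C Q) (V Z : ℕ) (hV : Q^4 ≤ V)
    (a b : ℕ → ℝ) (g : ℕ → ℝ) (hg : ∀ m, |g m| ≤ 1) (p : ℕ → Prop) [DecidablePred p]
    (T : ℝ) (hT3 : 3 ≤ T) (hT : 3 + Real.log Z ≤ T)
    (ha : ∑ d ∈ Ioc V Z, a d^2/d ≤ T^3) (hb : ∑ d ∈ Ioc V Z, b d^2/d ≤ T^4) :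
    ∑ c ∈ C, ‖(∑ d ∈ (Ioc V Z).filter p, (a d : ℂ) * cv c d / d) *
      (∑ m ∈ Ioc V Z, ((b m * g m : ℝ) : ℂ) * cv c m / m)‖ ≤ T^5 := by
  have h1 := ls C Q hC V Z hV (fun d => if p d then (a d : ℂ) else 0)
  have h2 := ls C Q hC V Z hV (fun m => ((b m * g m : ℝ) : ℂ))
  have h1' : ∑ c ∈ C, ‖∑ d ∈ (Ioc V Z).filter p, (a d : ℂ) * cv c d / d‖^2 ≤ T^4 := by
    refine le_trans (le_of_eq ?_) (h1.trans ?_)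
    · refine sum_congr rfl fun c _ => ?_
      rw [sum_filter]
      congr 2
      refine sum_congr rfl fun d _ => ?_
      split_ifs <;> simp
    · calc _ ≤ T * T^3 := by
            refine mul_le_mul hT (le_trans (sum_le_sum fun d _ => ?_) ha)
              (sum_nonneg fun d _ => by positivity) (by linarith)
            refine div_le_div_of_nonneg_right ?_ (by positivity)
            split_ifs
            · simp
            · simp; positivity
        _ = _ := by ring
  have h2' : ∑ c ∈ C, ‖∑ m ∈ Ioc V Z, ((b m * g m : ℝ) : ℂ) * cv c m / m‖^2 ≤ T^5 := by
    refine h2.trans ?_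
    calc _ ≤ T * T^4 := by
          refine mul_le_mul hT (le_trans (sum_le_sum fun d _ => ?_) hb)
            (sum_nonneg fun d _ => by positivity) (by linarith)
          refine div_le_div_of_nonneg_right ?_ (by positivity)
          rw [Complex.norm_real, Real.norm_eq_abs, sq_abs, mul_pow]
          have : g d ^2 ≤ 1 := by rw [← sq_abs]; have := hg d; have := abs_nonneg (g d); nlinarith
          nlinarith [sq_nonneg (b d)]
      _ = _ := by ring
  refine (cs_norm C _ _ _ _ h1' h2').trans ?_
  calc _ ≤ T^2 * T^3 := by
        refine mul_le_mul (sqrt_pow_bound hT3 4 2 (by norm_num)) (sqrt_pow_bound hT3 5 3 (by norm_num)) (by positivity) (by positivity)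
    _ = _ := by ring

lemma typeII_err (C : Finset Ch) (Q : ℕ) (hC : PF C Q) (V Z : ℕ) (hV : Q^4 ≤ V)
    (b : ℕ → ℝ) (g : ℕ → ℝ) (δ : ℝ) (hδ : 0 ≤ δ) (hg : ∀ m ∈ Ioc V Z, |g m| ≤ δ)
    (T : ℝ) (hT3 : 3 ≤ T) (hT : 3 + Real.log Z ≤ T) (hb : ∑ d ∈ Ioc V Z, b d^2/d ≤ T^4) :
    ∑ c ∈ C, ‖∑ m ∈ Ioc V Z, ((b m * g m : ℝ) : ℂ) * cv c m / m‖ ≤ Q * δ * T^3 := by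
  have h2 := ls C Q hC V Z hV (fun m => ((b m * g m : ℝ) : ℂ))
  have h2' : ∑ c ∈ C, ‖∑ m ∈ Ioc V Z, ((b m * g m : ℝ) : ℂ) * cv c m / m‖^2 ≤ δ^2 * T^5 := by
    refine h2.trans ?_
    calc _ ≤ T * (δ^2 * T^4) := by
          refine mul_le_mul hT (le_trans (sum_le_sum (g := fun d : ℕ => δ^2 * (b d^2/d)) fun d hd => ?_) ?_)
            (sum_nonneg fun d _ => by positivity) (by linarith)
          · rw [← mul_div_assoc]
            refine div_le_div_of_nonneg_right ?_ (by positivity)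
            rw [Complex.norm_real, Real.norm_eq_abs, sq_abs, mul_pow]
            have : g d ^2 ≤ δ^2 := by rw [← sq_abs]; have := hg d hd; have := abs_nonneg (g d); nlinarith
            nlinarith [sq_nonneg (b d)]
          · rw [← mul_sum]; gcongr
      _ = _ := by ring
  have h1 : ∑ c ∈ C, ‖(1:ℂ)‖^2 ≤ (Q:ℝ)^2 := by
    simp; exact_mod_cast hC.card
  have := cs_norm C _ _ _ _ h1 h2'
  simp only [one_mul] at this
  refine this.trans ?_
  rw [Real.sqrt_sq (by positivity), Real.sqrt_mul (by positivity), Real.sqrt_sq hδ, mul_assoc]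
  have := sqrt_pow_bound hT3 5 3 (by norm_num)
  gcongr

set_option maxHeartbeats 1000000 in
lemma typeII (C : Finset Ch) (Q : ℕ) (hC : PF C Q) (hQ : 1 ≤ Q) (V Z : ℕ) (hV : Q^4 ≤ V) (X : ℝ) (f : ℝ → ℝ)
    (hf : FF X f)
    (a b : ℕ → ℝ)
    (T : ℝ) (hT3 : 3 ≤ T) (hT : 3 + Real.log Z ≤ T)
    (ha : ∑ d ∈ Ioc V Z, a d^2/d ≤ T^3) (ha1 : ∑ d ∈ Ioc V Z, |a d|/d ≤ T^2)
    (hb : ∑ d ∈ Ioc V Z, b d^2/d ≤ T^4) :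
    ∑ c ∈ C, ‖∑ d ∈ Ioc V Z, ∑ m ∈ Ioc V Z, (a d : ℂ) * (b m : ℂ) *
      (cv c (d*m) * ((f (Real.log ((d*m : ℕ):ℝ)/X) / ((d*m : ℕ):ℝ) : ℝ) : ℂ))‖ ≤ 2 * √Q * T^6 := by
  have hX := hf.pos
  set S : ℝ := √Q with hS
  have hS1 : 1 ≤ S := by rw [hS]; exact Real.one_le_sqrt.2 (by exact_mod_cast hQ)
  have hSQ : S * S = Q := Real.mul_self_sqrt (by positivity)
  set κ : ℕ → ℕ := fun d => ⌊Real.log d * S⌋₊ with hκ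
  set M := κ Z with hM
  set ε : ℕ → ℕ → ℝ := fun d m => f (Real.log ((d*m : ℕ):ℝ)/X) - f ((κ d / S + Real.log m)/X) with hε
  have hεb : ∀ d ∈ Ioc V Z, ∀ m ∈ Ioc V Z, |ε d m| ≤ 1/S := by
    intro d hd m hm
    have hd0 : 0 < d := by have := mem_Ioc.1 hd; omega
    have hm0 : 0 < m := by have := mem_Ioc.1 hm; omega
    refine (hf.lip _ _).trans ?_
    rw [← sub_div, abs_div, abs_of_pos hX, mul_div_cancel₀ _ hX.ne']
    push_cast
    rw [Real.log_mul (by positivity) (by positivity), add_sub_add_right_eq_sub]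
    have h1 : (κ d : ℝ) ≤ Real.log d * S := Nat.floor_le (mul_nonneg (Real.log_natCast_nonneg d) (by linarith))
    have h2 : Real.log d * S < κ d + 1 := Nat.lt_floor_add_one _
    have hS0 : 0 < S := by linarith
    rw [abs_le]
    constructor
    · have : (κ d:ℝ)/S ≤ Real.log d := by rw [div_le_iff₀ hS0]; exact h1
      have : 0 < 1/S := by positivity
      linarith
    · have : Real.log d ≤ (κ d:ℝ)/S + 1/S := by rw [← add_div, le_div_iff₀ hS0]; exact h2.le
      linarith
  have hsplit : ∀ c, ∑ d ∈ Ioc V Z, ∑ m ∈ Ioc V Z, (a d : ℂ) * (b m : ℂ) *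
      (cv c (d*m) * ((f (Real.log ((d*m : ℕ):ℝ)/X) / ((d*m : ℕ):ℝ) : ℝ) : ℂ)) =
      ∑ l ∈ range (M+1), (∑ d ∈ (Ioc V Z).filter (fun d => κ d = l), (a d : ℂ) * cv c d / d) *
        (∑ m ∈ Ioc V Z, ((b m * f ((l / S + Real.log m)/X) : ℝ) : ℂ) * cv c m / m)
      + ∑ d ∈ Ioc V Z, (a d : ℂ) * cv c d / d * ∑ m ∈ Ioc V Z, ((b m * ε d m : ℝ) : ℂ) * cv c m / m := by
    intro c
    have h1 : ∑ l ∈ range (M+1), (∑ d ∈ (Ioc V Z).filter (fun d => κ d = l), (a d : ℂ) * cv c d / d) *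
        (∑ m ∈ Ioc V Z, ((b m * f ((l / S + Real.log m)/X) : ℝ) : ℂ) * cv c m / m) =
        ∑ d ∈ Ioc V Z, (a d : ℂ) * cv c d / d *
        (∑ m ∈ Ioc V Z, ((b m * f ((κ d / S + Real.log m)/X) : ℝ) : ℂ) * cv c m / m) := by
      rw [← sum_fiberwise_of_maps_to (s := Ioc V Z) (g := κ) (t := range (M+1))]
      · refine sum_congr rfl fun l _ => ?_
        rw [sum_mul]
        refine sum_congr rfl fun d hd => ?_
        rw [(mem_filter.1 hd).2]
      · intro d hd
        rw [mem_range, Nat.lt_succ_iff]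
        have hd' := mem_Ioc.1 hd
        apply Nat.floor_le_floor
        have : Real.log d ≤ Real.log Z := Real.log_le_log (by exact_mod_cast (by omega)) (by exact_mod_cast hd'.2)
        gcongr
    rw [h1, ← sum_add_distrib]
    refine sum_congr rfl fun d hd => ?_
    rw [← mul_add, ← sum_add_distrib, mul_sum]
    refine sum_congr rfl fun m hm => ?_
    have hd0 : (d:ℂ) ≠ 0 := by have := mem_Ioc.1 hd; exact_mod_cast (by omega)
    have hm0 : (m:ℂ) ≠ 0 := by have := mem_Ioc.1 hm; exact_mod_cast (by omega)
    rw [cv_mul, hε]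
    push_cast
    field_simp
    ring
  have hmain : ∑ c ∈ C, ‖∑ l ∈ range (M+1), (∑ d ∈ (Ioc V Z).filter (fun d => κ d = l), (a d : ℂ) * cv c d / d) *
        (∑ m ∈ Ioc V Z, ((b m * f ((l / S + Real.log m)/X) : ℝ) : ℂ) * cv c m / m)‖ ≤ (M+1:ℕ) * T^5 := by
    refine (sum_le_sum fun c _ => norm_sum_le _ _).trans ?_
    rw [sum_comm]
    refine (sum_le_sum fun l _ => typeII_main C Q hC V Z hV a b _ (fun m => ?_) _ T hT3 hT ha hb).trans ?_
    · rw [abs_of_nonneg (hf.nonneg _)]; exact hf.le1 _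
    · simp
  have herr : ∑ c ∈ C, ‖∑ d ∈ Ioc V Z, (a d : ℂ) * cv c d / d * ∑ m ∈ Ioc V Z, ((b m * ε d m : ℝ) : ℂ) * cv c m / m‖
      ≤ T^2 * (Q * (1/S) * T^3) := by
    refine (sum_le_sum fun c _ => norm_sum_le _ _).trans ?_
    rw [sum_comm]
    refine (sum_le_sum (g := fun d : ℕ => |a d|/d * (Q * (1/S) * T^3)) fun d hd => ?_).trans ?_
    · have := typeII_err C Q hC V Z hV b (ε d) (1/S) (by positivity) (hεb d hd) T hT3 hT hb
      refine le_trans ?_ (mul_le_mul_of_nonneg_left this (by positivity))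
      rw [mul_sum]
      refine sum_le_sum fun c _ => ?_
      rw [norm_mul]
      refine mul_le_mul_of_nonneg_right ?_ (norm_nonneg _)
      rw [norm_div, norm_mul, Complex.norm_real, Real.norm_eq_abs, Complex.norm_natCast]
      have := cv_norm c d
      refine div_le_div_of_nonneg_right ?_ (by positivity)
      exact mul_le_of_le_one_right (abs_nonneg _) this
    · rw [← sum_mul]
      refine mul_le_mul_of_nonneg_right ha1 (by positivity)
  have hMb : ((M+1:ℕ):ℝ) ≤ S * T := by
    have : (M:ℝ) ≤ Real.log Z * S := Nat.floor_le (mul_nonneg (Real.log_natCast_nonneg Z) (by linarith))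
    push_cast
    nlinarith
  have hQS : (Q:ℝ) * (1/S) = S := by rw [← hSQ]; field_simp
  calc _ ≤ (M+1:ℕ) * T^5 + T^2 * (Q * (1/S) * T^3) := by
        refine le_trans (sum_le_sum fun c _ => ?_) ((sum_add_distrib).le.trans (add_le_add hmain herr))
        rw [hsplit c]
        exact norm_add_le _ _
    _ ≤ (S*T) * T^5 + S * T^5 * T := by
        rw [hQS]
        refine add_le_add (mul_le_mul_of_nonneg_right hMb (by positivity)) ?_
        have : 0 ≤ S * T^5 := by positivity
        nlinarith
    _ = _ := by ring
end DSR

namespace DSR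
open Finset ArithmeticFunction
open scoped ArithmeticFunction.zeta ArithmeticFunction.Moebius

lemma log_succ_sub (m : ℕ) (hm : 0 < m) : |Real.log m - Real.log (m+1:ℕ)| ≤ 1/m := by
  have hm' : (0:ℝ) < m := by exact_mod_cast hm
  rw [abs_sub_comm, abs_of_nonneg]
  · rw [← Real.log_div (by positivity) (by positivity)]
    refine (Real.log_le_sub_one_of_pos (by positivity)).trans (le_of_eq ?_)
    push_cast; field_simp; ring
  · rw [sub_nonneg]; apply Real.log_le_log hm'; push_cast; linarith

lemma diff_bound_aux (e e' f f' i i' E r : ℝ) (he : |e| ≤ E) (he' : |e'| ≤ E) (hE : |e - e'| ≤ r) (hf : |f| ≤ 1)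
    (hf' : |f'| ≤ 1)
    (hff : |f - f'| ≤ r) (hi : 0 ≤ i') (hii : i' ≤ i) (hir : i - i' ≤ r * i) (hr : 0 ≤ r) :
    |e * f * i - e' * f' * i'| ≤ (1 + 2*E) * (r * i) := by
  have hE0 : 0 ≤ E := (abs_nonneg _).trans he
  have : e * f * i - e' * f' * i' = (e - e') * f * i + e' * (f - f') * i + e' * f' * (i - i') := by ring
  rw [this]
  have h1 : |(e - e') * f * i| ≤ r * 1 * i := by
    rw [abs_mul, abs_mul, abs_of_nonneg (hi.trans hii)]; gcongr; linarith
  have h2 : |e' * (f - f') * i| ≤ E * r * i := by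
    rw [abs_mul, abs_mul, abs_of_nonneg (hi.trans hii)]; gcongr; linarith
  have h3 : |e' * f' * (i - i')| ≤ E * 1 * (r * i) := by
    rw [abs_mul, abs_mul, abs_of_nonneg (sub_nonneg.2 hii)]; gcongr
  refine (abs_add_three _ _ _).trans ?_
  linarith

/-- type I inner sum -/
lemma typeI (c : Ch) (Q : ℕ) (h0 : c.1 ≠ 0) (hle : c.1 ≤ Q) (h1 : c.2 ≠ 1) (X : ℝ) (f : ℝ → ℝ) (hf : FF X f)
    (d : ℕ) (hd0 : 0 < d) (hd : (d:ℝ) ≤ Real.exp (X/20)) (e : ℕ → ℝ) (E : ℝ)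
    (he : ∀ m ∈ Ioc 0 (Nx X + 1), |e m| ≤ E) (hee : ∀ m, 0 < m → |e m - e (m+1)| ≤ 1/m) (Z : ℕ) (hZ : Z = Nx X) :
    ‖∑ m ∈ Ioc 0 Z, ((e m : ℝ):ℂ) *
      (cv c (d*m) * ((f (Real.log ((d*m : ℕ):ℝ)/X) / ((d*m : ℕ):ℝ) : ℝ) : ℂ))‖ ≤
      Q * ((1 + 2*E) * (2 * Real.exp (-(3*X/40))) * (1 + Real.log Z)) := by
  subst hZ
  have hX := hf.pos
  haveI : NeZero c.1 := ⟨h0⟩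
  have hE0 : 0 ≤ E := (abs_nonneg _).trans (he 1 (by simp))
  have hd1 : (1:ℝ) ≤ d := by exact_mod_cast hd0
  set u : ℕ → ℝ := fun m => e m * f (Real.log ((d*m : ℕ):ℝ)/X) * (1/((d*m : ℕ):ℝ)) with hu
  have hzero : ∀ m : ℕ, (m:ℝ) < Real.exp (3*X/40) → f (Real.log ((d*m : ℕ):ℝ)/X) = 0 := by
    intro m hm
    apply hf.supp
    left
    rcases Nat.eq_zero_or_pos m with rfl | hm0
    · simp
    rw [div_lt_iff₀ hX, Real.log_lt_iff_lt_exp (by positivity)]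
    push_cast
    calc (d:ℝ)*m < Real.exp (X/20) * Real.exp (3*X/40) := by
          apply mul_lt_mul' hd hm (by positivity) (by positivity)
      _ = _ := by rw [← Real.exp_add]; congr 1; ring
  have hu1 : u 1 = 0 := by
    rw [hu]; simp only
    rw [hzero 1 (by simp; positivity)]; simp
  have huZ : u (Nx X + 1) = 0 := by
    rw [hu]; simp only
    rw [f_zero_of_ge hf.supp X hX]; · simp
    nlinarith
  have hdiff : ∀ m ∈ Ico 1 (Nx X + 1), |u m - u (m+1)| ≤ (1+2*E) * (2 * Real.exp (-(3*X/40))) * (1/m) := by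
    intro m hm
    rw [mem_Ico] at hm
    have hm0 : (0:ℝ) < m := by exact_mod_cast hm.1
    have hm1 : (1:ℝ) ≤ m := by exact_mod_cast hm.1
    by_cases hlt : ((m+1:ℕ):ℝ) < Real.exp (3*X/40)
    · have e1 : u (m+1) = 0 := by rw [hu]; simp only; rw [hzero _ hlt]; simp
      have e2 : u m = 0 := by
        rw [hu]; simp only; rw [hzero m (by push_cast at hlt; linarith)]; simp
      rw [e1, e2]; simp; positivity
    · push Not at hlt
      have hr : 1/(m:ℝ) ≤ 2 * Real.exp (-(3*X/40)) := by
        rw [Real.exp_neg, div_le_iff₀ hm0]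
        have : 0 < Real.exp (3*X/40) := Real.exp_pos _
        field_simp
        push_cast at hlt
        linarith
      have hb : |u m - u (m+1)| ≤ (1+2*E) * (1/m * (1/((d*m:ℕ):ℝ))) := by
        apply diff_bound_aux
        · exact he m (by rw [mem_Ioc]; omega)
        · exact he (m+1) (by rw [mem_Ioc]; omega)
        · exact hee m hm.1
        · rw [abs_of_nonneg (hf.nonneg _)]; exact hf.le1 _
        · rw [abs_of_nonneg (hf.nonneg _)]; exact hf.le1 _
        · refine (hf.lip _ _).trans ?_
          rw [← sub_div, abs_div, abs_of_pos hX, mul_div_cancel₀ _ hX.ne']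
          refine le_trans (le_of_eq ?_) (log_succ_sub m hm.1)
          push_cast
          rw [Real.log_mul (by positivity) (by positivity), Real.log_mul (by positivity) (by positivity)]
          congr 1; ring
        · positivity
        · push_cast; gcongr; linarith
        · push_cast
          rw [div_sub_div _ _ (by positivity) (by positivity), one_div_mul_one_div, div_le_div_iff₀ (by positivity) (by positivity)]
          have : (0:ℝ) ≤ d * d * m * m := by positivity
          nlinarith
        · positivity
      refine hb.trans ?_
      rw [mul_assoc]
      have : 1/((d*m:ℕ):ℝ) ≤ 1/m := by push_cast; apply one_div_le_one_div_of_le hm0; nlinarith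
      have h3 : 0 ≤ 1/((d*m:ℕ):ℝ) := by positivity
      gcongr
  have key := abel_bound (fun m => cv c m) (fun m => ((u m : ℝ):ℂ)) c.1 (fun N => char_sum_bound c.2 h1 N) 1 (Nx X + 1) (by omega)
  have hI : Ioc 0 (Nx X) = Ico 1 (Nx X + 1) := by ext; simp; omega
  have heq : ∑ m ∈ Ioc 0 (Nx X), ((e m : ℝ):ℂ) *
      (cv c (d*m) * ((f (Real.log ((d*m : ℕ):ℝ)/X) / ((d*m : ℕ):ℝ) : ℝ) : ℂ)) =
      cv c d * ∑ m ∈ Ico 1 (Nx X + 1), cv c m * ((u m : ℝ):ℂ) := by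
    rw [hI, mul_sum]
    refine sum_congr rfl fun m _ => ?_
    rw [cv_mul, hu]; push_cast; ring
  rw [heq, norm_mul]
  simp only [hu1, huZ, Complex.ofReal_zero, norm_zero, zero_add] at key
  have hs : ∑ n ∈ Ico 1 (Nx X + 1), ‖((u n : ℝ):ℂ) - ((u (n+1) : ℝ):ℂ)‖ ≤
      (1+2*E) * (2 * Real.exp (-(3*X/40))) * (1 + Real.log (Nx X)) := by
    refine le_trans (sum_le_sum fun m hm => ?_) (b := ∑ m ∈ Ico 1 (Nx X + 1), (1+2*E) * (2 * Real.exp (-(3*X/40))) * (1/(m:ℝ))) ?_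
    · rw [← Complex.ofReal_sub, Complex.norm_real, Real.norm_eq_abs]; exact hdiff m hm
    · rw [← mul_sum, ← hI]
      refine mul_le_mul_of_nonneg_left (sum_inv_Ioc _) (by positivity)
  calc _ ≤ 1 * (c.1 * ((1+2*E) * (2 * Real.exp (-(3*X/40))) * (1 + Real.log (Nx X)))) := by
        refine mul_le_mul (cv_norm c d) (key.trans ?_) (norm_nonneg _) zero_le_one
        refine mul_le_mul_of_nonneg_left hs (by positivity)
    _ ≤ _ := by
      rw [one_mul]
      have : 0 ≤ Real.log (Nx X) := Real.log_natCast_nonneg _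
      gcongr

end DSR

namespace DSR
open Finset ArithmeticFunction
open scoped ArithmeticFunction.zeta ArithmeticFunction.Moebius

lemma log_Nx (X : ℝ) (hX : 0 < X) : Real.log (Nx X) ≤ 4*X+1 := by
  have h1 : (1:ℝ) ≤ Real.exp (4*X) := Real.one_le_exp (by positivity)
  have h2 : ((Nx X : ℕ):ℝ) ≤ Real.exp (4*X) * Real.exp 1 := by
    unfold Nx; push_cast
    have h3 := Nat.floor_le (Real.exp_pos (4*X)).le
    have h4 : (2:ℝ) ≤ Real.exp 1 := by have := Real.add_one_le_exp (1:ℝ); linarith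
    nlinarith
  rw [← Real.exp_add] at h2
  rw [Real.log_le_iff_le_exp (by unfold Nx; positivity)]
  exact h2

lemma typeI_sum (c : Ch) (Q : ℕ) (h0 : c.1 ≠ 0) (hle : c.1 ≤ Q) (h1 : c.2 ≠ 1) (X : ℝ) (f : ℝ → ℝ) (hf : FF X f)
    (e a : ℕ → ℝ) (E : ℝ)
    (he : ∀ m ∈ Ioc 0 (Nx X + 1), |e m| ≤ E) (hee : ∀ m, 0 < m → |e m - e (m+1)| ≤ 1/m)
    (A : ℝ) (ha : ∀ d ∈ Ioc 0 (Nx X), |a d| ≤ A) (D : ℕ) (hD : (D:ℝ) ≤ Real.exp (X/20)) (haD : ∀ d, D < d → a d = 0) :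
    ‖∑ d ∈ Ioc 0 (Nx X), ∑ m ∈ Ioc 0 (Nx X), ((a d : ℝ):ℂ) * ((e m : ℝ):ℂ) *
      (cv c (d*m) * ((f (Real.log ((d*m : ℕ):ℝ)/X) / ((d*m : ℕ):ℝ) : ℝ) : ℂ))‖ ≤
      Q * (A * (1 + 2*E) * 2 * (1 + Real.log (Nx X))) * Real.exp (-(X/40)) := by
  have hA0 : 0 ≤ A := (abs_nonneg _).trans (ha 1 (by rw [mem_Ioc]; unfold Nx; omega))
  have hE0 : 0 ≤ E := (abs_nonneg _).trans (he 1 (by simp))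
  have hL : 0 ≤ Real.log (Nx X) := Real.log_natCast_nonneg _
  set B : ℝ := Q * ((1 + 2*E) * (2 * Real.exp (-(3*X/40))) * (1 + Real.log (Nx X))) with hB
  have hB0 : 0 ≤ B := by positivity
  have h2 : ∀ d ∈ Ioc 0 (Nx X), ‖∑ m ∈ Ioc 0 (Nx X), ((a d : ℝ):ℂ) * ((e m : ℝ):ℂ) *
      (cv c (d*m) * ((f (Real.log ((d*m : ℕ):ℝ)/X) / ((d*m : ℕ):ℝ) : ℝ) : ℂ))‖ ≤ if d ≤ D then A * B else 0 := by
    intro d hd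
    simp_rw [mul_assoc ((a d : ℝ):ℂ)]
    rw [← mul_sum, norm_mul, Complex.norm_real, Real.norm_eq_abs]
    split_ifs with hdD
    · refine mul_le_mul (ha d hd) ?_ (norm_nonneg _) hA0
      have hdD' : (d:ℝ) ≤ D := by exact_mod_cast hdD
      exact typeI c Q h0 hle h1 X f hf d (mem_Ioc.1 hd).1 (by linarith) e E he hee _ rfl
    · rw [haD d (by omega)]; simp
  refine (norm_sum_le _ _).trans ((sum_le_sum h2).trans ?_)
  rw [← sum_filter, sum_const, nsmul_eq_mul]
  have h3 : ((filter (fun d => d ≤ D) (Ioc 0 (Nx X))).card : ℝ) ≤ Real.exp (X/20) := by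
    refine le_trans ?_ hD
    have : (filter (fun d => d ≤ D) (Ioc 0 (Nx X))).card ≤ (Ioc 0 D).card := by
      apply card_le_card
      intro d hd; simp at hd ⊢; omega
    simpa using this
  refine (mul_le_mul_of_nonneg_right h3 (by positivity)).trans (le_of_eq ?_)
  have : Real.exp (-(X/40)) = Real.exp (X/20) * Real.exp (-(3*X/40)) := by
    rw [← Real.exp_add]; congr 1; ring
  rw [hB, this]; ring

lemma moebius_real_abs (n : ℕ) : |(μ : ArithmeticFunction ℝ) n| ≤ 1 := by
  rw [intCoe_apply]
  exact_mod_cast abs_moebius_le_one (n := n)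

lemma restr_abs_le (p : ℕ → Prop) [DecidablePred p] (a : ArithmeticFunction ℝ) (n : ℕ) :
    |restr p a n| ≤ |a n| := by
  rw [restr_apply]; split_ifs
  · exact le_rfl
  · simp

lemma alpha_le (U V : ℕ) (n : ℕ) :
    |(restr (· ≤ V) vonMangoldt * restr (· ≤ U) (μ : ArithmeticFunction ℝ)) n| ≤ Real.log n := by
  have h : (vonMangoldt * (ζ : ArithmeticFunction ℝ)) n = Real.log n := by
    rw [vonMangoldt_mul_zeta, log_apply]
  rw [← h, mul_apply, mul_apply]
  refine (abs_sum_le_sum_abs _ _).trans (sum_le_sum fun x hx => ?_)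
  rw [abs_mul]
  have hx2 : 0 < x.2 := Nat.pos_of_ne_zero (by
    have := Nat.mem_divisorsAntidiagonal.1 hx
    rintro h; rw [h] at this; simp at this; omega)
  rw [zeta_real x.2 hx2]
  refine mul_le_mul ?_ ((restr_abs_le _ _ _).trans (moebius_real_abs _)) (abs_nonneg _) vonMangoldt_nonneg
  refine (restr_abs_le _ _ _).trans (le_of_eq (abs_of_nonneg vonMangoldt_nonneg))

lemma alpha_zero (U V : ℕ) (n : ℕ) (hn : V * U < n) :
    (restr (· ≤ V) vonMangoldt * restr (· ≤ U) (μ : ArithmeticFunction ℝ)) n = 0 := by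
  rw [mul_apply]
  refine sum_eq_zero fun x hx => ?_
  rw [restr_apply, restr_apply]
  have := (Nat.mem_divisorsAntidiagonal.1 hx).1
  split_ifs with h1 h2
  · have := Nat.mul_le_mul h1 h2; omega
  · simp
  · simp
  · simp

lemma beta_le (U : ℕ) (n : ℕ) :
    |(restr (U < ·) (μ : ArithmeticFunction ℝ) * (ζ : ArithmeticFunction ℝ)) n| ≤ tau n := by
  rw [← zeta_conv, mul_apply, mul_apply]
  refine (abs_sum_le_sum_abs _ _).trans (sum_le_sum fun x hx => ?_)
  rw [abs_mul, abs_of_nonneg (zeta_real_nonneg x.2)]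
  refine mul_le_mul_of_nonneg_right ?_ (zeta_real_nonneg _)
  have hx1 : 0 < x.1 := Nat.pos_of_ne_zero (by
    have := Nat.mem_divisorsAntidiagonal.1 hx
    rintro h; rw [h] at this; simp at this; omega)
  rw [zeta_real x.1 hx1]
  exact (restr_abs_le _ _ _).trans (moebius_real_abs _)

lemma beta_zero (U : ℕ) (n : ℕ) (hn : n ≤ U) :
    (restr (U < ·) (μ : ArithmeticFunction ℝ) * (ζ : ArithmeticFunction ℝ)) n = 0 := by
  rw [mul_apply]
  refine sum_eq_zero fun x hx => ?_
  rw [restr_apply, if_neg, zero_mul]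
  have h := Nat.mem_divisorsAntidiagonal.1 hx
  have : x.1 ≤ n := Nat.le_of_dvd (by omega) ⟨x.2, h.1.symm⟩
  omega

set_option maxHeartbeats 1000000 in
theorem partB (X : ℝ) (f : ℝ → ℝ) (hf : FF X f) (Q : ℕ) (hQ : 1 ≤ Q) (hQX : (Q:ℝ) ≤ Real.exp (X/200))
    (C : Finset Ch) (hC : PF C Q) :
    ∑ c ∈ C, ‖SL X f c.2‖ ≤ 3 * √Q * (4*X+5)^6 := by
  have hX := hf.pos
  set Z := Nx X with hZ
  set T : ℝ := 4*X+5 with hT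
  have hT3 : 3 ≤ T := by linarith
  have hLZ : Real.log Z ≤ 4*X+1 := log_Nx X hX
  have hL0 : 0 ≤ Real.log Z := Real.log_natCast_nonneg _
  set V : ℕ := ⌊Real.exp (X/40)⌋₊ with hVdef
  have hVle : (V:ℝ) ≤ Real.exp (X/40) := Nat.floor_le (Real.exp_pos _).le
  have hV : Q^4 ≤ V := by
    apply Nat.le_floor
    push_cast
    calc (Q:ℝ)^4 ≤ (Real.exp (X/200))^4 := by gcongr
      _ = Real.exp (X/50) := by rw [← Real.exp_nat_mul]; congr 1; push_cast; ring
      _ ≤ _ := by apply Real.exp_le_exp.2; linarith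
  have hV1 : 1 ≤ V := le_trans (Nat.one_le_pow _ _ hQ) hV
  set w : Ch → ℕ → ℂ := fun c n => cv c n * ((f (Real.log n/X) / n : ℝ) : ℂ) with hw
  have hwz : ∀ c n, Z < n → w c n = 0 := by
    intro c n hn
    simp only [hw]
    rw [f_zero_of_ge hf.supp X hX n hn.le]; simp
  have hSL : ∀ c : Ch, SL X f c.2 = ∑ n ∈ Ioc 0 Z, ((restr (V < ·) vonMangoldt n : ℝ):ℂ) * w c n := by
    intro c
    unfold SL
    have e1 : ∑ n ∈ range (Nx X), chiL c.2 n * ((f (Real.log n / X) / n : ℝ) : ℂ) =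
        ∑ n ∈ range (Nx X + 1), chiL c.2 n * ((f (Real.log n / X) / n : ℝ) : ℂ) := by
      rw [sum_range_succ, f_zero_of_ge hf.supp X hX (Nx X) le_rfl]; simp
    rw [e1]
    symm
    have hsub : Ioc 0 Z ⊆ range (Nx X + 1) := by intro n hn; simp at hn ⊢; omega
    refine (sum_congr rfl fun n hn => ?_).trans (sum_subset hsub fun n hn hn' => ?_)
    · rw [restr_apply]
      split_ifs with hVn
      · simp only [hw, chiL, Pi.mul_apply, cv]; ring
      · have : f (Real.log n / X) = 0 := by
          apply hf.supp; left
          have hn0 : (0:ℝ) < n := by exact_mod_cast (mem_Ioc.1 hn).1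
          rw [div_lt_iff₀ hX, Real.log_lt_iff_lt_exp hn0]
          have : (n:ℝ) ≤ V := by exact_mod_cast (not_lt.1 hVn)
          have h2 : Real.exp (X/40) < Real.exp (1/8*X) := Real.exp_lt_exp.2 (by linarith)
          linarith
        rw [this]; simp
    · have : n = 0 := by simp at hn hn'; by_contra h; have := hn' (by omega); omega
      subst this; simp
  set a1 := restr (· ≤ V) (μ : ArithmeticFunction ℝ) with ha1
  set a2 := restr (· ≤ V) vonMangoldt * restr (· ≤ V) (μ : ArithmeticFunction ℝ) with ha2
  set l2 := restr (V < ·) vonMangoldt with hl2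
  set b2 := restr (V < ·) (μ : ArithmeticFunction ℝ) * (ζ : ArithmeticFunction ℝ) with hb2
  have hva : l2 = a1 * log - a2 * (ζ : ArithmeticFunction ℝ) + l2 * b2 := vaughan V V
  have hlogle : ∀ n ∈ Ioc 0 (Z+1), Real.log n ≤ T := by
    intro n hn
    rw [mem_Ioc] at hn
    have h0 : (0:ℝ) < n := by exact_mod_cast hn.1
    have h1 : (n:ℝ) ≤ 2 * Z := by
      have : n ≤ 2 * Z := by have : 1 ≤ Z := by rw [hZ]; unfold Nx; omega
                             omega
      exact_mod_cast this
    calc Real.log n ≤ Real.log (2*Z) := Real.log_le_log h0 h1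
      _ = Real.log 2 + Real.log Z := Real.log_mul (by norm_num) (by rw [hZ]; unfold Nx; positivity)
      _ ≤ _ := by have := Real.log_two_lt_d9; linarith
  have hEx : 0 ≤ Real.exp (-(X/40)) := (Real.exp_pos _).le
  have hI : ∀ c ∈ C, ∀ (a e : ArithmeticFunction ℝ), (∀ m ∈ Ioc 0 (Nx X + 1), |e m| ≤ T) →
      (∀ m, 0 < m → |e m - e (m+1)| ≤ 1/m) → (∀ d ∈ Ioc 0 (Nx X), |a d| ≤ T) → (∀ d, V*V < d → a d = 0) →
      ‖∑ n ∈ Ioc 0 Z, (((a * e) n : ℝ):ℂ) * w c n‖ ≤ Q * (6 * T^3) * Real.exp (-(X/40)) := by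
    intro c hc a e h1 h2 h3 h4
    rw [conv_sum a e (w c) Z (hwz c)]
    refine (typeI_sum c Q (hC.ne c hc) (hC.le c hc) (hC.ne1 c hc) X f hf e a T h1 h2 T h3 (V*V) ?_ h4).trans ?_
    · push_cast
      calc (V:ℝ)*V ≤ Real.exp (X/40) * Real.exp (X/40) := by gcongr
        _ = _ := by rw [← Real.exp_add]; congr 1; ring
    · refine mul_le_mul_of_nonneg_right (mul_le_mul_of_nonneg_left ?_ (by positivity)) hEx
      calc T * (1 + 2*T) * 2 * (1 + Real.log (Nx X)) ≤ T * (3*T) * 2 * T := by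
            have : 1 + Real.log (Nx X) ≤ T := by linarith
            have : 1 + 2*T ≤ 3*T := by linarith
            gcongr
        _ = _ := by ring
  have hT1 : ∀ c ∈ C, ‖∑ n ∈ Ioc 0 Z, (((a1 * log) n : ℝ):ℂ) * w c n‖ ≤ Q * (6 * T^3) * Real.exp (-(X/40)) := by
    intro c hc
    refine hI c hc a1 log ?_ ?_ ?_ ?_
    · intro m hm
      rw [log_apply, abs_of_nonneg (Real.log_natCast_nonneg m)]
      exact hlogle m hm
    · intro m hm; rw [log_apply, log_apply]; exact log_succ_sub m hm
    · intro d hd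
      exact ((restr_abs_le _ _ _).trans (moebius_real_abs _)).trans (by linarith)
    · intro d hd
      rw [ha1, restr_apply, if_neg]
      nlinarith
  have hT2 : ∀ c ∈ C, ‖∑ n ∈ Ioc 0 Z, (((a2 * (ζ : ArithmeticFunction ℝ)) n : ℝ):ℂ) * w c n‖ ≤ Q * (6 * T^3) * Real.exp (-(X/40)) := by
    intro c hc
    refine hI c hc a2 _ ?_ ?_ ?_ ?_
    · intro m hm
      rw [zeta_real m (mem_Ioc.1 hm).1]; simp; linarith
    · intro m hm; rw [zeta_real m hm, zeta_real (m+1) (by omega)]; simp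
    · intro d hd
      refine (alpha_le _ _ _).trans (hlogle d ?_)
      simp at hd ⊢; omega
    · intro d hd
      exact alpha_zero V V d hd
  have hT3' : ∑ c ∈ C, ‖∑ n ∈ Ioc 0 Z, (((l2 * b2) n : ℝ):ℂ) * w c n‖ ≤ 2 * √Q * T^6 := by
    have hl2le : ∀ d ∈ Ioc V Z, |l2 d| ≤ Real.log Z := by
      intro d hd
      rw [mem_Ioc] at hd
      refine (restr_abs_le _ _ _).trans ?_
      rw [abs_of_nonneg vonMangoldt_nonneg]
      refine vonMangoldt_le_log.trans (Real.log_le_log (by exact_mod_cast (by omega)) (by exact_mod_cast hd.2))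
    have hinv : ∑ d ∈ Ioc V Z, (1:ℝ)/d ≤ T := by
      refine (sum_le_sum_of_subset_of_nonneg (fun m hm => ?_) (fun _ _ _ => by positivity)).trans ((sum_inv_Ioc Z).trans (by linarith))
      simp at hm ⊢; omega
    have h := typeII C Q hC hQ V Z hV X f hf l2 b2 T hT3 (by linarith) ?_ ?_ ?_
    · refine le_trans (le_of_eq ?_) h
      refine sum_congr rfl fun c _ => ?_
      rw [conv_sum l2 b2 (w c) Z (hwz c)]
      congr 1
      have hsub : Ioc V Z ⊆ Ioc 0 Z := by intro n hn; simp at hn ⊢; omega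
      symm
      refine (sum_congr rfl fun d _ => ?_).trans (sum_subset hsub fun d hd hd' => ?_)
      · refine sum_subset hsub fun m hm hm' => ?_
        have : b2 m = 0 := beta_zero V m (by simp at hm hm'; by_contra hh; have := hm' (by omega); omega)
        rw [this]; simp
      · have : l2 d = 0 := by
          rw [hl2, restr_apply, if_neg]
          simp at hd hd'; intro hh; have := hd' hh; omega
        rw [this]; simp
    · calc _ ≤ ∑ d ∈ Ioc V Z, T^2 * ((1:ℝ)/d) := by
            refine sum_le_sum fun d hd => ?_
            rw [mul_one_div]
            refine div_le_div_of_nonneg_right ?_ (by positivity)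
            rw [← sq_abs]
            have := hl2le d hd
            have : |l2 d| ≤ T := by linarith
            gcongr
        _ ≤ T^2 * T := by rw [← mul_sum]; gcongr
        _ = _ := by ring
    · calc _ ≤ ∑ d ∈ Ioc V Z, T * ((1:ℝ)/d) := by
            refine sum_le_sum fun d hd => ?_
            rw [mul_one_div]
            refine div_le_div_of_nonneg_right ?_ (by positivity)
            have := hl2le d hd
            linarith
        _ ≤ T * T := by rw [← mul_sum]; gcongr
        _ = _ := by ring
    · calc _ ≤ ∑ d ∈ Ioc V Z, tau d^2/d := by
            refine sum_le_sum fun d hd => ?_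
            refine div_le_div_of_nonneg_right ?_ (by positivity)
            rw [← sq_abs]
            have := beta_le V d
            gcongr
        _ ≤ ∑ d ∈ Ioc 0 Z, tau d^2/d := by
            refine sum_le_sum_of_subset_of_nonneg (fun m hm => ?_) (fun _ _ _ => by positivity)
            simp at hm ⊢; omega
        _ ≤ _ := tau_sq_sum Z
        _ ≤ _ := by
          have : 1 + Real.log Z ≤ T := by linarith
          gcongr
  have hdec : ∀ c ∈ C, ‖SL X f c.2‖ ≤ 2 * (Q * (6 * T^3) * Real.exp (-(X/40))) +
      ‖∑ n ∈ Ioc 0 Z, (((l2 * b2) n : ℝ):ℂ) * w c n‖ := by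
    intro c hc
    have : SL X f c.2 = ∑ n ∈ Ioc 0 Z, (((a1 * log) n : ℝ):ℂ) * w c n
        - ∑ n ∈ Ioc 0 Z, (((a2 * (ζ : ArithmeticFunction ℝ)) n : ℝ):ℂ) * w c n
        + ∑ n ∈ Ioc 0 Z, (((l2 * b2) n : ℝ):ℂ) * w c n := by
      rw [hSL c, ← sum_sub_distrib, ← sum_add_distrib]
      refine sum_congr rfl fun n _ => ?_
      have h5 : l2 n = (a1 * log) n - (a2 * (ζ : ArithmeticFunction ℝ)) n + (l2 * b2) n := by
        conv_lhs => rw [hva]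
        rw [ArithmeticFunction.add_apply, sub_eq_add_neg, ArithmeticFunction.add_apply, sub_eq_add_neg]
        rfl
      rw [h5]; push_cast; ring
    rw [this]
    refine (norm_add_le _ _).trans (add_le_add ((norm_sub_le _ _).trans ?_) le_rfl)
    have := hT1 c hc
    have := hT2 c hc
    linarith
  refine (sum_le_sum hdec).trans ?_
  rw [sum_add_distrib, sum_const, nsmul_eq_mul]
  have hcard : (C.card:ℝ) ≤ (Q:ℝ)^2 := by exact_mod_cast hC.card
  have hQ3 : (Q:ℝ)^2 * Q * Real.exp (-(X/40)) ≤ 1 := by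
    calc (Q:ℝ)^2 * Q * Real.exp (-(X/40)) = (Q:ℝ)^3 * Real.exp (-(X/40)) := by ring
      _ ≤ (Real.exp (X/200))^3 * Real.exp (-(X/40)) := by gcongr
      _ = Real.exp (-(X/100)) := by
        rw [← Real.exp_nat_mul, ← Real.exp_add]; congr 1; push_cast; ring
      _ ≤ 1 := Real.exp_le_one_iff.2 (by linarith)
  have hS1 : 1 ≤ √(Q:ℝ) := Real.one_le_sqrt.2 (by exact_mod_cast hQ)
  have hTT : 12 * T^3 ≤ T^6 := by
    have : (27:ℝ) ≤ T^3 := by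
      calc (27:ℝ) = 3^3 := by norm_num
        _ ≤ _ := by gcongr
    have e : T^6 = T^3*T^3 := by ring
    rw [e]; nlinarith
  have hfin : (C.card:ℝ) * (2 * (Q * (6 * T^3) * Real.exp (-(X/40)))) ≤ √(Q:ℝ) * T^6 := by
    calc (C.card:ℝ) * (2 * (Q * (6 * T^3) * Real.exp (-(X/40)))) ≤ (Q:ℝ)^2 * (2 * (Q * (6 * T^3) * Real.exp (-(X/40)))) := by
          refine mul_le_mul_of_nonneg_right hcard (by positivity)
      _ = 12 * T^3 * ((Q:ℝ)^2 * Q * Real.exp (-(X/40))) := by ring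
      _ ≤ 12 * T^3 * 1 := by gcongr
      _ ≤ T^6 := by linarith
      _ ≤ _ := by
        have : 0 ≤ T^6 := by positivity
        nlinarith
  linarith
end DSR

namespace DSR
open Finset ArithmeticFunction
open scoped ArithmeticFunction.zeta ArithmeticFunction.Moebius

lemma tau_pow_sum (r Z : ℕ) : ∑ n ∈ Ioc 0 Z, tau n ^ r / n ≤ (1 + Real.log Z)^(2^r) := by
  induction r with
  | zero => simpa using sum_inv_Ioc Z
  | succ r ih =>
    have h := conv_sum_le (ζ : ArithmeticFunction ℝ) ζ zeta_real_nonneg zeta_real_nonneg (fun n => tau n^r/(n:ℝ))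
      (fun n => div_nonneg (pow_nonneg (tau_nonneg n) _) (Nat.cast_nonneg _)) Z
    simp_rw [zeta_conv] at h
    have h0 : 0 ≤ ∑ n ∈ Ioc 0 Z, tau n ^ r / n :=
      sum_nonneg fun n _ => div_nonneg (pow_nonneg (tau_nonneg n) _) (Nat.cast_nonneg _)
    calc _ = ∑ n ∈ Ioc 0 Z, tau n * (tau n ^ r / n) := by
          refine sum_congr rfl fun d hd => ?_
          ring
      _ ≤ _ := h
      _ ≤ (∑ n ∈ Ioc 0 Z, tau n ^ r/n)^2 := by
          rw [sq, sum_mul_sum]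
          refine sum_le_sum fun d hd => sum_le_sum fun m hm => ?_
          rw [zeta_real d (mem_Ioc.1 hd).1, zeta_real m (mem_Ioc.1 hm).1]
          push_cast; rw [div_mul_div_comm, one_mul, one_mul, ← mul_pow]
          have := tau_mul_le d m
          have := tau_nonneg (d*m)
          gcongr
      _ ≤ ((1 + Real.log Z)^(2^r))^2 := by gcongr
      _ = _ := by rw [← pow_mul]; rfl

lemma le_phi_tau (n : ℕ) (hn : 0 < n) : (n:ℝ) ≤ (n.totient:ℝ) * tau n := by
  have h := Nat.sum_totient n
  have : n ≤ n.totient * n.divisors.card := by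
    calc n = ∑ d ∈ n.divisors, d.totient := h.symm
      _ ≤ ∑ d ∈ n.divisors, n.totient := sum_le_sum fun d hd =>
          Nat.le_of_dvd (Nat.totient_pos.2 hn) (Nat.totient_dvd_of_dvd (Nat.dvd_of_mem_divisors hd))
      _ = _ := by rw [sum_const, smul_eq_mul, mul_comm]
  unfold tau
  exact_mod_cast this

lemma tau_ge_one (n : ℕ) (hn : 0 < n) : 1 ≤ tau n := by
  unfold tau
  exact_mod_cast Finset.card_pos.2 ⟨1, by simp; omega⟩

lemma tau_pow_le (r n : ℕ) (hn : 0 < n) : tau n ^ r ≤ n * (1 + Real.log n)^(2^r) := by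
  have h := tau_pow_sum r n
  have h1 : tau n^r/n ≤ ∑ n ∈ Ioc 0 n, tau n ^ r / n :=
    single_le_sum (f := fun n : ℕ => tau n ^ r / n)
      (fun n _ => div_nonneg (pow_nonneg (tau_nonneg n) _) (Nat.cast_nonneg _)) (by simp; omega)
  have hn' : (0:ℝ) < n := by exact_mod_cast hn
  have := h1.trans h
  rw [div_le_iff₀ hn'] at this
  linarith

/-- weights over multiples of c -/
lemma weight_mult (r Y c : ℕ) (hc : 0 < c) :
    ∑ q ∈ (Ioc 0 Y).filter (c ∣ ·), tau q^r / (q.totient:ℝ) ≤ tau c^(r+1)/c * (1 + Real.log Y)^(2^(r+1)) := by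
  have hc' : (0:ℝ) < c := by exact_mod_cast hc
  calc _ ≤ ∑ q ∈ (Ioc 0 Y).filter (c ∣ ·), tau q^(r+1) / q := by
        refine sum_le_sum fun q hq => ?_
        have hq0 : 0 < q := (mem_Ioc.1 (mem_filter.1 hq).1).1
        have h1 := le_phi_tau q hq0
        have h2 : (0:ℝ) < q.totient := by exact_mod_cast Nat.totient_pos.2 hq0
        have h3 : (0:ℝ) < q := by exact_mod_cast hq0
        rw [div_le_div_iff₀ h2 h3, pow_succ, mul_assoc, mul_comm (tau q) _]
        exact mul_le_mul_of_nonneg_left h1 (pow_nonneg (tau_nonneg q) _)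
    _ ≤ ∑ m ∈ Ioc 0 Y, tau (c*m)^(r+1) / ((c*m:ℕ):ℝ) := by
        have himg : (Ioc 0 Y).filter (c ∣ ·) ⊆ (Ioc 0 Y).image (fun m => c*m) := by
          intro q hq
          simp only [mem_filter, mem_Ioc, mem_image] at hq ⊢
          obtain ⟨⟨h1, h2⟩, m, rfl⟩ := hq
          refine ⟨m, ⟨Nat.pos_of_mul_pos_left h1, ?_⟩, rfl⟩
          have := Nat.le_mul_of_pos_left m hc
          omega
        refine (sum_le_sum_of_subset_of_nonneg himg fun _ _ _ => div_nonneg (pow_nonneg (tau_nonneg _) _) (Nat.cast_nonneg _)).trans ?_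
        rw [sum_image]
        intro a _ b _ h
        exact Nat.eq_of_mul_eq_mul_left hc h
    _ ≤ ∑ m ∈ Ioc 0 Y, tau c^(r+1)/c * (tau m^(r+1)/m) := by
        refine sum_le_sum fun m _ => ?_
        rw [div_mul_div_comm, ← mul_pow]
        push_cast
        have := tau_mul_le c m
        have := tau_nonneg (c*m)
        gcongr
    _ ≤ _ := by
        rw [← mul_sum]
        exact mul_le_mul_of_nonneg_left (tau_pow_sum _ _) (div_nonneg (pow_nonneg (tau_nonneg _) _) (Nat.cast_nonneg _))

open Classical in
/-- nontrivial primitive characters of modulus at most Y -/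
noncomputable def PC (Y : ℕ) : Finset Ch :=
  (Ioc 0 Y).sigma (fun n => (univ : Finset (DirichletCharacter ℂ n)).filter (fun χ => χ.IsPrimitive ∧ χ ≠ 1))

lemma mem_PC (Y : ℕ) (c : Ch) : c ∈ PC Y ↔ (0 < c.1 ∧ c.1 ≤ Y) ∧ c.2.IsPrimitive ∧ c.2 ≠ 1 := by
  unfold PC; simp

open Classical in
lemma PC_card (Y : ℕ) : (PC Y).card ≤ Y^2 := by
  unfold PC
  rw [card_sigma, sq]
  calc _ ≤ ∑ n ∈ Ioc 0 Y, Y := by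
        refine sum_le_sum fun n hn => ?_
        rw [mem_Ioc] at hn
        haveI : NeZero n := ⟨by omega⟩
        refine (card_le_univ _).trans ?_
        rw [← Nat.card_eq_fintype_card, DirichletCharacter.card_eq_totient_of_hasEnoughRootsOfUnity]
        exact (Nat.totient_le n).trans hn.2
    _ = _ := by simp

lemma PF_of_subset (Q : ℕ) (C : Finset Ch) (h : C ⊆ PC Q) : PF C Q where
  ne c hc := by have := (mem_PC _ _).1 (h hc); omega
  le c hc := by have := (mem_PC _ _).1 (h hc); omega
  prim c hc := ((mem_PC _ _).1 (h hc)).2.1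
  ne1 c hc := ((mem_PC _ _).1 (h hc)).2.2
  card := (card_le_card h).trans (PC_card Q)

noncomputable def toPrim {q : ℕ} (χ : DirichletCharacter ℂ q) : Ch := ⟨χ.conductor, χ.primitiveCharacter⟩

open Classical in
lemma group_prim (q Y : ℕ) (hq : 0 < q) (hqY : q ≤ Y) (G : Ch → ℝ) (hG : ∀ c, 0 ≤ G c) :
    ∑ χ ∈ (univ : Finset (DirichletCharacter ℂ q)).filter (· ≠ 1), G (toPrim χ) ≤
      ∑ c ∈ (PC Y).filter (fun c => c.1 ∣ q), G c := by
  haveI : NeZero q := ⟨hq.ne'⟩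
  let lift : Ch → DirichletCharacter ℂ q := fun c =>
    if h : c.1 ∣ q then DirichletCharacter.changeLevel h c.2 else 1
  have hl : ∀ χ : DirichletCharacter ℂ q, lift (toPrim χ) = χ := by
    intro χ
    simp only [lift, toPrim]
    rw [dif_pos χ.conductor_dvd_level]
    exact χ.changeLevel_primitiveCharacter
  have hinj : Function.Injective (toPrim (q := q)) := Function.LeftInverse.injective hl
  rw [← sum_image (f := G) (g := toPrim (q := q)) (fun a _ b _ h => hinj h)]
  refine sum_le_sum_of_subset_of_nonneg ?_ fun c _ _ => hG c
  intro c hc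
  rw [mem_image] at hc
  obtain ⟨χ, hχ, rfl⟩ := hc
  rw [mem_filter, mem_PC]
  have hd := χ.conductor_dvd_level
  refine ⟨⟨⟨Nat.pos_of_ne_zero χ.conductor_ne_zero, (Nat.le_of_dvd hq hd).trans hqY⟩, χ.primitiveCharacter_isPrimitive, ?_⟩, hd⟩
  intro h
  have hχ' : χ ≠ 1 := by simpa using hχ
  apply hχ'
  rw [← χ.changeLevel_primitiveCharacter]
  have h' : χ.primitiveCharacter = 1 := h
  rw [h', DirichletCharacter.changeLevel_one]

open Classical in
lemma group_all (Y r : ℕ) (G : Ch → ℝ) (hG : ∀ c, 0 ≤ G c) :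
    ∑ q ∈ Ioc 0 Y, tau q^r / (q.totient:ℝ) *
      ∑ χ ∈ (univ : Finset (DirichletCharacter ℂ q)).filter (· ≠ 1), G (toPrim χ) ≤
    (1 + Real.log Y)^(2^(r+1)) * ∑ c ∈ PC Y, G c * (tau c.1^(r+1)/c.1) := by
  calc _ ≤ ∑ q ∈ Ioc 0 Y, tau q^r / (q.totient:ℝ) * ∑ c ∈ (PC Y).filter (fun c => c.1 ∣ q), G c := by
        refine sum_le_sum fun q hq => ?_
        rw [mem_Ioc] at hq
        exact mul_le_mul_of_nonneg_left (group_prim q Y hq.1 hq.2 G hG)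
          (div_nonneg (pow_nonneg (tau_nonneg _) _) (Nat.cast_nonneg _))
    _ = ∑ c ∈ PC Y, G c * ∑ q ∈ (Ioc 0 Y).filter (c.1 ∣ ·), tau q^r / (q.totient:ℝ) := by
        simp_rw [mul_sum, sum_filter]
        rw [sum_comm]
        refine sum_congr rfl fun c _ => sum_congr rfl fun q _ => ?_
        split_ifs
        · ring
        · rfl
    _ ≤ ∑ c ∈ PC Y, G c * (tau c.1^(r+1)/c.1 * (1 + Real.log Y)^(2^(r+1))) := by
        refine sum_le_sum fun c hc => mul_le_mul_of_nonneg_left (weight_mult r Y c.1 ?_) (hG c)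
        exact ((mem_PC _ _).1 hc).1.1
    _ = _ := by rw [mul_sum]; refine sum_congr rfl fun c _ => by ring

/-- tau power saving -/
lemma tau_pow_rpow (s n : ℕ) (hn : 0 < n) :
    tau n^s / n ≤ (n:ℝ)^(-(3/4:ℝ)) * (1 + Real.log n)^(2^(4*s)) := by
  have hn' : (0:ℝ) < n := by exact_mod_cast hn
  have h := tau_pow_le (4*s) n hn
  have hL : 1 ≤ 1 + Real.log n := by have := Real.log_natCast_nonneg n; linarith
  have hT : 0 ≤ tau n^s := pow_nonneg (tau_nonneg n) _
  have h1 : tau n^s ≤ (n:ℝ)^(1/4:ℝ) * (1 + Real.log n)^(2^(4*s)) := by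
    have h2 : (tau n^s)^4 ≤ ((n:ℝ)^(1/4:ℝ) * (1 + Real.log n)^(2^(4*s)))^4 := by
      rw [← pow_mul, mul_comm s 4, mul_pow, ← Real.rpow_natCast ((n:ℝ)^(1/4:ℝ)) 4, ← Real.rpow_mul hn'.le]
      norm_num
      refine h.trans (mul_le_mul_of_nonneg_left ?_ hn'.le)
      exact le_self_pow₀ (one_le_pow₀ hL) (by norm_num)
    exact le_of_pow_le_pow_left₀ (by norm_num) (by positivity) h2
  rw [div_le_iff₀ hn']
  refine h1.trans (le_of_eq ?_)
  have : (n:ℝ)^(1/4:ℝ) = (n:ℝ)^(-(3/4:ℝ)) * n := by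
    rw [← Real.rpow_add_one hn'.ne']; norm_num
  rw [this]; ring

end DSR

namespace DSR
open Finset ArithmeticFunction

noncomputable def SP {q : ℕ} (X : ℝ) (f : ℝ → ℝ) (χ : DirichletCharacter ℂ q) : ℂ :=
  ∑ n ∈ (range (Nx X)).filter Nat.Prime, χ n * ((f (Real.log n / X) * Real.log n / n : ℝ) : ℂ)

lemma natlog_le (n : ℕ) : (Nat.log 2 n : ℝ) ≤ 2 * Real.log n := by
  rcases Nat.eq_zero_or_pos n with rfl | hn
  · simp
  have h := Nat.pow_log_le_self 2 hn.ne'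
  have h1 : ((2:ℝ)^(Nat.log 2 n)) ≤ n := by exact_mod_cast h
  have h2 := Real.log_le_log (by positivity) h1
  rw [Real.log_pow] at h2
  have := Real.log_two_gt_d9
  have h3 : (0:ℝ) ≤ Nat.log 2 n := by positivity
  nlinarith

lemma pp_sum (X : ℝ) (hX : 0 < X) (S : Finset ℕ) (N : ℕ) (hS : ∀ n ∈ S, 0 < n ∧ n ≤ N ∧ ¬ n.Prime ∧ IsPrimePow n ∧ Real.exp (X/8) ≤ n) :
    ∑ n ∈ S, (1:ℝ)/n ≤ Real.exp (-(X/16)) * ((1 + 2 * Real.log N) * (1 + Real.log N)) := by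
  have h1 : ∀ n ∈ S, (1:ℝ)/n ≤ Real.exp (-(X/16)) * (1/(n.minFac:ℝ)) := by
    intro n hn
    obtain ⟨h0, h1, h2, h3, h4⟩ := hS n hn
    have h5 := Nat.minFac_sq_le_self h0 h2
    have h6 : ((n.minFac:ℝ))^2 ≤ n := by exact_mod_cast h5
    have hn0 : (0:ℝ) < n := by exact_mod_cast h0
    have hp : (0:ℝ) < n.minFac := by exact_mod_cast Nat.minFac_pos n
    have h7 : Real.exp (X/16) * n.minFac ≤ n := by
      apply le_of_sq_le_sq _ hn0.le
      rw [mul_pow, sq (n:ℝ), ← Real.exp_nat_mul]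
      have : ((2:ℕ):ℝ) * (X/16) = X/8 := by push_cast; ring
      rw [this]
      gcongr
    rw [Real.exp_neg, ← one_div, one_div_mul_one_div]
    exact one_div_le_one_div_of_le (by positivity) h7
  refine (sum_le_sum h1).trans ?_
  rw [← mul_sum]
  refine mul_le_mul_of_nonneg_left ?_ (Real.exp_pos _).le
  rw [← sum_fiberwise_of_maps_to (g := Nat.minFac) (t := Ioc 0 N)]
  · have h2 : ∀ p ∈ Ioc 0 N, ∑ n ∈ S.filter (fun n => n.minFac = p), (1:ℝ)/(n.minFac:ℝ) ≤ (1 + 2 * Real.log N) * (1/(p:ℝ)) := by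
      intro p _
      rw [sum_congr rfl (g := fun _ => (1:ℝ)/(p:ℝ)) (fun n hn => by rw [(mem_filter.1 hn).2]), sum_const, nsmul_eq_mul]
      refine mul_le_mul_of_nonneg_right ?_ (by positivity)
      have hc : (S.filter (fun n => n.minFac = p)).card ≤ (range (Nat.log 2 N + 1)).card := by
        refine (card_le_card (t := (range (Nat.log 2 N + 1)).image (fun k => p^k)) ?_).trans card_image_le
        intro n hn
        rw [mem_filter] at hn
        obtain ⟨h0, h1, h2, h3, h4⟩ := hS n hn.1
        rw [mem_image]
        refine ⟨n.factorization n.minFac, ?_, ?_⟩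
        · rw [mem_range, Nat.lt_succ_iff]
          apply Nat.le_log_of_pow_le (by norm_num)
          have hn1 : n ≠ 1 := h3.ne_one
          calc 2^(n.factorization n.minFac) ≤ n.minFac^(n.factorization n.minFac) :=
                Nat.pow_le_pow_left (Nat.minFac_prime hn1).two_le _
            _ = n := h3.minFac_pow_factorization_eq
            _ ≤ N := h1
        · rw [← hn.2]; exact h3.minFac_pow_factorization_eq
      rw [card_range] at hc
      have hc' : ((S.filter (fun n => n.minFac = p)).card:ℝ) ≤ Nat.log 2 N + 1 := by exact_mod_cast hc
      have := natlog_le N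
      linarith
    refine (sum_le_sum h2).trans ?_
    rw [← mul_sum]
    refine mul_le_mul_of_nonneg_left (sum_inv_Ioc N) ?_
    have := Real.log_natCast_nonneg N
    positivity
  · intro n hn
    obtain ⟨h0, h1, h2, h3, h4⟩ := hS n hn
    rw [mem_Ioc]
    exact ⟨Nat.minFac_pos n, (Nat.minFac_le h0).trans h1⟩

lemma pp_bound {q : ℕ} (X : ℝ) (f : ℝ → ℝ) (hf : FF X f) (χ : DirichletCharacter ℂ q) :
    ‖SL X f χ - SP X f χ‖ ≤ 2 * (4*X+5)^3 * Real.exp (-(X/16)) := by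
  have hX := hf.pos
  have hN := log_Nx X hX
  have hL0 := Real.log_natCast_nonneg (Nx X)
  have e1 : SL X f χ - SP X f χ = ∑ n ∈ (range (Nx X)).filter (fun n => ¬ n.Prime),
      chiL χ n * ((f (Real.log n / X) / n : ℝ) : ℂ) := by
    unfold SL SP
    rw [← sum_filter_add_sum_filter_not (range (Nx X)) Nat.Prime, sub_eq_iff_eq_add, add_comm]
    congr 1
    refine sum_congr rfl fun n hn => ?_
    simp only [chiL, Pi.mul_apply]
    rw [vonMangoldt_apply_prime (mem_filter.1 hn).2]
    push_cast; ring
  rw [e1]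
  classical
  set S : Finset ℕ := ((range (Nx X)).filter (fun n : ℕ => ¬ n.Prime)).filter (fun n : ℕ => IsPrimePow n ∧ Real.exp (X/8) ≤ (n:ℝ)) with hS
  have e2 : ∑ n ∈ (range (Nx X)).filter (fun n => ¬ n.Prime), chiL χ n * ((f (Real.log n / X) / n : ℝ) : ℂ) =
      ∑ n ∈ S, chiL χ n * ((f (Real.log n / X) / n : ℝ) : ℂ) := by
    symm
    refine sum_subset (filter_subset _ _) fun n hn hn' => ?_
    by_cases hpp : IsPrimePow n
    · have hlt : (n:ℝ) < Real.exp (X/8) := by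
        by_contra h
        exact hn' (mem_filter.2 ⟨hn, hpp, not_lt.1 h⟩)
      have hn0 : (0:ℝ) < n := by exact_mod_cast hpp.pos
      have : f (Real.log n / X) = 0 := by
        apply hf.supp; left
        rw [div_lt_iff₀ hX, Real.log_lt_iff_lt_exp hn0]
        convert hlt using 2; ring
      rw [this]; simp
    · simp only [chiL, Pi.mul_apply]
      rw [vonMangoldt_eq_zero_iff.2 hpp]; simp
  rw [e2]
  have h3 := pp_sum X hX S (Nx X) (fun n hn => by
    rw [hS, mem_filter, mem_filter, mem_range] at hn
    exact ⟨hn.2.1.pos, hn.1.1.le, hn.1.2, hn.2.1, hn.2.2⟩)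
  have h4 : ∀ n ∈ S, ‖chiL χ n * ((f (Real.log n / X) / n : ℝ) : ℂ)‖ ≤ Real.log (Nx X) * (1/n) := by
    intro n hn
    rw [hS, mem_filter, mem_filter, mem_range] at hn
    have hn0 : (0:ℝ) < n := by exact_mod_cast hn.2.1.pos
    rw [norm_mul, Complex.norm_real, Real.norm_eq_abs, abs_of_nonneg (div_nonneg (hf.nonneg _) hn0.le)]
    refine mul_le_mul ((norm_chiL χ n).trans (vonMangoldt_le_log.trans ?_)) ?_ (div_nonneg (hf.nonneg _) hn0.le) hL0
    · exact Real.log_le_log hn0 (by exact_mod_cast hn.1.1.le)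
    · exact div_le_div_of_nonneg_right (hf.le1 _) hn0.le
  refine (norm_sum_le _ _).trans ((sum_le_sum h4).trans ?_)
  rw [← mul_sum]
  set L := Real.log (Nx X)
  calc L * ∑ n ∈ S, (1:ℝ)/n ≤ (4*X+5) * (Real.exp (-(X/16)) * ((2*(4*X+5)) * (4*X+5))) := by
        refine mul_le_mul (by linarith) (h3.trans ?_) (sum_nonneg fun n _ => by positivity) (by linarith)
        refine mul_le_mul_of_nonneg_left ?_ (Real.exp_pos _).le
        refine mul_le_mul (by linarith) (by linarith) (by linarith) (by linarith)
    _ = _ := by ring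

lemma SP_prim {q : ℕ} (X : ℝ) (f : ℝ → ℝ) (hf : FF X f) (χ : DirichletCharacter ℂ q) (hq0 : 0 < q)
    (hq : (q:ℝ) < Real.exp (X/8)) : SP X f χ = SP X f χ.primitiveCharacter := by
  have hX := hf.pos
  unfold SP
  refine sum_congr rfl fun n hn => ?_
  have hp := (mem_filter.1 hn).2
  have hn0 : (0:ℝ) < n := by exact_mod_cast hp.pos
  by_cases hlt : (n:ℝ) < Real.exp (X/8)
  · have : f (Real.log n / X) = 0 := by
      apply hf.supp; left
      rw [div_lt_iff₀ hX, Real.log_lt_iff_lt_exp hn0]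
      convert hlt using 2; ring
    rw [this]; simp
  · have hqn : q < n := by
      have : (q:ℝ) < n := lt_of_lt_of_le hq (not_lt.1 hlt)
      exact_mod_cast this
    have hc : Nat.Coprime n q := (Nat.Prime.coprime_iff_not_dvd hp).2 (fun h => by
      have := Nat.le_of_dvd hq0 h; omega)
    have := χ.primitiveCharacter_apply_of_isCoprime (a := (n:ℤ)) (Nat.isCoprime_iff_coprime.2 hc)
    push_cast at this
    rw [this]
end DSR

namespace DSR
open Finset ArithmeticFunction

lemma expexp_beats (C : ℝ) (k : ℕ) (c : ℝ) (hc : 0 < c) :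
    ∀ᶠ i : ℕ in Filter.atTop, C * (Real.exp i)^k ≤ Real.exp (c * Real.exp i) := by
  have h := (Real.tendsto_pow_mul_exp_neg_atTop_nhds_zero k).comp
    ((Real.tendsto_exp_atTop.comp (tendsto_natCast_atTop_atTop (R := ℝ))).const_mul_atTop hc)
  have h2 : ∀ᶠ i : ℕ in Filter.atTop, ((fun x : ℝ => x^k * Real.exp (-x)) ∘ fun i : ℕ => c * (Real.exp ∘ Nat.cast) i) i
      < c^k / (|C| + 1) := h.eventually (gt_mem_nhds (by positivity))
  filter_upwards [h2] with i hi
  simp only [Function.comp] at hi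
  set x := Real.exp (i:ℝ)
  have hx : 0 < x := Real.exp_pos _
  rw [Real.exp_neg, mul_pow, ← div_eq_mul_inv, div_lt_div_iff₀ (Real.exp_pos _) (by positivity), mul_assoc] at hi
  have h3 := lt_of_mul_lt_mul_left hi (by positivity)
  have : 0 < x^k := by positivity
  nlinarith [le_abs_self C]

lemma exp_ev (C : ℝ) : ∀ᶠ i : ℕ in Filter.atTop, C ≤ Real.exp i :=
  (Real.tendsto_exp_atTop.comp (tendsto_natCast_atTop_atTop (R := ℝ))).eventually (Filter.eventually_ge_atTop C)

/-- one dyadic block, both cases -/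
lemma block_bound (A A1 : ℕ) (i : ℕ) (X : ℝ) (hX : X = Real.exp i) (f : ℝ → ℝ) (hf : FF X f)
    (hX1 : 5 ≤ X)
    (hA : ∀ (q : ℕ) [NeZero q] (χ : DirichletCharacter ℂ q), χ.IsPrimitive → χ ≠ 1 →
      (q:ℝ) ≤ Real.exp (A * i) → ‖SL X f χ‖ ≤ Real.exp (-(A1 * i)))
    (j : ℕ) (C : Finset Ch) (hC : C ⊆ PC (2^(j+1))) (hCj : ∀ c ∈ C, 2^j ≤ c.1)
    (hj : (2:ℝ)^(j+1) ≤ Real.exp (X/200)) :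
    ∑ c ∈ C, ‖SL X f c.2‖ * (c.1:ℝ)^(-(3/4:ℝ)) ≤ Real.exp (2*A*i - A1*i) + 6 * (5*X)^6 * Real.exp (-(A/4*i)) := by
  have hX0 : 0 < X := by linarith
  by_cases hQ : (2:ℝ)^(j+1) ≤ Real.exp (A*i)
  · have h1 : ∀ c ∈ C, ‖SL X f c.2‖ * (c.1:ℝ)^(-(3/4:ℝ)) ≤ Real.exp (-(A1*i)) := by
      intro c hc
      have hm := (mem_PC _ _).1 (hC hc)
      haveI : NeZero c.1 := ⟨by omega⟩
      have hle : (c.1:ℝ) ≤ Real.exp (A*i) := by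
        refine le_trans ?_ hQ
        exact_mod_cast hm.1.2
      have hc1 : (1:ℝ) ≤ c.1 := by exact_mod_cast hm.1.1
      have := hA c.1 c.2 hm.2.1 hm.2.2 hle
      calc _ ≤ Real.exp (-(A1*i)) * 1 := by
            refine mul_le_mul this (Real.rpow_le_one_of_one_le_of_nonpos hc1 (by norm_num)) (by positivity) (Real.exp_pos _).le
        _ = _ := mul_one _
    refine (sum_le_sum h1).trans ?_
    rw [sum_const, nsmul_eq_mul]
    have h2 : (C.card:ℝ) ≤ Real.exp (2*A*i) := by
      have : (C.card:ℝ) ≤ ((2:ℝ)^(j+1))^2 := by exact_mod_cast (card_le_card hC).trans (PC_card _)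
      refine this.trans ?_
      calc ((2:ℝ)^(j+1))^2 ≤ (Real.exp (A*i))^2 := by gcongr
        _ = _ := by rw [← Real.exp_nat_mul]; congr 1; push_cast; ring
    calc (C.card:ℝ) * Real.exp (-(A1*i)) ≤ Real.exp (2*A*i) * Real.exp (-(A1*i)) := by gcongr
      _ = Real.exp (2*A*i - A1*i) := by rw [← Real.exp_add]; congr 1
      _ ≤ _ := by have : 0 ≤ 6 * (5*X)^6 * Real.exp (-(A/4*i)) := by positivity
                  linarith
  · push Not at hQ
    have hB := partB X f hf (2^(j+1)) Nat.one_le_two_pow (by push_cast; exact hj) C (PF_of_subset _ C hC)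
    set P : ℝ := (2:ℝ)^j with hP
    have hP0 : 0 < P := by positivity
    have hcast : ((2^(j+1):ℕ):ℝ) = 2 * P := by push_cast; rw [hP]; ring
    rw [hcast] at hB
    have hQ' : Real.exp (A*i) ≤ 2*P := by rw [hP]; rw [pow_succ] at hQ; linarith
    calc _ ≤ ∑ c ∈ C, ‖SL X f c.2‖ * P^(-(3/4:ℝ)) := by
          refine sum_le_sum fun c hc => mul_le_mul_of_nonneg_left ?_ (norm_nonneg _)
          refine Real.rpow_le_rpow_of_nonpos hP0 ?_ (by norm_num)
          rw [hP]; exact_mod_cast hCj c hc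
      _ = (∑ c ∈ C, ‖SL X f c.2‖) * P^(-(3/4:ℝ)) := by rw [sum_mul]
      _ ≤ (3 * √(2*P) * (4*X+5)^6) * P^(-(3/4:ℝ)) := by gcongr
      _ ≤ (3 * √(2*P) * (5*X)^6) * P^(-(3/4:ℝ)) := by gcongr; linarith
      _ = 3 * (√2 * (5*X)^6) * P^(-(1/4:ℝ)) := by
          rw [Real.sqrt_mul (by norm_num), Real.sqrt_eq_rpow P]
          have : P^(-(1/4:ℝ)) = P^(1/2:ℝ) * P^(-(3/4:ℝ)) := by rw [← Real.rpow_add hP0]; norm_num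
          rw [this]; ring
      _ ≤ 3 * (√2 * (5*X)^6) * (2^(1/4:ℝ) * Real.exp (-(A/4*i))) := by
          have h5 : P^(-(1/4:ℝ)) ≤ 2^(1/4:ℝ) * Real.exp (-(A/4*i)) := by
            have h6 : (2*P)^(-(1/4:ℝ)) ≤ (Real.exp (A*i))^(-(1/4:ℝ)) :=
              Real.rpow_le_rpow_of_nonpos (Real.exp_pos _) hQ' (by norm_num)
            rw [← Real.exp_mul, Real.mul_rpow (by norm_num) hP0.le] at h6
            have h7 : (2:ℝ)^(1/4:ℝ) * (2:ℝ)^(-(1/4:ℝ)) = 1 := by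
              rw [← Real.rpow_add (by norm_num)]; norm_num
            calc P^(-(1/4:ℝ)) = 2^(1/4:ℝ) * (2^(-(1/4:ℝ)) * P^(-(1/4:ℝ))) := by rw [← mul_assoc, h7, one_mul]
              _ ≤ 2^(1/4:ℝ) * Real.exp (A*i*(-(1/4:ℝ))) := by gcongr
              _ = _ := by congr 2; ring
          gcongr
      _ ≤ 6 * (5*X)^6 * Real.exp (-(A/4*i)) := by
          have h8 : √2 * (2:ℝ)^(1/4:ℝ) ≤ 2 := by
            rw [Real.sqrt_eq_rpow, ← Real.rpow_add (by norm_num)]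
            calc (2:ℝ)^((1/2:ℝ)+1/4) ≤ 2^(1:ℝ) := Real.rpow_le_rpow_of_exponent_le (by norm_num) (by norm_num)
              _ = 2 := by norm_num
          have h9 : 0 ≤ 3 * (5*X)^6 * Real.exp (-(A/4*i)) := by positivity
          nlinarith
      _ ≤ _ := by have := Real.exp_pos (2*A*i - A1*i); linarith

open Classical in
lemma BV_core (r A' i : ℕ) (M A A1 : ℕ) (hM : M = 2^(r+1) + 2^(4*(r+1))) (hA : A = 4*(M + A' + 10))
    (hA1 : A1 = 2*A + M + A' + 2) (X : ℝ) (hX : X = Real.exp i) (f : ℝ → ℝ) (hf : FF X f)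
    (hpA : ∀ (q : ℕ) [NeZero q] (χ : DirichletCharacter ℂ q), χ.IsPrimitive → χ ≠ 1 →
      (q:ℝ) ≤ Real.exp (A * i) → ‖SL X f χ‖ ≤ Real.exp (-(A1 * i)))
    (hpp : 2*5^3 * X^(M + A' + 4) ≤ Real.exp (1/20 * X)) (hbig : 6*5^6+400 ≤ X)
    (Y : ℕ) (hY : (Y:ℝ) ≤ Real.exp (X/400)) :
    ∑ q ∈ Ioc 0 Y, tau q^r / (q.totient:ℝ) *
      ∑ χ ∈ (univ : Finset (DirichletCharacter ℂ q)).filter (· ≠ 1), ‖SP X f χ‖ ≤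
      Real.exp (-(A' * i)) := by
  have hX0 : 0 < X := by linarith
  have hX1 : 1 ≤ X := by linarith
  have hlogY : Real.log Y ≤ X/400 := by
    rcases Nat.eq_zero_or_pos Y with h | h
    · subst h; simp; positivity
    · calc Real.log Y ≤ Real.log (Real.exp (X/400)) := Real.log_le_log (by exact_mod_cast h) hY
        _ = _ := Real.log_exp _
  have hlogY0 : 0 ≤ Real.log Y := Real.log_natCast_nonneg _
  set pp : ℝ := 2*(4*X+5)^3*Real.exp (-(X/16)) with hppd
  have hpp0 : 0 ≤ pp := by positivity
  set G : Ch → ℝ := fun c => ‖SL X f c.2‖ + pp with hG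
  have hG0 : ∀ c, 0 ≤ G c := fun c => by positivity
  have hexpn : ∀ n : ℕ, Real.exp (-(n * i)) = (X^n)⁻¹ := by
    intro n; rw [Real.exp_neg, hX, ← Real.exp_nat_mul]
  have s1 : ∑ q ∈ Ioc 0 Y, tau q^r / (q.totient:ℝ) *
      ∑ χ ∈ (univ : Finset (DirichletCharacter ℂ q)).filter (· ≠ 1), ‖SP X f χ‖ ≤
      ∑ q ∈ Ioc 0 Y, tau q^r / (q.totient:ℝ) *
      ∑ χ ∈ (univ : Finset (DirichletCharacter ℂ q)).filter (· ≠ 1), G (toPrim χ) := by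
    refine sum_le_sum fun q hq => ?_
    rw [mem_Ioc] at hq
    have ht := tau_nonneg q
    refine mul_le_mul_of_nonneg_left (sum_le_sum fun χ hχ => ?_) (by positivity)
    have hqx : (q:ℝ) < Real.exp (X/8) := by
      calc (q:ℝ) ≤ Y := by exact_mod_cast hq.2
        _ ≤ Real.exp (X/400) := hY
        _ < _ := Real.exp_lt_exp.2 (by linarith)
    rw [SP_prim X f hf χ hq.1 hqx]
    have h := pp_bound X f hf χ.primitiveCharacter
    rw [norm_sub_rev] at h
    have h2 := norm_le_norm_add_norm_sub' (SP X f χ.primitiveCharacter) (SL X f χ.primitiveCharacter)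
    change _ ≤ ‖SL X f χ.primitiveCharacter‖ + pp
    linarith
  refine s1.trans ((group_all Y r G hG0).trans ?_)
  have s2 : ∑ c ∈ PC Y, G c * (tau c.1^(r+1)/(c.1:ℝ)) ≤
      X^(2^(4*(r+1))) * ∑ c ∈ PC Y, G c * (c.1:ℝ)^(-(3/4:ℝ)) := by
    rw [mul_sum]
    refine sum_le_sum fun c hc => ?_
    have hm := ((mem_PC _ _).1 hc).1
    have hc1 : (1:ℝ) ≤ c.1 := by exact_mod_cast hm.1
    have h1 := tau_pow_rpow (r+1) c.1 hm.1
    have h2 : 1 + Real.log c.1 ≤ X := by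
      have : Real.log c.1 ≤ Real.log Y := Real.log_le_log (by linarith) (by exact_mod_cast hm.2)
      linarith
    have h3 : 0 ≤ Real.log c.1 := Real.log_natCast_nonneg _
    have h4 : (1 + Real.log c.1)^(2^(4*(r+1))) ≤ X^(2^(4*(r+1))) := pow_le_pow_left₀ (by linarith) h2 _
    calc _ ≤ G c * ((c.1:ℝ)^(-(3/4:ℝ)) * X^(2^(4*(r+1)))) := by
          refine mul_le_mul_of_nonneg_left (h1.trans ?_) (hG0 c)
          exact mul_le_mul_of_nonneg_left h4 (by positivity)
      _ = _ := by ring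
  have s3 : (1 + Real.log Y)^(2^(r+1)) ≤ X^(2^(r+1)) := pow_le_pow_left₀ (by linarith) (by linarith) _
  have s4 : ∑ c ∈ PC Y, G c * (c.1:ℝ)^(-(3/4:ℝ)) =
      ∑ c ∈ PC Y, ‖SL X f c.2‖ * (c.1:ℝ)^(-(3/4:ℝ)) + ∑ c ∈ PC Y, pp * (c.1:ℝ)^(-(3/4:ℝ)) := by
    rw [← sum_add_distrib]; exact sum_congr rfl fun c _ => by simp only [hG]; ring
  have s5 : ∑ c ∈ PC Y, pp * (c.1:ℝ)^(-(3/4:ℝ)) ≤ (X^(M+A'+1))⁻¹ := by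
    have h1 : ∑ c ∈ PC Y, pp * (c.1:ℝ)^(-(3/4:ℝ)) ≤ ∑ c ∈ PC Y, pp := by
      refine sum_le_sum fun c hc => ?_
      have hm := ((mem_PC _ _).1 hc).1
      have hc1 : (1:ℝ) ≤ c.1 := by exact_mod_cast hm.1
      have := Real.rpow_le_one_of_one_le_of_nonpos hc1 (by norm_num : -(3/4:ℝ) ≤ 0)
      nlinarith
    rw [sum_const, nsmul_eq_mul] at h1
    have h2 : ((PC Y).card:ℝ) ≤ Real.exp (X/200) := by
      calc ((PC Y).card:ℝ) ≤ (Y:ℝ)^2 := by exact_mod_cast PC_card Y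
        _ ≤ (Real.exp (X/400))^2 := by gcongr
        _ = _ := by rw [← Real.exp_nat_mul]; congr 1; push_cast; ring
    refine h1.trans ?_
    calc ((PC Y).card:ℝ) * pp ≤ Real.exp (X/200) * (2*(5*X)^3*Real.exp (-(X/16))) := by
          rw [hppd]; gcongr; linarith
      _ = 2*(5*X)^3 * Real.exp (X/200 + -(X/16)) := by rw [Real.exp_add]; ring
      _ ≤ 2*(5*X)^3 * Real.exp (-(1/20*X)) := by gcongr; linarith
      _ ≤ _ := by
          rw [Real.exp_neg, ← div_eq_mul_inv, div_le_iff₀ (Real.exp_pos _), inv_mul_eq_div, le_div_iff₀ (by positivity)]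
          refine le_trans (le_of_eq ?_) hpp
          ring
  have s6 : ∑ c ∈ PC Y, ‖SL X f c.2‖ * (c.1:ℝ)^(-(3/4:ℝ)) ≤ X * ((X^(M+A'+2))⁻¹ + (X^(M+A'+3))⁻¹) := by
    have hmap : ∀ c ∈ PC Y, Nat.log 2 c.1 ∈ range (Nat.log 2 Y + 1) := by
      intro c hc
      have hm := ((mem_PC _ _).1 hc).1
      rw [mem_range]
      have := Nat.log_mono_right (b := 2) hm.2
      omega
    rw [← sum_fiberwise_of_maps_to hmap]
    have hblk : ∀ j ∈ range (Nat.log 2 Y + 1), ∑ c ∈ (PC Y).filter (fun c => Nat.log 2 c.1 = j),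
        ‖SL X f c.2‖ * (c.1:ℝ)^(-(3/4:ℝ)) ≤ (X^(M+A'+2))⁻¹ + (X^(M+A'+3))⁻¹ := by
      intro j hj
      rcases ((PC Y).filter (fun c => Nat.log 2 c.1 = j)).eq_empty_or_nonempty with he | ⟨c0, hc0⟩
      · rw [he, sum_empty]; positivity
      have hY0 : 2^j ≤ Y := by
        rw [mem_filter] at hc0
        have hm := ((mem_PC _ _).1 hc0.1).1
        rw [← hc0.2]
        exact (Nat.pow_log_le_self 2 (by omega)).trans hm.2
      have h := block_bound A A1 i X hX f hf (by linarith) hpA j ((PC Y).filter (fun c => Nat.log 2 c.1 = j))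
        (by
          intro c hc
          rw [mem_filter] at hc
          have hm := (mem_PC _ _).1 hc.1
          rw [mem_PC]
          refine ⟨⟨hm.1.1, ?_⟩, hm.2⟩
          have := Nat.lt_pow_succ_log_self (b := 2) (by norm_num) c.1
          rw [hc.2] at this
          exact this.le)
        (by
          intro c hc
          rw [mem_filter] at hc
          have hm := (mem_PC _ _).1 hc.1
          rw [← hc.2]
          exact Nat.pow_log_le_self 2 (by omega))
        (by
          have h1 : (2:ℝ)^(j+1) ≤ 2 * Real.exp (X/400) := by
            rw [pow_succ, mul_comm]
            have : (2:ℝ)^j ≤ Y := by exact_mod_cast hY0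
            linarith
          have h2 : (2:ℝ) ≤ Real.exp (X/400) := by
            have := Real.add_one_le_exp (X/400)
            linarith
          calc (2:ℝ)^(j+1) ≤ 2 * Real.exp (X/400) := h1
            _ ≤ Real.exp (X/400) * Real.exp (X/400) := by gcongr
            _ = _ := by rw [← Real.exp_add]; congr 1; ring)
      refine h.trans (add_le_add ?_ ?_)
      · rw [← hexpn]
        refine Real.exp_le_exp.2 (le_of_eq ?_)
        rw [hA1]; push_cast; ring
      · have h1 : Real.exp (-((A:ℝ)/4*i)) = (X^(M+A'+10))⁻¹ := by
          rw [← hexpn]; congr 1; rw [hA]; push_cast; ring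
        rw [h1, ← div_eq_mul_inv, inv_eq_one_div, div_le_div_iff₀ (by positivity) (by positivity), one_mul]
        calc 6 * (5*X)^6 * X^(M+A'+3) = (6*5^6) * X^(M+A'+9) := by ring
          _ ≤ X * X^(M+A'+9) := by gcongr; linarith
          _ = _ := by ring
    refine (sum_le_sum hblk).trans ?_
    rw [sum_const, nsmul_eq_mul, card_range]
    refine mul_le_mul_of_nonneg_right ?_ (by positivity)
    have := natlog_le Y
    push_cast
    linarith
  have hMM : X^M = X^(2^(r+1)) * X^(2^(4*(r+1))) := by rw [hM, pow_add]
  rw [hexpn]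
  have hsum0 : 0 ≤ ∑ c ∈ PC Y, G c * (tau c.1^(r+1)/(c.1:ℝ)) :=
    sum_nonneg fun c _ => mul_nonneg (hG0 c) (div_nonneg (pow_nonneg (tau_nonneg _) _) (Nat.cast_nonneg _))
  calc _ ≤ X^(2^(r+1)) * (X^(2^(4*(r+1))) * (X * ((X^(M+A'+2))⁻¹ + (X^(M+A'+3))⁻¹) + (X^(M+A'+1))⁻¹)) := by
        refine mul_le_mul s3 (s2.trans ?_) hsum0 (by positivity)
        refine mul_le_mul_of_nonneg_left ?_ (by positivity)
        rw [s4]; exact add_le_add s6 s5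
    _ = X^M * (X * ((X^(M+A'+2))⁻¹ + (X^(M+A'+3))⁻¹) + (X^(M+A'+1))⁻¹) := by rw [hMM]; ring
    _ = (2 + 1/X) / X * (X^A')⁻¹ := by
        simp only [pow_add]
        field_simp
        ring
    _ ≤ 1 * (X^A')⁻¹ := by
        refine mul_le_mul_of_nonneg_right ?_ (by positivity)
        rw [div_le_one hX0]
        have : 1/X ≤ 1 := by rw [div_le_one hX0]; exact hX1
        linarith
    _ = _ := one_mul _

open Classical in
theorem BV (r A' : ℕ) : ∃ B : ℕ, 1 ≤ B ∧ ∀ I0 : ℕ, ∃ i ≥ I0, FF (Real.exp i) (ff (B*i)) ∧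
    ∀ Y : ℕ, (Y:ℝ) ≤ Real.exp (Real.exp i/400) →
    ∑ q ∈ Ioc 0 Y, tau q^r / (q.totient:ℝ) *
      ∑ χ ∈ (univ : Finset (DirichletCharacter ℂ q)).filter (· ≠ 1), ‖SP (Real.exp i) (ff (B*i)) χ‖ ≤
      Real.exp (-(A' * i)) := by
  set M : ℕ := 2^(r+1) + 2^(4*(r+1)) with hM
  set A : ℕ := 4*(M + A' + 10) with hA
  have hAone : 1 ≤ A := by rw [hA]; exact Nat.le_trans (by norm_num) (Nat.mul_le_mul_left 4 (Nat.le_add_left 10 (M + A')))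
  set A1 : ℕ := 2*A + M + A' + 2 with hA1
  obtain ⟨B, hB1, hB⟩ := partA A A1 hAone
  refine ⟨B, hB1, fun I0 => ?_⟩
  have hev := ((hB.and (exp_beats (Real.exp 1 * B) 1 1 one_pos)).and
    ((expexp_beats (2*5^3) (M + A' + 4) (1/20) (by norm_num)).and (exp_ev (6*5^6+400)))).and
    (Filter.eventually_ge_atTop 2)
  obtain ⟨I1, hI1⟩ := Filter.eventually_atTop.1 hev
  obtain ⟨i, hi, hgood⟩ := good_scales A B hAone hB1 (max I0 I1)
  obtain ⟨⟨⟨hpA, hlip⟩, hpp, hbig⟩, hi2⟩ := hI1 i (le_trans (le_max_right _ _) hi)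
  have hpA := hpA hgood
  have hFF : FF (Real.exp i) (ff (B*i)) := by
    have hc : ((B*i:ℕ):ℝ) = B * i := by push_cast; ring
    refine ⟨Real.exp_pos _, fun v => ff_nonneg _ v, fun v => ff_le_one _ v, fun v hv => ff_supp _ v hv, fun v w => ?_⟩
    refine (ff_lip (B*i) v w).trans (mul_le_mul_of_nonneg_right ?_ (abs_nonneg _))
    rw [hc]
    rw [pow_one, one_mul] at hlip
    linarith
  refine ⟨i, le_trans (le_max_left _ _) hi, hFF, fun Y hY => ?_⟩
  exact BV_core r A' i M A A1 hM hA hA1 _ rfl (ff (B*i)) hFF hpA hpp hbig Y hY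
end DSR

namespace DSR
open Finset ArithmeticFunction

noncomputable def w2 (X : ℝ) (f : ℝ → ℝ) (n : ℕ) : ℝ := f (Real.log n / X) * Real.log n / n
noncomputable def w1 (X : ℝ) (f : ℝ → ℝ) (n : ℕ) : ℝ := f (Real.log n / X) / n
noncomputable def mass2 (X : ℝ) (f : ℝ → ℝ) : ℝ := ∑ n ∈ (range (Nx X)).filter Nat.Prime, w2 X f n
noncomputable def mass1 (X : ℝ) (f : ℝ → ℝ) : ℝ := ∑ n ∈ range (Nx X), w1 X f n
open Classical in
noncomputable def EE (X : ℝ) (f : ℝ → ℝ) (q : ℕ) : ℝ :=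
  (q.totient:ℝ)⁻¹ * ∑ χ ∈ (univ : Finset (DirichletCharacter ℂ q)).filter (· ≠ 1), ‖SP X f χ‖

lemma EE_nonneg (X : ℝ) (f : ℝ → ℝ) (q : ℕ) : 0 ≤ EE X f q := by unfold EE; positivity

lemma w2_nonneg (X : ℝ) (f : ℝ → ℝ) (hf : FF X f) (n : ℕ) : 0 ≤ w2 X f n := by
  have := hf.nonneg (Real.log n / X)
  have := Real.log_natCast_nonneg n
  unfold w2; positivity

lemma w1_nonneg (X : ℝ) (f : ℝ → ℝ) (hf : FF X f) (n : ℕ) : 0 ≤ w1 X f n := by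
  have := hf.nonneg (Real.log n / X)
  unfold w1; positivity

lemma f_zero_small {X : ℝ} {f : ℝ → ℝ} (hf : FF X f) (n : ℕ) (h : (n:ℝ) < Real.exp (X/8)) :
    f (Real.log n / X) = 0 := by
  have hX := hf.pos
  apply hf.supp; left
  rcases Nat.eq_zero_or_pos n with rfl | hn
  · simp
  rw [div_lt_iff₀ hX, Real.log_lt_iff_lt_exp (by exact_mod_cast hn)]
  convert h using 2; ring

open Classical in
lemma SP_one (X : ℝ) (f : ℝ → ℝ) (hf : FF X f) (q : ℕ) (hq0 : 0 < q) (hq : (q:ℝ) < Real.exp (X/8)) :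
    SP X f (1 : DirichletCharacter ℂ q) = ((mass2 X f : ℝ) : ℂ) := by
  unfold SP mass2
  rw [Complex.ofReal_sum]
  refine sum_congr rfl fun n hn => ?_
  have hp := (mem_filter.1 hn).2
  unfold w2
  by_cases hlt : (n:ℝ) < Real.exp (X/8)
  · rw [f_zero_small hf n hlt]; simp
  · have hqn : q < n := by
      have : (q:ℝ) < n := lt_of_lt_of_le hq (not_lt.1 hlt)
      exact_mod_cast this
    have hc : Nat.Coprime n q := (Nat.Prime.coprime_iff_not_dvd hp).2 (fun h => by
      have := Nat.le_of_dvd hq0 h; omega)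
    rw [MulChar.one_apply ((ZMod.isUnit_iff_coprime n q).2 hc), one_mul]

open Classical in
lemma prime_ap (X : ℝ) (f : ℝ → ℝ) (hf : FF X f) (q : ℕ) (hq0 : 0 < q) (hq : (q:ℝ) < Real.exp (X/8))
    (a : ℕ) (ha : a.Coprime q) :
    |∑ n ∈ (range (Nx X)).filter (fun n => n.Prime ∧ n ≡ a [MOD q]), w2 X f n - mass2 X f / q.totient| ≤ EE X f q := by
  haveI : NeZero q := ⟨hq0.ne'⟩
  have hφ : (0:ℝ) < q.totient := by exact_mod_cast Nat.totient_pos.2 hq0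
  have hu : IsUnit (a : ZMod q) := (ZMod.isUnit_iff_coprime a q).2 ha
  have key : (q.totient:ℂ) * ((∑ n ∈ (range (Nx X)).filter (fun n => n.Prime ∧ n ≡ a [MOD q]), w2 X f n : ℝ) : ℂ) =
      ∑ χ : DirichletCharacter ℂ q, χ (a:ZMod q)⁻¹ * SP X f χ := by
    unfold SP
    simp_rw [mul_sum]
    rw [sum_comm, Complex.ofReal_sum, mul_sum, ← filter_filter, sum_filter]
    refine sum_congr rfl fun n hn => ?_
    simp_rw [← mul_assoc]
    rw [← sum_mul, DirichletCharacter.sum_char_inv_mul_char_eq ℂ hu]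
    have : (a : ZMod q) = n ↔ n ≡ a [MOD q] := by
      rw [ZMod.natCast_eq_natCast_iff]; exact Nat.ModEq.comm
    by_cases h : n ≡ a [MOD q]
    · rw [if_pos h, if_pos (this.2 h)]; rfl
    · rw [if_neg h, if_neg (fun h' => h (this.1 h'))]; simp
  rw [← sum_filter_add_sum_filter_not univ (fun χ : DirichletCharacter ℂ q => χ ≠ 1)] at key
  have h1 : (univ : Finset (DirichletCharacter ℂ q)).filter (fun χ => ¬ (χ ≠ 1)) = {1} := by
    ext χ; simp
  have hui : IsUnit ((a:ZMod q)⁻¹) := by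
    obtain ⟨u, hu'⟩ := hu
    rw [← hu', ZMod.inv_coe_unit]; exact Units.isUnit _
  rw [h1, sum_singleton, SP_one X f hf q hq0 hq, MulChar.one_apply hui, one_mul] at key
  have h2 : (((∑ n ∈ (range (Nx X)).filter (fun n => n.Prime ∧ n ≡ a [MOD q]), w2 X f n - mass2 X f / q.totient : ℝ)) : ℂ)
      = (q.totient:ℂ)⁻¹ * ∑ χ ∈ (univ : Finset (DirichletCharacter ℂ q)).filter (· ≠ 1), χ (a:ZMod q)⁻¹ * SP X f χ := by
    have hφ' : (q.totient:ℂ) ≠ 0 := by exact_mod_cast hφ.ne'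
    rw [eq_sub_of_add_eq key.symm]
    push_cast
    field_simp
  rw [← Real.norm_eq_abs, ← Complex.norm_real, h2, norm_mul, norm_inv, Complex.norm_natCast]
  unfold EE
  refine mul_le_mul_of_nonneg_left ?_ (by positivity)
  refine le_trans (norm_sum_le _ _) ?_
  refine le_trans (sum_le_sum (g := fun χ => ‖SP X f χ‖) fun χ _ => ?_) (le_of_eq (sum_congr (by ext; simp) fun _ _ => rfl))
  rw [norm_mul]
  exact mul_le_of_le_one_left (norm_nonneg _) (DirichletCharacter.norm_le_one χ _)

/-- equidistribution of the smooth weight in arithmetic progressions -/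
lemma w1_diff (X : ℝ) (f : ℝ → ℝ) (hf : FF X f) (m n : ℕ) (hm : 0 < m) (hmn : m ≤ n) :
    |w1 X f m - w1 X f n| ≤ 2 * (n - m) / (m:ℝ)^2 := by
  have hX := hf.pos
  have hm0 : (0:ℝ) < m := by exact_mod_cast hm
  have hmn' : (m:ℝ) ≤ n := by exact_mod_cast hmn
  have hn0 : (0:ℝ) < n := by linarith
  have hl : |f (Real.log m / X) - f (Real.log n / X)| ≤ (n - m)/m := by
    refine (hf.lip _ _).trans ?_
    rw [← sub_div, abs_div, abs_of_pos hX, mul_div_cancel₀ _ hX.ne', abs_sub_comm,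
      abs_of_nonneg (sub_nonneg.2 (Real.log_le_log hm0 hmn')), ← Real.log_div hn0.ne' hm0.ne']
    refine (Real.log_le_sub_one_of_pos (by positivity)).trans (le_of_eq ?_)
    field_simp
  unfold w1
  have e : f (Real.log m / X)/m - f (Real.log n / X)/n =
    (f (Real.log m / X) - f (Real.log n / X))/m + f (Real.log n / X) * ((n-m)/(m*n)) := by
    field_simp; ring
  rw [e]
  refine (abs_add_le _ _).trans ?_
  have h0 := hf.nonneg (Real.log n / X)
  have h1 := hf.le1 (Real.log n / X)
  have h4 : 0 ≤ ((n:ℝ)-m)/(m*n) := div_nonneg (by linarith) (by positivity)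
  rw [abs_div, abs_of_pos hm0, abs_mul, abs_of_nonneg h0, abs_of_nonneg h4]
  have h2 : |f (Real.log m / X) - f (Real.log n / X)| / m ≤ (n-m)/(m:ℝ)^2 := by
    rw [div_le_div_iff₀ hm0 (by positivity)]
    rw [le_div_iff₀ hm0] at hl
    nlinarith
  have h3 : f (Real.log n / X) * ((n-m)/(m*n)) ≤ (n-m)/(m:ℝ)^2 := by
    have : ((n:ℝ)-m)/(m*n) ≤ (n-m)/(m:ℝ)^2 := by
      apply div_le_div_of_nonneg_left (by linarith) (by positivity)
      nlinarith
    nlinarith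
  calc _ ≤ (n-m)/(m:ℝ)^2 + (n-m)/(m:ℝ)^2 := add_le_add h2 h3
    _ = _ := by ring

lemma sum_blocks (w : ℕ → ℝ) (q M : ℕ) : ∑ n ∈ range (q*M), w n = ∑ j ∈ range M, ∑ a ∈ range q, w (q*j + a) := by
  induction M with
  | zero => simp
  | succ M ih => rw [Nat.mul_succ, sum_range_add, ih, sum_range_succ]

lemma w1_zero_of_ge (X : ℝ) (f : ℝ → ℝ) (hf : FF X f) (n : ℕ) (h : Nx X ≤ n) : w1 X f n = 0 := by
  unfold w1; rw [f_zero_of_ge hf.supp X hf.pos n h]; simp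

lemma w1_ap (X : ℝ) (f : ℝ → ℝ) (hf : FF X f) (q : ℕ) (hq0 : 0 < q) (hq : 2 * (q:ℝ) ≤ Real.exp (X/8)) (a : ℕ) :
    |∑ n ∈ (range (Nx X)).filter (fun n => n ≡ a [MOD q]), w1 X f n - mass1 X f / q| ≤
      4 * Real.exp (-(X/8)) * (4*X+2) := by
  have hX := hf.pos
  set M := Nx X with hM
  have hM0 : 0 < M := by rw [hM]; unfold Nx; omega
  have hsub : range M ⊆ range (q*M) := range_subset_range.2 (Nat.le_mul_of_pos_left M hq0)
  have hq0' : (0:ℝ) < q := by exact_mod_cast hq0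
  have e1 : ∑ n ∈ (range M).filter (fun n => n ≡ a [MOD q]), w1 X f n = ∑ j ∈ range M, w1 X f (q*j + a % q) := by
    rw [sum_filter, sum_subset hsub, sum_blocks]
    · refine sum_congr rfl fun j _ => ?_
      rw [sum_eq_single (a % q)]
      · rw [if_pos]; unfold Nat.ModEq; simp
      · intro b hb hne
        rw [if_neg]
        unfold Nat.ModEq
        rw [Nat.mul_add_mod, Nat.mod_eq_of_lt (mem_range.1 hb)]
        exact hne
      · intro h; exact absurd (mem_range.2 (Nat.mod_lt a hq0)) h
    · intro n _ hn
      rw [w1_zero_of_ge X f hf n (by simpa using hn)]; simp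
  have e2 : mass1 X f = ∑ b ∈ range q, ∑ j ∈ range M, w1 X f (q*j + b) := by
    unfold mass1
    rw [sum_subset hsub, sum_blocks, sum_comm]
    intro n _ hn
    rw [w1_zero_of_ge X f hf n (by simpa using hn)]
  have hd : ∀ b ∈ range q, |∑ j ∈ range M, w1 X f (q*j + a % q) - ∑ j ∈ range M, w1 X f (q*j + b)| ≤
      4 * Real.exp (-(X/8)) * (4*X+2) := by
    intro b hb
    rw [← sum_sub_distrib]
    refine (abs_sum_le_sum_abs _ _).trans ?_
    have hj : ∀ j ∈ range M, |w1 X f (q*j + a % q) - w1 X f (q*j + b)| ≤ 4 * Real.exp (-(X/8)) * (1/(j:ℝ)) := by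
      intro j _
      have ha' := Nat.mod_lt a hq0
      have hb' := mem_range.1 hb
      by_cases hs : (q:ℝ)*(j+1) ≤ Real.exp (X/8)
      · have hz : ∀ c, c < q → w1 X f (q*j + c) = 0 := by
          intro c hc
          unfold w1
          rw [f_zero_small hf]; · simp
          refine lt_of_lt_of_le ?_ hs
          have : q*j + c < q*(j+1) := by rw [mul_add]; omega
          exact_mod_cast this
        rw [hz _ ha', hz _ hb', sub_self, abs_zero]; positivity
      · push Not at hs
        have hjq : Real.exp (X/8) ≤ 2 * (q*j) := by nlinarith
        have hj0 : 0 < j := by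
          rcases Nat.eq_zero_or_pos j with h | h
          · subst h; simp at hjq; exact absurd hjq (not_le.2 (Real.exp_pos _))
          · exact h
        have hj0' : (0:ℝ) < j := by exact_mod_cast hj0
        have gen : ∀ c d, c ≤ d → d < q → |w1 X f (q*j + c) - w1 X f (q*j + d)| ≤ 4 * Real.exp (-(X/8)) * (1/(j:ℝ)) := by
          intro c d hcd hd
          have h := w1_diff X f hf (q*j+c) (q*j+d) (by positivity) (by omega)
          refine h.trans ?_
          have hcd' : (c:ℝ) ≤ d := by exact_mod_cast hcd
          have hd' : (d:ℝ) ≤ q := by exact_mod_cast hd.le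
          have hc0 : (0:ℝ) ≤ c := by positivity
          push_cast
          calc 2 * ((q:ℝ)*j + d - (q*j+c)) / ((q:ℝ)*j+c)^2 ≤ 2 * q / ((q:ℝ)*j)^2 := by
                have h8 : (0:ℝ) < q*j := by positivity
                apply div_le_div₀ (by positivity) (by linarith) (by positivity)
                apply pow_le_pow_left₀ h8.le; linarith
            _ = 2 / ((q:ℝ)*j) * (1/(j:ℝ)) := by field_simp
            _ ≤ _ := by
                refine mul_le_mul_of_nonneg_right ?_ (by positivity)
                rw [Real.exp_neg, ← div_eq_mul_inv, div_le_div_iff₀ (by positivity) (Real.exp_pos _)]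
                linarith
        rcases le_total (a % q) b with h | h
        · exact gen _ _ h hb'
        · rw [abs_sub_comm]; exact gen _ _ h ha'
    refine (sum_le_sum hj).trans ?_
    rw [← mul_sum]
    refine mul_le_mul_of_nonneg_left ?_ (by positivity)
    have h1 : ∑ j ∈ range M, (1:ℝ)/j ≤ ∑ j ∈ range (M+1), (1:ℝ)/j :=
      sum_le_sum_of_subset_of_nonneg (range_subset_range.2 (by omega)) fun _ _ _ => by positivity
    have h2 := sum_inv_le M
    have h3 := log_Nx X hX
    rw [← hM] at h3
    linarith
  rw [e1, e2]
  have e3 : ∑ j ∈ range M, w1 X f (q*j + a % q) - (∑ b ∈ range q, ∑ j ∈ range M, w1 X f (q*j + b))/q =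
      (∑ b ∈ range q, (∑ j ∈ range M, w1 X f (q*j + a % q) - ∑ j ∈ range M, w1 X f (q*j + b)))/q := by
    rw [sum_sub_distrib, sum_const, card_range, nsmul_eq_mul]; field_simp
  rw [e3, abs_div, abs_of_pos hq0', div_le_iff₀ hq0']
  refine (abs_sum_le_sum_abs _ _).trans ((sum_le_sum hd).trans (le_of_eq ?_))
  rw [sum_const, card_range, nsmul_eq_mul, mul_comm]
end DSR

namespace DSR
open Finset ArithmeticFunction

lemma log8 : 2 ≤ Real.log 8 ∧ Real.log 8 ≤ 3 := by
  have : (8:ℝ) = 2^3 := by norm_num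
  rw [this, Real.log_pow]
  have := Real.log_two_gt_d9
  have := Real.log_two_lt_d9
  constructor <;> push_cast <;> linarith

lemma theta_block : ∃ t0 : ℕ, ∀ t ≥ t0, (1/4:ℝ) ≤ ∑ p ∈ (Ioc (8^t) (8^(t+1)) : Finset ℕ).filter Nat.Prime, Real.log p / p := by
  have h1 : ∀ᶠ n : ℕ in Filter.atTop, Real.log ((n:ℝ)+1) + 2 * √n * Real.log n ≤ (1/10) * n := by
    have ha : (fun x : ℝ => Real.log (x+1)) =o[Filter.atTop] (fun x : ℝ => x) := by
      have h := Real.isLittleO_log_id_atTop.comp_tendsto (Filter.tendsto_atTop_add_const_right Filter.atTop (1:ℝ) Filter.tendsto_id)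
      refine h.trans_isBigO ?_
      refine Asymptotics.IsBigO.of_bound 2 ?_
      filter_upwards [Filter.eventually_ge_atTop 1] with x hx
      simp only [Function.comp, id, Real.norm_eq_abs]
      rw [abs_of_nonneg (by linarith), abs_of_nonneg (by linarith)]; linarith
    have hb : (fun x : ℝ => 2 * √x * Real.log x) =o[Filter.atTop] (fun x : ℝ => x) := by
      have h := (isLittleO_log_rpow_atTop (r := 1/2) (by norm_num))
      have h2 := (Asymptotics.isBigO_refl (fun x : ℝ => 2 * √x) Filter.atTop).mul_isLittleO h
      refine h2.trans_isBigO ?_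
      refine Asymptotics.IsBigO.of_bound 2 ?_
      filter_upwards [Filter.eventually_ge_atTop 1] with x hx
      rw [← Real.sqrt_eq_rpow, Real.norm_eq_abs, Real.norm_eq_abs, mul_assoc, Real.mul_self_sqrt (by linarith),
        abs_of_nonneg (by linarith), abs_of_nonneg (by linarith)]
    have hc := (ha.add hb).bound (show (0:ℝ) < 1/10 by norm_num)
    have hd := tendsto_natCast_atTop_atTop (R := ℝ) |>.eventually hc
    filter_upwards [hd] with n hn
    simp only [Real.norm_eq_abs] at hn
    rw [abs_of_nonneg (show (0:ℝ) ≤ n by positivity)] at hn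
    exact (le_abs_self _).trans hn
  obtain ⟨N, hN⟩ := Filter.eventually_atTop.1 h1
  refine ⟨N, fun t ht => ?_⟩
  have h8 : N ≤ 8^(t+1) := by
    have : t + 1 < 8^(t+1) := Nat.lt_pow_self (by norm_num)
    omega
  have h2 := hN _ h8
  have h3 := Chebyshev.theta_ge (8^(t+1))
  have h4 := Chebyshev.theta_le_log4_mul_x (x := ((8^t:ℕ):ℝ)) (by positivity)
  have h5 : Chebyshev.theta ((8^(t+1):ℕ):ℝ) - Chebyshev.theta ((8^t:ℕ):ℝ) =
      ∑ p ∈ (Ioc (8^t) (8^(t+1)) : Finset ℕ).filter Nat.Prime, Real.log p := by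
    unfold Chebyshev.theta
    rw [Nat.floor_natCast, Nat.floor_natCast, sub_eq_iff_eq_add', ← sum_union]
    · refine sum_congr ?_ fun _ _ => rfl
      rw [← filter_union, Ioc_union_Ioc_eq_Ioc (Nat.zero_le _) (Nat.pow_le_pow_right (by norm_num) (by omega))]
    · refine disjoint_filter_filter ?_
      exact Ioc_disjoint_Ioc_of_le (le_refl (8^t))
  have h6 : (1/4:ℝ) * ((8^(t+1):ℕ):ℝ) ≤ ∑ p ∈ (Ioc (8^t) (8^(t+1)) : Finset ℕ).filter Nat.Prime, Real.log p := by
    rw [← h5]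
    have e : ((8^(t+1):ℕ):ℝ) = 8 * ((8^t:ℕ):ℝ) := by push_cast; ring
    have l4 : Real.log 4 = 2 * Real.log 2 := by
      rw [show (4:ℝ) = 2^2 by norm_num, Real.log_pow]; push_cast; ring
    have := Real.log_two_gt_d9
    have := Real.log_two_lt_d9
    have hp : (0:ℝ) < ((8^t:ℕ):ℝ) := by positivity
    rw [l4] at h4
    set U := ((8^(t+1):ℕ):ℝ)
    set V := ((8^t:ℕ):ℝ)
    nlinarith
  have hp : (0:ℝ) < ((8^(t+1):ℕ):ℝ) := by positivity
  calc (1/4:ℝ) ≤ (∑ p ∈ (Ioc (8^t) (8^(t+1)) : Finset ℕ).filter Nat.Prime, Real.log p) / ((8^(t+1):ℕ):ℝ) := by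
        rw [le_div_iff₀ hp]; exact h6
    _ ≤ _ := by
        rw [sum_div]
        refine sum_le_sum fun p hp => ?_
        rw [mem_filter, mem_Ioc] at hp
        have : (p:ℝ) ≤ ((8^(t+1):ℕ):ℝ) := by exact_mod_cast hp.1.2
        exact div_le_div_of_nonneg_left (Real.log_natCast_nonneg _) (by exact_mod_cast hp.2.pos) this

lemma sum_pow_blocks (w : ℕ → ℝ) (T : ℕ) : ∑ n ∈ Ioc 1 (8^T), w n = ∑ t ∈ range T, ∑ n ∈ (Ioc (8^t) (8^(t+1)) : Finset ℕ), w n := by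
  induction T with
  | zero => simp
  | succ T ih =>
    rw [sum_range_succ, ← ih, ← sum_union (Ioc_disjoint_Ioc_of_le (le_refl (8^T))),
      Ioc_union_Ioc_eq_Ioc (Nat.one_le_pow _ _ (by norm_num)) (Nat.pow_le_pow_right (by norm_num) (by omega))]

lemma mass_blocks (X : ℝ) (f : ℝ → ℝ) (hf : FF X f) (δ : ℝ) (T t0 : ℕ) (hδ0 : 0 ≤ δ)
    (ht0 : ∀ t ≥ t0, (1/4:ℝ) ≤ ∑ p ∈ (Ioc (8^t) (8^(t+1)) : Finset ℕ).filter Nat.Prime, Real.log p / p)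
    (hsm : ((8^t0:ℕ):ℝ) < Real.exp (X/8)) (hT : Nx X ≤ 8^T) (hX : 1 ≤ X)
    (hδ : ∀ t n : ℕ, 8^t < n → n ≤ 8^(t+1) → |f (Real.log n / X) - f (Real.log ((8^t:ℕ):ℝ) / X)| ≤ δ) :
    mass1 X f ≤ 7 * ∑ t ∈ range T, f (Real.log ((8^t:ℕ):ℝ) / X) + 7 * T * δ ∧
    7/8 * (∑ t ∈ range T, f (Real.log ((8^t:ℕ):ℝ) / X) - T * δ) ≤ mass1 X f ∧
    1/4 * (∑ t ∈ range T, f (Real.log ((8^t:ℕ):ℝ) / X) - T * δ) ≤ mass2 X f := by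
  have hz : ∀ n : ℕ, n ≤ 1 → f (Real.log n / X) = 0 := by
    intro n hn
    apply f_zero_small hf
    have : (n:ℝ) ≤ 1 := by exact_mod_cast hn
    have : (1:ℝ) < Real.exp (X/8) := Real.one_lt_exp_iff.2 (by linarith)
    linarith
  have gen : ∀ w : ℕ → ℝ, (∀ n : ℕ, f (Real.log n / X) = 0 → w n = 0) → ∑ n ∈ range (Nx X), w n =
      ∑ t ∈ range T, ∑ n ∈ (Ioc (8^t) (8^(t+1)) : Finset ℕ), w n := by
    intro w hw
    rw [← sum_pow_blocks]
    have h1 : ∑ n ∈ range (Nx X), w n = ∑ n ∈ range (8^T + 1), w n := by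
      refine sum_subset (range_subset_range.2 (by omega)) fun n _ hn => ?_
      exact hw n (f_zero_of_ge hf.supp X hf.pos n (by simpa using hn))
    rw [h1]
    symm
    refine sum_subset (fun n hn => ?_) fun n hn hn' => ?_
    · rw [mem_Ioc] at hn; rw [mem_range]; omega
    · rw [mem_Ioc] at hn'; rw [mem_range] at hn
      exact hw n (hz n (by omega))
  have hm1 : mass1 X f = ∑ t ∈ range T, ∑ n ∈ (Ioc (8^t) (8^(t+1)) : Finset ℕ), w1 X f n :=
    gen _ (fun n h => by unfold w1; rw [h]; simp)
  have hm2 : mass2 X f = ∑ t ∈ range T, ∑ n ∈ (Ioc (8^t) (8^(t+1)) : Finset ℕ).filter Nat.Prime, w2 X f n := by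
    unfold mass2
    rw [sum_filter, gen]
    · simp_rw [sum_filter]
    · intro n h; unfold w2; rw [h]; simp
  have hcard : ∀ t : ℕ, ((Ioc (8^t) (8^(t+1)) : Finset ℕ).card : ℝ) = 7 * (8:ℝ)^t := by
    intro t
    rw [Nat.card_Ioc, Nat.cast_sub (Nat.pow_le_pow_right (by norm_num) (by omega))]; push_cast; ring
  have hup : ∀ t : ℕ, ∑ n ∈ (Ioc (8^t) (8^(t+1)) : Finset ℕ), (1:ℝ)/n ≤ 7 := by
    intro t
    calc _ ≤ ∑ n ∈ (Ioc (8^t) (8^(t+1)) : Finset ℕ), (1:ℝ)/(8:ℝ)^t := by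
          refine sum_le_sum fun n hn => ?_
          rw [mem_Ioc] at hn
          have : (8:ℝ)^t ≤ n := by exact_mod_cast hn.1.le
          exact one_div_le_one_div_of_le (by positivity) this
      _ = 7 := by rw [sum_const, nsmul_eq_mul, hcard]; field_simp
  have hlo : ∀ t : ℕ, 7/8 ≤ ∑ n ∈ (Ioc (8^t) (8^(t+1)) : Finset ℕ), (1:ℝ)/n := by
    intro t
    calc (7/8:ℝ) = ∑ n ∈ (Ioc (8^t) (8^(t+1)) : Finset ℕ), (1:ℝ)/(8:ℝ)^(t+1) := by
          rw [sum_const, nsmul_eq_mul, hcard]; field_simp; ring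
      _ ≤ _ := by
          refine sum_le_sum fun n hn => ?_
          rw [mem_Ioc] at hn
          have : (n:ℝ) ≤ (8:ℝ)^(t+1) := by exact_mod_cast hn.2
          have h0 : 0 < n := by omega
          exact one_div_le_one_div_of_le (by exact_mod_cast h0) this
  have hsum : ∀ c : ℝ, ∑ t ∈ range T, c * (f (Real.log ((8^t:ℕ):ℝ) / X) - δ) =
      c * (∑ t ∈ range T, f (Real.log ((8^t:ℕ):ℝ) / X) - T * δ) := by
    intro c; rw [← mul_sum, sum_sub_distrib, sum_const, card_range, nsmul_eq_mul]
  refine ⟨?_, ?_, ?_⟩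
  · rw [hm1]
    calc _ ≤ ∑ t ∈ range T, 7 * (f (Real.log ((8^t:ℕ):ℝ) / X) + δ) := by
          refine sum_le_sum fun t _ => ?_
          have h0 := hf.nonneg (Real.log ((8^t:ℕ):ℝ) / X)
          calc _ ≤ ∑ n ∈ (Ioc (8^t) (8^(t+1)) : Finset ℕ), (f (Real.log ((8^t:ℕ):ℝ) / X) + δ) * (1/(n:ℝ)) := by
                refine sum_le_sum fun n hn => ?_
                rw [mem_Ioc] at hn
                have := (abs_le.1 (hδ t n hn.1 hn.2)).2
                unfold w1
                rw [div_eq_mul_one_div]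
                exact mul_le_mul_of_nonneg_right (by linarith) (by positivity)
            _ ≤ _ := by rw [← mul_sum, mul_comm]; exact mul_le_mul_of_nonneg_right (hup t) (by positivity)
      _ = _ := by rw [← mul_sum, sum_add_distrib, sum_const, card_range, nsmul_eq_mul]; ring
  · rw [hm1, ← hsum]
    refine sum_le_sum fun t _ => ?_
    have hs : 0 ≤ ∑ n ∈ (Ioc (8^t) (8^(t+1)) : Finset ℕ), w1 X f n := sum_nonneg fun n _ => w1_nonneg X f hf n
    rcases le_or_gt (f (Real.log ((8^t:ℕ):ℝ) / X) - δ) 0 with h | h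
    · linarith
    calc _ ≤ (f (Real.log ((8^t:ℕ):ℝ) / X) - δ) * ∑ n ∈ (Ioc (8^t) (8^(t+1)) : Finset ℕ), (1:ℝ)/n := by
          have := hlo t; nlinarith
      _ ≤ _ := by
          rw [mul_sum]
          refine sum_le_sum fun n hn => ?_
          rw [mem_Ioc] at hn
          have := (abs_le.1 (hδ t n hn.1 hn.2)).1
          unfold w1
          rw [div_eq_mul_one_div (f _) (n:ℝ)]
          exact mul_le_mul_of_nonneg_right (by linarith) (by positivity)
  · rw [hm2, ← hsum]
    refine sum_le_sum fun t _ => ?_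
    have hs : 0 ≤ ∑ n ∈ (Ioc (8^t) (8^(t+1)) : Finset ℕ).filter Nat.Prime, w2 X f n := sum_nonneg fun n _ => w2_nonneg X f hf n
    rcases le_or_gt (f (Real.log ((8^t:ℕ):ℝ) / X) - δ) 0 with h | h
    · linarith
    have htt : t0 ≤ t := by
      by_contra hlt
      have : f (Real.log ((8^t:ℕ):ℝ) / X) = 0 := by
        apply f_zero_small hf
        refine lt_of_le_of_lt ?_ hsm
        exact_mod_cast Nat.pow_le_pow_right (by norm_num : 0 < 8) (by omega)
      linarith
    calc _ ≤ (f (Real.log ((8^t:ℕ):ℝ) / X) - δ) * ∑ n ∈ (Ioc (8^t) (8^(t+1)) : Finset ℕ).filter Nat.Prime, Real.log n / n := by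
          have := ht0 t htt; nlinarith
      _ ≤ _ := by
          rw [mul_sum]
          refine sum_le_sum fun n hn => ?_
          rw [mem_filter, mem_Ioc] at hn
          have := (abs_le.1 (hδ t n hn.1.1 hn.1.2)).1
          unfold w2
          rw [mul_div_assoc]
          exact mul_le_mul_of_nonneg_right (by linarith) (div_nonneg (Real.log_natCast_nonneg _) (by positivity))

set_option maxHeartbeats 1600000 in
theorem mass_cmp (B : ℕ) (hB : 1 ≤ B) : ∀ᶠ i : ℕ in Filter.atTop,
    mass1 (Real.exp i) (ff (B*i)) ≤ 50 * mass2 (Real.exp i) (ff (B*i)) ∧ 1 ≤ mass1 (Real.exp i) (ff (B*i)) := by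
  obtain ⟨t0, ht0⟩ := theta_block
  have hB0 : (1:ℝ) ≤ B := by exact_mod_cast hB
  filter_upwards [exp_beats (Real.exp 1 * B) 1 1 one_pos, exp_beats (100000 * B^2) 2 1 one_pos, exp_ev (24 * t0 + 100),
    Filter.eventually_ge_atTop 1] with i hlip hq hbig hi1
  set X := Real.exp (i:ℝ) with hX
  rw [one_mul] at hlip hq
  rw [pow_one] at hlip
  have ht00 : (0:ℝ) ≤ t0 := by positivity
  have hX1 : 100 ≤ X := by linarith
  have hX0 : 0 < X := by linarith
  have hi1' : (1:ℝ) ≤ i := by exact_mod_cast hi1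
  set b : ℝ := B * i with hb
  have hb1 : 1 ≤ b := by rw [hb]; nlinarith
  have hbX : 100000 * b^2 ≤ X := by rw [hb, mul_pow]; linarith
  have hc : ((B*i:ℕ):ℝ) = b := by push_cast; ring
  have he := Real.exp_one_lt_d9
  have he0 := Real.exp_pos 1
  obtain ⟨l81, l82⟩ := log8
  set f := ff (B*i) with hfd
  have lip : ∀ v w, |f v - f w| ≤ 3 * b * |v - w| := fun v w => by
    have := ff_lip (B*i) v w
    rw [hc] at this
    refine this.trans (mul_le_mul_of_nonneg_right ?_ (abs_nonneg _))
    nlinarith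
  have hf : FF X f := by
    refine ⟨hX0, fun v => ff_nonneg _ v, fun v => ff_le_one _ v, fun v hv => ff_supp _ v hv, fun v w => ?_⟩
    refine (lip v w).trans (mul_le_mul_of_nonneg_right ?_ (abs_nonneg _))
    nlinarith
  set T : ℕ := ⌈4*X⌉₊ + 1 with hT
  have hT1 : (T:ℝ) ≤ 5*X := by
    have := Nat.ceil_lt_add_one (a := 4*X) (by positivity)
    rw [hT]; push_cast; linarith
  have hT2 : 4*X+1 ≤ (T:ℝ) := by
    have := Nat.le_ceil (4*X)
    rw [hT]; push_cast; linarith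
  have hlog : ∀ t : ℕ, Real.log ((8^t:ℕ):ℝ) = t * Real.log 8 := by
    intro t; push_cast; rw [Real.log_pow]
  set δ : ℝ := 9 * b / X with hδd
  have hmb := mass_blocks X f hf δ T t0 (by positivity) ht0
    (by
      rw [← Real.log_lt_iff_lt_exp (by positivity), hlog]
      nlinarith)
    (by
      have h1 : (Nx X : ℝ) ≤ ((8^T:ℕ):ℝ) := by
        have h2 := log_Nx X hX0
        have h3 : (0:ℝ) < Nx X := by unfold Nx; positivity
        rw [← Real.log_le_log_iff h3 (by positivity), hlog]
        nlinarith
      exact_mod_cast h1)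
    (by linarith)
    (by
      intro t n h1 h2
      refine (lip _ _).trans ?_
      have hn1 : ((8^t:ℕ):ℝ) ≤ n := by exact_mod_cast h1.le
      have hn2 : (n:ℝ) ≤ ((8^(t+1):ℕ):ℝ) := by exact_mod_cast h2
      have hp : (0:ℝ) < ((8^t:ℕ):ℝ) := by positivity
      have k1 := Real.log_le_log hp hn1
      have k2 := Real.log_le_log (by linarith) hn2
      rw [hlog] at k1 k2
      rw [hlog, ← sub_div, abs_div, abs_of_pos hX0, abs_of_nonneg (by linarith), hδd, ← mul_div_assoc]
      push_cast at k2
      refine div_le_div_of_nonneg_right ?_ hX0.le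
      nlinarith)
  obtain ⟨m1, m2, m3⟩ := hmb
  set F := ∑ t ∈ range T, f (Real.log ((8^t:ℕ):ℝ) / X) with hF
  have hTδ : T * δ ≤ 45 * b := by
    rw [hδd, ← mul_div_assoc, div_le_iff₀ hX0]; nlinarith
  have hFl : 200 * b ≤ F := by
    set t1 := ⌈X / Real.log 8⌉₊ with ht1
    set m := ⌊X/(36*b)⌋₊ with hm
    have hm1 : X/(36*b) - 1 ≤ m := (Nat.sub_one_lt_floor _).le
    have hm2 : (m:ℝ) ≤ X/(36*b) := Nat.floor_le (by positivity)
    have hm3 : (m:ℝ) * (36*b) ≤ X := by rwa [le_div_iff₀ (by positivity)] at hm2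
    have ht1a : X ≤ t1 * Real.log 8 := by
      have := Nat.le_ceil (X / Real.log 8)
      rwa [div_le_iff₀ (by linarith)] at this
    have ht1b : (t1:ℝ) * Real.log 8 ≤ X + Real.log 8 := by
      have := (Nat.ceil_lt_add_one (a := X / Real.log 8) (div_nonneg hX0.le (by linarith))).le
      rw [← ht1] at this
      calc (t1:ℝ) * Real.log 8 ≤ (X / Real.log 8 + 1) * Real.log 8 := by gcongr
        _ = _ := by have : Real.log 8 ≠ 0 := by linarith
                    field_simp
    have hsub : Ico t1 (t1+m) ⊆ range T := by
      intro t ht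
      rw [mem_Ico] at ht; rw [mem_range]
      have : (t:ℝ) < T := by
        have h1 : (t:ℝ) < t1 + m := by exact_mod_cast ht.2
        have h2 : (m:ℝ) ≤ X := by nlinarith
        have h3 : (t1:ℝ) ≤ X + 2 := by nlinarith
        linarith
      exact_mod_cast this
    have hf1 : 1/2 ≤ f 1 := by
      rw [hfd]; unfold ff phi
      refine le_max_of_le_left ?_
      rw [hc]
      have : Real.exp (-b) ≤ 1/2 := by
        rw [Real.exp_neg, inv_eq_one_div]
        apply one_div_le_one_div_of_le (by norm_num)
        have := Real.add_one_le_exp b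
        linarith
      norm_num
      linarith
    have hterm : ∀ t ∈ Ico t1 (t1+m), 1/8 ≤ f (Real.log ((8^t:ℕ):ℝ) / X) := by
      intro t ht
      rw [mem_Ico] at ht
      have h1 : (t1:ℝ) ≤ t := by exact_mod_cast ht.1
      have h2 : (t:ℝ) ≤ t1 + m := by exact_mod_cast ht.2.le
      have h := (abs_le.1 (lip (Real.log ((8^t:ℕ):ℝ) / X) 1)).1
      have h3 : |Real.log ((8^t:ℕ):ℝ) / X - 1| ≤ (3 + 3 * m)/X := by
        rw [hlog]
        have e : (t:ℝ) * Real.log 8 / X - 1 = (t * Real.log 8 - X)/X := by field_simp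
        rw [e, abs_div, abs_of_pos hX0, abs_of_nonneg (by nlinarith)]
        refine div_le_div_of_nonneg_right ?_ hX0.le
        nlinarith
      have h4 : 3 * b * ((3 + 3 * m)/X) ≤ 3/8 := by
        rw [← mul_div_assoc, div_le_iff₀ hX0]
        nlinarith
      have h5 : 3 * b * |Real.log ((8^t:ℕ):ℝ) / X - 1| ≤ 3 * b * ((3 + 3 * m)/X) := by gcongr
      linarith
    have h6 : (m:ℝ) * (1/8) ≤ F := by
      calc (m:ℝ) * (1/8) = ∑ t ∈ Ico t1 (t1+m), (1/8:ℝ) := by rw [sum_const, Nat.card_Ico]; simp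
        _ ≤ ∑ t ∈ Ico t1 (t1+m), f (Real.log ((8^t:ℕ):ℝ) / X) := sum_le_sum hterm
        _ ≤ F := sum_le_sum_of_subset_of_nonneg hsub fun t _ _ => hf.nonneg _
    have h7 : 1700 * b ≤ X/(36*b) := by
      rw [le_div_iff₀ (by positivity)]; nlinarith
    linarith
  constructor <;> nlinarith
end DSR

namespace DSR
open Finset

section tensor
variable {P σ : Type} [Fintype P] [DecidableEq P] [Fintype σ] [DecidableEq σ]

noncomputable def tform (B : P → σ → σ → ℝ) (Y : (P → σ) → ℝ) : ℝ :=
  ∑ c, ∑ c', Y c * Y c' * ∏ p, B p (c p) (c' p)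

def qf (B : σ → σ → ℝ) (v : σ → ℝ) : ℝ := ∑ s, ∑ t, v s * v t * B s t

structure PSD (B : σ → σ → ℝ) : Prop where
  symm : ∀ s t, B s t = B t s
  nonneg : ∀ v, 0 ≤ qf B v

open scoped MatrixOrder Matrix.Norms.L2Operator in
lemma psd_gram (B : σ → σ → ℝ) (h : PSD B) : ∃ u : σ → σ → ℝ, ∀ s t, B s t = ∑ x, u x s * u x t := by
  have hB : (Matrix.of B).PosSemidef := by
    rw [Matrix.posSemidef_iff_dotProduct_mulVec]
    refine ⟨?_, fun x => ?_⟩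
    · ext s t; simp [h.symm s t]
    · have := h.nonneg x
      unfold qf at this
      simp only [dotProduct, Matrix.mulVec, mul_sum]
      refine this.trans (le_of_eq (sum_congr rfl fun s _ => sum_congr rfl fun t _ => ?_))
      simp; ring
  obtain ⟨U, hU⟩ := CStarAlgebra.nonneg_iff_eq_star_mul_self.mp hB.nonneg
  refine ⟨U, fun s t => ?_⟩
  have := congrFun (congrFun hU s) t
  rw [Matrix.mul_apply] at this
  simpa [Matrix.star_eq_conjTranspose] using this

lemma tform_gram {Ω : Type} [Fintype Ω] [DecidableEq Ω] (B : P → σ → σ → ℝ) (w : P → Ω → ℝ) (u : P → Ω → σ → ℝ)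
    (h : ∀ p s t, B p s t = ∑ x, w p x * (u p x s * u p x t)) (Y : (P → σ) → ℝ) :
    tform B Y = ∑ x : P → Ω, (∏ p, w p (x p)) * (∑ c, Y c * ∏ p, u p (x p) (c p))^2 := by
  unfold tform
  simp_rw [h, Fintype.prod_sum, prod_mul_distrib, mul_sum]
  simp_rw [sq, sum_mul_sum, mul_sum]
  rw [sum_comm' (t' := univ) (s' := fun _ => univ) (by simp)]
  rw [sum_comm]
  have : ∀ c' : P → σ, ∑ c : P → σ, ∑ x : P → Ω, Y c * Y c' * ((∏ p, w p (x p)) * ((∏ p, u p (x p) (c p)) * ∏ p, u p (x p) (c' p)))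
    = ∑ x : P → Ω, ∑ c : P → σ, Y c * Y c' * ((∏ p, w p (x p)) * ((∏ p, u p (x p) (c p)) * ∏ p, u p (x p) (c' p))) := fun c' => sum_comm
  rw [sum_comm]
  simp_rw [this]
  rw [sum_comm]
  refine sum_congr rfl fun x _ => ?_
  rw [sum_comm]
  exact sum_congr rfl fun c _ => sum_congr rfl fun c' _ => by ring

lemma tensor_le (A B : P → σ → σ → ℝ) (hB : ∀ p, PSD (B p)) (hD : ∀ p, PSD (fun s t => A p s t - B p s t))
    (Y : (P → σ) → ℝ) : tform B Y ≤ tform A Y := by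
  choose u hu using fun p => psd_gram (B p) (hB p)
  choose d hd using fun p => psd_gram _ (hD p)
  have hA : ∀ p s t, A p s t = ∑ x : σ ⊕ σ, 1 * (Sum.elim (u p) (d p) x s * Sum.elim (u p) (d p) x t) := by
    intro p s t
    rw [Fintype.sum_sum_type]
    simp only [Sum.elim_inl, Sum.elim_inr, one_mul]
    rw [← hu, ← hd]; ring
  rw [tform_gram A (fun _ _ => 1) (fun p => Sum.elim (u p) (d p)) hA,
    tform_gram B (fun _ _ => 1) u (fun p s t => by simp [hu p s t])]
  simp only [prod_const_one, one_mul]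
  have hinj : Function.Injective (fun (x : P → σ) (p : P) => (Sum.inl (x p) : σ ⊕ σ)) := by
    intro x y h
    funext p
    exact Sum.inl_injective (congrFun h p)
  calc _ = ∑ x ∈ univ.map ⟨_, hinj⟩, (∑ c, Y c * ∏ p, Sum.elim (u p) (d p) (x p) (c p))^2 := by
        rw [sum_map]; simp
    _ ≤ _ := sum_le_sum_of_subset_of_nonneg (subset_univ _) fun _ _ _ => sq_nonneg _

lemma tform_conj (M T : P → σ → σ → ℝ) (Y : (P → σ) → ℝ) :
    tform M (fun d => ∑ c, Y c * ∏ p, T p (c p) (d p)) =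
      tform (fun p s t => ∑ a, ∑ b, T p s a * T p t b * M p a b) Y := by
  have h1 : ∀ c c' : P → σ, ∏ p, ∑ a, ∑ b, T p (c p) a * T p (c' p) b * M p a b =
      ∑ d : P → σ, ∑ d' : P → σ, (∏ p, T p (c p) (d p)) * (∏ p, T p (c' p) (d' p)) * ∏ p, M p (d p) (d' p) := by
    intro c c'
    rw [Fintype.prod_sum]
    refine sum_congr rfl fun d _ => ?_
    rw [Fintype.prod_sum]
    refine sum_congr rfl fun d' _ => ?_
    rw [prod_mul_distrib, prod_mul_distrib]
  unfold tform
  simp_rw [h1, sum_mul_sum, sum_mul, mul_sum]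
  calc ∑ d : P → σ, ∑ d' : P → σ, ∑ c : P → σ, ∑ c' : P → σ, Y c * (∏ p, T p (c p) (d p)) * (Y c' * ∏ p, T p (c' p) (d' p)) * ∏ p, M p (d p) (d' p)
      = ∑ d : P → σ, ∑ c : P → σ, ∑ d' : P → σ, ∑ c' : P → σ, Y c * (∏ p, T p (c p) (d p)) * (Y c' * ∏ p, T p (c' p) (d' p)) * ∏ p, M p (d p) (d' p) :=
        sum_congr rfl fun d _ => sum_comm
    _ = ∑ c : P → σ, ∑ d : P → σ, ∑ c' : P → σ, ∑ d' : P → σ, Y c * (∏ p, T p (c p) (d p)) * (Y c' * ∏ p, T p (c' p) (d' p)) * ∏ p, M p (d p) (d' p) := by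
        rw [sum_comm]; exact sum_congr rfl fun c _ => sum_congr rfl fun d _ => sum_comm
    _ = _ := by
        refine sum_congr rfl fun c _ => ?_
        rw [sum_comm]
        exact sum_congr rfl fun c' _ => sum_congr rfl fun d _ => sum_congr rfl fun d' _ => by ring

lemma qf_conj (M T : σ → σ → ℝ) (v : σ → ℝ) :
    qf (fun s t => ∑ a, ∑ b, T s a * T t b * M a b) v = qf M (fun a => ∑ s, v s * T s a) := by
  unfold qf
  simp_rw [sum_mul_sum, sum_mul, mul_sum]
  calc ∑ s, ∑ t, ∑ a, ∑ b, v s * v t * (T s a * T t b * M a b)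
      = ∑ s, ∑ a, ∑ t, ∑ b, v s * v t * (T s a * T t b * M a b) := sum_congr rfl fun s _ => sum_comm
    _ = ∑ a, ∑ s, ∑ b, ∑ t, v s * v t * (T s a * T t b * M a b) := by
        rw [sum_comm]; exact sum_congr rfl fun c _ => sum_congr rfl fun d _ => sum_comm
    _ = _ := by
        refine sum_congr rfl fun a _ => ?_
        rw [sum_comm]
        exact sum_congr rfl fun b _ => sum_congr rfl fun s _ => sum_congr rfl fun t _ => by ring

lemma qf_sub (A B : σ → σ → ℝ) (v : σ → ℝ) : qf (fun s t => A s t - B s t) v = qf A v - qf B v := by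
  unfold qf; simp_rw [mul_sub, sum_sub_distrib]

lemma conj_symm (M T : σ → σ → ℝ) (hM : ∀ s t, M s t = M t s) (s t : σ) :
    ∑ a, ∑ b, T s a * T t b * M a b = ∑ a, ∑ b, T t a * T s b * M a b := by
  rw [sum_comm]
  exact sum_congr rfl fun a _ => sum_congr rfl fun b _ => by rw [hM b a]; ring
end tensor

section colors
variable {k : ℕ}

def TT (p : ℝ) : Option (Fin k) → Option (Fin k) → ℝ
  | none, none => 1
  | none, some _ => 0
  | some _, none => 1
  | some i, some j => if i = j then -p else 0

def MM (q : Fin k → ℝ) : Option (Fin k) → Option (Fin k) → ℝ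
  | none, none => 1
  | none, some i => q i
  | some i, none => q i
  | some i, some j => if i = j then q i else 0

noncomputable def q2 (m : Fin k) (p : ℝ) (i : Fin k) : ℝ := if i = m then 0 else 1/(p-1)

def AA (p : ℝ) : Option (Fin k) → Option (Fin k) → ℝ
  | none, none => 1
  | none, some _ => 0
  | some _, none => 0
  | some i, some j => if i = j then p else 0

/-- weights and vectors of the lower form -/
noncomputable def wC (m : Fin k) (p : ℝ) : Option (Fin k) → ℝ
  | none => 1 - 1/(p-1)^2
  | some i => if i = m then 0 else p - 3*k
def eC (m : Fin k) : Option (Fin k) → Option (Fin k) → ℝ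
  | none, none => 1
  | none, some j => if j = m then 1 else 0
  | some _, none => 0
  | some i, some j => if i = j then 1 else 0

lemma MM_symm (q : Fin k → ℝ) (s t : Option (Fin k)) : MM q s t = MM q t s := by
  rcases s with _ | i <;> rcases t with _ | j <;> simp [MM]
  by_cases h : i = j
  · subst h; simp
  · rw [if_neg h, if_neg (Ne.symm h)]

lemma qf_MM (q : Fin k → ℝ) (a : Option (Fin k) → ℝ) :
    qf (MM q) a = a none^2 + 2 * a none * ∑ i, q i * a (some i) + ∑ i, q i * a (some i)^2 := by
  unfold qf
  simp only [Fintype.sum_option, MM, mul_ite, mul_zero, sum_ite_eq, mem_univ, if_true, sum_add_distrib]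
  rw [mul_sum, sq]
  have : ∀ i, 2 * a none * (q i * a (some i)) = a none * a (some i) * q i + a (some i) * a none * q i := fun i => by ring
  simp_rw [this, sum_add_distrib]
  have h2 : ∀ i, q i * a (some i)^2 = a (some i) * a (some i) * q i := fun i => by ring
  simp_rw [h2]
  ring

lemma TT_vec (p : ℝ) (v : Option (Fin k) → ℝ) : (fun a => ∑ s, v s * TT p s a) =
    fun a : Option (Fin k) => match a with
      | none => v none + ∑ i, v (some i)
      | some j => -p * v (some j) := by
  funext a
  rcases a with _ | j
  · simp [Fintype.sum_option, TT]
  · simp [Fintype.sum_option, TT]; ring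

lemma qf_B (p : ℝ) (q : Fin k → ℝ) (v : Option (Fin k) → ℝ) :
    qf (fun s t => ∑ a, ∑ b, TT p s a * TT p t b * MM q a b) v =
      (v none + ∑ i, v (some i))^2 - 2 * p * (v none + ∑ i, v (some i)) * ∑ i, q i * v (some i) + p^2 * ∑ i, q i * v (some i)^2 := by
  rw [qf_conj, TT_vec, qf_MM]
  have h1 : ∑ i, q i * (-p * v (some i)) = -p * ∑ i, q i * v (some i) := by
    rw [mul_sum]; exact sum_congr rfl fun i _ => by ring
  have h2 : ∑ i, q i * (-p * v (some i))^2 = p^2 * ∑ i, q i * v (some i)^2 := by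
    rw [mul_sum]; exact sum_congr rfl fun i _ => by ring
  simp only [h1, h2]
  ring

lemma qf_AA (p : ℝ) (v : Option (Fin k) → ℝ) : qf (AA p) v = v none^2 + p * ∑ i, v (some i)^2 := by
  unfold qf
  simp only [Fintype.sum_option, AA, mul_ite, mul_zero, sum_ite_eq, mem_univ, if_true, sum_const_zero, add_zero, zero_add, mul_one]
  rw [mul_sum, sq]
  congr 1
  exact sum_congr rfl fun i _ => by ring

lemma cs_fin (a : Fin k → ℝ) : (∑ i, a i)^2 ≤ k * ∑ i, a i^2 := by
  have := sq_sum_le_card_mul_sum_sq (s := univ) (f := a)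
  simpa using this

lemma psd_B1 (p : ℝ) (hp0 : 0 < p) (hp : (k:ℝ) ≤ p) :
    PSD (fun s t : Option (Fin k) => ∑ a, ∑ b, TT p s a * TT p t b * MM (fun _ => 1/p) a b) ∧
    PSD (fun s t : Option (Fin k) => AA p s t - ∑ a, ∑ b, TT p s a * TT p t b * MM (fun _ => 1/p) a b) := by
  have key : ∀ v : Option (Fin k) → ℝ, qf (fun s t => ∑ a, ∑ b, TT p s a * TT p t b * MM (fun _ => 1/p) a b) v =
      v none^2 + p * ∑ i, v (some i)^2 - (∑ i, v (some i))^2 := by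
    intro v
    rw [qf_B, ← mul_sum, ← mul_sum]
    field_simp; ring
  refine ⟨⟨conj_symm _ _ (MM_symm _), fun v => ?_⟩, ⟨fun s t => ?_, fun v => ?_⟩⟩
  · rw [key]
    have h1 := cs_fin (fun i => v (some i))
    have h2 : 0 ≤ ∑ i, v (some i)^2 := sum_nonneg fun _ _ => sq_nonneg _
    nlinarith [sq_nonneg (v none)]
  · rw [conj_symm _ _ (MM_symm _)]
    congr 1
    rcases s with _ | i <;> rcases t with _ | j <;> simp [AA, eq_comm]
  · rw [qf_sub, key, qf_AA]
    nlinarith [sq_nonneg (∑ i, v (some i))]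

lemma psd_B2 (m : Fin k) (p : ℝ) (hp3 : 3 ≤ p) (hp : 3 * (k:ℝ) ≤ p) :
    PSD (fun s t : Option (Fin k) => ∑ x, wC m p x * (eC m x s * eC m x t)) ∧
    PSD (fun s t : Option (Fin k) => ∑ a, ∑ b, TT p s a * TT p t b * MM (q2 m p) a b - ∑ x, wC m p x * (eC m x s * eC m x t)) := by
  have hr0 : 0 < p - 1 := by linarith
  have hw : ∀ x, 0 ≤ wC m p x := by
    intro x
    rcases x with _ | i
    · simp only [wC]
      have : 1/(p-1)^2 ≤ 1 := by rw [div_le_one (by positivity)]; nlinarith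
      linarith
    · simp only [wC]; split_ifs <;> linarith
  have hq : ∀ v : Option (Fin k) → ℝ, qf (fun s t => ∑ x, wC m p x * (eC m x s * eC m x t)) v =
      ∑ x, wC m p x * (∑ s, v s * eC m x s)^2 := by
    intro v
    unfold qf
    simp_rw [sq, sum_mul_sum, mul_sum]
    rw [sum_comm]
    have : ∀ t, ∑ s, ∑ x, v s * v t * (wC m p x * (eC m x s * eC m x t)) = ∑ x, ∑ s, v s * v t * (wC m p x * (eC m x s * eC m x t)) :=
      fun t => sum_comm
    simp_rw [this]
    rw [sum_comm]
    refine sum_congr rfl fun x _ => ?_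
    rw [sum_comm]
    exact sum_congr rfl fun c _ => sum_congr rfl fun c' _ => by ring
  have hsy : ∀ s t : Option (Fin k), ∑ x, wC m p x * (eC m x s * eC m x t) = ∑ x, wC m p x * (eC m x t * eC m x s) :=
    fun s t => sum_congr rfl fun x _ => by ring
  refine ⟨⟨hsy, fun v => ?_⟩, ⟨fun s t => ?_, fun v => ?_⟩⟩
  · rw [hq]; exact sum_nonneg fun x _ => mul_nonneg (hw x) (sq_nonneg _)
  · rw [conj_symm _ _ (MM_symm _), hsy]
  · rw [qf_sub, hq, qf_B]
    set z : Fin k → ℝ := fun i => if i = m then 0 else v (some i) with hz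
    have e1 : ∑ i, v (some i) = v (some m) + ∑ i, z i := by
      have : ∀ i, v (some i) = (if i = m then v (some m) else 0) + z i := by
        intro i; simp only [hz]; split_ifs with h
        · rw [h]; ring
        · ring
      conv_lhs => rw [sum_congr rfl fun i _ => this i]
      rw [sum_add_distrib]; simp
    have e2 : ∑ i, q2 m p i * v (some i) = 1/(p-1) * ∑ i, z i := by
      rw [mul_sum]; refine sum_congr rfl fun i _ => ?_
      simp only [q2, hz]; split_ifs <;> ring
    have e3 : ∑ i, q2 m p i * v (some i)^2 = 1/(p-1) * ∑ i, z i^2 := by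
      rw [mul_sum]; refine sum_congr rfl fun i _ => ?_
      simp only [q2, hz]; split_ifs <;> ring
    have e4 : ∑ x, wC m p x * (∑ s, v s * eC m x s)^2 =
        (1 - 1/(p-1)^2) * (v none + v (some m))^2 + (p - 3*k) * ∑ i, z i^2 := by
      rw [Fintype.sum_option]
      congr 1
      · simp [wC, eC, Fintype.sum_option]
      · rw [mul_sum]
        refine sum_congr rfl fun i _ => ?_
        simp only [wC, eC, Fintype.sum_option, hz]
        split_ifs <;> simp
    rw [e1, e2, e3, e4]
    have h1 := cs_fin z
    have h2 : 0 ≤ ∑ i, z i^2 := sum_nonneg fun _ _ => sq_nonneg _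
    set S := ∑ i, z i
    set Q := ∑ i, z i^2
    set u := v none + v (some m) with hu
    set r := 1/(p-1) with hr
    have hr1 : 0 < r := by positivity
    have hr2 : r ≤ 1/2 := by rw [hr, div_le_div_iff₀ hr0 (by norm_num)]; linarith
    have hpr : p * r = 1 + r := by rw [hr]; field_simp; ring
    have e5 : (1:ℝ)/(p-1)^2 = r^2 := by rw [hr]; field_simp
    rw [e5]
    have e6 : (v none + (v (some m) + S))^2 - 2 * p * (v none + (v (some m) + S)) * (r * S) + p^2 * (r * Q) -
        ((1 - r^2) * u^2 + (p - 3*k) * Q) = (r*u - S)^2 - (2+2*r) * S^2 + (1 + r + 3*k) * Q := by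
      have : p^2 * (r * Q) = (p + (1+r)) * Q := by
        calc p^2*(r*Q) = p * (p*r) * Q := by ring
          _ = _ := by rw [hpr, mul_add, mul_one, hpr]
      rw [this]
      have h7 : 2 * p * (v none + (v (some m) + S)) * (r * S) = 2 * (1+r) * (u + S) * S := by
        rw [← hpr, hu]; ring
      rw [h7, hu]; ring
    rw [e6]
    have hk : (0:ℝ) ≤ k := by positivity
    have h8 : (2+2*r) * S^2 ≤ 3 * (k * Q) := by nlinarith [sq_nonneg S]
    nlinarith [sq_nonneg (r*u - S)]

variable {P : Type} [Fintype P] [DecidableEq P]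

noncomputable def lam (pv : P → ℝ) (Y : (P → Option (Fin k)) → ℝ) (d : P → Option (Fin k)) : ℝ :=
  ∑ c, Y c * ∏ p, TT (pv p) (c p) (d p)

theorem E1_le (pv : P → ℝ) (hp0 : ∀ p, 0 < pv p) (hp : ∀ p, (k:ℝ) ≤ pv p) (Y : (P → Option (Fin k)) → ℝ) :
    tform (fun p => MM (fun _ => 1/pv p)) (lam pv Y) ≤ ∑ c, Y c^2 * ∏ p, (if c p = none then 1 else pv p) := by
  unfold lam
  rw [tform_conj]
  refine (tensor_le (fun p => AA (pv p)) _ (fun p => (psd_B1 _ (hp0 p) (hp p)).1) (fun p => (psd_B1 _ (hp0 p) (hp p)).2) Y).trans (le_of_eq ?_)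
  unfold tform
  refine sum_congr rfl fun c _ => ?_
  rw [sum_eq_single c]
  · rw [sq]
    congr 1
    refine prod_congr rfl fun p _ => ?_
    cases c p <;> simp [AA]
  · intro c' _ hne
    obtain ⟨p, hp⟩ := Function.ne_iff.1 hne
    rw [prod_eq_zero (mem_univ p), mul_zero]
    cases h1 : c p <;> cases h2 : c' p
    · rw [h1, h2] at hp; exact absurd rfl hp
    · simp [AA]
    · simp [AA]
    · rw [h1, h2] at hp; simp only [AA]; exact if_neg (fun h => hp (by rw [h]))
  · simp

theorem E2_ge (m : Fin k) (pv : P → ℝ) (hp0 : ∀ p, 3 ≤ pv p) (hp : ∀ p, 3 * (k:ℝ) ≤ pv p) (Y : (P → Option (Fin k)) → ℝ) :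
    ∑ x : P → Option (Fin k), (∏ p, wC m (pv p) (x p)) * (∑ c, Y c * ∏ p, eC m (x p) (c p))^2 ≤
    tform (fun p => MM (q2 m (pv p))) (lam pv Y) := by
  unfold lam
  rw [tform_conj]
  rw [← tform_gram (fun p s t => ∑ x, wC m (pv p) x * (eC m x s * eC m x t)) (fun p => wC m (pv p)) (fun _ => eC m) (fun _ _ _ => rfl)]
  exact tensor_le _ _ (fun p => (psd_B2 m _ (hp0 p) (hp p)).1) (fun p => (psd_B2 m _ (hp0 p) (hp p)).2) Y
end colors
end DSR

namespace DSR
open Finset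

section sieve
variable {P : Type} [Fintype P] [DecidableEq P] {k : ℕ}

noncomputable def vS (pv : P → ℝ) (S : Finset P) : ℝ := ∏ p ∈ S, 1 / pv p
noncomputable def ell (pv : P → ℝ) (S : Finset P) : ℝ := ∑ p ∈ S, Real.log (pv p)
def fib (c : P → Option (Fin k)) (i : Fin k) : Finset P := univ.filter fun p => c p = some i
def spp (c : P → Option (Fin k)) : Finset P := univ.filter fun p => c p ≠ none

noncomputable def YY (pv : P → ℝ) (g : ℝ → ℝ) (LR : ℝ) (c : P → Option (Fin k)) : ℝ :=
  vS pv (spp c) * (∏ i, g (ell pv (fib c i))) * (if ell pv (spp c) ≤ LR then 1 else 0)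

lemma prod_fib (c : P → Option (Fin k)) (F : P → ℝ) : ∏ p ∈ spp c, F p = ∏ i, ∏ p ∈ fib c i, F p := by
  unfold spp fib
  simp_rw [prod_filter]
  rw [prod_comm]
  refine prod_congr rfl fun p _ => ?_
  cases h : c p with
  | none => simp
  | some j => simp

lemma sum_fib (c : P → Option (Fin k)) (F : P → ℝ) : ∑ p ∈ spp c, F p = ∑ i, ∑ p ∈ fib c i, F p := by
  unfold spp fib
  simp_rw [sum_filter]
  rw [sum_comm]
  refine sum_congr rfl fun p _ => ?_
  cases h : c p with
  | none => simp
  | some j => simp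

lemma mem_fib (c : P → Option (Fin k)) (i : Fin k) (p : P) : p ∈ fib c i ↔ c p = some i := by simp [fib]
lemma mem_spp (c : P → Option (Fin k)) (p : P) : p ∈ spp c ↔ c p ≠ none := by simp [spp]

lemma fib_inj {c c' : P → Option (Fin k)} (h : ∀ i, fib c i = fib c' i) : c = c' := by
  funext p
  cases h1 : c p with
  | none =>
    cases h2 : c' p with
    | none => rfl
    | some j =>
      have := (mem_fib c' j p).2 h2
      rw [← h j, mem_fib, h1] at this; exact this
  | some j =>
    have := (mem_fib c j p).2 h1
    rw [h j, mem_fib] at this; exact this.symm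

lemma fib_disj (c : P → Option (Fin k)) {i j : Fin k} (hij : i ≠ j) (p : P) (h1 : p ∈ fib c i) (h2 : p ∈ fib c j) : False := by
  rw [mem_fib] at h1 h2
  rw [h1] at h2
  exact hij (Option.some.inj h2)

/-- colourings to tuples -/
lemma tuple_le (C : Finset (P → Option (Fin k))) (φ : (P → Option (Fin k)) → Fin k → Finset P)
    (hφ : Set.InjOn φ C) (H : Fin k → Finset P → ℝ) (hH : ∀ i S, 0 ≤ H i S) :
    ∑ c ∈ C, ∏ i, H i (φ c i) ≤ ∏ i, ∑ S, H i S := by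
  rw [Fintype.prod_sum]
  rw [← sum_image (f := fun T : Fin k → Finset P => ∏ i, H i (T i)) (s := C) (g := φ) hφ]
  exact sum_le_sum_of_subset_of_nonneg (subset_univ _) fun T _ _ => prod_nonneg fun i _ => hH _ _

lemma vS_pos (pv : P → ℝ) (hp : ∀ p, 0 < pv p) (S : Finset P) : 0 < vS pv S :=
  prod_pos fun p _ => one_div_pos.2 (hp p)
lemma ell_nonneg (pv : P → ℝ) (hp : ∀ p, 1 ≤ pv p) (S : Finset P) : 0 ≤ ell pv S :=
  sum_nonneg fun p _ => Real.log_nonneg (hp p)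

lemma ell_mono (pv : P → ℝ) (hp : ∀ p, 1 ≤ pv p) {S T : Finset P} (h : S ⊆ T) : ell pv S ≤ ell pv T :=
  sum_le_sum_of_subset_of_nonneg h fun p _ _ => Real.log_nonneg (hp p)

structure GG (g : ℝ → ℝ) (LR : ℝ) : Prop where
  nonneg : ∀ x, 0 ≤ g x
  le1 : ∀ x, g x ≤ 1
  anti : Antitone g
  supp : ∀ x, LR / 2 < x → g x = 0

noncomputable def JJ (pv : P → ℝ) (g : ℝ → ℝ) : ℝ := ∑ S, vS pv S * g (ell pv S)
noncomputable def I2 (pv : P → ℝ) (g : ℝ → ℝ) : ℝ := ∑ S, vS pv S * g (ell pv S)^2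
noncomputable def I3 (pv : P → ℝ) (g : ℝ → ℝ) : ℝ := ∑ S, vS pv S * g (ell pv S)^2 * ell pv S
noncomputable def T0 (pv : P → ℝ) (LR : ℝ) : ℝ := ∑ S : Finset P, vS pv S * (if ell pv S ≤ LR then 1 else 0)

theorem E1_le' (pv : P → ℝ) (hp0 : ∀ p, 1 ≤ pv p) (hp : ∀ p, (k:ℝ) ≤ pv p) (g : ℝ → ℝ) (LR : ℝ) (hg : GG g LR) :
    tform (fun p => MM (k := k) (fun _ => 1/pv p)) (lam pv (YY pv g LR)) ≤ I2 pv g ^ k := by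
  have hp1 : ∀ p, 0 < pv p := fun p => by linarith [hp0 p]
  refine (E1_le pv hp1 hp _).trans ?_
  have h1 : ∀ c : P → Option (Fin k), YY pv g LR c^2 * ∏ p, (if c p = none then 1 else pv p) ≤
      ∏ i, (vS pv (fib c i) * g (ell pv (fib c i))^2) := by
    intro c
    have e1 : ∏ p, (if c p = none then 1 else pv p) = (vS pv (spp c))⁻¹ := by
      unfold vS spp
      rw [prod_filter, ← prod_inv_distrib]
      refine prod_congr rfl fun p _ => ?_
      by_cases h : c p = none <;> simp [h]
    rw [e1, prod_mul_distrib]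
    have e2 : ∏ i, vS pv (fib c i) = vS pv (spp c) := by unfold vS; rw [prod_fib]
    rw [e2, prod_pow]
    have := vS_pos pv hp1 (spp c)
    unfold YY
    have h3 : (0:ℝ) ≤ (∏ i, g (ell pv (fib c i)))^2 := sq_nonneg _
    split_ifs
    · apply le_of_eq; field_simp
    · simp only [mul_zero]; simp; positivity
  refine (sum_le_sum fun c _ => h1 c).trans ?_
  refine (tuple_le univ fib (fun c _ c' _ h => fib_inj fun i => congrFun h i) (fun _ S => vS pv S * g (ell pv S)^2)
    (fun i S => mul_nonneg (vS_pos pv hp1 S).le (sq_nonneg _))).trans ?_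
  simp [I2]

lemma TT_term (pv : P → ℝ) (c d : P → Option (Fin k)) (h : ∏ p, TT (pv p) (c p) (d p) ≠ 0) (p : P) (hd : d p ≠ none) :
    c p = d p := by
  have := (prod_ne_zero_iff.1 h) p (mem_univ p)
  revert this
  cases h1 : c p <;> cases h2 : d p
  · simp
  · simp [TT]
  · exact absurd h2 hd
  · simp only [TT]; intro h; split_ifs at h with h'
    · rw [h']
    · exact absurd rfl h

lemma lam_zero (pv : P → ℝ) (hp0 : ∀ p, 1 ≤ pv p) (g : ℝ → ℝ) (LR : ℝ) (d : P → Option (Fin k)) (hd : LR < ell pv (spp d)) :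
    lam pv (YY pv g LR) d = 0 := by
  unfold lam
  refine sum_eq_zero fun c _ => ?_
  by_cases h : ∏ p, TT (pv p) (c p) (d p) = 0
  · rw [h, mul_zero]
  · have hs : spp d ⊆ spp c := by
      intro p hp
      rw [mem_spp] at hp ⊢
      rw [TT_term pv c d h p hp]; exact hp
    unfold YY
    rw [if_neg (not_le.2 (hd.trans_le (ell_mono pv hp0 hs)))]; simp

lemma lam_le (pv : P → ℝ) (hp0 : ∀ p, 1 ≤ pv p) (g : ℝ → ℝ) (LR : ℝ) (hg : GG g LR) (d : P → Option (Fin k)) :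
    |lam pv (YY pv g LR) d| ≤ T0 pv LR ^ k := by
  have hp1 : ∀ p, 0 < pv p := fun p => by linarith [hp0 p]
  unfold lam
  refine (abs_sum_le_sum_abs _ _).trans ?_
  set C := univ.filter fun c : P → Option (Fin k) => ∀ p, d p ≠ none → c p = d p with hC
  have h1 : ∑ c, |YY pv g LR c * ∏ p, TT (pv p) (c p) (d p)| = ∑ c ∈ C, |YY pv g LR c * ∏ p, TT (pv p) (c p) (d p)| := by
    symm
    refine sum_subset (subset_univ _) fun c _ hc => ?_
    by_cases h : ∏ p, TT (pv p) (c p) (d p) = 0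
    · rw [h, mul_zero, abs_zero]
    · exact absurd (by rw [hC]; simp only [mem_filter, mem_univ, true_and]; exact fun p hp => TT_term pv c d h p hp) hc
  rw [h1]
  have h2 : ∀ c ∈ C, |YY pv g LR c * ∏ p, TT (pv p) (c p) (d p)| ≤
      ∏ i, (vS pv (fib c i \ spp d) * (if ell pv (fib c i \ spp d) ≤ LR then 1 else 0)) := by
    intro c hc
    simp only [hC, mem_filter, mem_univ, true_and] at hc
    by_cases hl : ell pv (spp c) ≤ LR
    swap
    · unfold YY; rw [if_neg hl]; simp
      exact prod_nonneg fun i _ => by have := vS_pos pv hp1 (fib c i \ spp d); split_ifs <;> positivity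
    have h3 : ∀ i, ell pv (fib c i \ spp d) ≤ LR := fun i =>
      (ell_mono pv hp0 (fun p hp => by
        rw [mem_sdiff, mem_fib] at hp; rw [mem_spp, hp.1]; simp)).trans hl
    have e1 : ∏ i, (vS pv (fib c i \ spp d) * (if ell pv (fib c i \ spp d) ≤ LR then (1:ℝ) else 0)) = ∏ p, (if c p ≠ none ∧ d p = none then 1 / pv p else 1) := by
      have : ∀ i, vS pv (fib c i \ spp d) * (if ell pv (fib c i \ spp d) ≤ LR then (1:ℝ) else 0) = ∏ p ∈ fib c i, if d p = none then 1 / pv p else 1 := by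
        intro i
        rw [if_pos (h3 i), mul_one]
        unfold vS
        rw [← prod_filter]
        refine prod_congr ?_ fun _ _ => rfl
        ext p; simp [mem_spp]
      simp_rw [this]
      rw [← prod_fib]
      unfold spp
      rw [prod_filter]
      refine prod_congr rfl fun p _ => ?_
      by_cases h : c p = none <;> simp [h]
    rw [e1]
    unfold YY
    rw [if_pos hl, mul_one, abs_mul, abs_mul, abs_of_pos (vS_pos pv hp1 _), abs_of_nonneg (prod_nonneg fun i _ => hg.nonneg _), abs_prod]
    have h4 : ∏ i, g (ell pv (fib c i)) ≤ 1 := prod_le_one (fun i _ => hg.nonneg _) fun i _ => hg.le1 _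
    have h5 : (0:ℝ) ≤ ∏ p, |TT (pv p) (c p) (d p)| := prod_nonneg fun p _ => abs_nonneg _
    calc vS pv (spp c) * (∏ i, g (ell pv (fib c i))) * ∏ p, |TT (pv p) (c p) (d p)|
        ≤ vS pv (spp c) * 1 * ∏ p, |TT (pv p) (c p) (d p)| := by
          have := vS_pos pv hp1 (spp c)
          gcongr
      _ = _ := by
          rw [mul_one]; unfold vS spp; rw [prod_filter, ← prod_mul_distrib]
          refine prod_congr rfl fun p _ => ?_
          by_cases h : d p = none
          · cases h' : c p <;> simp [h, TT]
          · rw [hc p h]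
            have h6 := hp1 p
            cases h' : d p with
            | none => exact absurd h' h
            | some j => simp [TT, abs_of_pos h6, h6.ne']
  refine (sum_le_sum h2).trans ?_
  refine (tuple_le C (fun c i => fib c i \ spp d) ?_ (fun _ S => vS pv S * (if ell pv S ≤ LR then 1 else 0))
    (fun i S => by have := vS_pos pv hp1 S; split_ifs <;> positivity)).trans ?_
  · intro c hc c' hc' h
    simp only [hC, coe_filter, mem_univ, true_and, Set.mem_setOf_eq] at hc hc'
    refine fib_inj fun i => ?_
    ext p
    have h6 := congrArg (p ∈ ·) (congrFun h i)
    simp only [mem_sdiff, eq_iff_iff] at h6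
    by_cases hd : d p = none
    · simpa [mem_spp, hd] using h6
    · rw [mem_fib, mem_fib, hc p hd, hc' p hd]
  · simp [T0]

/-- number of colourings in the support -/
lemma card_supp (pv : P → ℝ) (hp0 : ∀ p, 1 ≤ pv p) (LR : ℝ) :
    ((univ.filter fun d : P → Option (Fin k) => ell pv (spp d) ≤ LR).card : ℝ) ≤ Real.exp LR * T0 pv LR ^ k := by
  have hp1 : ∀ p, 0 < pv p := fun p => by linarith [hp0 p]
  have h1 : ∀ d ∈ univ.filter (fun d : P → Option (Fin k) => ell pv (spp d) ≤ LR), (1:ℝ) ≤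
      Real.exp LR * ∏ i, (vS pv (fib d i) * (if ell pv (fib d i) ≤ LR then 1 else 0)) := by
    intro d hd
    simp only [mem_filter, mem_univ, true_and] at hd
    have h3 : ∀ i, ell pv (fib d i) ≤ LR := fun i =>
      (ell_mono pv hp0 (fun p hp => by rw [mem_fib] at hp; rw [mem_spp, hp]; simp)).trans hd
    have e1 : ∏ i, (vS pv (fib d i) * (if ell pv (fib d i) ≤ LR then (1:ℝ) else 0)) = vS pv (spp d) := by
      unfold vS; rw [prod_fib]
      refine prod_congr rfl fun i _ => ?_
      rw [if_pos (h3 i), mul_one]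
    rw [e1]
    have e2 : vS pv (spp d) = Real.exp (-ell pv (spp d)) := by
      unfold vS ell
      rw [← sum_neg_distrib, Real.exp_sum]
      refine prod_congr rfl fun p _ => ?_
      rw [Real.exp_neg, Real.exp_log (hp1 p), one_div]
    rw [e2, ← Real.exp_add]
    exact Real.one_le_exp (by linarith)
  calc ((univ.filter fun d : P → Option (Fin k) => ell pv (spp d) ≤ LR).card : ℝ)
      = ∑ d ∈ univ.filter (fun d : P → Option (Fin k) => ell pv (spp d) ≤ LR), (1:ℝ) := by simp
    _ ≤ _ := sum_le_sum h1
    _ = Real.exp LR * ∑ d ∈ univ.filter (fun d : P → Option (Fin k) => ell pv (spp d) ≤ LR),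
        ∏ i, (vS pv (fib d i) * (if ell pv (fib d i) ≤ LR then 1 else 0)) := by rw [mul_sum]
    _ ≤ _ := by
      refine mul_le_mul_of_nonneg_left ?_ (Real.exp_pos _).le
      refine (tuple_le _ fib (fun c _ c' _ h => fib_inj fun i => congrFun h i) (fun _ S => vS pv S * (if ell pv S ≤ LR then 1 else 0))
        (fun i S => by have := vS_pos pv hp1 S; split_ifs <;> positivity)).trans ?_
      simp [T0]

lemma T0_nonneg (pv : P → ℝ) (hp0 : ∀ p, 1 ≤ pv p) (LR : ℝ) : 0 ≤ T0 pv LR :=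
  sum_nonneg fun S _ => by
    have := vS_pos pv (fun p => by linarith [hp0 p]) S
    split_ifs <;> positivity

lemma lam_l1 (pv : P → ℝ) (hp0 : ∀ p, 1 ≤ pv p) (g : ℝ → ℝ) (LR : ℝ) (hg : GG g LR) :
    ∑ d : P → Option (Fin k), |lam pv (YY pv g LR) d| ≤ Real.exp LR * T0 pv LR ^ (2*k) := by
  have hT := T0_nonneg pv hp0 LR
  calc ∑ d : P → Option (Fin k), |lam pv (YY pv g LR) d|
      = ∑ d ∈ univ.filter (fun d : P → Option (Fin k) => ell pv (spp d) ≤ LR), |lam pv (YY pv g LR) d| := by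
        symm
        refine sum_subset (subset_univ _) fun d _ hd => ?_
        rw [lam_zero pv hp0 g LR d (by simpa using hd), abs_zero]
    _ ≤ ∑ d ∈ univ.filter (fun d : P → Option (Fin k) => ell pv (spp d) ≤ LR), T0 pv LR ^ k :=
        sum_le_sum fun d _ => lam_le pv hp0 g LR hg d
    _ = ((univ.filter fun d : P → Option (Fin k) => ell pv (spp d) ≤ LR).card : ℝ) * T0 pv LR ^ k := by
        rw [sum_const, nsmul_eq_mul]
    _ ≤ (Real.exp LR * T0 pv LR ^ k) * T0 pv LR ^ k := by
        have := card_supp (k := k) pv hp0 LR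
        gcongr
    _ = _ := by rw [two_mul, pow_add]; ring
end sieve
end DSR

namespace DSR
open Finset

lemma wei {ι : Type*} (s : Finset ι) (a : ι → ℝ) (h0 : ∀ i ∈ s, 0 ≤ a i) (h1 : ∀ i ∈ s, a i ≤ 1) :
    1 - ∑ i ∈ s, a i ≤ ∏ i ∈ s, (1 - a i) := by
  classical
  induction s using Finset.induction_on with
  | empty => simp
  | insert x s hx ih =>
    rw [sum_insert hx, prod_insert hx]
    have ih := ih (fun i hi => h0 i (mem_insert_of_mem hi)) (fun i hi => h1 i (mem_insert_of_mem hi))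
    have hs : 0 ≤ ∑ i ∈ s, a i := sum_nonneg fun i hi => h0 i (mem_insert_of_mem hi)
    have h2 := h0 x (mem_insert_self _ _)
    have h3 := h1 x (mem_insert_self _ _)
    nlinarith [mul_le_mul_of_nonneg_left ih (sub_nonneg.2 h3)]

section sieve2
variable {P : Type} [Fintype P] [DecidableEq P] {k : ℕ}

noncomputable def Js (pv : P → ℝ) (g : ℝ → ℝ) (s : Finset P) : ℝ :=
  ∑ a ∈ univ.filter (fun a => Disjoint a s), vS pv a * g (ell pv a)

lemma JJ_le (pv : P → ℝ) (hp0 : ∀ p, 1 ≤ pv p) (g : ℝ → ℝ) (LR : ℝ) (hg : GG g LR) (s : Finset P) :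
    JJ pv g ≤ Js pv g s * ∏ p ∈ s, (1 + 1 / pv p) := by
  have hp1 : ∀ p, 0 < pv p := fun p => by linarith [hp0 p]
  rw [prod_one_add]
  unfold JJ Js
  rw [sum_mul_sum, ← sum_product']
  have h1 : ∀ S : Finset P, vS pv S * g (ell pv S) ≤ vS pv (S \ s) * g (ell pv (S \ s)) * ∏ p ∈ S ∩ s, 1 / pv p := by
    intro S
    have e1 : vS pv S = vS pv (S \ s) * ∏ p ∈ S ∩ s, 1 / pv p := by
      unfold vS
      rw [mul_comm, ← sdiff_inter_self_left S s, mul_comm]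
      exact (prod_sdiff inter_subset_left).symm
    rw [e1]
    have h2 := hg.anti (ell_mono pv hp0 (sdiff_subset (s := S) (t := s)))
    have h3 := (vS_pos pv hp1 S).le
    rw [e1] at h3
    nlinarith [mul_le_mul_of_nonneg_left h2 h3]
  refine (sum_le_sum fun S _ => h1 S).trans ?_
  have hinj : Set.InjOn (fun S : Finset P => (S \ s, S ∩ s)) (univ : Finset (Finset P)) := by
    intro S _ S' _ h
    simp only [Prod.mk.injEq] at h
    rw [← sdiff_union_inter S s, h.1, h.2, sdiff_union_inter]
  rw [← sum_image (f := fun x : Finset P × Finset P => vS pv x.1 * g (ell pv x.1) * ∏ p ∈ x.2, 1 / pv p) hinj]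
  refine sum_le_sum_of_subset_of_nonneg ?_ fun x _ _ => ?_
  · intro x hx
    obtain ⟨S, -, rfl⟩ := mem_image.1 hx
    simp only [mem_product, mem_filter, mem_univ, true_and, mem_powerset]
    exact ⟨sdiff_disjoint, inter_subset_right⟩
  · exact mul_nonneg (mul_nonneg (vS_pos pv hp1 _).le (hg.nonneg _)) (vS_pos pv hp1 x.2).le

noncomputable def gx (pv : P → ℝ) (g : ℝ → ℝ) (m : Fin k) (x : P → Option (Fin k)) : ℝ :=
  ∏ i, if i = m then 1 else g (ell pv (fib x i))

lemma inner_ge (pv : P → ℝ) (hp0 : ∀ p, 1 ≤ pv p) (g : ℝ → ℝ) (LR : ℝ) (hg : GG g LR) (m : Fin k)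
    (x : P → Option (Fin k)) (hx : ∀ p, x p ≠ some m) (hl : ell pv (spp x) ≤ LR/2) :
    vS pv (spp x) * gx pv g m x * Js pv g (spp x) ≤ ∑ c, YY pv g LR c * ∏ p, eC m (x p) (c p) := by
  have hp1 : ∀ p, 0 < pv p := fun p => by linarith [hp0 p]
  have heC : ∀ c : P → Option (Fin k), 0 ≤ ∏ p, eC m (x p) (c p) := fun c => prod_nonneg fun p _ => by
    cases x p <;> cases c p <;> simp only [eC] <;> (try split_ifs) <;> norm_num
  have hYY : ∀ c : P → Option (Fin k), 0 ≤ YY pv g LR c := fun c => by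
    unfold YY
    have := (vS_pos pv hp1 (spp c)).le
    have := prod_nonneg (s := univ) fun i (_ : i ∈ univ) => hg.nonneg (ell pv (fib c i))
    split_ifs <;> positivity
  let ψ : Finset P → P → Option (Fin k) := fun a p => if p ∈ a then some m else x p
  have hfm : ∀ a, fib (ψ a) m = a := by
    intro a; ext p; rw [mem_fib]; simp only [ψ]; split_ifs with h <;> simp [h, hx]
  have hfi : ∀ a, Disjoint a (spp x) → ∀ i, i ≠ m → fib (ψ a) i = fib x i := by
    intro a ha i hi; ext p; rw [mem_fib, mem_fib]; simp only [ψ]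
    split_ifs with h
    · have := disjoint_left.1 ha h
      rw [mem_spp, not_not] at this
      simp [this, Ne.symm hi]
    · rfl
  have hsp : ∀ a, spp (ψ a) = a ∪ spp x := by
    intro a; ext p; rw [mem_spp, mem_union, mem_spp]; simp only [ψ]; split_ifs with h <;> simp [h]
  have hinj : Set.InjOn ψ (univ.filter (fun a => Disjoint a (spp x)) : Finset (Finset P)) := by
    intro a _ a' _ h
    rw [← hfm a, h, hfm]
  have h1 : ∑ a ∈ univ.filter (fun a => Disjoint a (spp x)), YY pv g LR (ψ a) * ∏ p, eC m (x p) (ψ a p) ≤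
      ∑ c, YY pv g LR c * ∏ p, eC m (x p) (c p) := by
    rw [← sum_image (f := fun c => YY pv g LR c * ∏ p, eC m (x p) (c p)) hinj]
    exact sum_le_sum_of_subset_of_nonneg (subset_univ _) fun c _ _ => mul_nonneg (hYY c) (heC c)
  refine le_trans ?_ h1
  unfold Js
  rw [mul_sum]
  refine sum_le_sum fun a ha => ?_
  simp only [mem_filter, mem_univ, true_and] at ha
  have e1 : ∏ p, eC m (x p) (ψ a p) = 1 := by
    refine prod_eq_one fun p _ => ?_
    simp only [ψ]
    split_ifs with h
    · have := disjoint_left.1 ha h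
      rw [mem_spp, not_not] at this
      rw [this]; simp [eC]
    · cases x p <;> simp [eC]
  rw [e1, mul_one]
  by_cases hL : LR / 2 < ell pv a
  · rw [hg.supp _ hL, mul_zero, mul_zero]; exact hYY _
  unfold YY
  rw [hsp]
  have e2 : ell pv (a ∪ spp x) = ell pv a + ell pv (spp x) := sum_union ha
  have e3 : vS pv (a ∪ spp x) = vS pv a * vS pv (spp x) := prod_union ha
  rw [if_pos (by rw [e2]; linarith [not_lt.1 hL]), e3, mul_one]
  have e4 : ∏ i, g (ell pv (fib (ψ a) i)) = g (ell pv a) * gx pv g m x := by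
    unfold gx
    rw [← mul_prod_erase univ _ (mem_univ m), ← mul_prod_erase univ (fun i => if i = m then (1:ℝ) else g (ell pv (fib x i))) (mem_univ m), hfm]
    simp only [if_true, one_mul]
    congr 1
    refine prod_congr rfl fun i hi => ?_
    rw [hfi a ha i (ne_of_mem_erase hi), if_neg (ne_of_mem_erase hi)]
  rw [e4]
  apply le_of_eq; ring

lemma termC (pv : P → ℝ) (hp3 : ∀ p, 3 ≤ pv p) (hk : ∀ p, 3 * (k:ℝ) + 2 ≤ pv p) (g : ℝ → ℝ) (LR : ℝ) (hg : GG g LR)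
    (hκ : ∑ p, 1 / (pv p - 1)^2 ≤ 1/2) (m : Fin k)
    (x : P → Option (Fin k)) (hx : ∀ p, x p ≠ some m) (hl : ell pv (spp x) ≤ LR/2) :
    JJ pv g ^ 2 / 2 * (vS pv (spp x) * (∏ p ∈ spp x, (1 - (3*k+2) / pv p)) * gx pv g m x ^ 2) ≤
      (∏ p, wC m (pv p) (x p)) * (∑ c, YY pv g LR c * ∏ p, eC m (x p) (c p))^2 := by
  have hp0 : ∀ p, 1 ≤ pv p := fun p => by linarith [hp3 p]
  have hp1 : ∀ p, 0 < pv p := fun p => by linarith [hp3 p]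
  have h1 := inner_ge pv hp0 g LR hg m x hx hl
  have h2 := JJ_le pv hp0 g LR hg (spp x)
  set s := spp x with hs
  have hJ0 : 0 ≤ JJ pv g := sum_nonneg fun S _ => mul_nonneg (vS_pos pv hp1 S).le (hg.nonneg _)
  have hg0 : 0 ≤ gx pv g m x := prod_nonneg fun i _ => by split_ifs; exacts [zero_le_one, hg.nonneg _]
  have hv := vS_pos pv hp1 s
  have hPr0 : 0 < ∏ p ∈ s, (1 + 1 / pv p) := prod_pos fun p _ => by have := hp1 p; positivity
  have e1 : ∏ p, wC m (pv p) (x p) = (∏ p ∈ univ \ s, (1 - 1/(pv p - 1)^2)) * ∏ p ∈ s, (pv p - 3*k) := by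
    rw [← prod_sdiff (subset_univ s)]
    congr 1
    · refine prod_congr rfl fun p hp => ?_
      have : x p = none := by
        by_contra h
        exact (mem_sdiff.1 hp).2 ((mem_spp x p).2 h)
      rw [this]; rfl
    · refine prod_congr rfl fun p hp => ?_
      rw [hs, mem_spp] at hp
      cases h : x p with
      | none => exact absurd h hp
      | some i =>
        have : i ≠ m := fun h' => hx p (by rw [h, h'])
        simp [wC, this]
  have hq : ∀ p, 1/(pv p - 1)^2 ≤ 1 := fun p => by
    rw [div_le_one (by have := hp3 p; nlinarith)]; nlinarith [hp3 p]
  have h3 : (1:ℝ)/2 ≤ ∏ p ∈ univ \ s, (1 - 1/(pv p - 1)^2) := by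
    refine le_trans ?_ (wei _ _ (fun p _ => by positivity) (fun p _ => hq p))
    have : ∑ p ∈ univ \ s, 1/(pv p - 1)^2 ≤ ∑ p, 1/(pv p - 1)^2 :=
      sum_le_sum_of_subset_of_nonneg (subset_univ _) fun p _ _ => by positivity
    linarith
  have h4 : vS pv s * ∏ p ∈ s, (1 - (3*k+2) / pv p) ≤ (∏ p ∈ s, (pv p - 3*k)) * (vS pv s / ∏ p ∈ s, (1 + 1 / pv p))^2 := by
    unfold vS
    rw [← prod_div_distrib, ← prod_pow, ← prod_mul_distrib, ← prod_mul_distrib]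
    refine prod_le_prod (fun p _ => ?_) fun p _ => ?_
    · have := hp1 p
      have h5 : (3*k+2) / pv p ≤ 1 := by rw [div_le_one this]; exact hk p
      exact mul_nonneg (by positivity) (by linarith)
    · have := hp1 p
      have hkk : (0:ℝ) ≤ k := by positivity
      have e5 : (pv p - 3*k) * (1 / pv p / (1 + 1/pv p))^2 = (pv p - 3*k) / (pv p + 1)^2 := by field_simp
      rw [e5]
      have e6 : 1 / pv p * (1 - (3*k+2)/pv p) = (pv p - (3*k+2)) / pv p^2 := by field_simp
      rw [e6, div_le_div_iff₀ (by positivity) (by positivity)]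
      nlinarith [mul_nonneg hkk this.le]
  have h5 : vS pv s * gx pv g m x * (JJ pv g / ∏ p ∈ s, (1 + 1 / pv p)) ≤ ∑ c, YY pv g LR c * ∏ p, eC m (x p) (c p) := by
    refine le_trans ?_ h1
    refine mul_le_mul_of_nonneg_left ?_ (mul_nonneg hv.le hg0)
    rw [div_le_iff₀ hPr0]; exact h2
  have h6 : 0 ≤ vS pv s * gx pv g m x * (JJ pv g / ∏ p ∈ s, (1 + 1 / pv p)) := by positivity
  have h7 := pow_le_pow_left₀ h6 h5 2
  rw [e1]
  have h8 : 0 ≤ ∏ p ∈ s, (pv p - 3*k) := prod_nonneg fun p _ => by linarith [hk p]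
  calc JJ pv g ^ 2 / 2 * (vS pv s * (∏ p ∈ s, (1 - (3*k+2) / pv p)) * gx pv g m x ^ 2)
      ≤ JJ pv g ^ 2 / 2 * (((∏ p ∈ s, (pv p - 3*k)) * (vS pv s / ∏ p ∈ s, (1 + 1 / pv p))^2) * gx pv g m x ^ 2) := by
        refine mul_le_mul_of_nonneg_left (mul_le_mul_of_nonneg_right h4 (by positivity)) (by positivity)
    _ = (1/2 * (∏ p ∈ s, (pv p - 3*k))) * (vS pv s * gx pv g m x * (JJ pv g / ∏ p ∈ s, (1 + 1 / pv p)))^2 := by ring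
    _ ≤ ((∏ p ∈ univ \ s, (1 - 1/(pv p - 1)^2)) * ∏ p ∈ s, (pv p - 3*k)) * (∑ c, YY pv g LR c * ∏ p, eC m (x p) (c p))^2 := by
        refine mul_le_mul (mul_le_mul_of_nonneg_right h3 h8) h7 (by positivity) (mul_nonneg (by linarith) h8)

lemma tupsum (H φ : Fin k → Finset P → ℝ) (N e : Fin k → ℝ) (hH : ∀ l S, 0 ≤ H l S) (hφ : ∀ l S, 0 ≤ φ l S)
    (h : ∀ l, ∑ S, H l S * φ l S ≤ N l * e l) :
    ∑ T : Fin k → Finset P, (∏ l, H l (T l)) * (∏ l, φ l (T l)) ≤ (∏ l, N l) * ∏ l, e l := by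
  simp_rw [← prod_mul_distrib]
  rw [← Fintype.prod_sum (fun l S => H l S * φ l S)]
  exact prod_le_prod (fun l _ => sum_nonneg fun S _ => mul_nonneg (hH _ _) (hφ _ _)) fun l _ => h l

noncomputable def Hm (pv : P → ℝ) (g : ℝ → ℝ) (m : Fin k) (l : Fin k) (S : Finset P) : ℝ :=
  if l = m then (if S = ∅ then 1 else 0) else vS pv S * g (ell pv S)^2
noncomputable def Nm (pv : P → ℝ) (g : ℝ → ℝ) (m : Fin k) (l : Fin k) : ℝ := if l = m then 1 else I2 pv g

lemma Hm_nonneg (pv : P → ℝ) (hp1 : ∀ p, 0 < pv p) (g : ℝ → ℝ) (m l : Fin k) (S : Finset P) : 0 ≤ Hm pv g m l S := by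
  have := (vS_pos pv hp1 S).le
  unfold Hm; split_ifs <;> positivity

lemma Hm_sum (pv : P → ℝ) (g : ℝ → ℝ) (m l : Fin k) : ∑ S, Hm pv g m l S = Nm pv g m l := by
  unfold Hm Nm; split_ifs
  · simp
  · rfl

lemma I2_nonneg (pv : P → ℝ) (hp1 : ∀ p, 0 < pv p) (g : ℝ → ℝ) : 0 ≤ I2 pv g :=
  sum_nonneg fun S _ => mul_nonneg (vS_pos pv hp1 S).le (sq_nonneg _)

lemma Nm_nonneg (pv : P → ℝ) (hp1 : ∀ p, 0 < pv p) (g : ℝ → ℝ) (m l : Fin k) : 0 ≤ Nm pv g m l := by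
  have := I2_nonneg pv hp1 g
  unfold Nm; split_ifs <;> positivity

lemma Hm_mem (pv : P → ℝ) (hp0 : ∀ p, 1 ≤ pv p) (g : ℝ → ℝ) (LR : ℝ) (hg : GG g LR) (m l : Fin k) (p : P) :
    ∑ S, Hm pv g m l S * (if p ∈ S then 1 else 0) ≤ Nm pv g m l * (1 / pv p) := by
  have hp1 : ∀ p, 0 < pv p := fun p => by linarith [hp0 p]
  have hpp := hp1 p
  unfold Hm Nm
  split_ifs
  · rw [sum_eq_zero]
    · positivity
    · intro S _
      by_cases h : S = ∅ <;> simp [h]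
  · simp only [mul_ite, mul_one, mul_zero]
    rw [← sum_filter]
    have h1 : ∀ S ∈ univ.filter (fun S => p ∈ S), vS pv S * g (ell pv S)^2 ≤ (vS pv (S.erase p) * g (ell pv (S.erase p))^2) * (1 / pv p) := by
      intro S hS
      have hS : p ∈ S := by simpa using hS
      have e1 : vS pv S = (1 / pv p) * vS pv (S.erase p) := (mul_prod_erase S _ hS).symm
      have h2 := pow_le_pow_left₀ (hg.nonneg _) (hg.anti (ell_mono pv hp0 (erase_subset p S))) 2
      have h3 := (vS_pos pv hp1 S).le
      calc _ ≤ vS pv S * g (ell pv (S.erase p))^2 := mul_le_mul_of_nonneg_left h2 h3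
        _ = _ := by rw [e1]; ring
    refine (sum_le_sum h1).trans ?_
    rw [← sum_mul]
    refine mul_le_mul_of_nonneg_right ?_ (by positivity)
    have hinj : Set.InjOn (fun S : Finset P => S.erase p) (univ.filter (fun S => p ∈ S) : Finset (Finset P)) := by
      intro S hS S' hS' h
      simp only [coe_filter, mem_univ, true_and, Set.mem_setOf_eq] at hS hS'
      simp only at h
      rw [← insert_erase hS, h, insert_erase hS']
    rw [← sum_image (f := fun S : Finset P => vS pv S * g (ell pv S)^2) hinj]
    exact sum_le_sum_of_subset_of_nonneg (subset_univ _) fun S _ _ => mul_nonneg (vS_pos pv hp1 S).le (sq_nonneg _)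

lemma Hm_ell (pv : P → ℝ) (g : ℝ → ℝ) (m l : Fin k) (ε : ℝ) (hε : 0 ≤ ε) (h : I3 pv g ≤ ε * I2 pv g) :
    ∑ S, Hm pv g m l S * ell pv S ≤ Nm pv g m l * ε := by
  unfold Hm Nm
  split_ifs
  · rw [sum_eq_zero]
    · linarith
    · intro S _
      by_cases h : S = ∅ <;> simp [h, ell]
  · rw [mul_comm]; exact h
end sieve2
end DSR

namespace DSR
open Finset

section sieve3
variable {P : Type} [Fintype P] [DecidableEq P] {k : ℕ}

noncomputable def brk (pv : P → ℝ) (LR : ℝ) (T : Fin k → Finset P) : ℝ :=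
  1 - (∑ i, ∑ j ∈ univ.erase i, ∑ p, ((if p ∈ T i then 1 else 0) * (if p ∈ T j then (1:ℝ) else 0)))
    - (∑ i, ∑ p, (3*k+2) / pv p * (if p ∈ T i then 1 else 0)) - (∑ i, 2 / LR * ell pv (T i))

/-- colourings from disjoint tuples -/
lemma exists_col (T : Fin k → Finset P) (h : ∀ i j, i ≠ j → ∀ p, p ∈ T i → p ∈ T j → False) :
    ∃ x : P → Option (Fin k), fib x = T := by
  classical
  refine ⟨fun p => if h : ∃ i, p ∈ T i then some h.choose else none, ?_⟩
  funext i; ext p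
  rw [mem_fib]
  split_ifs with h'
  · constructor
    · intro h2
      have := h'.choose_spec
      rw [Option.some.inj h2] at this; exact this
    · intro h2
      by_contra h3
      exact h _ _ (fun h4 => h3 (by rw [h4])) p h'.choose_spec h2
  · simp only [reduceCtorEq, false_iff]
    exact fun h2 => h' ⟨i, h2⟩

lemma stepD1 (pv : P → ℝ) (hp3 : ∀ p, 3 ≤ pv p) (hk : ∀ p, 3 * (k:ℝ) + 2 ≤ pv p) (g : ℝ → ℝ) (LR : ℝ) (hL : 0 < LR)
    (m : Fin k) :
    ∑ T : Fin k → Finset P, (∏ l, Hm pv g m l (T l)) * brk pv LR T ≤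
      ∑ x ∈ univ.filter (fun x : P → Option (Fin k) => (∀ p, x p ≠ some m) ∧ ell pv (spp x) ≤ LR/2),
        vS pv (spp x) * (∏ p ∈ spp x, (1 - (3*k+2) / pv p)) * gx pv g m x ^ 2 := by
  classical
  have hp0 : ∀ p, 1 ≤ pv p := fun p => by linarith [hp3 p]
  have hp1 : ∀ p, 0 < pv p := fun p => by linarith [hp3 p]
  set Gd := univ.filter (fun x : P → Option (Fin k) => (∀ p, x p ≠ some m) ∧ ell pv (spp x) ≤ LR/2) with hGd
  have hA : ∀ T : Fin k → Finset P, 0 ≤ ∑ i, ∑ j ∈ univ.erase i, ∑ p, ((if p ∈ T i then 1 else 0) * (if p ∈ T j then (1:ℝ) else 0)) :=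
    fun T => sum_nonneg fun i _ => sum_nonneg fun j _ => sum_nonneg fun p _ => by split_ifs <;> norm_num
  have hB : ∀ T : Fin k → Finset P, 0 ≤ ∑ i, ∑ p, (3*k+2) / pv p * (if p ∈ T i then (1:ℝ) else 0) :=
    fun T => sum_nonneg fun i _ => sum_nonneg fun p _ => by have := hp1 p; split_ifs <;> positivity
  have hC : ∀ T : Fin k → Finset P, 0 ≤ ∑ i, 2 / LR * ell pv (T i) :=
    fun T => sum_nonneg fun i _ => mul_nonneg (by positivity) (ell_nonneg pv hp0 _)
  have hinj : Set.InjOn (fib : (P → Option (Fin k)) → Fin k → Finset P) Gd :=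
    fun c _ c' _ h => fib_inj fun i => congrFun h i
  have h1 : ∀ T : Fin k → Finset P, T ∉ Gd.image fib → (∏ l, Hm pv g m l (T l)) * brk pv LR T ≤ 0 := by
    intro T hT
    have hH : 0 ≤ ∏ l, Hm pv g m l (T l) := prod_nonneg fun l _ => Hm_nonneg pv hp1 g m l _
    by_cases hd : ∀ i j, i ≠ j → ∀ p, p ∈ T i → p ∈ T j → False
    · obtain ⟨x, rfl⟩ := exists_col T hd
      have hx : x ∉ Gd := fun h => hT (mem_image_of_mem _ h)
      simp only [hGd, mem_filter, mem_univ, true_and, not_and_or, not_forall, not_not, not_le] at hx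
      rcases hx with ⟨p, hp⟩ | hx
      · rw [prod_eq_zero (mem_univ m), zero_mul]
        unfold Hm
        rw [if_pos rfl, if_neg]
        exact ne_empty_of_mem ((mem_fib x m p).2 hp)
      · refine mul_nonpos_of_nonneg_of_nonpos hH ?_
        have e1 : ∑ i, 2 / LR * ell pv (fib x i) = 2 / LR * ell pv (spp x) := by
          rw [← mul_sum]; unfold ell; rw [sum_fib]
        have h2 : 1 ≤ 2 / LR * ell pv (spp x) := by
          rw [div_mul_eq_mul_div, le_div_iff₀ hL]; linarith
        have h3 := hA (fib x)
        have h4 := hB (fib x)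
        unfold brk; rw [e1]; linarith
    · push Not at hd
      obtain ⟨i, j, hij, p, hpi, hpj, -⟩ := hd
      refine mul_nonpos_of_nonneg_of_nonpos hH ?_
      have h2 : 1 ≤ ∑ i, ∑ j ∈ univ.erase i, ∑ p, ((if p ∈ T i then 1 else 0) * (if p ∈ T j then (1:ℝ) else 0)) := by
        calc (1:ℝ) = (if p ∈ T i then 1 else 0) * (if p ∈ T j then (1:ℝ) else 0) := by simp [hpi, hpj]
          _ ≤ ∑ p, ((if p ∈ T i then 1 else 0) * (if p ∈ T j then (1:ℝ) else 0)) :=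
            single_le_sum (f := fun p => (if p ∈ T i then 1 else 0) * (if p ∈ T j then (1:ℝ) else 0)) (fun p _ => by split_ifs <;> norm_num) (mem_univ p)
          _ ≤ ∑ j ∈ univ.erase i, ∑ p, ((if p ∈ T i then 1 else 0) * (if p ∈ T j then (1:ℝ) else 0)) :=
            single_le_sum (f := fun j => ∑ p, ((if p ∈ T i then 1 else 0) * (if p ∈ T j then (1:ℝ) else 0)))
              (fun j _ => sum_nonneg fun p _ => by split_ifs <;> norm_num) (mem_erase.2 ⟨hij.symm, mem_univ j⟩)
          _ ≤ _ := single_le_sum (f := fun i => ∑ j ∈ univ.erase i, ∑ p, ((if p ∈ T i then 1 else 0) * (if p ∈ T j then (1:ℝ) else 0)))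
              (fun i _ => sum_nonneg fun j _ => sum_nonneg fun p _ => by split_ifs <;> norm_num) (mem_univ i)
      have h3 := hB T
      have h4 := hC T
      unfold brk; linarith
  have h2 : ∑ T : Fin k → Finset P, (∏ l, Hm pv g m l (T l)) * brk pv LR T ≤
      ∑ T ∈ Gd.image fib, (∏ l, Hm pv g m l (T l)) * brk pv LR T := by
    rw [← sum_sdiff (subset_univ (Gd.image fib))]
    have := sum_nonpos (s := univ \ Gd.image fib) (f := fun T => (∏ l, Hm pv g m l (T l)) * brk pv LR T) fun T hT => h1 T (mem_sdiff.1 hT).2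
    linarith
  refine h2.trans ?_
  rw [sum_image hinj]
  refine sum_le_sum fun x hx => ?_
  simp only [hGd, mem_filter, mem_univ, true_and] at hx
  have e1 : ∏ l, Hm pv g m l (fib x l) = vS pv (spp x) * gx pv g m x^2 := by
    have : vS pv (spp x) = ∏ l, vS pv (fib x l) := by unfold vS; rw [prod_fib]
    rw [this]; unfold gx
    rw [← prod_pow, ← prod_mul_distrib]
    refine prod_congr rfl fun l _ => ?_
    unfold Hm
    split_ifs with h h'
    · rw [h']; simp [vS]
    · exact absurd (by rw [h]; exact filter_eq_empty_iff.2 fun p _ => hx.1 p) h'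
    · rfl
  rw [e1]
  have h3 : brk pv LR (fib x) ≤ ∏ p ∈ spp x, (1 - (3*k+2) / pv p) := by
    refine le_trans ?_ (wei _ _ (fun p _ => by have := hp1 p; positivity) (fun p _ => by rw [div_le_one (hp1 p)]; exact hk p))
    have e2 : ∑ i, ∑ p, (3*k+2) / pv p * (if p ∈ fib x i then (1:ℝ) else 0) = ∑ p ∈ spp x, (3*k+2) / pv p := by
      rw [sum_fib]
      refine sum_congr rfl fun i _ => ?_
      simp
    have h4 := hA (fib x)
    have h5 := hC (fib x)
    unfold brk; rw [e2]; linarith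
  have h4 : 0 ≤ vS pv (spp x) * gx pv g m x^2 := mul_nonneg (vS_pos pv hp1 _).le (sq_nonneg _)
  calc _ ≤ vS pv (spp x) * gx pv g m x^2 * ∏ p ∈ spp x, (1 - (3*k+2) / pv p) := mul_le_mul_of_nonneg_left h3 h4
    _ = _ := by ring

lemma stepD2 (pv : P → ℝ) (hp3 : ∀ p, 3 ≤ pv p) (g : ℝ → ℝ) (LR : ℝ) (hL : 0 < LR) (hg : GG g LR)
    (h3 : 8 * k * I3 pv g ≤ LR * I2 pv g) (hσ : ((k:ℝ)^2 + k * (3*k+2)) * ∑ p, 1 / (pv p)^2 ≤ 1/4) (m : Fin k) :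
    I2 pv g ^ (k-1) / 2 ≤ ∑ T : Fin k → Finset P, (∏ l, Hm pv g m l (T l)) * brk pv LR T := by
  have hp0 : ∀ p, 1 ≤ pv p := fun p => by linarith [hp3 p]
  have hp1 : ∀ p, 0 < pv p := fun p => by linarith [hp3 p]
  have hkpos : 0 < (k:ℝ) := by exact_mod_cast (Fin.pos m)
  have hH := Hm_nonneg pv hp1 g m
  set N := ∏ l, Nm pv g m l with hN
  have hN0 : 0 ≤ N := prod_nonneg fun l _ => Nm_nonneg pv hp1 g m l
  have eN : N = I2 pv g ^ (k-1) := by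
    rw [hN, ← mul_prod_erase univ _ (mem_univ m)]
    have : ∀ l ∈ univ.erase m, Nm pv g m l = I2 pv g := fun l hl => by unfold Nm; rw [if_neg (ne_of_mem_erase hl)]
    rw [prod_congr rfl this, prod_const, card_erase_of_mem (mem_univ m)]
    simp [Nm]
  have e0 : ∑ T : Fin k → Finset P, ∏ l, Hm pv g m l (T l) = N := by
    rw [← Fintype.prod_sum]; simp_rw [Hm_sum]; rfl
  -- pairs
  have hpair : ∀ i j p, i ≠ j → ∑ T : Fin k → Finset P, (∏ l, Hm pv g m l (T l)) * ((if p ∈ T i then 1 else 0) * (if p ∈ T j then (1:ℝ) else 0)) ≤ N * (1 / pv p^2) := by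
    intro i j p hij
    have := tupsum (Hm pv g m) (fun l S => (if l = i then (if p ∈ S then 1 else 0) else 1) * (if l = j then (if p ∈ S then (1:ℝ) else 0) else 1))
      (Nm pv g m) (fun l => (if l = i then 1 / pv p else 1) * (if l = j then 1 / pv p else 1)) hH
      (fun l S => by split_ifs <;> norm_num) (fun l => by
        have h1 := Hm_mem pv hp0 g LR hg m l p
        by_cases h : l = i
        · have h' : l ≠ j := fun h' => hij (h.symm.trans h')
          subst h; simpa [hij] using h1
        · by_cases h' : l = j
          · subst h'; simpa [h] using h1
          · simp only [if_neg h, if_neg h', mul_one]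
            rw [Hm_sum])
    simp only [prod_mul_distrib, prod_ite_eq', mem_univ, if_true] at this
    refine this.trans (le_of_eq ?_)
    rw [← hN]; ring
  have hsing : ∀ i (f : Finset P → ℝ) (e : ℝ), (∀ S, 0 ≤ f S) → (∑ S, Hm pv g m i S * f S ≤ Nm pv g m i * e) →
      ∑ T : Fin k → Finset P, (∏ l, Hm pv g m l (T l)) * f (T i) ≤ N * e := by
    intro i f e hf he
    have := tupsum (Hm pv g m) (fun l S => (if l = i then f S else 1))
      (Nm pv g m) (fun l => (if l = i then e else 1)) hH
      (fun l S => by split_ifs; exacts [hf S, zero_le_one]) (fun l => by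
        by_cases h : l = i
        · subst h; simpa using he
        · simp only [if_neg h, mul_one]; rw [Hm_sum])
    simp only [prod_ite_eq', mem_univ, if_true] at this
    exact this
  set σ := ∑ p, 1 / (pv p)^2 with hs
  have hσ0 : 0 ≤ σ := sum_nonneg fun p _ => by have := hp1 p; positivity
  have hA : ∑ T : Fin k → Finset P, (∏ l, Hm pv g m l (T l)) * (∑ i, ∑ j ∈ univ.erase i, ∑ p, ((if p ∈ T i then 1 else 0) * (if p ∈ T j then (1:ℝ) else 0))) ≤ N * (k^2 * σ) := by
    simp_rw [mul_sum]
    rw [sum_comm]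
    have : ∀ i ∈ (univ : Finset (Fin k)), ∑ T : Fin k → Finset P, ∑ j ∈ univ.erase i, ∑ p, (∏ l, Hm pv g m l (T l)) * ((if p ∈ T i then 1 else 0) * (if p ∈ T j then (1:ℝ) else 0)) ≤ k * (N * σ) := by
      intro i _
      rw [sum_comm]
      calc _ ≤ ∑ j ∈ univ.erase i, N * σ := by
            refine sum_le_sum fun j hj => ?_
            rw [sum_comm, hs, mul_sum]
            exact sum_le_sum fun p _ => hpair i j p (ne_of_mem_erase hj).symm
        _ ≤ ∑ j : Fin k, N * σ := sum_le_sum_of_subset_of_nonneg (erase_subset _ _) fun j _ _ => mul_nonneg hN0 hσ0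
        _ = _ := by simp
    refine (sum_le_sum this).trans (le_of_eq ?_)
    simp; ring
  have hB : ∑ T : Fin k → Finset P, (∏ l, Hm pv g m l (T l)) * (∑ i, ∑ p, (3*k+2) / pv p * (if p ∈ T i then (1:ℝ) else 0)) ≤ N * (k * (3*k+2) * σ) := by
    simp_rw [mul_sum]
    rw [sum_comm]
    have : ∀ i ∈ (univ : Finset (Fin k)), ∑ T : Fin k → Finset P, ∑ p, (∏ l, Hm pv g m l (T l)) * ((3*k+2) / pv p * (if p ∈ T i then (1:ℝ) else 0)) ≤ N * ((3*k+2) * σ) := by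
      intro i _
      rw [sum_comm, hs, mul_sum, mul_sum]
      refine sum_le_sum fun p _ => ?_
      have hpp := hp1 p
      refine hsing i (fun S => (3*k+2) / pv p * (if p ∈ S then (1:ℝ) else 0)) _ (fun S => by split_ifs <;> positivity) ?_
      have h1 := Hm_mem pv hp0 g LR hg m i p
      calc ∑ S, Hm pv g m i S * ((3*k+2) / pv p * (if p ∈ S then (1:ℝ) else 0))
          = (3*k+2) / pv p * ∑ S, Hm pv g m i S * (if p ∈ S then (1:ℝ) else 0) := by
            rw [mul_sum]; exact sum_congr rfl fun S _ => by ring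
        _ ≤ (3*k+2) / pv p * (Nm pv g m i * (1 / pv p)) := mul_le_mul_of_nonneg_left h1 (by positivity)
        _ = _ := by field_simp
    refine (sum_le_sum this).trans (le_of_eq ?_)
    simp; ring
  have hC : ∑ T : Fin k → Finset P, (∏ l, Hm pv g m l (T l)) * (∑ i, 2 / LR * ell pv (T i)) ≤ N * (1/4) := by
    simp_rw [mul_sum]
    rw [sum_comm]
    have : ∀ i ∈ (univ : Finset (Fin k)), ∑ T : Fin k → Finset P, (∏ l, Hm pv g m l (T l)) * (2 / LR * ell pv (T i)) ≤ N * (1 / (4*k)) := by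
      intro i _
      refine hsing i (fun S => 2 / LR * ell pv S) _ (fun S => mul_nonneg (by positivity) (ell_nonneg pv hp0 S)) ?_
      have h1 := Hm_ell pv g m i (LR / (8*k)) (by positivity) (by
        rw [div_mul_eq_mul_div, le_div_iff₀ (by positivity)]; linarith)
      calc ∑ S, Hm pv g m i S * (2 / LR * ell pv S)
          = 2 / LR * ∑ S, Hm pv g m i S * ell pv S := by
            rw [mul_sum]; exact sum_congr rfl fun S _ => by ring
        _ ≤ 2 / LR * (Nm pv g m i * (LR / (8*k))) := mul_le_mul_of_nonneg_left h1 (by positivity)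
        _ = _ := by field_simp; ring
    refine (sum_le_sum this).trans (le_of_eq ?_)
    simp; field_simp
  have e1 : ∑ T : Fin k → Finset P, (∏ l, Hm pv g m l (T l)) * brk pv LR T = N
      - (∑ T : Fin k → Finset P, (∏ l, Hm pv g m l (T l)) * (∑ i, ∑ j ∈ univ.erase i, ∑ p, ((if p ∈ T i then 1 else 0) * (if p ∈ T j then (1:ℝ) else 0))))
      - (∑ T : Fin k → Finset P, (∏ l, Hm pv g m l (T l)) * (∑ i, ∑ p, (3*k+2) / pv p * (if p ∈ T i then (1:ℝ) else 0)))
      - (∑ T : Fin k → Finset P, (∏ l, Hm pv g m l (T l)) * (∑ i, 2 / LR * ell pv (T i))) := by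
    rw [← e0, ← sum_sub_distrib, ← sum_sub_distrib, ← sum_sub_distrib]
    refine sum_congr rfl fun T _ => ?_
    unfold brk
    generalize (∏ l, Hm pv g m l (T l)) = a
    ring
  rw [e1, ← eN]
  have h5 : N * (k^2 * σ) + N * (k * (3*k+2) * σ) ≤ N * (1/4) := by
    rw [← mul_add]
    refine mul_le_mul_of_nonneg_left ?_ hN0
    linarith
  linarith

theorem E2_ge' (pv : P → ℝ) (hp3 : ∀ p, 3 ≤ pv p) (hk : ∀ p, 3 * (k:ℝ) + 2 ≤ pv p) (g : ℝ → ℝ) (LR : ℝ) (hL : 0 < LR) (hg : GG g LR)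
    (hκ : ∑ p, 1 / (pv p - 1)^2 ≤ 1/2)
    (h3 : 8 * k * I3 pv g ≤ LR * I2 pv g) (hσ : ((k:ℝ)^2 + k * (3*k+2)) * ∑ p, 1 / (pv p)^2 ≤ 1/4) (m : Fin k) :
    JJ pv g^2 * I2 pv g ^ (k-1) / 4 ≤ tform (fun p => MM (q2 m (pv p))) (lam pv (YY pv g LR)) := by
  classical
  have hp1 : ∀ p, 0 < pv p := fun p => by linarith [hp3 p]
  have hk3 : ∀ p, 3 * (k:ℝ) ≤ pv p := fun p => by linarith [hk p]
  refine le_trans ?_ (E2_ge m pv hp3 hk3 _)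
  set Gd := univ.filter (fun x : P → Option (Fin k) => (∀ p, x p ≠ some m) ∧ ell pv (spp x) ≤ LR/2) with hGd
  have h1 := (stepD2 pv hp3 g LR hL hg h3 hσ m).trans (stepD1 pv hp3 hk g LR hL m)
  have h2 : ∑ x ∈ Gd, (∏ p, wC m (pv p) (x p)) * (∑ c, YY pv g LR c * ∏ p, eC m (x p) (c p))^2 ≤
      ∑ x : P → Option (Fin k), (∏ p, wC m (pv p) (x p)) * (∑ c, YY pv g LR c * ∏ p, eC m (x p) (c p))^2 := by
    refine sum_le_sum_of_subset_of_nonneg (subset_univ _) fun x _ _ => mul_nonneg (prod_nonneg fun p _ => ?_) (sq_nonneg _)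
    have h5 := hp3 p
    cases x p with
    | none =>
      simp only [wC]
      rw [sub_nonneg, div_le_one (by nlinarith)]; nlinarith
    | some i =>
      simp only [wC]
      split_ifs
      · exact le_rfl
      · linarith [hk3 p]
  refine le_trans ?_ h2
  calc JJ pv g^2 * I2 pv g ^ (k-1) / 4 = JJ pv g^2 / 2 * (I2 pv g ^ (k-1) / 2) := by ring
    _ ≤ JJ pv g^2 / 2 * _ := mul_le_mul_of_nonneg_left h1 (by positivity)
    _ ≤ _ := by
      rw [mul_sum]
      refine sum_le_sum fun x hx => ?_
      simp only [mem_filter, mem_univ, true_and] at hx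
      exact termC pv hp3 hk g LR hg hκ m x hx.1 hx.2
end sieve3
end DSR

namespace DSR
open Finset

lemma cop_lower (W : ℕ) (hW : 0 < W) (Q : ℕ) :
    (W.totient : ℝ) / W * ∑ j ∈ range Q, (1:ℝ)/(j+1) ≤ ∑ n ∈ (Ico 1 (Q*W+1)).filter (fun n => W.Coprime n), (1:ℝ)/n := by
  have hW' : (0:ℝ) < W := by exact_mod_cast hW
  induction Q with
  | zero => simp
  | succ Q ih =>
    rw [sum_range_succ, mul_add, sum_filter, ← sum_Ico_consecutive _ (show 1 ≤ Q*W+1 by omega) (show Q*W+1 ≤ (Q+1)*W+1 by nlinarith),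
      ← sum_filter, ← sum_filter]
    refine add_le_add ih ?_
    have e : (Q+1)*W+1 = (Q*W+1) + W := by ring
    rw [e]
    have hc := Nat.filter_coprime_Ico_eq_totient W (Q*W+1)
    calc (W.totient : ℝ) / W * (1/(Q+1)) = ∑ n ∈ (Ico (Q*W+1) (Q*W+1+W)).filter (fun n => W.Coprime n), (1:ℝ)/((Q+1)*W) := by
          rw [sum_const, hc, nsmul_eq_mul]; field_simp
      _ ≤ _ := by
          refine sum_le_sum fun n hn => ?_
          simp only [mem_filter, mem_Ico] at hn
          have h1 : (n:ℝ) ≤ (Q+1)*W := by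
            have : n ≤ (Q+1)*W := by rw [add_mul]; omega
            exact_mod_cast this
          have h2 : (0:ℝ) < n := by exact_mod_cast (show 0 < n by omega)
          exact one_div_le_one_div_of_le h2 h1

lemma cop_upper (W : ℕ) (hW : 0 < W) (Q : ℕ) :
    ∑ n ∈ (Ico 1 ((Q+1)*W+1)).filter (fun n => W.Coprime n), (1:ℝ)/n ≤ W + (W.totient : ℝ) / W * ∑ j ∈ range (Q+1), (1:ℝ)/j := by
  have hW' : (0:ℝ) < W := by exact_mod_cast hW
  induction Q with
  | zero =>
    simp only [zero_add, one_mul, range_one, sum_singleton, Nat.cast_zero, div_zero, mul_zero, add_zero]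
    calc ∑ n ∈ (Ico 1 (W+1)).filter (fun n => W.Coprime n), (1:ℝ)/n ≤ ∑ n ∈ Ico 1 (W+1), (1:ℝ)/n :=
          sum_le_sum_of_subset_of_nonneg (filter_subset _ _) fun _ _ _ => by positivity
      _ ≤ ∑ n ∈ Ico 1 (W+1), (1:ℝ) := sum_le_sum fun n hn => by
          have : (1:ℝ) ≤ n := by exact_mod_cast (mem_Ico.1 hn).1
          rw [div_le_one (by linarith)]; exact this
      _ = _ := by simp
  | succ Q ih =>
    rw [sum_range_succ, mul_add, sum_filter, ← sum_Ico_consecutive _ (show 1 ≤ (Q+1)*W+1 by omega) (show (Q+1)*W+1 ≤ (Q+1+1)*W+1 by nlinarith),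
      ← sum_filter, ← sum_filter, ← add_assoc]
    refine add_le_add ih ?_
    have e : (Q+1+1)*W+1 = ((Q+1)*W+1) + W := by ring
    rw [e]
    have hc := Nat.filter_coprime_Ico_eq_totient W ((Q+1)*W+1)
    calc _ ≤ ∑ n ∈ (Ico ((Q+1)*W+1) ((Q+1)*W+1+W)).filter (fun n => W.Coprime n), (1:ℝ)/((Q+1)*W) := by
          refine sum_le_sum fun n hn => ?_
          simp only [mem_filter, mem_Ico] at hn
          have h1 : ((Q:ℝ)+1)*W ≤ n := by
            have : (Q+1)*W ≤ n := by omega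
            exact_mod_cast this
          exact one_div_le_one_div_of_le (by positivity) h1
      _ = _ := by rw [sum_const, hc, nsmul_eq_mul]; push_cast; field_simp

noncomputable def Acop (W N : ℕ) : ℝ := ∑ n ∈ (Ico 1 (N+1)).filter (fun n => W.Coprime n), (1:ℝ)/n

lemma Acop_upper (W : ℕ) (hW : 0 < W) (N : ℕ) (hN : 0 < N) : Acop W N ≤ W + (W.totient : ℝ) / W * (1 + Real.log N) := by
  have h1 : N ≤ (N/W+1)*W := by
    have := Nat.lt_div_mul_add hW (a := N)
    rw [add_mul]; omega
  calc Acop W N ≤ ∑ n ∈ (Ico 1 ((N/W+1)*W+1)).filter (fun n => W.Coprime n), (1:ℝ)/n :=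
        sum_le_sum_of_subset_of_nonneg (filter_subset_filter _ (Ico_subset_Ico_right (by omega))) fun _ _ _ => by positivity
    _ ≤ _ := cop_upper W hW _
    _ ≤ _ := by
      have h2 := sum_inv_le (N/W)
      have h3 : Real.log ((N/W : ℕ):ℝ) ≤ Real.log N := by
        rcases Nat.eq_zero_or_pos (N/W) with h | h
        · rw [h]; simp; exact Real.log_natCast_nonneg _
        · exact Real.log_le_log (by exact_mod_cast h) (by exact_mod_cast Nat.div_le_self _ _)
      gcongr
      linarith

lemma Acop_lower (W : ℕ) (hW : 0 < W) (N : ℕ) :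
    (W.totient : ℝ) / W * (Real.log (N+1) - Real.log W) ≤ Acop W N := by
  have hW' : (0:ℝ) < W := by exact_mod_cast hW
  have h1 : N/W*W ≤ N := Nat.div_mul_le_self _ _
  have h2 : Real.log (N+1) - Real.log W ≤ ∑ j ∈ range (N/W), (1:ℝ)/(j+1) := by
    have h3 := log_add_one_le_harmonic (N/W)
    have e : ((harmonic (N/W) : ℚ) : ℝ) = ∑ j ∈ range (N/W), (1:ℝ)/(j+1) := by
      unfold harmonic; push_cast; exact sum_congr rfl fun j _ => by rw [one_div]
    rw [e] at h3
    refine le_trans ?_ h3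
    rw [← Real.log_div (by positivity) hW'.ne']
    refine Real.log_le_log (by positivity) ?_
    rw [div_le_iff₀ hW']
    have : N + 1 ≤ (N/W+1)*W := by
      have := Nat.lt_div_mul_add hW (a := N)
      rw [add_mul]; omega
    exact_mod_cast this
  calc _ ≤ (W.totient : ℝ) / W * ∑ j ∈ range (N/W), (1:ℝ)/(j+1) := by gcongr
    _ ≤ _ := cop_lower W hW _
    _ ≤ _ := sum_le_sum_of_subset_of_nonneg (filter_subset_filter _ (Ico_subset_Ico_right (by omega))) fun _ _ _ => by positivity

/-- sieving primes -/
abbrev PP (R W : ℕ) : Type := {p : ℕ // p ∈ (range (R+1)).filter (fun p => p.Prime ∧ ¬ p ∣ W)}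
noncomputable def pw (R W : ℕ) : PP R W → ℝ := fun p => (p.1 : ℝ)

lemma PP_prime {R W : ℕ} (p : PP R W) : p.1.Prime := (mem_filter.1 p.2).2.1
lemma PP_ndvd {R W : ℕ} (p : PP R W) : ¬ p.1 ∣ W := (mem_filter.1 p.2).2.2
lemma PP_le {R W : ℕ} (p : PP R W) : p.1 ≤ R := by have := (mem_filter.1 p.2).1; simp at this; omega

def pS {R W : ℕ} (S : Finset (PP R W)) : ℕ := ∏ p ∈ S, p.1

lemma pS_pos {R W : ℕ} (S : Finset (PP R W)) : 0 < pS S := prod_pos fun p _ => (PP_prime p).pos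
lemma vS_pS {R W : ℕ} (S : Finset (PP R W)) : vS (pw R W) S = 1 / (pS S : ℝ) := by
  unfold vS pS pw; push_cast; rw [prod_div_distrib]; simp
lemma ell_pS {R W : ℕ} (S : Finset (PP R W)) : ell (pw R W) S = Real.log (pS S : ℝ) := by
  unfold ell pS pw; push_cast
  rw [Real.log_prod]
  intro p _
  have := (PP_prime p).pos
  positivity

lemma mem_pS {R W : ℕ} (S : Finset (PP R W)) (p : PP R W) : p ∈ S ↔ p.1 ∣ pS S := by
  constructor
  · exact fun h => dvd_prod_of_mem (fun p : PP R W => p.1) h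
  · intro h
    obtain ⟨q, hq, hd⟩ := (PP_prime p).prime.exists_mem_finset_dvd h
    have := (Nat.prime_dvd_prime_iff_eq (PP_prime p) (PP_prime q)).1 hd
    rwa [Subtype.ext this]

lemma pS_inj {R W : ℕ} : Function.Injective (pS : Finset (PP R W) → ℕ) := by
  intro S S' h
  ext p; rw [mem_pS, mem_pS, h]

lemma pS_coprime {R W : ℕ} (S : Finset (PP R W)) : W.Coprime (pS S) :=
  Nat.Coprime.prod_right fun p _ => ((Nat.Prime.coprime_iff_not_dvd (PP_prime p)).2 (PP_ndvd p)).symm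

lemma pS_of_sqf {R W : ℕ} (b : ℕ) (hb : Squarefree b) (hR : b ≤ R) (hW : W.Coprime b) :
    pS (univ.filter fun p : PP R W => p.1 ∣ b) = b := by
  have hb0 : b ≠ 0 := hb.ne_zero
  conv_rhs => rw [← Nat.prod_primeFactors_of_squarefree hb]
  unfold pS
  refine prod_bij (fun p _ => p.1) ?_ ?_ ?_ ?_
  · intro p hp
    rw [Nat.mem_primeFactors]
    exact ⟨PP_prime p, (mem_filter.1 hp).2, hb0⟩
  · intro p _ q _ h; exact Subtype.ext h
  · intro q hq
    rw [Nat.mem_primeFactors] at hq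
    have hle := Nat.le_of_dvd (Nat.pos_of_ne_zero hb0) hq.2.1
    refine ⟨⟨q, ?_⟩, ?_, rfl⟩
    · simp only [mem_filter, mem_range]
      exact ⟨by omega, hq.1, fun h => hq.1.one_lt.ne' (Nat.dvd_one.1 (hW ▸ Nat.dvd_gcd h hq.2.1))⟩
    · simp [hq.2.1]
  · intros; rfl

lemma T0_le_Acop (R W : ℕ) (z : ℝ) : T0 (pw R W) z ≤ Acop W ⌊Real.exp z⌋₊ := by
  unfold T0
  simp only [mul_ite, mul_one, mul_zero]
  rw [← sum_filter]
  simp_rw [vS_pS, ell_pS]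
  rw [← sum_image (f := fun n : ℕ => 1 / (n:ℝ)) (fun S _ S' _ h => pS_inj h)]
  refine sum_le_sum_of_subset_of_nonneg ?_ fun _ _ _ => by positivity
  intro n hn
  obtain ⟨S, hS, rfl⟩ := mem_image.1 hn
  have hS := (mem_filter.1 hS).2
  simp only [mem_filter, mem_Ico]
  refine ⟨⟨pS_pos S, Nat.lt_succ_of_le (Nat.le_floor ?_)⟩, pS_coprime S⟩
  rwa [← Real.log_le_iff_le_exp (by exact_mod_cast pS_pos S)]

lemma sum_sq_le (N : ℕ) : ∑ n ∈ Ico 1 (N+1), 1/(n:ℝ)^2 ≤ 2 := by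
  rcases Nat.eq_zero_or_pos N with h | h
  · subst h; simp
  rw [sum_eq_sum_Ico_succ_bot (by omega)]
  have := sum_Ioc_inv_sq_le_sub (α := ℝ) one_ne_zero h
  have e : Ico (1+1) (N+1) = Ioc 1 N := by ext; simp; omega
  rw [e]
  simp only [one_div]
  have h2 : (0:ℝ) ≤ (N:ℝ)⁻¹ := by positivity
  simp at this ⊢
  linarith

lemma Acop_le_T0 (R W : ℕ) (z : ℝ) (hz : ⌊Real.exp z⌋₊ ≤ R) : Acop W ⌊Real.exp z⌋₊ ≤ 2 * T0 (pw R W) z := by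
  set N := ⌊Real.exp z⌋₊ with hN
  have hT : 0 ≤ T0 (pw R W) z := T0_nonneg _ (fun p => by unfold pw; exact_mod_cast (PP_prime p).one_lt.le) _
  choose a b h1 h2 using Nat.sq_mul_squarefree
  let ψ : ℕ → ℕ × Finset (PP R W) := fun n => (b n, univ.filter fun p : PP R W => p.1 ∣ a n)
  have hprop : ∀ n ∈ (Ico 1 (N+1)).filter (fun n => W.Coprime n), 0 < a n ∧ 0 < b n ∧ a n ≤ N ∧ b n ≤ N ∧ W.Coprime (a n) := by
    intro n hn
    simp only [mem_filter, mem_Ico] at hn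
    have ha : 0 < a n := Nat.pos_of_ne_zero (h2 n).ne_zero
    have hb : 0 < b n := by
      rcases Nat.eq_zero_or_pos (b n) with h | h
      · have := h1 n; rw [h] at this; simp at this; omega
      · exact h
    have e := h1 n
    have hda : a n ∣ n := Dvd.intro_left _ e
    have hdb : b n ∣ n := Dvd.intro (b n * a n) (by rw [← mul_assoc, ← sq]; exact e)
    have hn0 : 0 < n := by omega
    have := Nat.le_of_dvd hn0 hda
    have := Nat.le_of_dvd hn0 hdb
    exact ⟨ha, hb, by omega, by omega, hn.2.coprime_dvd_right hda⟩
  have hpS : ∀ n ∈ (Ico 1 (N+1)).filter (fun n => W.Coprime n), pS (univ.filter fun p : PP R W => p.1 ∣ a n) = a n := fun n hn =>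
    pS_of_sqf _ (h2 n) ((hprop n hn).2.2.1.trans hz) (hprop n hn).2.2.2.2
  have hinj : Set.InjOn ψ ((Ico 1 (N+1)).filter (fun n => W.Coprime n) : Finset ℕ) := by
    intro n hn n' hn' h
    simp only [ψ, Prod.mk.injEq] at h
    rw [← h1 n, ← h1 n', h.1, ← hpS n hn, ← hpS n' hn', h.2]
  have h3 : Acop W N = ∑ x ∈ ((Ico 1 (N+1)).filter (fun n => W.Coprime n)).image ψ, 1/(x.1:ℝ)^2 * (1 / (pS x.2:ℝ)) := by
    rw [sum_image hinj]
    refine sum_congr rfl fun n hn => ?_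
    simp only [ψ]
    have e2 : (n:ℝ) = (b n:ℝ)^2 * a n := by exact_mod_cast (h1 n).symm
    rw [hpS n hn, one_div_mul_one_div, ← e2]
  rw [h3]
  calc _ ≤ ∑ x ∈ (Ico 1 (N+1)) ×ˢ (univ.filter fun S : Finset (PP R W) => ell (pw R W) S ≤ z), 1/(x.1:ℝ)^2 * (1 / (pS x.2:ℝ)) := by
        refine sum_le_sum_of_subset_of_nonneg ?_ fun _ _ _ => by positivity
        intro x hx
        obtain ⟨n, hn, rfl⟩ := mem_image.1 hx
        have hp := hprop n hn
        simp only [ψ, mem_product, mem_Ico, mem_filter, mem_univ, true_and]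
        refine ⟨⟨hp.2.1, by omega⟩, ?_⟩
        rw [ell_pS, hpS n hn, Real.log_le_iff_le_exp (by exact_mod_cast hp.1)]
        exact (Nat.le_floor_iff (Real.exp_pos _).le).1 hp.2.2.1
    _ = (∑ n ∈ Ico 1 (N+1), 1/(n:ℝ)^2) * T0 (pw R W) z := by
        rw [sum_product, sum_mul]
        refine sum_congr rfl fun n _ => ?_
        dsimp only
        rw [← mul_sum]
        congr 1
        unfold T0
        simp only [mul_ite, mul_one, mul_zero]
        rw [← sum_filter]
        exact sum_congr rfl fun S _ => (vS_pS S).symm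
    _ ≤ _ := mul_le_mul_of_nonneg_right (sum_sq_le N) hT

lemma T0_upper (W : ℕ) (hW : 0 < W) : ∃ z0 : ℝ, 1 ≤ z0 ∧ ∀ R : ℕ, ∀ z : ℝ, z0 ≤ z → z ≤ Real.log R →
    T0 (pw R W) z ≤ 2 * ((W.totient : ℝ) / W) * z ∧ 1/4 * ((W.totient : ℝ) / W) * z ≤ T0 (pw R W) z := by
  have hW' : (0:ℝ) < W := by exact_mod_cast hW
  have hφ : (0:ℝ) < W.totient := by exact_mod_cast Nat.totient_pos.2 hW
  set ρ := (W.totient : ℝ) / W with hρ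
  have hρ0 : 0 < ρ := by positivity
  have hlW : 0 ≤ Real.log W := Real.log_natCast_nonneg _
  refine ⟨W/ρ + 1 + 2 * Real.log W, by have : 0 ≤ W/ρ := by positivity
                                       linarith, fun R z hz hzR => ?_⟩
  have hWr : 0 ≤ W/ρ := by positivity
  have hz1 : 1 ≤ z := by linarith
  have hN0 : 0 < ⌊Real.exp z⌋₊ := Nat.floor_pos.2 (Real.one_le_exp (by linarith))
  have hNle : (⌊Real.exp z⌋₊ : ℝ) ≤ Real.exp z := Nat.floor_le (Real.exp_pos _).le
  have hNlt : Real.exp z < ⌊Real.exp z⌋₊ + 1 := Nat.lt_floor_add_one _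
  constructor
  · have h1 := Acop_upper W hW _ hN0
    have h2 : Real.log (⌊Real.exp z⌋₊ : ℝ) ≤ z := by
      rw [Real.log_le_iff_le_exp (by exact_mod_cast hN0)]; exact hNle
    have h3 := T0_le_Acop R W z
    have h4 : ρ * (1 + Real.log (⌊Real.exp z⌋₊ : ℝ)) ≤ ρ * (1 + z) := by gcongr
    have h5 : (W:ℝ) + ρ ≤ ρ * z := by
      have : (W:ℝ) + ρ = ρ * (W/ρ + 1) := by field_simp
      rw [this]
      refine mul_le_mul_of_nonneg_left (by linarith) hρ0.le
    nlinarith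
  · have h1 := Acop_lower W hW ⌊Real.exp z⌋₊
    have h2 : z ≤ Real.log (⌊Real.exp z⌋₊ + 1 : ℝ) := by
      rw [Real.le_log_iff_exp_le (by positivity)]; exact hNlt.le
    have hR : 0 < (R:ℝ) := by
      by_contra h
      have : (R:ℝ) = 0 := le_antisymm (not_lt.1 h) (Nat.cast_nonneg _)
      rw [this] at hzR; simp at hzR; linarith
    have h3 := Acop_le_T0 R W z (by
      have : Real.exp z ≤ R := by rwa [← Real.le_log_iff_exp_le hR]
      exact_mod_cast hNle.trans this)
    have h4 : ρ * (z/2) ≤ ρ * (Real.log (⌊Real.exp z⌋₊ + 1 : ℝ) - Real.log W) :=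
      mul_le_mul_of_nonneg_left (by linarith) hρ0.le
    linarith

lemma T0_crude (R W : ℕ) (hR : 1 ≤ R) : T0 (pw R W) (Real.log R) ≤ 1 + Real.log R := by
  have hR' : (0:ℝ) < R := by exact_mod_cast hR
  refine (T0_le_Acop R W _).trans ?_
  rw [Real.exp_log hR', Nat.floor_natCast]
  refine le_trans ?_ (sum_inv_Ioc R)
  refine sum_le_sum_of_subset_of_nonneg ?_ fun _ _ _ => by positivity
  intro n hn; simp at hn ⊢; omega
end DSR

namespace DSR
open Finset

noncomputable def gf (J0 : ℕ) (L0 x : ℝ) : ℝ := ∑ l ∈ range (J0+1), (1/2:ℝ)^(l+1) * (if x ≤ 2^l * L0 then 1 else 0)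

lemma half_sum (n : ℕ) : ∑ l ∈ range n, (1/2:ℝ)^(l+1) = 1 - (1/2)^n := by
  induction n with
  | zero => simp
  | succ n ih => rw [sum_range_succ, ih]; ring

lemma gf_GG (J0 : ℕ) (L0 LR : ℝ) (hL0 : 0 ≤ L0) (h : 2^J0 * L0 ≤ LR/2) : GG (gf J0 L0) LR where
  nonneg x := sum_nonneg fun l _ => by split_ifs <;> positivity
  le1 x := by
    calc gf J0 L0 x ≤ ∑ l ∈ range (J0+1), (1/2:ℝ)^(l+1) := sum_le_sum fun l _ => by
          split_ifs
          · simp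
          · simp
      _ ≤ 1 := by rw [half_sum]; have : (0:ℝ) ≤ (1/2)^(J0+1) := by positivity
                  linarith
  anti x y hxy := by
    refine sum_le_sum fun l _ => mul_le_mul_of_nonneg_left ?_ (by positivity)
    split_ifs with h1 h2
    · exact le_rfl
    · exact absurd (hxy.trans h1) h2
    · exact zero_le_one
    · exact le_rfl
  supp x hx := by
    refine sum_eq_zero fun l hl => ?_
    rw [if_neg, mul_zero]
    intro h2
    have : (2:ℝ)^l ≤ 2^J0 := pow_le_pow_right₀ (by norm_num) (by simp at hl; omega)
    have := mul_le_mul_of_nonneg_right this hL0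
    linarith

lemma gf_sq (J0 : ℕ) (L0 x : ℝ) (hL0 : 0 ≤ L0) :
    gf J0 L0 x ^ 2 ≤ ∑ l ∈ range (J0+1), (1/4:ℝ)^l * (if x ≤ 2^l * L0 then 1 else 0) := by
  classical
  by_cases h : ∃ l, l ∈ range (J0+1) ∧ x ≤ 2^l * L0
  · set l0 := Nat.find h with hl0
    obtain ⟨h1, h2⟩ := Nat.find_spec h
    rw [← hl0] at h1 h2
    have hmin : ∀ l, l ∈ range (J0+1) → x ≤ 2^l * L0 → l0 ≤ l := fun l a b => Nat.find_min' h ⟨a, b⟩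
    have h3 : gf J0 L0 x ≤ (1/2)^l0 := by
      unfold gf
      calc _ ≤ ∑ l ∈ Ico l0 (J0+1), (1/2:ℝ)^(l+1) := by
            simp only [mul_ite, mul_one, mul_zero]
            rw [← sum_filter]
            refine sum_le_sum_of_subset_of_nonneg ?_ fun _ _ _ => by positivity
            intro l hl
            rw [mem_filter] at hl
            rw [mem_Ico]
            exact ⟨hmin l hl.1 hl.2, mem_range.1 hl.1⟩
        _ = (1/2)^l0 - (1/2)^(J0+1) := by
            rw [sum_Ico_eq_sub _ (mem_range.1 h1).le, half_sum, half_sum]; ring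
        _ ≤ _ := by have : (0:ℝ) ≤ (1/2)^(J0+1) := by positivity
                    linarith
    have h4 : 0 ≤ gf J0 L0 x := sum_nonneg fun l _ => by split_ifs <;> positivity
    calc gf J0 L0 x^2 ≤ ((1/2)^l0)^2 := pow_le_pow_left₀ h4 h3 2
      _ = (1/4:ℝ)^l0 * (if x ≤ 2^l0 * L0 then 1 else 0) := by
        rw [if_pos h2, mul_one, ← pow_mul, mul_comm, pow_mul]; norm_num
      _ ≤ _ := single_le_sum (f := fun l => (1/4:ℝ)^l * (if x ≤ 2^l * L0 then 1 else 0)) (fun l _ => by split_ifs <;> positivity) h1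
  · push Not at h
    have : gf J0 L0 x = 0 := sum_eq_zero fun l hl => by rw [if_neg (not_le.2 (h l hl)), mul_zero]
    rw [this]
    simp only [ne_eq, OfNat.ofNat_ne_zero, not_false_eq_true, zero_pow]
    exact sum_nonneg fun l _ => by split_ifs <;> positivity

section
variable {P : Type} [Fintype P] [DecidableEq P]

lemma JJ_eq (pv : P → ℝ) (J0 : ℕ) (L0 : ℝ) :
    JJ pv (gf J0 L0) = ∑ l ∈ range (J0+1), (1/2:ℝ)^(l+1) * T0 pv (2^l * L0) := by
  unfold JJ gf T0
  simp_rw [mul_sum]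
  rw [sum_comm]
  exact sum_congr rfl fun l _ => sum_congr rfl fun S _ => by ring

lemma I2_le (pv : P → ℝ) (hp : ∀ p, 0 < pv p) (J0 : ℕ) (L0 : ℝ) (hL0 : 0 ≤ L0) :
    I2 pv (gf J0 L0) ≤ ∑ l ∈ range (J0+1), (1/4:ℝ)^l * T0 pv (2^l * L0) := by
  unfold I2 T0
  calc _ ≤ ∑ S, vS pv S * ∑ l ∈ range (J0+1), (1/4:ℝ)^l * (if ell pv S ≤ 2^l * L0 then 1 else 0) :=
        sum_le_sum fun S _ => mul_le_mul_of_nonneg_left (gf_sq J0 L0 _ hL0) (vS_pos pv hp S).le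
    _ = _ := by
      simp_rw [mul_sum]
      rw [sum_comm]
      exact sum_congr rfl fun l _ => sum_congr rfl fun S _ => by ring

lemma I3_le (pv : P → ℝ) (hp : ∀ p, 1 ≤ pv p) (J0 : ℕ) (L0 : ℝ) (hL0 : 0 ≤ L0) :
    I3 pv (gf J0 L0) ≤ ∑ l ∈ range (J0+1), (1/4:ℝ)^l * (2^l * L0 * T0 pv (2^l * L0)) := by
  have hp1 : ∀ p, 0 < pv p := fun p => by linarith [hp p]
  unfold I3 T0
  calc _ ≤ ∑ S, ∑ l ∈ range (J0+1), (1/4:ℝ)^l * (2^l * L0 * (vS pv S * (if ell pv S ≤ 2^l * L0 then 1 else 0))) := by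
        refine sum_le_sum fun S _ => ?_
        have h1 := mul_le_mul_of_nonneg_left (gf_sq J0 L0 (ell pv S) hL0) (mul_nonneg (vS_pos pv hp1 S).le (ell_nonneg pv hp S))
        calc vS pv S * gf J0 L0 (ell pv S)^2 * ell pv S = vS pv S * ell pv S * gf J0 L0 (ell pv S)^2 := by ring
          _ ≤ _ := h1
          _ ≤ _ := by
            rw [mul_sum]
            refine sum_le_sum fun l _ => ?_
            have hv := (vS_pos pv hp1 S).le
            split_ifs with h
            · calc vS pv S * ell pv S * ((1/4:ℝ)^l * 1) = ((1/4:ℝ)^l * vS pv S) * ell pv S := by ring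
                _ ≤ ((1/4:ℝ)^l * vS pv S) * (2^l * L0) := mul_le_mul_of_nonneg_left h (by positivity)
                _ = _ := by ring
            · simp
    _ = _ := by
      simp_rw [mul_sum]
      rw [sum_comm]

lemma I2_ge (pv : P → ℝ) (hp : ∀ p, 0 < pv p) (J0 : ℕ) (L0 : ℝ) (hL0 : 0 ≤ L0) :
    1/4 * T0 pv L0 ≤ I2 pv (gf J0 L0) := by
  unfold I2 T0
  rw [mul_sum]
  refine sum_le_sum fun S _ => ?_
  have hv := (vS_pos pv hp S).le
  split_ifs with h
  · have h1 : 1/2 ≤ gf J0 L0 (ell pv S) := by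
      calc (1/2:ℝ) = (1/2:ℝ)^(0+1) * (if ell pv S ≤ 2^0 * L0 then 1 else 0) := by simp [h]
        _ ≤ _ := single_le_sum (f := fun l => (1/2:ℝ)^(l+1) * (if ell pv S ≤ 2^l * L0 then (1:ℝ) else 0))
          (fun l _ => by split_ifs <;> positivity) (by simp)
    have h2 : 1/4 ≤ gf J0 L0 (ell pv S)^2 := by nlinarith
    nlinarith [mul_le_mul_of_nonneg_left h2 hv]
  · have : 0 ≤ gf J0 L0 (ell pv S)^2 := sq_nonneg _
    simp; positivity
end

lemma PP_sigma (R W D0 : ℕ) (hD : 3 ≤ D0) (hW : ∀ p, p.Prime → p ≤ D0 → p ∣ W) :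
    ∑ p : PP R W, 1 / (pw R W p - 1)^2 ≤ 1 / ((D0:ℝ) - 1) := by
  have hlt : ∀ p : PP R W, D0 < p.1 := fun p => by
    by_contra h
    exact PP_ndvd p (hW p.1 (PP_prime p) (not_lt.1 h))
  have e : ∀ p : PP R W, 1 / (pw R W p - 1)^2 = (((p.1 - 1 : ℕ) : ℝ)^2)⁻¹ := by
    intro p
    have := hlt p
    unfold pw
    rw [Nat.cast_sub (by omega)]; simp
  simp_rw [e]
  rw [← sum_image (f := fun n : ℕ => ((n:ℝ)^2)⁻¹) (s := univ) (g := fun p : PP R W => p.1 - 1)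
    (fun p _ q _ h => by
      have := hlt p
      have := hlt q
      simp only at h
      exact Subtype.ext (by omega))]
  have h1 := sum_Ioc_inv_sq_le_sub (α := ℝ) (k := D0 - 1) (n := max (D0-1) R) (by omega) (le_max_left _ _)
  have h2 : (0:ℝ) ≤ ((max (D0-1) R : ℕ) : ℝ)⁻¹ := by positivity
  have h3 : ((D0 - 1 : ℕ) : ℝ)⁻¹ = 1 / ((D0:ℝ) - 1) := by rw [Nat.cast_sub (by omega)]; simp
  rw [h3] at h1
  refine le_trans (sum_le_sum_of_subset_of_nonneg ?_ fun _ _ _ => by positivity) (h1.trans (by linarith))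
  intro n hn
  obtain ⟨p, -, rfl⟩ := mem_image.1 hn
  have := hlt p
  have := PP_le p
  rw [mem_Ioc]
  exact ⟨by omega, le_trans (by omega) (le_max_right _ _)⟩

set_option maxHeartbeats 1600000 in
/-- The sieve weights. -/
theorem sieve_weights (J0 k : ℕ) (hk : k = 2^J0) (W : ℕ) (hW0 : 0 < W) (hW : ∀ p, p.Prime → p ≤ 24*k^2+3 → p ∣ W) :
    ∃ L1 : ℝ, ∀ R : ℕ, 1 ≤ R → L1 ≤ Real.log R → ∃ lm : (PP R W → Option (Fin k)) → ℝ, ∃ E : ℝ, 1 ≤ E ∧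
      (∀ d, Real.log R < ell (pw R W) (spp d) → lm d = 0) ∧
      (∀ d, |lm d| ≤ (1 + Real.log R)^k) ∧
      (∑ d, |lm d| ≤ R * (1 + Real.log R)^(2*k)) ∧
      (tform (fun p => MM (fun _ => 1/pw R W p)) lm ≤ E) ∧
      (∀ m : Fin k, 1 / 262144 * ((W.totient : ℝ) / W) * Real.log R * (J0+1) / k * E ≤
        tform (fun p => MM (q2 m (pw R W p))) lm) := by
  have hk1 : (1:ℝ) ≤ k := by rw [hk]; exact_mod_cast Nat.one_le_two_pow
  have hk0 : (0:ℝ) < k := by linarith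
  have hkn : 1 ≤ k := by exact_mod_cast hk1
  obtain ⟨z0, hz0, hM⟩ := T0_upper W hW0
  have hW' : (0:ℝ) < W := by exact_mod_cast hW0
  have hφ : (0:ℝ) < W.totient := by exact_mod_cast Nat.totient_pos.2 hW0
  set ρ := (W.totient : ℝ) / W with hρ
  have hρ0 : 0 < ρ := by positivity
  refine ⟨256 * k * (J0+1) * (z0 + 16/ρ), fun R hR hL => ?_⟩
  set LR := Real.log R with hLR
  have hR' : (0:ℝ) < R := by exact_mod_cast hR
  set L0 := LR / (256 * k * (J0+1)) with hL0d
  have hden : (0:ℝ) < 256 * k * (J0+1) := by positivity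
  have hL0 : z0 + 16/ρ ≤ L0 := by rw [hL0d, le_div_iff₀ hden]; linarith
  have h16 : 0 < 16/ρ := by positivity
  have hL0z : z0 ≤ L0 := by linarith
  have hL0p : 0 < L0 := by linarith
  have hLRe : LR = 256 * k * (J0+1) * L0 := by rw [hL0d]; field_simp
  have hJ : (0:ℝ) ≤ J0 := by positivity
  have hkJ : (2:ℝ)^J0 = k := by rw [hk]; push_cast; rfl
  have hkL : 0 < k * L0 := by positivity
  have hLRp : 0 < LR := by rw [hLRe]; positivity
  have h1 : 2^J0 * L0 ≤ LR/2 := by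
    rw [hkJ, hLRe]
    nlinarith [mul_nonneg hkL.le hJ]
  have hg := gf_GG J0 L0 LR hL0p.le h1
  have hl : ∀ l ∈ range (J0+1), z0 ≤ 2^l * L0 ∧ 2^l * L0 ≤ LR := by
    intro l hl
    have h2 : (2:ℝ)^l ≤ 2^J0 := pow_le_pow_right₀ (by norm_num) (by simp at hl; omega)
    have h3 : (1:ℝ) ≤ 2^l := one_le_pow₀ (by norm_num)
    constructor
    · nlinarith
    · have := mul_le_mul_of_nonneg_right h2 hL0p.le
      linarith
  have hpP : ∀ p : PP R W, (24*(k:ℝ)^2+3) + 1 ≤ pw R W p := by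
    intro p
    have : 24*k^2+3 < p.1 := by
      by_contra h
      exact PP_ndvd p (hW p.1 (PP_prime p) (not_lt.1 h))
    unfold pw
    exact_mod_cast this
  have hp3 : ∀ p : PP R W, 3 ≤ pw R W p := fun p => by nlinarith [hpP p]
  have hp1 : ∀ p : PP R W, 1 ≤ pw R W p := fun p => by linarith [hp3 p]
  have hp0 : ∀ p : PP R W, 0 < pw R W p := fun p => by linarith [hp3 p]
  have hpk : ∀ p : PP R W, 3 * (k:ℝ) + 2 ≤ pw R W p := fun p => by nlinarith [hpP p]
  have hJJ : ρ * L0 * (J0+1) / 8 ≤ JJ (pw R W) (gf J0 L0) := by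
    rw [JJ_eq]
    calc ρ * L0 * (J0+1) / 8 = ∑ l ∈ range (J0+1), ρ * L0 / 8 := by
          rw [sum_const, card_range, nsmul_eq_mul]; push_cast; ring
      _ ≤ _ := by
          refine sum_le_sum fun l hl' => ?_
          have h2 := (hM R (2^l*L0) (hl l hl').1 (hl l hl').2).2
          calc ρ * L0 / 8 = (1/2:ℝ)^(l+1) * (1/4 * ρ * (2^l*L0)) := by
                rw [pow_succ, one_div, inv_pow]; field_simp; norm_num
            _ ≤ _ := mul_le_mul_of_nonneg_left h2 (by positivity)
  have hI2u : I2 (pw R W) (gf J0 L0) ≤ 4 * ρ * L0 := by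
    refine (I2_le _ hp0 J0 L0 hL0p.le).trans ?_
    calc _ ≤ ∑ l ∈ range (J0+1), 4 * ρ * L0 * (1/2:ℝ)^(l+1) := by
          refine sum_le_sum fun l hl' => ?_
          have h2 := (hM R (2^l*L0) (hl l hl').1 (hl l hl').2).1
          calc _ ≤ (1/4:ℝ)^l * (2 * ρ * (2^l*L0)) := mul_le_mul_of_nonneg_left h2 (by positivity)
            _ = 2 * ρ * L0 * ((1/4:ℝ)^l * 2^l) := by ring
            _ = _ := by rw [← mul_pow, pow_succ]; norm_num; ring
      _ = 4 * ρ * L0 * (1 - (1/2)^(J0+1)) := by rw [← mul_sum, half_sum]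
      _ ≤ 4 * ρ * L0 * 1 := by
          have : (0:ℝ) ≤ (1/2)^(J0+1) := by positivity
          refine mul_le_mul_of_nonneg_left (by linarith) (by positivity)
      _ = _ := mul_one _
  have hI3u : I3 (pw R W) (gf J0 L0) ≤ 2 * ρ * L0^2 * (J0+1) := by
    refine (I3_le _ hp1 J0 L0 hL0p.le).trans ?_
    calc _ ≤ ∑ l ∈ range (J0+1), 2 * ρ * L0^2 := by
          refine sum_le_sum fun l hl' => ?_
          have h2 := (hM R (2^l*L0) (hl l hl').1 (hl l hl').2).1
          calc _ ≤ (1/4:ℝ)^l * (2^l*L0 * (2 * ρ * (2^l*L0))) := by gcongr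
            _ = 2 * ρ * L0^2 * ((1/4:ℝ)^l * (2^l*2^l)) := by ring
            _ = _ := by rw [← mul_pow, ← mul_pow]; norm_num
      _ = _ := by rw [sum_const, card_range, nsmul_eq_mul]; push_cast; ring
  have hI2l : ρ * L0 / 16 ≤ I2 (pw R W) (gf J0 L0) := by
    have h2 := I2_ge (pw R W) hp0 J0 L0 hL0p.le
    have h3 := (hM R L0 hL0z (by have := (hl 0 (by simp)).2; simpa using this)).2
    linarith
  have hI21 : 1 ≤ I2 (pw R W) (gf J0 L0) := by
    refine le_trans ?_ hI2l
    have : 16/ρ ≤ L0 := by linarith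
    rw [div_le_iff₀ hρ0] at this
    linarith
  have hc3 : 8 * k * I3 (pw R W) (gf J0 L0) ≤ LR * I2 (pw R W) (gf J0 L0) := by
    calc 8 * k * I3 (pw R W) (gf J0 L0) ≤ 8 * k * (2 * ρ * L0^2 * (J0+1)) := by gcongr
      _ = 256 * k * (J0+1) * L0 * (ρ * L0 / 16) := by ring
      _ ≤ _ := by rw [hLRe]; exact mul_le_mul_of_nonneg_left hI2l (by positivity)
  have hσ1 := PP_sigma R W (24*k^2+3) (by omega) hW
  have hcast : (((24*k^2+3 : ℕ) : ℝ) - 1) = 24*(k:ℝ)^2+2 := by push_cast; ring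
  rw [hcast] at hσ1
  have hκ : ∑ p, 1 / (pw R W p - 1)^2 ≤ 1/2 := hσ1.trans (by
    rw [div_le_div_iff₀ (by positivity) (by norm_num)]; nlinarith)
  have hσ : ((k:ℝ)^2 + k * (3*k+2)) * ∑ p, 1 / (pw R W p)^2 ≤ 1/4 := by
    have h2 : ∑ p, 1 / (pw R W p)^2 ≤ ∑ p, 1 / (pw R W p - 1)^2 := sum_le_sum fun p _ => by
      have := hp3 p
      refine one_div_le_one_div_of_le (by nlinarith) (by nlinarith)
    calc _ ≤ ((k:ℝ)^2 + k * (3*k+2)) * (1 / (24*(k:ℝ)^2+2)) := mul_le_mul_of_nonneg_left (h2.trans hσ1) (by positivity)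
      _ ≤ _ := by
        rw [mul_one_div, div_le_div_iff₀ (by positivity) (by norm_num)]; nlinarith
  have hT0 : T0 (pw R W) LR ≤ 1 + LR := T0_crude R W hR
  have hT00 := T0_nonneg (pw R W) hp1 LR
  refine ⟨lam (pw R W) (YY (pw R W) (gf J0 L0) LR), I2 (pw R W) (gf J0 L0)^k, one_le_pow₀ hI21, fun d hd => lam_zero _ hp1 _ _ d hd,
    fun d => (lam_le _ hp1 _ _ hg d).trans (pow_le_pow_left₀ hT00 hT0 k), ?_, ?_, fun m => ?_⟩
  · refine (lam_l1 _ hp1 _ _ hg).trans ?_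
    rw [hLR, Real.exp_log hR', ← hLR]
    exact mul_le_mul_of_nonneg_left (pow_le_pow_left₀ hT00 hT0 _) hR'.le
  · exact E1_le' _ hp1 (fun p => by linarith [hpk p]) _ _ hg
  · refine le_trans ?_ (E2_ge' _ hp3 hpk _ _ hLRp hg hκ hc3 hσ m)
    set I := I2 (pw R W) (gf J0 L0) with hI
    have hIp : 0 < I := by linarith
    have e1 : I^k = I * I^(k-1) := by rw [← pow_succ', Nat.sub_add_cancel hkn]
    have hJ2 := pow_le_pow_left₀ (by positivity) hJJ 2
    have h5 : 1 / 262144 * ρ * LR * (J0+1) / k * I ≤ JJ (pw R W) (gf J0 L0)^2/4 := by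
      have e2 : 1 / 262144 * ρ * LR * (J0+1) / k = 1/1024 * ρ * L0 * (J0+1)^2 := by
        rw [hLRe]; field_simp; norm_num
      rw [e2]
      calc 1/1024 * ρ * L0 * (J0+1)^2 * I ≤ 1/1024 * ρ * L0 * (J0+1)^2 * (4 * ρ * L0) :=
            mul_le_mul_of_nonneg_left hI2u (by positivity)
        _ = (ρ * L0 * (J0+1) / 8)^2/4 := by ring
        _ ≤ _ := by linarith
    rw [e1]
    calc _ = (1 / 262144 * ρ * LR * (J0+1) / k * I) * I^(k-1) := by ring
      _ ≤ (JJ (pw R W) (gf J0 L0)^2/4) * I^(k-1) := mul_le_mul_of_nonneg_right h5 (by positivity)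
      _ = _ := by ring
end DSR

namespace DSR
open Finset

section pairs
variable {k R W : ℕ}

def ind (h : Fin k → ℕ) (t p : ℕ) (s : Option (Fin k)) (N : ℕ) : ℝ :=
  match s with
  | none => 1
  | some i => if N + h i ≡ t [MOD p] then 1 else 0

lemma crt_PP (b : ℕ) (r : PP R W → ℕ) (S : Finset (PP R W)) :
    ∃ a, ∀ n, (n ≡ b [MOD W] ∧ ∀ p ∈ S, n ≡ r p [MOD p.1]) ↔ n ≡ a [MOD W * pS S] := by
  induction S using Finset.induction_on with
  | empty => exact ⟨b, fun n => by simp [pS]⟩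
  | insert p S hp ih =>
    obtain ⟨a, ha⟩ := ih
    have e : pS (insert p S) = p.1 * pS S := by unfold pS; rw [prod_insert hp]
    have hc : Nat.Coprime p.1 (W * pS S) := by
      rw [Nat.Prime.coprime_iff_not_dvd (PP_prime p), Nat.Prime.dvd_mul (PP_prime p), ← mem_pS]
      rintro (h | h)
      · exact PP_ndvd p h
      · exact hp h
    refine ⟨Nat.chineseRemainder hc (r p) a, fun n => ?_⟩
    rw [e, show W * (p.1 * pS S) = p.1 * (W * pS S) by ring, ← Nat.modEq_and_modEq_iff_modEq_mul hc]
    have h1 := (Nat.chineseRemainder hc (r p) a).2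
    constructor
    · rintro ⟨h2, h3⟩
      exact ⟨(h3 p (mem_insert_self _ _)).trans h1.1.symm,
        ((ha n).1 ⟨h2, fun x hx => h3 x (mem_insert_of_mem hx)⟩).trans h1.2.symm⟩
    · rintro ⟨h2, h3⟩
      have h4 := (ha n).2 (h3.trans h1.2)
      refine ⟨h4.1, fun x hx => ?_⟩
      rcases mem_insert.1 hx with rfl | hx
      · exact h2.trans h1.1
      · exact h4.2 x hx

lemma shift_mod (N x t p : ℕ) (hp : 0 < p) : N + x ≡ t [MOD p] ↔ N ≡ t + (p-1)*x [MOD p] := by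
  have h : (p-1)*x + x = p * x := by
    rw [← Nat.succ_mul, Nat.succ_eq_add_one, Nat.sub_add_cancel hp]
  constructor
  · intro h1
    have h2 := h1.add_right ((p-1)*x)
    rw [add_assoc, add_comm x, h] at h2
    exact (show N + p * x ≡ N [MOD p] by simp [Nat.ModEq]).symm.trans h2
  · intro h1
    have h2 := h1.add_right x
    rw [add_assoc, h] at h2
    exact h2.trans (show t + p * x ≡ t [MOD p] by simp [Nat.ModEq])

lemma pair_cases (h : Fin k → ℕ) (hW : ∀ i j, i ≠ j → ∀ p, p.Prime → h i ≡ h j [MOD p] → p ∣ W) (t : ℕ)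
    (d d' : PP R W → Option (Fin k)) :
    ((∀ N, ∏ p, (ind h t p.1 (d p) N * ind h t p.1 (d' p) N) = 0) ∧
      ∀ q : PP R W → Fin k → ℝ, ∏ p, MM (q p) (d p) (d' p) = 0) ∨
    ∃ e : PP R W → Option (Fin k), spp e = spp d ∪ spp d' ∧
      (∀ N, ∏ p, (ind h t p.1 (d p) N * ind h t p.1 (d' p) N) = ∏ p, ind h t p.1 (e p) N) ∧
      ∀ q : PP R W → Fin k → ℝ, ∏ p, MM (q p) (d p) (d' p) = ∏ p, MM (q p) (e p) none := by
  by_cases hc : ∀ p i j, d p = some i → d' p = some j → i = j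
  · right
    refine ⟨fun p => (d p).or (d' p), ?_, fun N => prod_congr rfl fun p _ => ?_, fun q => prod_congr rfl fun p _ => ?_⟩
    · ext p
      simp only [spp, mem_filter, mem_univ, true_and, mem_union]
      cases d p <;> simp
    · have := hc p
      cases h1 : d p <;> cases h2 : d' p <;> simp_all [ind]
    · have := hc p
      cases h1 : d p <;> cases h2 : d' p <;> simp_all [MM]
  · left
    push Not at hc
    obtain ⟨p, i, j, h1, h2, hij⟩ := hc
    refine ⟨fun N => prod_eq_zero (mem_univ p) ?_, fun q => prod_eq_zero (mem_univ p) ?_⟩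
    · rw [h1, h2]
      simp only [ind]
      split_ifs with h3 h4 <;> simp
      exact PP_ndvd p (hW i j hij p.1 (PP_prime p) (Nat.ModEq.add_left_cancel' N (h3.trans h4.symm)))
    · rw [h1, h2]; simp [MM, hij]

lemma ind_eval (h : Fin k → ℕ) (t b : ℕ) (e : PP R W → Option (Fin k)) :
    ∃ a, (∀ N, N ≡ a [MOD W * pS (spp e)] → N ≡ b [MOD W] ∧ ∀ p i, e p = some i → N + h i ≡ t [MOD p.1]) ∧
      ∀ (A : Finset ℕ) (w : ℕ → ℝ), ∑ n ∈ A.filter (fun n => n ≡ b [MOD W]), w n * ∏ p, ind h t p.1 (e p) n =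
        ∑ n ∈ A.filter (fun n => n ≡ a [MOD W * pS (spp e)]), w n := by
  obtain ⟨a, ha⟩ := crt_PP b (fun p => match e p with | none => 0 | some i => t + (p.1-1) * h i) (spp e)
  have key : ∀ n, n ≡ a [MOD W * pS (spp e)] ↔ n ≡ b [MOD W] ∧ ∀ p i, e p = some i → n + h i ≡ t [MOD p.1] := by
    intro n
    rw [← ha]
    refine and_congr_right fun _ => ⟨fun h1 p i hi => ?_, fun h1 p hp => ?_⟩
    · have := h1 p (by simp [spp, hi])
      rw [hi] at this
      exact (shift_mod _ _ _ _ (PP_prime p).pos).2 this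
    · cases hi : e p with
      | none => simp [spp, hi] at hp
      | some i => exact (shift_mod _ _ _ _ (PP_prime p).pos).1 (h1 p i hi)
  refine ⟨a, fun N hN => (key N).1 hN, fun A w => ?_⟩
  rw [sum_filter, sum_filter]
  refine sum_congr rfl fun n _ => ?_
  by_cases hb : n ≡ b [MOD W]
  · rw [if_pos hb]
    by_cases hn : n ≡ a [MOD W * pS (spp e)]
    · rw [if_pos hn, prod_eq_one, mul_one]
      intro p _
      cases hi : e p with
      | none => rfl
      | some i => simp [ind, ((key n).1 hn).2 p i hi]
    · rw [if_neg hn]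
      rw [key] at hn
      push Not at hn
      obtain ⟨p, i, h1, h2⟩ := hn hb
      rw [prod_eq_zero (mem_univ p), mul_zero]
      rw [h1]; simp [ind, h2]
  · rw [if_neg hb, if_neg fun h => hb ((key n).1 h).1]

lemma prod_MM (q : PP R W → ℝ) (e : PP R W → Option (Fin k)) (Q : PP R W → Fin k → ℝ)
    (hQ : ∀ p i, e p = some i → Q p i = q p) : ∏ p, MM (Q p) (e p) none = ∏ p ∈ spp e, q p := by
  unfold spp
  rw [prod_filter]
  refine prod_congr rfl fun p _ => ?_
  cases hi : e p with
  | none => simp [MM]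
  | some i => simp [MM, hQ p i hi]

lemma pS_union_le (S T : Finset (PP R W)) : pS (S ∪ T) ≤ pS S * pS T := by
  have h := prod_union_inter (s₁ := S) (s₂ := T) (f := fun p : PP R W => p.1)
  have h2 := pS_pos (S ∩ T)
  unfold pS at *
  rw [← h]
  exact Nat.le_mul_of_pos_right _ h2

lemma S1_pair (X : ℝ) (f : ℝ → ℝ) (hf : FF X f) (h : Fin k → ℕ) (hW : ∀ i j, i ≠ j → ∀ p, p.Prime → h i ≡ h j [MOD p] → p ∣ W)
    (b : ℕ) (hW0 : 0 < W) (hq : 2 * ((W:ℝ) * R^2) ≤ Real.exp (X/8)) (d d' : PP R W → Option (Fin k))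
    (hd : pS (spp d) ≤ R) (hd' : pS (spp d') ≤ R) :
    |∑ n ∈ (range (Nx X)).filter (fun n => n ≡ b [MOD W]), w1 X f n * ∏ p, (ind h 0 p.1 (d p) n * ind h 0 p.1 (d' p) n)
      - mass1 X f / W * ∏ p, MM (fun _ => 1/pw R W p) (d p) (d' p)| ≤ 4 * Real.exp (-(X/8)) * (4*X+2) := by
  have hX := hf.pos
  rcases pair_cases h hW 0 d d' with ⟨h1, h2⟩ | ⟨e, he, h1, h2⟩
  · simp only [h1, h2 (fun p _ => 1 / pw R W p), mul_zero, sum_const_zero, sub_zero, abs_zero]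
    positivity
  · obtain ⟨a, -, ha⟩ := ind_eval h 0 b e
    simp only [h1]
    rw [h2 (fun p _ => 1 / pw R W p), ha, prod_MM (fun p => 1 / pw R W p) e _ (fun _ _ _ => rfl)]
    have hle : pS (spp e) ≤ R * R := by rw [he]; exact (pS_union_le _ _).trans (Nat.mul_le_mul hd hd')
    have hle' : (pS (spp e) : ℝ) ≤ R^2 := by rw [sq]; exact_mod_cast hle
    have := w1_ap X f hf (W * pS (spp e)) (Nat.mul_pos hW0 (pS_pos _)) (by
      push_cast
      refine le_trans ?_ hq
      gcongr) a
    convert this using 3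
    have := vS_pS (spp e)
    unfold vS at this
    rw [this]; push_cast
    rw [div_mul_div_comm, mul_one]

lemma totient_pS (S : Finset (PP R W)) : ((W * pS S).totient : ℝ) = W.totient * ∏ p ∈ S, (pw R W p - 1) := by
  rw [Nat.totient_mul (pS_coprime S)]
  push_cast
  congr 1
  induction S using Finset.induction_on with
  | empty => simp [pS]
  | insert p S hp ih =>
    have e : pS (insert p S) = p.1 * pS S := by unfold pS; rw [prod_insert hp]
    have hc : Nat.Coprime p.1 (pS S) := by
      rw [Nat.Prime.coprime_iff_not_dvd (PP_prime p), ← mem_pS]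
      exact hp
    rw [e, Nat.totient_mul hc, Nat.totient_prime (PP_prime p), prod_insert hp, Nat.cast_mul, ih, Nat.cast_sub (PP_prime p).one_le]
    simp [pw]

lemma S2_pair (X : ℝ) (f : ℝ → ℝ) (hf : FF X f) (h : Fin k → ℕ) (hW : ∀ i j, i ≠ j → ∀ p, p.Prime → h i ≡ h j [MOD p] → p ∣ W)
    (m : Fin k) (b : ℕ) (hb : b.Coprime W) (hW0 : 0 < W) (hR : 1 ≤ R) (hq : (W:ℝ) * R^2 < Real.exp (X/8)) (d d' : PP R W → Option (Fin k))
    (hd : pS (spp d) ≤ R) (hd' : pS (spp d') ≤ R) :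
    |∑ n ∈ ((range (Nx X)).filter Nat.Prime).filter (fun n => n ≡ b [MOD W]), w2 X f n * ∏ p, (ind h (h m) p.1 (d p) n * ind h (h m) p.1 (d' p) n)
      - mass2 X f / W.totient * ∏ p, MM (q2 m (pw R W p)) (d p) (d' p)| ≤ EE X f (W * pS (spp d ∪ spp d')) := by
  have hX := hf.pos
  have hW1 : (1:ℝ) ≤ W := by exact_mod_cast hW0
  have hR1 : (1:ℝ) ≤ R := by exact_mod_cast hR
  rcases pair_cases h hW (h m) d d' with ⟨h1, h2⟩ | ⟨e, he, h1, h2⟩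
  · simp only [h1, h2 (fun p => q2 m (pw R W p)), mul_zero, sum_const_zero, sub_zero, abs_zero]
    exact EE_nonneg _ _ _
  · obtain ⟨a, ha1, ha⟩ := ind_eval h (h m) b e
    simp only [h1]
    rw [h2 (fun p => q2 m (pw R W p)), ha, ← he]
    by_cases hm : ∃ p, e p = some m
    · obtain ⟨p, hp⟩ := hm
      rw [prod_eq_zero (mem_univ p) (by rw [hp]; simp [MM, q2]), sum_eq_zero]
      · simp [EE_nonneg]
      · intro n hn
        simp only [mem_filter] at hn
        have h3 := (ha1 n hn.2).2 p m hp
        have h4 : p.1 ∣ n := by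
          have : n + h m ≡ 0 + h m [MOD p.1] := by simpa using h3
          exact (Nat.modEq_zero_iff_dvd).1 (Nat.ModEq.add_right_cancel' _ this)
        have h5 : p.1 = n := ((Nat.prime_dvd_prime_iff_eq (PP_prime p) hn.1.2).1 h4)
        have h6 : (n:ℝ) ≤ R := by rw [← h5]; exact_mod_cast PP_le p
        have h7 : (n:ℝ) < Real.exp (X/8) := lt_of_le_of_lt (by nlinarith) hq
        unfold w2
        rw [f_zero_small hf n h7]; simp
    · push Not at hm
      rw [prod_MM (fun p => 1 / (pw R W p - 1)) e _ (fun p i hi => by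
        have : i ≠ m := fun hh => hm p (hh ▸ hi)
        simp [q2, this])]
      have hle : pS (spp e) ≤ R * R := by rw [he]; exact (pS_union_le _ _).trans (Nat.mul_le_mul hd hd')
      have hle' : (pS (spp e) : ℝ) ≤ R^2 := by rw [sq]; exact_mod_cast hle
      have ha2 := ha1 a (Nat.ModEq.refl _)
      have hcop : a.Coprime (W * pS (spp e)) := by
        refine Nat.Coprime.mul_right ?_ ?_
        · rw [Nat.coprime_iff_gcd_eq_one, ha2.1.gcd_eq]; exact hb
        · refine Nat.Coprime.prod_right fun p hp => ?_
          rw [Nat.coprime_comm, Nat.Prime.coprime_iff_not_dvd (PP_prime p)]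
          intro hpa
          cases hi : e p with
          | none => simp [spp, hi] at hp
          | some i =>
            have h3 := ha2.2 p i hi
            have h4 : h i ≡ h m [MOD p.1] := by
              refine Nat.ModEq.trans ?_ h3
              have := ((Nat.modEq_zero_iff_dvd).2 hpa).add_right (h i)
              simpa using this.symm
            exact PP_ndvd p (hW i m (fun hh => hm p (hh ▸ hi)) p.1 (PP_prime p) h4)
      have := prime_ap X f hf (W * pS (spp e)) (Nat.mul_pos hW0 (pS_pos _)) (by
        push_cast
        refine lt_of_le_of_lt ?_ hq
        gcongr) a hcop
      rw [filter_filter]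
      convert this using 3
      rw [totient_pS, prod_div_distrib, prod_const_one, div_mul_div_comm, mul_one]

end pairs
end DSR

namespace DSR
open Finset

section sums
variable {k R W : ℕ}

noncomputable def nu (h : Fin k → ℕ) (t : ℕ) (lm : (PP R W → Option (Fin k)) → ℝ) (N : ℕ) : ℝ :=
  ∑ d, lm d * ∏ p, ind h t p.1 (d p) N

lemma quad_sum (A : Finset ℕ) (w : ℕ → ℝ) (h : Fin k → ℕ) (t : ℕ) (lm : (PP R W → Option (Fin k)) → ℝ) :
    ∑ n ∈ A, w n * nu h t lm n ^2 = ∑ d, ∑ d', lm d * lm d' * ∑ n ∈ A, w n * ∏ p, (ind h t p.1 (d p) n * ind h t p.1 (d' p) n) := by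
  unfold nu
  simp_rw [sq, sum_mul_sum, mul_sum]
  rw [sum_comm]
  refine sum_congr rfl fun d _ => ?_
  rw [sum_comm]
  refine sum_congr rfl fun d' _ => sum_congr rfl fun n _ => ?_
  rw [prod_mul_distrib]; ring

lemma quad_err (A : Finset ℕ) (w : ℕ → ℝ) (h : Fin k → ℕ) (t : ℕ) (lm : (PP R W → Option (Fin k)) → ℝ) (c : ℝ)
    (B : PP R W → Option (Fin k) → Option (Fin k) → ℝ) (G : (PP R W → Option (Fin k)) → (PP R W → Option (Fin k)) → ℝ)
    (hG : ∀ d d', lm d ≠ 0 → lm d' ≠ 0 → |∑ n ∈ A, w n * ∏ p, (ind h t p.1 (d p) n * ind h t p.1 (d' p) n) - c * ∏ p, B p (d p) (d' p)| ≤ G d d') :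
    |∑ n ∈ A, w n * nu h t lm n ^2 - c * tform B lm| ≤ ∑ d, ∑ d', |lm d| * |lm d'| * G d d' := by
  rw [quad_sum]
  unfold tform
  rw [mul_sum, ← sum_sub_distrib]
  refine (abs_sum_le_sum_abs _ _).trans (sum_le_sum fun d _ => ?_)
  rw [mul_sum, ← sum_sub_distrib]
  refine (abs_sum_le_sum_abs _ _).trans (sum_le_sum fun d' _ => ?_)
  by_cases hd : lm d = 0
  · simp [hd]
  by_cases hd' : lm d' = 0
  · simp [hd']
  rw [show ∀ x y : ℝ, lm d * lm d' * x - c * (lm d * lm d' * y) = lm d * lm d' * (x - c * y) by intros; ring, abs_mul, abs_mul]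
  exact mul_le_mul_of_nonneg_left (hG d d' hd hd') (by positivity)

lemma lm_supp (hR : 1 ≤ R) (lm : (PP R W → Option (Fin k)) → ℝ) (hlm : ∀ d, Real.log R < ell (pw R W) (spp d) → lm d = 0)
    (d : PP R W → Option (Fin k)) (hd : lm d ≠ 0) : pS (spp d) ≤ R := by
  by_contra hc
  push Not at hc
  apply hd (hlm d _)
  rw [ell_pS]
  exact Real.log_lt_log (by exact_mod_cast hR) (by exact_mod_cast hc)

lemma S1_eval (X : ℝ) (f : ℝ → ℝ) (hf : FF X f) (h : Fin k → ℕ) (hW : ∀ i j, i ≠ j → ∀ p, p.Prime → h i ≡ h j [MOD p] → p ∣ W)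
    (b : ℕ) (hW0 : 0 < W) (hR : 1 ≤ R) (hq : 2 * ((W:ℝ) * R^2) ≤ Real.exp (X/8)) (lm : (PP R W → Option (Fin k)) → ℝ)
    (hlm : ∀ d, Real.log R < ell (pw R W) (spp d) → lm d = 0) :
    |∑ n ∈ (range (Nx X)).filter (fun n => n ≡ b [MOD W]), w1 X f n * nu h 0 lm n ^ 2
      - mass1 X f / W * tform (fun p => MM (fun _ => 1/pw R W p)) lm| ≤ (∑ d, |lm d|)^2 * (4 * Real.exp (-(X/8)) * (4*X+2)) := by
  refine (quad_err _ _ h 0 lm _ _ (fun _ _ => 4 * Real.exp (-(X/8)) * (4*X+2)) fun d d' hd hd' =>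
    S1_pair X f hf h hW b hW0 hq d d' (lm_supp hR lm hlm d hd) (lm_supp hR lm hlm d' hd')).trans (le_of_eq ?_)
  rw [sq, sum_mul_sum, sum_mul]
  simp_rw [sum_mul]

lemma card_sub (S : Finset (PP R W)) : #((univ : Finset (PP R W → Option (Fin k))).filter fun d => spp d ⊆ S) = (k+1)^(#S) := by
  have : ((univ : Finset (PP R W → Option (Fin k))).filter fun d => spp d ⊆ S) =
      Fintype.piFinset (fun p => if p ∈ S then univ else {none}) := by
    ext d
    simp only [mem_filter, mem_univ, true_and, Fintype.mem_piFinset, spp, subset_iff]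
    refine forall_congr' fun p => ?_
    by_cases hp : p ∈ S <;> simp [hp]
  rw [this, Fintype.card_piFinset]
  have h2 : ∀ p : PP R W, #(if p ∈ S then (univ : Finset (Option (Fin k))) else {none}) = if p ∈ S then k+1 else 1 := by
    intro p; split_ifs <;> simp
  simp_rw [h2]
  rw [prod_ite_mem, univ_inter, prod_const]

lemma tau_pS (hW0 : 0 < W) (S : Finset (PP R W)) : (2:ℝ)^(#S) ≤ tau (W * pS S) := by
  have h1 : #S.powerset ≤ #(W * pS S).divisors := by
    refine card_le_card_of_injOn pS (fun T hT => ?_) (pS_inj.injOn)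
    have hT' := mem_powerset.1 (mem_coe.1 hT)
    rw [mem_coe, Nat.mem_divisors]
    refine ⟨Dvd.dvd.mul_left ?_ _, (Nat.mul_pos hW0 (pS_pos _)).ne'⟩
    exact prod_dvd_prod_of_subset _ _ _ hT'
  rw [card_powerset] at h1
  unfold tau
  exact_mod_cast h1

lemma group_sum (hW0 : 0 < W) (E : ℕ → ℝ) (hE : ∀ q, 0 ≤ E q) :
    ∑ d ∈ (univ : Finset (PP R W → Option (Fin k))).filter (fun d => pS (spp d) ≤ R),
      ∑ d' ∈ (univ : Finset (PP R W → Option (Fin k))).filter (fun d => pS (spp d) ≤ R), E (W * pS (spp d ∪ spp d'))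
    ≤ ∑ q ∈ Ioc 0 (W * R^2), tau q ^ (2*(k+1)) * E q := by
  rw [← sum_product']
  set T := ((univ : Finset (PP R W → Option (Fin k))).filter (fun d => pS (spp d) ≤ R)) with hT
  set U := (univ : Finset (Finset (PP R W))).filter (fun S => pS S ≤ R^2) with hU
  have hmap : ∀ x ∈ T ×ˢ T, spp x.1 ∪ spp x.2 ∈ U := by
    intro x hx
    simp only [hT, mem_product, mem_filter, mem_univ, true_and] at hx
    simp only [hU, mem_filter, mem_univ, true_and]
    exact (pS_union_le _ _).trans (by rw [sq]; exact Nat.mul_le_mul hx.1 hx.2)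
  rw [← sum_fiberwise_of_maps_to hmap]
  calc _ ≤ ∑ S ∈ U, tau (W * pS S) ^ (2*(k+1)) * E (W * pS S) := by
        refine sum_le_sum fun S _ => ?_
        have h1 : ∑ x ∈ (T ×ˢ T).filter (fun x => spp x.1 ∪ spp x.2 = S), E (W * pS (spp x.1 ∪ spp x.2)) =
            #((T ×ˢ T).filter (fun x => spp x.1 ∪ spp x.2 = S)) * E (W * pS S) := by
          rw [← nsmul_eq_mul]
          refine sum_eq_card_nsmul fun x hx => ?_
          rw [(mem_filter.1 hx).2]
        rw [h1]
        refine mul_le_mul_of_nonneg_right ?_ (hE _)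
        have h2 : #((T ×ˢ T).filter (fun x => spp x.1 ∪ spp x.2 = S)) ≤ (k+1)^(#S) * (k+1)^(#S) := by
          rw [← card_sub (k := k) S, ← card_product]
          refine card_le_card fun x hx => ?_
          have := (mem_filter.1 hx).2
          simp only [mem_product, mem_filter, mem_univ, true_and]
          rw [← this]
          exact ⟨subset_union_left, subset_union_right⟩
        calc (#((T ×ˢ T).filter (fun x => spp x.1 ∪ spp x.2 = S)) : ℝ) ≤ ((k+1)^(#S) * (k+1)^(#S) : ℕ) := by exact_mod_cast h2
          _ ≤ (((2:ℕ)^(k+1))^(#S) * (2^(k+1))^(#S) : ℕ) := by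
              have h3 : k+1 ≤ 2^(k+1) := Nat.lt_two_pow_self.le
              exact_mod_cast Nat.mul_le_mul (Nat.pow_le_pow_left h3 _) (Nat.pow_le_pow_left h3 _)
          _ = ((2:ℝ)^(#S))^(2*(k+1)) := by push_cast; rw [← pow_mul, ← pow_mul, ← pow_add]; congr 1; ring
          _ ≤ _ := pow_le_pow_left₀ (by positivity) (tau_pS hW0 S) _
    _ = ∑ q ∈ U.image (fun S => W * pS S), tau q ^ (2*(k+1)) * E q := by
        rw [sum_image]
        intro S _ S' _ h
        exact pS_inj (Nat.eq_of_mul_eq_mul_left hW0 h)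
    _ ≤ _ := by
        refine sum_le_sum_of_subset_of_nonneg (fun q hq => ?_) fun q _ _ => mul_nonneg (pow_nonneg (tau_nonneg _) _) (hE _)
        obtain ⟨S, hS, rfl⟩ := mem_image.1 hq
        have := (mem_filter.1 hS).2
        exact mem_Ioc.2 ⟨Nat.mul_pos hW0 (pS_pos _), Nat.mul_le_mul_left _ this⟩

lemma S2_eval (X : ℝ) (f : ℝ → ℝ) (hf : FF X f) (h : Fin k → ℕ) (hW : ∀ i j, i ≠ j → ∀ p, p.Prime → h i ≡ h j [MOD p] → p ∣ W)
    (m : Fin k) (b : ℕ) (hb : b.Coprime W) (hW0 : 0 < W) (hR : 1 ≤ R) (hq : (W:ℝ) * R^2 < Real.exp (X/8)) (lm : (PP R W → Option (Fin k)) → ℝ)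
    (hlm : ∀ d, Real.log R < ell (pw R W) (spp d) → lm d = 0) (M : ℝ) (hM : ∀ d, |lm d| ≤ M) :
    |∑ n ∈ ((range (Nx X)).filter Nat.Prime).filter (fun n => n ≡ b [MOD W]), w2 X f n * nu h (h m) lm n ^ 2
      - mass2 X f / W.totient * tform (fun p => MM (q2 m (pw R W p))) lm|
      ≤ M^2 * ∑ q ∈ Ioc 0 (W * R^2), tau q ^ (2*(k+1)) * EE X f q := by
  refine (quad_err _ _ h (h m) lm _ _ (fun d d' => EE X f (W * pS (spp d ∪ spp d'))) fun d d' hd hd' =>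
    S2_pair X f hf h hW m b hb hW0 hR hq d d' (lm_supp hR lm hlm d hd) (lm_supp hR lm hlm d' hd')).trans ?_
  refine le_trans ?_ (mul_le_mul_of_nonneg_left (group_sum (k := k) (R := R) hW0 (EE X f) (EE_nonneg X f)) (sq_nonneg M))
  rw [mul_sum, sum_filter]
  have hM0 : 0 ≤ M := (abs_nonneg _).trans (hM fun _ => none)
  refine sum_le_sum fun d _ => ?_
  split_ifs with hd
  · rw [mul_sum, sum_filter]
    refine sum_le_sum fun d' _ => ?_
    split_ifs with hd'
    · rw [sq]
      exact mul_le_mul_of_nonneg_right (mul_le_mul (hM _) (hM _) (abs_nonneg _) hM0) (EE_nonneg _ _ _)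
    · have : lm d' = 0 := by by_contra hc; exact hd' (lm_supp hR lm hlm d' hc)
      simp [this]
  · have : lm d = 0 := by by_contra hc; exact hd (lm_supp hR lm hlm d hc)
    simp [this]

end sums
end DSR

namespace DSR
open Finset

section upper
variable {k R W : ℕ}

lemma ind_abs (h : Fin k → ℕ) (t p : ℕ) (s : Option (Fin k)) (N : ℕ) : |ind h t p s N| ≤ 1 := by
  cases s with
  | none => simp [ind]
  | some i => simp only [ind]; split_ifs <;> simp

lemma nu_abs (h : Fin k → ℕ) (t : ℕ) (lm : (PP R W → Option (Fin k)) → ℝ) (N : ℕ) : |nu h t lm N| ≤ ∑ d, |lm d| := by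
  unfold nu
  refine (abs_sum_le_sum_abs _ _).trans (sum_le_sum fun d _ => ?_)
  rw [abs_mul, abs_prod]
  exact mul_le_of_le_one_right (abs_nonneg _) (prod_le_one (fun _ _ => abs_nonneg _) fun _ _ => ind_abs _ _ _ _ _)

lemma nu_shift (h : Fin k → ℕ) (m : Fin k) (lm : (PP R W → Option (Fin k)) → ℝ) (n : ℕ) :
    nu h (h m) lm (n + h m) = nu h 0 lm n := by
  unfold nu
  refine sum_congr rfl fun d _ => ?_
  congr 1
  refine prod_congr rfl fun p _ => ?_
  cases d p with
  | none => rfl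
  | some i =>
    simp only [ind]
    have : n + h m + h i ≡ h m [MOD p.1] ↔ n + h i ≡ 0 [MOD p.1] := by
      constructor
      · intro hh
        refine Nat.ModEq.add_right_cancel' (h m) ?_
        rw [zero_add, add_right_comm]; exact hh
      · intro hh
        have := hh.add_right (h m)
        rw [zero_add, add_right_comm] at this; exact this
    simp [this]

lemma w2_le (X : ℝ) (f : ℝ → ℝ) (hf : FF X f) (n : ℕ) : w2 X f n ≤ (4*X+1) * w1 X f n := by
  have hX := hf.pos
  by_cases h : Nx X ≤ n
  · unfold w2 w1; rw [f_zero_of_ge hf.supp X hX n h]; simp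
  · rcases Nat.eq_zero_or_pos n with h0 | h0
    · subst h0; simp [w2, w1]
    have h1 : Real.log n ≤ 4*X+1 := (Real.log_le_log (by exact_mod_cast h0) (by exact_mod_cast (not_le.1 h).le)).trans (log_Nx X hX)
    have h2 := w1_nonneg X f hf n
    calc w2 X f n = Real.log n * w1 X f n := by unfold w2 w1; ring
      _ ≤ _ := mul_le_mul_of_nonneg_right h1 h2

lemma S2_upper (X : ℝ) (f : ℝ → ℝ) (hf : FF X f) (h : Fin k → ℕ) (H : ℕ) (hH : ∀ i, h i ≤ H) (K b N0 : ℕ)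
    (hN0 : 2 * ((N0:ℝ) + H) ≤ Real.exp (X/8))
    (hbad : ∀ n, N0 ≤ n → n ≡ b [MOD W] → #(univ.filter fun i => (n + h i).Prime) ≤ K)
    (lm : (PP R W → Option (Fin k)) → ℝ) :
    ∑ m, ∑ n ∈ ((range (Nx X)).filter Nat.Prime).filter (fun n => n ≡ b + h m [MOD W]), w2 X f n * nu h (h m) lm n ^ 2
    ≤ K * (4*X+1) * (∑ n ∈ (range (Nx X)).filter (fun n => n ≡ b [MOD W]), w1 X f n * nu h 0 lm n ^ 2
      + (∑ d, |lm d|)^2 * (4 * H * Real.exp (-(X/8)) * (4*X+2))) := by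
  have hX := hf.pos
  set V := ∑ d, |lm d| with hV
  have hV0 : 0 ≤ V := sum_nonneg fun _ _ => abs_nonneg _
  have hex := Real.exp_pos (X/8)
  have hlarge : ∀ n m, w2 X f (n + h m) ≠ 0 → Real.exp (X/8)/2 ≤ n ∧ N0 ≤ n ∧ 0 < n := by
    intro n m hw
    have h1 : Real.exp (X/8) ≤ ((n + h m : ℕ):ℝ) := by
      by_contra hc
      push Not at hc
      apply hw
      unfold w2; rw [f_zero_small hf _ hc]; simp
    have h2 : (h m : ℝ) ≤ H := by exact_mod_cast hH m
    push_cast at h1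
    have h3 : Real.exp (X/8)/2 + N0 ≤ n := by linarith
    have h4 : (N0:ℝ) ≤ n := by linarith
    have h5 : (0:ℝ) < n := by have : (0:ℝ) ≤ N0 := Nat.cast_nonneg _; linarith
    exact ⟨by have : (0:ℝ) ≤ N0 := Nat.cast_nonneg _; linarith, by exact_mod_cast h4, by exact_mod_cast h5⟩
  have step1 : ∀ m, ∑ n ∈ ((range (Nx X)).filter Nat.Prime).filter (fun n => n ≡ b + h m [MOD W]), w2 X f n * nu h (h m) lm n ^ 2
      ≤ ∑ n ∈ (range (Nx X)).filter (fun n => n ≡ b [MOD W]), (if (n + h m).Prime then w2 X f (n + h m) else 0) * nu h 0 lm n ^ 2 := by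
    intro m
    set A := ((range (Nx X)).filter Nat.Prime).filter (fun n => n ≡ b + h m [MOD W])
    have e1 : ∑ n ∈ A, w2 X f n * nu h (h m) lm n ^ 2 = ∑ n ∈ A.filter (fun n => h m ≤ n), w2 X f n * nu h (h m) lm n ^ 2 := by
      refine Eq.symm ((sum_filter (s := A) (fun n => h m ≤ n) _).trans ?_)
      refine sum_congr rfl fun n hnA => ?_
      split_ifs with hn
      · rfl
      · have : w2 X f n = 0 := by
          unfold w2
          rw [f_zero_small hf n]
          · simp
          · have h1 : (n:ℝ) < H := by exact_mod_cast lt_of_lt_of_le (not_le.1 hn) (hH m)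
            have : (0:ℝ) ≤ N0 := Nat.cast_nonneg _
            have : (0:ℝ) ≤ n := Nat.cast_nonneg _
            linarith
        simp [this]
    rw [e1]
    refine le_trans (le_of_eq ?_) (sum_le_sum_of_subset_of_nonneg (s := (A.filter (fun n => h m ≤ n)).image (fun n => n - h m)) ?_ ?_)
    · rw [sum_image]
      · refine sum_congr rfl fun n hn => ?_
        obtain ⟨hA, hle⟩ := mem_filter.1 hn
        have hp := (mem_filter.1 (mem_filter.1 hA).1).2
        have e2 := nu_shift h m lm (n - h m)
        rw [Nat.sub_add_cancel hle] at e2 ⊢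
        rw [if_pos hp, e2]
      · intro n hn n' hn' hh
        have h1 := (mem_filter.1 (mem_coe.1 hn)).2
        have h2 := (mem_filter.1 (mem_coe.1 hn')).2
        simp only at hh
        omega
    · intro n hn
      obtain ⟨x, hx, rfl⟩ := mem_image.1 hn
      obtain ⟨hA, hle⟩ := mem_filter.1 hx
      have hr := mem_range.1 (mem_filter.1 (mem_filter.1 hA).1).1
      have hm := (mem_filter.1 hA).2
      refine mem_filter.2 ⟨mem_range.2 (by omega), ?_⟩
      refine Nat.ModEq.add_right_cancel' (h m) ?_
      rw [Nat.sub_add_cancel hle]; exact hm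
    · intro n _ _
      refine mul_nonneg ?_ (sq_nonneg _)
      split_ifs
      · exact w2_nonneg X f hf _
      · exact le_rfl
  set er : ℕ → ℝ := fun n => 4 * H * Real.exp (-(X/8)) * (1/n) with her
  have her0 : ∀ n, 0 ≤ er n := fun n => by simp only [her]; positivity
  have step2 : ∀ n, n ≡ b [MOD W] → ∑ m, (if (n + h m).Prime then w2 X f (n + h m) else 0) ≤ K * (4*X+1) * (w1 X f n + er n) := by
    intro n hn
    have hw := w1_nonneg X f hf n
    by_cases hall : ∀ m, w2 X f (n + h m) = 0
    · simp only [hall, ite_self, sum_const_zero]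
      have := her0 n
      positivity
    · push Not at hall
      obtain ⟨m0, hm0⟩ := hall
      obtain ⟨h1, h2, h3⟩ := hlarge n m0 hm0
      have h3' : (0:ℝ) < n := by exact_mod_cast h3
      rw [← sum_filter]
      have hterm : ∀ m, w2 X f (n + h m) ≤ (4*X+1) * (w1 X f n + er n) := by
        intro m
        refine (w2_le X f hf _).trans (mul_le_mul_of_nonneg_left ?_ (by positivity))
        have h4 := w1_diff X f hf n (n + h m) h3 (Nat.le_add_right _ _)
        have h5 := (abs_sub_le_iff.1 h4).2
        have h6 : 2 * (((n + h m : ℕ):ℝ) - n) / (n:ℝ)^2 ≤ er n := by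
          push_cast
          have h7 : (h m : ℝ) ≤ H := by exact_mod_cast hH m
          have h8 : (1:ℝ)/n ≤ 2 * Real.exp (-(X/8)) := by
            rw [div_le_iff₀ h3']
            have : Real.exp (-(X/8)) * Real.exp (X/8) = 1 := by rw [← Real.exp_add]; simp
            nlinarith [Real.exp_pos (-(X/8))]
          calc 2 * ((n:ℝ) + h m - n) / (n:ℝ)^2 = 2 * h m * (1/n) * (1/n) := by field_simp; ring
            _ ≤ 2 * H * (2 * Real.exp (-(X/8))) * (1/n) := by gcongr
            _ = er n := by simp only [her]; ring
        linarith
      calc _ ≤ ∑ m ∈ univ.filter (fun i => (n + h i).Prime), (4*X+1) * (w1 X f n + er n) := sum_le_sum fun m _ => hterm m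
        _ = #(univ.filter (fun i => (n + h i).Prime)) * ((4*X+1) * (w1 X f n + er n)) := by rw [sum_const, nsmul_eq_mul]
        _ ≤ K * ((4*X+1) * (w1 X f n + er n)) := by
            refine mul_le_mul_of_nonneg_right (by exact_mod_cast hbad n h2 hn) ?_
            have := her0 n
            positivity
        _ = _ := by ring
  refine (sum_le_sum fun m _ => step1 m).trans ?_
  rw [sum_comm]
  calc _ ≤ ∑ n ∈ (range (Nx X)).filter (fun n => n ≡ b [MOD W]), K * (4*X+1) * (w1 X f n * nu h 0 lm n ^ 2 + V^2 * er n) := by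
        refine sum_le_sum fun n hn => ?_
        rw [← sum_mul]
        have h1 := step2 n (mem_filter.1 hn).2
        have h2 : nu h 0 lm n ^ 2 ≤ V^2 := by
          rw [← sq_abs]; exact pow_le_pow_left₀ (abs_nonneg _) (nu_abs h 0 lm n) 2
        refine (mul_le_mul_of_nonneg_right h1 (sq_nonneg _)).trans ?_
        rw [mul_assoc]
        refine mul_le_mul_of_nonneg_left ?_ (by positivity)
        have := mul_le_mul_of_nonneg_right h2 (her0 n)
        linarith
    _ = K * (4*X+1) * (∑ n ∈ (range (Nx X)).filter (fun n => n ≡ b [MOD W]), w1 X f n * nu h 0 lm n ^ 2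
          + V^2 * ∑ n ∈ (range (Nx X)).filter (fun n => n ≡ b [MOD W]), er n) := by
        rw [← mul_sum, sum_add_distrib, ← mul_sum]
    _ ≤ _ := by
        refine mul_le_mul_of_nonneg_left (add_le_add le_rfl (mul_le_mul_of_nonneg_left ?_ (sq_nonneg _))) (by positivity)
        calc _ ≤ ∑ n ∈ range (Nx X + 1), er n := by
              refine sum_le_sum_of_subset_of_nonneg (fun n hn => ?_) fun n _ _ => her0 n
              have := mem_range.1 (mem_filter.1 hn).1
              exact mem_range.2 (by omega)
          _ = 4 * H * Real.exp (-(X/8)) * ∑ n ∈ range (Nx X + 1), (1:ℝ)/n := by simp only [her]; rw [mul_sum]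
          _ ≤ _ := by
              refine mul_le_mul_of_nonneg_left ((sum_inv_le _).trans ?_) (by positivity)
              have := log_Nx X hX
              linarith

end upper
end DSR

namespace DSR
open Finset

set_option maxHeartbeats 1600000 in
lemma maynard_core (J0 K k : ℕ) (hK : 1 ≤ K) (hk : k = 2^J0) (hJ : 500000 * 262144 * K ≤ J0) (h : Fin k → ℕ) (W b : ℕ) (hW0 : 0 < W)
    (hWp : ∀ p, p.Prime → p ≤ 24*k^2+3 → p ∣ W)
    (hW : ∀ i j, i ≠ j → ∀ p, p.Prime → h i ≡ h j [MOD p] → p ∣ W) (hb : ∀ i, (b + h i).Coprime W) (N0 : ℕ)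
    (hbad : ∀ n, N0 ≤ n → n ≡ b [MOD W] → #(univ.filter fun i => (n + h i).Prime) ≤ K) : False := by
  classical
  obtain ⟨L1, hL1⟩ := sieve_weights J0 k hk W hW0 hWp
  obtain ⟨B, hB, hBV⟩ := BV (2*(k+1)) (2*k+1)
  obtain ⟨H, hH⟩ : ∃ H : ℕ, ∀ i, h i ≤ H := ⟨∑ i, h i, fun i => single_le_sum (f := h) (fun _ _ => Nat.zero_le _) (mem_univ i)⟩
  have hk1 : 1 ≤ k := by rw [hk]; exact Nat.one_le_two_pow
  have hev := (mass_cmp B hB).and ((exp_ev (7000 + 1000 * |L1| + W + k * 2^(2*k))).and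
    ((expexp_beats (2*W) 0 (1/3600) (by norm_num)).and ((expexp_beats (2*((N0:ℝ)+H)) 0 (1/8) (by norm_num)).and
    (expexp_beats (5*K*(4+4*H)*6*2^(4*k)) (4*k+2) (1/9) (by norm_num)))))
  obtain ⟨I0, hI0⟩ := Filter.eventually_atTop.1 hev
  obtain ⟨i, hi, hf, hE⟩ := hBV I0
  obtain ⟨⟨hm1, hm2⟩, hbig, hWX, hNX, hbeat⟩ := hI0 i hi
  generalize hfe : ff (B*i) = f at *
  have hXi : Real.exp (i:ℝ) = Real.exp i := rfl
  set X := Real.exp (i:ℝ) with hXdef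
  simp only [pow_zero, mul_one] at hWX hNX
  have hW1 : (1:ℝ) ≤ W := by exact_mod_cast hW0
  have hK1 : (1:ℝ) ≤ K := by exact_mod_cast hK
  have hkr : (1:ℝ) ≤ k := by exact_mod_cast hk1
  have hH0 : (0:ℝ) ≤ H := Nat.cast_nonneg _
  have hk2 : (0:ℝ) ≤ k * 2^(2*k) := by positivity
  have hX7 : 7000 ≤ X := by linarith [abs_nonneg L1]
  have hX0 : 0 < X := by linarith
  have hXL : |L1| ≤ X/1000 := by linarith [abs_nonneg L1]
  have hXW : (W:ℝ) ≤ X := by linarith [abs_nonneg L1]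
  have hXk : (k:ℝ) * 2^(2*k) ≤ X := by linarith [abs_nonneg L1]
  set R := ⌊Real.exp (X/900)⌋₊ with hR
  have hexp1 : 2 ≤ Real.exp (X/900) := by have := Real.add_one_le_exp (X/900); linarith
  have hRle : (R:ℝ) ≤ Real.exp (X/900) := Nat.floor_le (Real.exp_pos _).le
  have hRge : Real.exp (X/900) / 2 ≤ R := by
    have := Nat.lt_floor_add_one (Real.exp (X/900)); rw [← hR] at this; linarith
  have hR1 : 1 ≤ R := by
    have : (1:ℝ) ≤ R := by linarith
    exact_mod_cast this
  have hR1' : (1:ℝ) ≤ R := by exact_mod_cast hR1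
  have hLR : X/1000 ≤ Real.log R := by
    have h1 := Real.log_le_log (by positivity) hRge
    rw [Real.log_div (Real.exp_pos _).ne' two_ne_zero, Real.log_exp] at h1
    have := Real.log_two_lt_d9
    linarith
  have hLRu : Real.log R ≤ X/900 := by
    have h1 := Real.log_le_log (by linarith) hRle
    rwa [Real.log_exp] at h1
  obtain ⟨lm, E, hE1, hl1, hl2, hl3, hl4, hl5⟩ := hL1 R hR1 ((le_abs_self L1).trans (hXL.trans hLR))
  set LR := Real.log R with hLRd
  have hR2 : (R:ℝ)^2 ≤ Real.exp (X/450) := by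
    calc (R:ℝ)^2 ≤ (Real.exp (X/900))^2 := pow_le_pow_left₀ (by linarith) hRle 2
      _ = Real.exp (X/450) := by rw [← Real.exp_nat_mul]; congr 1; push_cast; ring
  have hWR : 2 * ((W:ℝ) * R^2) ≤ Real.exp (X/400) := by
    calc 2 * ((W:ℝ) * R^2) = (2 * W) * R^2 := by ring
      _ ≤ Real.exp (1/3600*X) * Real.exp (X/450) := mul_le_mul hWX hR2 (by positivity) (Real.exp_pos _).le
      _ = Real.exp (X/400) := by rw [← Real.exp_add]; congr 1; ring
  have hWRp : 0 < (W:ℝ) * R^2 := by positivity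
  have h48 : Real.exp (X/400) ≤ Real.exp (X/8) := Real.exp_le_exp.2 (by linarith)
  have hlr2 : 1 + LR ≤ 2*X := by linarith
  have hlr0 : 0 ≤ 1 + LR := by linarith
  -- prime sums
  set e2 := ((1+LR)^k)^2 * ∑ q ∈ Ioc 0 (W * R^2), tau q ^ (2*(k+1)) * EE X f q with he2
  have he2b : k * e2 ≤ 1 := by
    have h1 : ∑ q ∈ Ioc 0 (W * R^2), tau q ^ (2*(k+1)) * EE X f q ≤ Real.exp (-(((2*k+1 : ℕ):ℝ) * i)) := by
      refine le_trans (le_of_eq ?_) (hE (W * R^2) (by push_cast; linarith))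
      refine sum_congr rfl fun q _ => ?_
      unfold EE
      rw [← mul_assoc, div_eq_mul_inv]
    have h2 : Real.exp (-(((2*k+1 : ℕ):ℝ) * i)) = (X^(2*k+1))⁻¹ := by
      rw [Real.exp_neg, Real.exp_nat_mul]
    rw [h2] at h1
    have h3 : ((1+LR)^k)^2 ≤ 2^(2*k) * X^(2*k) := by
      rw [← pow_mul, ← mul_pow, mul_comm k 2]
      exact pow_le_pow_left₀ hlr0 hlr2 _
    calc k * e2 ≤ k * (2^(2*k) * X^(2*k) * (X^(2*k+1))⁻¹) := by
          refine mul_le_mul_of_nonneg_left (mul_le_mul h3 h1 ?_ (by positivity)) (by positivity)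
          exact sum_nonneg fun q _ => mul_nonneg (pow_nonneg (tau_nonneg _) _) (EE_nonneg _ _ _)
      _ = (k * 2^(2*k)) / X := by rw [pow_succ]; field_simp
      _ ≤ 1 := by rw [div_le_one hX0]; exact hXk
  have hS1 := (abs_sub_le_iff.1 (S1_eval X f hf h hW b hW0 hR1 (hWR.trans h48) lm hl1)).1
  have hS2 : ∀ m, mass2 X f / W * (1/262144 * LR * (J0+1) / k * E) - e2 ≤
      ∑ n ∈ ((range (Nx X)).filter Nat.Prime).filter (fun n => n ≡ b + h m [MOD W]), w2 X f n * nu h (h m) lm n ^ 2 := by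
    intro m
    have h1 := (abs_sub_le_iff.1 (S2_eval X f hf h hW m (b + h m) (hb m) hW0 hR1 (by linarith) lm hl1 _ hl2)).2
    have hphi : (0:ℝ) < W.totient := by exact_mod_cast Nat.totient_pos.2 hW0
    have hm20 : 0 ≤ mass2 X f := sum_nonneg fun n _ => w2_nonneg X f hf n
    have h2 : mass2 X f / W * (1/262144 * LR * (J0+1) / k * E) ≤ mass2 X f / W.totient * tform (fun p => MM (q2 m (pw R W p))) lm := by
      refine le_trans (le_of_eq ?_) (mul_le_mul_of_nonneg_left (hl5 m) (by positivity))
      field_simp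
    rw [← he2] at h1
    linarith
  have hU := S2_upper X f hf h H hH K b N0 (by
    have : X/8 = 1/8*X := by ring
    rw [this]; exact hNX) hbad lm
  have hL : mass2 X f / W * (1/262144 * LR * (J0+1) * E) - k * e2 ≤ ∑ m, ∑ n ∈ ((range (Nx X)).filter Nat.Prime).filter (fun n => n ≡ b + h m [MOD W]), w2 X f n * nu h (h m) lm n ^ 2 := by
    refine le_trans (le_of_eq ?_) (sum_le_sum fun m (_ : m ∈ univ) => hS2 m)
    rw [sum_const, card_univ, Fintype.card_fin, nsmul_eq_mul]
    field_simp
  have hLU := hL.trans hU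
  set V := ∑ d, |lm d| with hV
  set S1 := ∑ n ∈ (range (Nx X)).filter (fun n => n ≡ b [MOD W]), w1 X f n * nu h 0 lm n ^ 2
  have hV2 : V^2 ≤ Real.exp (X/450) * (2^(4*k) * X^(4*k)) := by
    have hV0 : 0 ≤ V := sum_nonneg fun _ _ => abs_nonneg _
    calc V^2 ≤ (R * (1+LR)^(2*k))^2 := pow_le_pow_left₀ hV0 hl3 2
      _ = R^2 * (1+LR)^(4*k) := by rw [mul_pow, ← pow_mul]; congr 2; ring
      _ ≤ Real.exp (X/450) * (2*X)^(4*k) := mul_le_mul hR2 (pow_le_pow_left₀ hlr0 hlr2 _) (by positivity) (Real.exp_pos _).le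
      _ = _ := by rw [mul_pow]
  set e3 := K * (4*X+1) * (V^2 * (4 * Real.exp (-(X/8)) * (4*X+2)) + V^2 * (4 * H * Real.exp (-(X/8)) * (4*X+2))) with he3
  have he3b : e3 ≤ 1 := by
    calc e3 = V^2 * Real.exp (-(X/8)) * (K * (4+4*H) * (4*X+1) * (4*X+2)) := by rw [he3]; ring
      _ ≤ (Real.exp (X/450) * (2^(4*k) * X^(4*k))) * Real.exp (-(X/8)) * (K * (4+4*H) * (5*X) * (6*X)) := by
          have : 4*X+1 ≤ 5*X := by linarith
          have : 4*X+2 ≤ 6*X := by linarith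
          gcongr
      _ = (5*K*(4+4*H)*6*2^(4*k) * X^(4*k+2)) * (Real.exp (X/450) * Real.exp (-(X/8))) := by ring
      _ ≤ Real.exp (1/9*X) * (Real.exp (X/450) * Real.exp (-(X/8))) := mul_le_mul_of_nonneg_right hbeat (by positivity)
      _ = Real.exp (1/9*X + (X/450 - X/8)) := by rw [Real.exp_add, Real.exp_sub, Real.exp_neg]; ring
      _ ≤ 1 := by rw [Real.exp_le_one_iff]; linarith
  have hS1' : S1 ≤ mass1 X f / W * E + V^2 * (4 * Real.exp (-(X/8)) * (4*X+2)) := by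
    have := mul_le_mul_of_nonneg_left hl4 (show 0 ≤ mass1 X f / W by positivity)
    linarith
  have hfin : mass2 X f / W * (1/262144 * LR * (J0+1) * E) ≤ K * (4*X+1) * (mass1 X f / W * E) + 2 := by
    have h1 : K * (4*X+1) * (S1 + V^2 * (4 * H * Real.exp (-(X/8)) * (4*X+2))) ≤
      K * (4*X+1) * ((mass1 X f / W * E + V^2 * (4 * Real.exp (-(X/8)) * (4*X+2))) + V^2 * (4 * H * Real.exp (-(X/8)) * (4*X+2))) :=
      mul_le_mul_of_nonneg_left (by linarith) (by positivity)
    have h2 : K * (4*X+1) * ((mass1 X f / W * E + V^2 * (4 * Real.exp (-(X/8)) * (4*X+2))) + V^2 * (4 * H * Real.exp (-(X/8)) * (4*X+2)))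
      = K * (4*X+1) * (mass1 X f / W * E) + e3 := by rw [he3]; ring
    linarith
  have hJr : 500000 * 262144 * (K:ℝ) ≤ J0 := by exact_mod_cast hJ
  have hlow : 10 * K * X * (mass1 X f / W * E) ≤ mass2 X f / W * (1/262144 * LR * (J0+1) * E) := by
    have h1 : 500 * K * X ≤ 1/262144 * LR * (J0+1) := by
      calc 500 * K * X = 1/262144 * (X/1000) * (500000 * 262144 * K) := by ring
        _ ≤ 1/262144 * LR * (J0+1) := by
          refine mul_le_mul (by linarith) (by linarith) (by positivity) (by positivity)
    have h3 : mass1 X f / 50 ≤ mass2 X f := by linarith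
    have h6 : 0 ≤ mass2 X f / W := div_nonneg (by linarith) (by linarith)
    calc 10 * K * X * (mass1 X f / W * E) = (mass1 X f / 50) / W * (500 * K * X * E) := by ring
      _ ≤ mass2 X f / W * (1/262144 * LR * (J0+1) * E) := by gcongr
  have hx1 : 1 ≤ X * (mass1 X f / W * E) := by
    calc (1:ℝ) ≤ X / W := by rw [one_le_div (by linarith)]; exact hXW
      _ = X * (1 / W * 1) := by ring
      _ ≤ _ := by gcongr
  have h4 : K * (4*X+1) * (mass1 X f / W * E) ≤ 5 * K * X * (mass1 X f / W * E) := by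
    refine mul_le_mul_of_nonneg_right ?_ (by positivity)
    calc (K:ℝ) * (4*X+1) ≤ K * (5*X) := mul_le_mul_of_nonneg_left (by linarith) (by positivity)
      _ = 5 * K * X := by ring
  have h5 : (1:ℝ) ≤ K * (X * (mass1 X f / W * E)) := one_le_mul_of_one_le_of_one_le hK1 hx1
  linarith

theorem maynard (K : ℕ) (hK : 1 ≤ K) : ∃ k D0 : ℕ, 1 ≤ k ∧ ∀ (h : Fin k → ℕ) (W b : ℕ), 0 < W →
    (∀ p, p.Prime → p ≤ D0 → p ∣ W) → (∀ i j, i ≠ j → ∀ p, p.Prime → h i ≡ h j [MOD p] → p ∣ W) →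
    (∀ i, (b + h i).Coprime W) → ∀ N0 : ℕ, ∃ n, N0 ≤ n ∧ n ≡ b [MOD W] ∧ K < #(univ.filter fun i => (n + h i).Prime) := by
  obtain ⟨J0, hJ⟩ : ∃ J0 : ℕ, 500000 * 262144 * K ≤ J0 := ⟨_, le_rfl⟩
  obtain ⟨k, hk⟩ : ∃ k : ℕ, k = 2^J0 := ⟨_, rfl⟩
  refine ⟨k, 24*k^2+3, by rw [hk]; exact Nat.one_le_two_pow, fun h W b hW0 h1 h2 h3 N0 => ?_⟩
  by_contra hc
  push Not at hc
  exact maynard_core J0 K k hK hk hJ h W b hW0 h1 h2 h3 N0 hc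
end DSR

namespace DSR
open Finset

def sd (g n : ℕ) : ℕ := (Nat.digits g n).sum

lemma sd_rec (g : ℕ) (hg : 2 ≤ g) (n : ℕ) : sd g n = n % g + sd g (n / g) := by
  unfold sd
  rcases Nat.eq_zero_or_pos n with rfl | h
  · simp
  · rw [Nat.digits_def' (by omega) h, List.sum_cons]

lemma sd_add (g : ℕ) (hg : 2 ≤ g) (M a x : ℕ) (ha : a < g^M) : sd g (a + g^M * x) = sd g a + sd g x := by
  induction M generalizing a with
  | zero =>
    have : a = 0 := by simpa using ha
    subst this; simp [sd]
  | succ M ih =>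
    rw [sd_rec g hg (a + _), sd_rec g hg a]
    have e : a + g^(M+1) * x = a + g * (g^M * x) := by ring
    rw [e, Nat.add_mul_mod_self_left, Nat.add_mul_div_left _ _ (by omega), ih (a/g) (by
      rw [Nat.div_lt_iff_lt_mul (by omega)]; rw [pow_succ] at ha; exact ha)]
    ring

def uu (g T e c : ℕ) : ℕ := 1 + ∑ j ∈ range c, g^(T*(e+j))

lemma uu_succ (g T e c : ℕ) : uu g T e (c+1) = uu g T e c + g^(T*(e+c)) := by
  unfold uu; rw [sum_range_succ]; ring

lemma uu_lt (g T e c : ℕ) (hg : 2 ≤ g) (hT : 1 ≤ T) (he : 1 ≤ e) : uu g T e c < g^(T*(e+c)) := by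
  induction c with
  | zero => simp only [uu, range_zero, sum_empty, add_zero]; exact Nat.one_lt_pow (Nat.mul_pos hT he).ne' hg
  | succ c ih =>
    rw [uu_succ]
    calc _ < g^(T*(e+c)) + g^(T*(e+c)) := by omega
      _ ≤ g^(T*(e+c)) * g := by nlinarith [Nat.zero_le (g^(T*(e+c)))]
      _ = g^(T*(e+c)+1) := (pow_succ _ _).symm
      _ ≤ g^(T*(e+(c+1))) := Nat.pow_le_pow_right (by omega) (by nlinarith)

lemma uu_sd (g T e c : ℕ) (hg : 2 ≤ g) (hT : 1 ≤ T) (he : 1 ≤ e) : sd g (uu g T e c) = 1 + c := by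
  induction c with
  | zero => simp only [uu, range_zero, sum_empty, add_zero, sd]; rw [Nat.digits_of_lt g 1 one_ne_zero (by omega)]; rfl
  | succ c ih =>
    have h1 : sd g 1 = 1 := by unfold sd; rw [Nat.digits_of_lt g 1 one_ne_zero (by omega)]; rfl
    have := sd_add g hg (T*(e+c)) (uu g T e c) 1 (uu_lt g T e c hg hT he)
    rw [mul_one] at this
    rw [uu_succ, this, ih, h1]; ring

lemma uu_ge (g T e c : ℕ) (hc : 1 ≤ c) : g^(T*e) < uu g T e c := by
  unfold uu
  have := single_le_sum (f := fun j => g^(T*(e+j))) (s := range c) (fun _ _ => Nat.zero_le _) (mem_range.2 hc)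
  simp only [add_zero] at this
  omega

lemma uu_mod_g (g T e c p : ℕ) (hT : 1 ≤ T) (he : 1 ≤ e) (hp : p ∣ g) : uu g T e c ≡ 1 [MOD p] := by
  unfold uu
  have : p ∣ ∑ j ∈ range c, g^(T*(e+j)) := dvd_sum fun j _ => hp.trans (dvd_pow_self g (Nat.mul_pos hT (by omega)).ne')
  simpa using ((Nat.modEq_zero_iff_dvd).2 this).add_left 1

lemma uu_mod_p (g T e c p : ℕ) (hp : p.Prime) (hpg : ¬ p ∣ g) (hT : (p-1) ∣ T) (hc : p ∣ c) : uu g T e c ≡ 1 [MOD p] := by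
  have h1 : ∀ x, g^(T*x) ≡ 1 [MOD p] := by
    intro x
    obtain ⟨y, rfl⟩ := hT
    have := (Nat.ModEq.pow_totient (((Nat.Prime.coprime_iff_not_dvd hp).2 hpg).symm)).pow (y*x)
    rw [Nat.totient_prime hp, one_pow, ← pow_mul] at this
    rw [mul_assoc]; exact this
  have h2 : ∀ c, ∑ j ∈ range c, g^(T*(e+j)) ≡ c [MOD p] := by
    intro c
    induction c with
    | zero => simp; rfl
    | succ c ih => rw [sum_range_succ]; exact ih.add (h1 _)
  unfold uu
  simpa using ((h2 c).trans ((Nat.modEq_zero_iff_dvd).2 hc)).add_left 1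

lemma crt_set (A : ℕ) (r : ℕ → ℕ) (S : Finset ℕ) (hS : ∀ p ∈ S, p.Prime ∧ ¬ p ∣ A) :
    ∃ b, b ≡ 0 [MOD A] ∧ ∀ p ∈ S, b ≡ r p [MOD p] := by
  have key : ∃ b, b ≡ 0 [MOD A] ∧ (∀ p ∈ S, b ≡ r p [MOD p]) := by
    induction S using Finset.induction_on with
    | empty => exact ⟨0, rfl, by simp⟩
    | insert p S hp ih =>
      obtain ⟨b, hb1, hb2⟩ := ih fun x hx => hS x (mem_insert_of_mem hx)
      obtain ⟨hpp, hpA⟩ := hS p (mem_insert_self _ _)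
      have hc : Nat.Coprime p (A * ∏ x ∈ S, x) := by
        refine Nat.Coprime.mul_right ((Nat.Prime.coprime_iff_not_dvd hpp).2 hpA) (Nat.Coprime.prod_right fun x hx => ?_)
        exact (Nat.coprime_primes hpp (hS x (mem_insert_of_mem hx)).1).2 fun h => hp (h ▸ hx)
      have h1 := (Nat.chineseRemainder hc (r p) b).2
      refine ⟨Nat.chineseRemainder hc (r p) b, ?_, fun x hx => ?_⟩
      · exact (h1.2.of_mul_right _).trans hb1
      · rcases mem_insert.1 hx with rfl | hx
        · exact h1.1
        · exact ((h1.2.of_mul_left _).of_dvd (dvd_prod_of_mem _ hx)).trans (hb2 x hx)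
  exact key

end DSR

namespace DSR
open Finset

lemma exists_shifts (g : ℕ) (hg : 2 ≤ g) (k : ℕ) (hk : 1 ≤ k) : ∃ (h : Fin k → ℕ) (M : ℕ), 1 ≤ M ∧ (∀ i, h i < g^M) ∧
    StrictMono h ∧ (∀ i j, i < j → sd g (h j) < sd g (h i)) ∧ (∀ i p, p.Prime → p ∣ g → h i ≡ 1 [MOD p]) ∧
    (∀ i p, p.Prime → ¬ p ∣ g → p ≤ k → h i ≡ 1 [MOD p]) := by
  set T := k.factorial with hT
  have hT1 : 1 ≤ T := Nat.factorial_pos k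
  have hlt : ∀ i j : Fin k, i < j → uu g T (1 + i * (T*k)) (T*(k-i)) < uu g T (1 + j * (T*k)) (T*(k-j)) := by
    intro i j hij
    have hij' : i.1 + 1 ≤ j.1 := hij
    refine (uu_lt g T _ _ hg hT1 (by omega)).trans (lt_of_le_of_lt ?_ (uu_ge g T _ _ (Nat.mul_pos hT1 (by omega))))
    refine Nat.pow_le_pow_right (by omega) (Nat.mul_le_mul_left _ ?_)
    calc 1 + i.1 * (T*k) + T * (k-i) ≤ 1 + i.1 * (T*k) + T * k := by
          have := Nat.mul_le_mul_left T (Nat.sub_le k i.1); omega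
      _ = 1 + (i.1+1) * (T*k) := by ring
      _ ≤ _ := by have := Nat.mul_le_mul_right (T*k) hij'; omega
  refine ⟨fun i => uu g T (1 + i * (T*k)) (T*(k-i)), T * (1 + k * (T*k)), Nat.mul_pos hT1 (by omega), fun i => ?_, fun i j hij => hlt i j hij,
    fun i j hij => ?_, fun i p _ hp => uu_mod_g g T _ _ p hT1 (by omega) hp, fun i p hp hpg hpk => ?_⟩
  · refine (uu_lt g T _ _ hg hT1 (by omega)).trans_le (Nat.pow_le_pow_right (by omega) (Nat.mul_le_mul_left _ ?_))
    calc 1 + i.1 * (T*k) + T * (k-i) ≤ 1 + i.1 * (T*k) + T * k := by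
          have := Nat.mul_le_mul_left T (Nat.sub_le k i.1); omega
      _ = 1 + (i.1+1) * (T*k) := by ring
      _ ≤ _ := by have := Nat.mul_le_mul_right (T*k) (show i.1+1 ≤ k from i.2); omega
  · simp only [uu_sd g T _ _ hg hT1 (show 1 ≤ 1 + i.1 * (T*k) by omega), uu_sd g T _ _ hg hT1 (show 1 ≤ 1 + j.1 * (T*k) by omega)]
    have hij' : i.1 < j.1 := hij
    have := Nat.mul_lt_mul_of_pos_left (show k - j.1 < k - i.1 by omega) hT1
    omega
  · refine uu_mod_p g T _ _ p hp hpg (Nat.dvd_factorial (by have := hp.two_le; omega) (by omega)) ?_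
    exact (Nat.dvd_factorial hp.pos hpk).mul_right _

lemma nth_prime_gt (n : ℕ) : n < Nat.nth Nat.Prime n := by
  have h1 := Nat.add_two_le_nth_prime n
  omega

lemma avoid (k p : ℕ) (hp : 0 < p) (h : Fin k → ℕ) (hk : k < p) : ∃ r, ∀ i, ¬ p ∣ r + h i := by
  have : ∃ r ∈ range p, r ∉ (univ : Finset (Fin k)).image (fun i => ((p-1) * h i) % p) := by
    by_contra hc
    push Not at hc
    have h1 := card_le_card (show range p ⊆ _ from hc)
    have h2 := card_image_le (s := (univ : Finset (Fin k))) (f := fun i => ((p-1) * h i) % p)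
    rw [card_range] at h1
    rw [card_univ, Fintype.card_fin] at h2
    omega
  obtain ⟨r, hr, hr2⟩ := this
  refine ⟨r, fun i hd => hr2 (mem_image.2 ⟨i, mem_univ _, ?_⟩)⟩
  have := (shift_mod r (h i) 0 p hp).1 ((Nat.modEq_zero_iff_dvd).2 hd)
  rw [zero_add] at this
  have h3 : r % p = r := Nat.mod_eq_of_lt (mem_range.1 hr)
  rw [← h3]; exact this.symm

theorem final_dev (g : ℕ) (hg : 2 ≤ g) (K : ℕ) (hK : 1 ≤ K) :
    {n : ℕ | ∀ i : ℕ, i + 1 < K → sd g (Nat.nth Nat.Prime (n + i + 1)) < sd g (Nat.nth Nat.Prime (n + i))}.Infinite := by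
  obtain ⟨k, D0, hk, hmay⟩ := maynard K hK
  obtain ⟨h, M, hM, hQ, hmono, hsd, hpg, hpk⟩ := exists_shifts g hg k hk
  obtain ⟨Q, hQd⟩ : ∃ Q, Q = g^M := ⟨_, rfl⟩
  simp only [← hQd] at hQ
  set D := D0 + Q + k with hD
  set q : ℕ → ℕ := fun j => Nat.nth Nat.Prime (D + j) with hq
  have hqp : ∀ j, (q j).Prime := fun j => Nat.prime_nth_prime _
  have hqinj : Function.Injective q := fun i j hij => by
    have := Nat.nth_injective Nat.infinite_setOf_prime hij; omega
  have hqD : ∀ j, D < q j := fun j => lt_of_le_of_lt (Nat.le_add_right D j) (nth_prime_gt _)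
  set D2 := D + ∑ j ∈ range Q, q j with hD2
  have hqD2 : ∀ j < Q, q j ≤ D2 := fun j hj => by
    have := single_le_sum (f := q) (s := range Q) (fun _ _ => Nat.zero_le _) (mem_range.2 hj)
    omega
  have hr : ∀ p, ∃ r, p.Prime → ¬ p ∣ g → (∀ i, ¬ p ∣ r + h i) ∧ (∀ j < Q, (∀ i, h i ≠ j) → p = q j → p ∣ r + j) := by
    intro p
    by_cases hp : p.Prime ∧ ¬ p ∣ g
    swap
    · exact ⟨0, fun h1 h2 => absurd ⟨h1, h2⟩ hp⟩
    obtain ⟨hp1, hp2⟩ := hp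
    by_cases hj : ∃ j < Q, (∀ i, h i ≠ j) ∧ p = q j
    · obtain ⟨j, hjQ, hjh, rfl⟩ := hj
      have hpQ : Q < q j := by have := hqD j; omega
      refine ⟨(q j - 1) * j, fun _ _ => ⟨fun i hd => ?_, fun j' hj' _ hjj => ?_⟩⟩
      · have h1 : h i + (q j - 1) * j ≡ h i + (q j - 1) * j [MOD q j] := rfl
        have h2 : (q j - 1) * j + h i ≡ 0 [MOD q j] := (Nat.modEq_zero_iff_dvd).2 hd
        have h3 : (q j - 1) * j + j ≡ 0 [MOD q j] := by
          rw [Nat.modEq_zero_iff_dvd, ← Nat.succ_mul, Nat.succ_eq_add_one, Nat.sub_add_cancel hp1.one_le]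
          exact dvd_mul_right _ _
        have h4 : h i ≡ j [MOD q j] := Nat.ModEq.add_left_cancel' _ (h2.trans h3.symm)
        exact hjh i (Nat.ModEq.eq_of_lt_of_lt h4 ((hQ i).trans hpQ) (hjQ.trans hpQ))
      · rw [← hqinj hjj, ← Nat.succ_mul, Nat.succ_eq_add_one, Nat.sub_add_cancel hp1.one_le]
        exact dvd_mul_right _ _
    · push Not at hj
      by_cases hpk' : p ≤ k
      · refine ⟨0, fun _ _ => ⟨fun i hd => ?_, fun j h1 h2 h3 => absurd h3 (hj j h1 h2)⟩⟩
        rw [zero_add] at hd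
        have := (hpk i p hp1 hp2 hpk').symm.trans ((Nat.modEq_zero_iff_dvd).2 hd)
        exact hp1.one_lt.ne' (Nat.dvd_one.1 ((Nat.modEq_zero_iff_dvd).1 this))
      · obtain ⟨r, hr⟩ := avoid k p hp1.pos h (not_le.1 hpk')
        exact ⟨r, fun _ _ => ⟨hr, fun j h1 h2 h3 => absurd h3 (hj j h1 h2)⟩⟩
  choose r hr using hr
  set S := (range (D2+1)).filter (fun p => p.Prime ∧ ¬ p ∣ g) with hS
  have hS1 : ∀ p ∈ S, p.Prime ∧ ¬ p ∣ g := fun p hp => (mem_filter.1 hp).2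
  obtain ⟨b, hb0, hbp⟩ := crt_set Q r S (fun p hp => ⟨(hS1 p hp).1, fun hd => (hS1 p hp).2 ((hS1 p hp).1.dvd_of_dvd_pow (hQd ▸ hd))⟩)
  set W := Q * ∏ p ∈ S, p with hW
  have hQ0 : 0 < Q := by rw [hQd]; exact Nat.pow_pos (by omega)
  have hW0 : 0 < W := Nat.mul_pos hQ0 (prod_pos fun p hp => (hS1 p hp).1.pos)
  have hgW : g ∣ Q := by rw [hQd]; exact dvd_pow_self g (by omega)
  have hWp : ∀ p, p.Prime → p ≤ D2 → p ∣ W := by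
    intro p hp hpD
    by_cases hpg' : p ∣ g
    · exact (hpg'.trans hgW).mul_right _
    · exact (dvd_prod_of_mem (fun p => p) (mem_filter.2 ⟨mem_range.2 (by omega), hp, hpg'⟩)).mul_left _
  have hcop : ∀ i, (b + h i).Coprime W := by
    intro i
    rw [Nat.coprime_comm]
    refine Nat.coprime_of_dvd fun p hp hpW hpb => ?_
    have hpQS : p ∣ g ∨ p ∈ S := by
      rcases hp.dvd_mul.1 hpW with h1 | h1
      · left; rw [hQd] at h1; exact hp.dvd_of_dvd_pow h1
      · right
        obtain ⟨x, hx, hpx⟩ := (Prime.dvd_finset_prod_iff hp.prime _).1 h1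
        rwa [(Nat.prime_dvd_prime_iff_eq hp (hS1 x hx).1).1 hpx]
    rcases hpQS with h1 | h1
    · have h2 : b + h i ≡ 0 + 1 [MOD p] := (hb0.of_dvd (h1.trans hgW)).add (hpg i p hp h1)
      have h3 := h2.symm.trans ((Nat.modEq_zero_iff_dvd).2 hpb)
      rw [zero_add] at h3
      exact hp.one_lt.ne' (Nat.dvd_one.1 ((Nat.modEq_zero_iff_dvd).1 h3))
    · have h2 := (hbp p h1).add_right (h i)
      exact (hr p hp (hS1 p h1).2).1 i ((Nat.modEq_zero_iff_dvd).1 (h2.symm.trans ((Nat.modEq_zero_iff_dvd).2 hpb)))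
  have hdiff : ∀ i j, i ≠ j → ∀ p, p.Prime → h i ≡ h j [MOD p] → p ∣ W := by
    intro i j hij p hp hmod
    refine hWp p hp ?_
    by_contra hc
    push Not at hc
    exact hij (hmono.injective (Nat.ModEq.eq_of_lt_of_lt hmod (by have := hQ i; omega) (by have := hQ j; omega)))
  refine Set.infinite_of_forall_exists_gt fun N => ?_
  obtain ⟨n, hn, hnb, hcard⟩ := hmay h W b hW0 (fun p hp hpD => hWp p hp (by omega)) hdiff hcop (Nat.nth Nat.Prime N + 1 + D2 + 1)
  have hnotp : ∀ j < Q, (n + j).Prime → ∃ i, h i = j := by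
    intro j hj hp
    by_contra hc
    push Not at hc
    by_cases hqg : q j ∣ g
    · have h1 := Nat.le_of_dvd (by omega) hqg
      have h2 : g ≤ Q := Nat.le_of_dvd hQ0 hgW
      have := hqD j
      omega
    · have hqS : q j ∈ S := mem_filter.2 ⟨mem_range.2 (by have := hqD2 j hj; omega), hqp j, hqg⟩
      have h1 := (hr (q j) (hqp j) hqg).2 j hj hc rfl
      have h2 : n ≡ r (q j) [MOD q j] := (hnb.of_dvd ((dvd_prod_of_mem (fun p => p) hqS).mul_left Q)).trans (hbp _ hqS)
      have h3 : q j ∣ n + j := (Nat.modEq_zero_iff_dvd).1 ((h2.add_right j).trans ((Nat.modEq_zero_iff_dvd).2 h1))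
      have h4 := (Nat.prime_dvd_prime_iff_eq (hqp j) hp).1 h3
      have := hqD2 j hj
      omega
  have hnQ : Q ∣ n := (Nat.modEq_zero_iff_dvd).1 ((hnb.of_dvd (dvd_mul_right Q _)).trans hb0)
  obtain ⟨x, hx⟩ := hnQ
  have hsdn : ∀ i, sd g (n + h i) = sd g (h i) + sd g x := by
    intro i
    rw [hx, add_comm, hQd]
    exact sd_add g hg M (h i) x (hQd ▸ hQ i)
  have hcount : Nat.count Nat.Prime n + K < Nat.count Nat.Prime (n + Q) := by
    rw [Nat.count_add, Nat.count_eq_card_filter_range (fun k => Nat.Prime (n + k))]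
    refine Nat.add_lt_add_left (hcard.trans_le ?_) _
    refine card_le_card_of_injOn h (fun i hi => ?_) hmono.injective.injOn
    have := (mem_filter.1 (mem_coe.1 hi)).2
    exact mem_coe.2 (mem_filter.2 ⟨mem_range.2 (hQ i), this⟩)
  have hinf := Nat.infinite_setOf_prime
  have hcN : N < Nat.count Nat.Prime n := by
    have h1 : Nat.nth Nat.Prime N < Nat.nth Nat.Prime (Nat.count Nat.Prime n) :=
      lt_of_lt_of_le (by omega) (Nat.le_nth_count (p := Nat.Prime) hinf n)
    exact (Nat.nth_lt_nth (p := Nat.Prime) hinf).1 h1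
  refine ⟨Nat.count Nat.Prime n, fun t ht => ?_, hcN⟩
  set c := Nat.count Nat.Prime n with hc
  have hloc : ∀ s, s < K → ∃ i, Nat.nth Nat.Prime (c + s) = n + h i := by
    intro s hs
    have h1 : n ≤ Nat.nth Nat.Prime (c + s) := (Nat.le_nth_count (p := Nat.Prime) hinf n).trans ((Nat.nth_le_nth (p := Nat.Prime) hinf).2 (Nat.le_add_right _ _))
    have h2 : Nat.nth Nat.Prime (c + s) < n + Q := Nat.nth_lt_of_lt_count (by omega)
    obtain ⟨y, hy⟩ := Nat.exists_eq_add_of_le h1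
    obtain ⟨i, hi⟩ := hnotp y (by omega) (hy ▸ Nat.prime_nth_prime _)
    exact ⟨i, by rw [hy, hi]⟩
  obtain ⟨i, hi⟩ := hloc t (by omega)
  obtain ⟨j, hj⟩ := hloc (t+1) ht
  have hlt : Nat.nth Nat.Prime (c + t) < Nat.nth Nat.Prime (c + (t+1)) := (Nat.nth_lt_nth hinf).2 (by omega)
  rw [hi, hj] at hlt
  have hij : i < j := hmono.lt_iff_lt.1 (by omega)
  rw [add_assoc c t 1, hi, hj, hsdn, hsdn]
  have := hsd i j hij
  omega

end DSR


/-- For every base `g ≥ 2` and every `K ≥ 1`, there are infinitely many `n` such that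
the base-`g` digit sum is strictly decreasing along the run of `K` consecutive primes
`p_n, p_{n+1}, …, p_{n+K-1}`. -/
theorem digitSum_decreasing_runs (g : ℕ) (hg : 2 ≤ g) (K : ℕ) (hK : 1 ≤ K) :
    {n : ℕ | ∀ i : ℕ, i + 1 < K →
      (Nat.digits g (Nat.nth Nat.Prime (n + i + 1))).sum <
        (Nat.digits g (Nat.nth Nat.Prime (n + i))).sum}.Infinite := by
  exact DSR.final_dev g hg K hK
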